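/- Let D be a reduced essential central hyperplane arrangement in ℂ⁴ with d > 4 hyperplanes. For α ∈ (0,1): α ∈ JC(D) if and only if one of the following holds: (a) there is a 2-dimensional edge W with m := μ_red(W) ≥ 3 such that mα ∈ ℤ and 2 ≤ mα < m; (b) there is a 1-dimensional edge V with μ_red(V) ≥ 4 and an integer i with 3 ≤ i < μ_red(V) such that α = i/μ_red(V) and C(i−1,2) − Σ_W C(⌈i·μ_red(W)/μ_red(V)⌉ − 1, 2) ≠ 0, the sum being over all 2-dimensional edges W with W ⊇ V and μ_red(W) ≥ 3; (c) there is an integer i with 4 ≤ i < d such that α = i/d and N(i) ≠ 0, where N(i) := C(i−1,3) − Σ_{(W,V)} [ 2·C(⌈i·μ_red(W)/d⌉−1, 3) − C(⌈i·μ_red(W)/d⌉−1, 2)·(⌈i·μ_red(V)/d⌉ − 3) ] + Σ_W [ 2·C(⌈i·μ_red(W)/d⌉−1, 3) − (i−3)·C(⌈i·μ_red(W)/d⌉−1, 2) ] − Σ_V C(⌈i·μ_red(V)/d⌉−1, 3), with W ranging over 2-dimensional edges with μ_red(W) ≥ 3, V over 1-dimensional edges with μ_red(V) ≥ 4, and (W,V)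 over such pairs with V ⊆ W. (Corollary 2.) -/

import Mathlib

open MeasureTheory
open scoped Classical

noncomputable section

/-- A central hyperplane arrangement (with multiplicities) in `ℂ^n`, given by a finite
nonempty family of pairwise non-proportional nonzero linear forms `g i` with
multiplicities `m i ≥ 1`. -/
structure Arrangement (n : ℕ) where
  ι : Type
  fintypeι : Fintype ι
  nonemptyι : Nonempty ι
  g : ι → ((Fin n → ℂ) →ₗ[ℂ] ℂ)
  m : ι → ℕ
  g_ne : ∀ i, g i ≠ 0
  m_pos : ∀ i, 0 < m i
  nonproportional : ∀ i j : ι, i ≠ j → ∀ c : ℂ, g i ≠ c • g j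

attribute [instance] Arrangement.fintypeι

namespace Arrangement

variable {n : ℕ}

/-- The defining polynomial `f = ∏ i, g i ^ m i` of the arrangement, as a function. -/
def f (D : Arrangement n) (x : Fin n → ℂ) : ℂ :=
  ∏ i, D.g i x ^ D.m i

/-- The degree `d = ∑ i, m i` of the arrangement. -/
def degree (D : Arrangement n) : ℕ := ∑ i, D.m i

/-- The arrangement is essential: the intersection of its hyperplanes is `{0}`. -/
def Essential (D : Arrangement n) : Prop :=
  (⨅ i, LinearMap.ker (D.g i)) = ⊥

/-- The arrangement is reduced: all multiplicities are `1`. -/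
def Reduced (D : Arrangement n) : Prop := ∀ i, D.m i = 1

/-- The set of edges `S(D)`: intersections of nonempty subfamilies of the hyperplanes. -/
def edges (D : Arrangement n) : Set (Submodule ℂ (Fin n → ℂ)) :=
  {V | ∃ I : Set D.ι, I.Nonempty ∧ V = ⨅ i ∈ I, LinearMap.ker (D.g i)}

/-- The codimension `γ(V)` of an edge. -/
def gamma (_D : Arrangement n) (V : Submodule ℂ (Fin n → ℂ)) : ℕ :=
  n - Module.finrank ℂ V

/-- The multiplicity `μ(V) = ∑_{i : V ⊆ D_i} m i` of an edge. -/
def mu (D : Arrangement n) (V : Submodule ℂ (Fin n → ℂ)) : ℕ :=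
  ∑ i ∈ Finset.univ.filter fun i => V ≤ LinearMap.ker (D.g i), D.m i

/-- The reduced multiplicity `μ_red(V) = #{i : V ⊆ D_i}` of an edge. -/
def muRed (D : Arrangement n) (V : Submodule ℂ (Fin n → ℂ)) : ℕ :=
  (Finset.univ.filter fun i => V ≤ LinearMap.ker (D.g i)).card

end Arrangement

/-- `α` is a jumping coefficient of (the divisor of) `f` at the point `x`: there is a
function `g` holomorphic near `x` with `|g|²·|f|^(−2β)` locally integrable at `x` for all
`0 < β < α`, while `|g|²·|f|^(−2α)` is not integrable on any neighborhood of `x`. -/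
def JumpingAtOf {k : ℕ} (f : (Fin k → ℂ) → ℂ) (α : ℝ) (x : Fin k → ℂ) : Prop :=
  ∃ (U : Set (Fin k → ℂ)) (g : (Fin k → ℂ) → ℂ), U ∈ nhds x ∧ DifferentiableOn ℂ g U ∧
    (∀ β : ℝ, 0 < β → β < α →
      ∃ W ∈ nhds x, IntegrableOn (fun y => ‖g y‖ ^ 2 * ‖f y‖ ^ (-2 * β)) W) ∧
    ∀ W ∈ nhds x, ¬ IntegrableOn (fun y => ‖g y‖ ^ 2 * ‖f y‖ ^ (-2 * α)) W

/-- The set `JC(D)` of jumping coefficients of the arrangement `D`. -/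
def Arrangement.JC {n : ℕ} (D : Arrangement n) : Set ℝ :=
  {α | 0 < α ∧ ∃ x : Fin n → ℂ, JumpingAtOf D.f α x}

namespace HypArr

open scoped ContDiff ComplexConjugate ENNReal
open Complex (I conj_I conj_conj exp_ne_zero mul_conj normSq_eq_norm_sq norm_exp_ofReal_mul_I norm_real ofRealCLM)
open ContinuousLinearMap (toSpanSingleton)
open ENNReal (mul_ne_top ofReal ofReal_add ofReal_le_ofReal ofReal_ne_top)
open Filter (Eventually Tendsto atTop eventually_all inter_mem univ_mem)
open Finset (mem_coe mem_filter mem_range mem_univ mul_sum range single_le_sum sum_add_distrib sum_congr sum_mul univ)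
open Fintype (card)
open Function (mem_support)
open LinearEquiv (coe_coe)
open LinearMap (ker mem_ker toContinuousLinearMap)
open Metric (ball ball_mem_nhds closedBall closedBall_mem_nhds)
open Module (finrank)
open Nat (lt_succ_iff)
open Pi (single)
open Polynomial (eval_C)
open Real (exp log mul_rpow pi rpow_add sq_sqrt sqrt)
open Set (Ioc)
open Submodule (eq_of_le_of_finrank_eq finrank_eq_zero finrank_mono mem_bot mem_iInf mem_span_singleton_self span)

variable {n : ℕ}

/-- Complex affine space. -/
abbrev E (n : ℕ) := Fin n → ℂ


/-- The constant coefficient operator `(∂_{x_j} + c ∂_{y_j}) / 2`. -/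
def dd (c : ℂ) (j : Fin n) (a : E n → ℂ) (y : E n) : ℂ :=
  (1 / 2) * (fderiv ℝ a y (single j 1) + c * fderiv ℝ a y (single j I))

notation "dz" => dd (-I)

notation "db" => dd I

/-- Smooth compactly supported functions. -/
def IsTest (a : E n → ℂ) : Prop := ContDiff ℝ ∞ a ∧ HasCompactSupport a

theorem dd_mul {c : ℂ} {j : Fin n} {a b : E n → ℂ} {y : E n}
    (ha : DifferentiableAt ℝ a y) (hb : DifferentiableAt ℝ b y) :
    dd c j (fun y => a y * b y) y = dd c j a y * b y + a y * dd c j b y := by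
  simp only [dd]
  rw [fderiv_fun_mul ha hb]
  simp
  ring

theorem dd_add {c : ℂ} {j : Fin n} {a b : E n → ℂ} {y : E n}
    (ha : DifferentiableAt ℝ a y) (hb : DifferentiableAt ℝ b y) :
    dd c j (fun y => a y + b y) y = dd c j a y + dd c j b y := by
  simp only [dd]
  rw [fderiv_fun_add ha hb]
  simp
  ring

theorem dd_sub {c : ℂ} {j : Fin n} {a b : E n → ℂ} {y : E n}
    (ha : DifferentiableAt ℝ a y) (hb : DifferentiableAt ℝ b y) :
    dd c j (fun y => a y - b y) y = dd c j a y - dd c j b y := by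
  simp only [dd]
  rw [fderiv_fun_sub ha hb]
  simp
  ring

theorem dd_neg {c : ℂ} {j : Fin n} {a : E n → ℂ} {y : E n} :
    dd c j (fun y => - a y) y = - dd c j a y := by
  simp only [dd]
  rw [fderiv_fun_neg]
  simp
  ring

theorem dd_const {c : ℂ} {j : Fin n} {y : E n} (r : ℂ) :
    dd c j (fun _ => r) y = 0 := by
  simp [dd]

theorem dd_const_mul {c : ℂ} {j : Fin n} {a : E n → ℂ} {y : E n} (r : ℂ)
    (ha : DifferentiableAt ℝ a y) :
    dd c j (fun y => r * a y) y = r * dd c j a y := by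
  rw [dd_mul (differentiableAt_const r) ha, dd_const]
  ring

theorem dd_conj {c : ℂ} {j : Fin n} {a : E n → ℂ} {y : E n} (ha : DifferentiableAt ℝ a y) :
    dd c j (fun y => conj (a y)) y = conj (dd (conj c) j a y) := by
  have h : fderiv ℝ (fun y => conj (a y)) y =
      (Complex.conjCLE : ℂ →L[ℝ] ℂ).comp (fderiv ℝ a y) :=
    ((Complex.conjCLE : ℂ →L[ℝ] ℂ).hasFDerivAt.comp y ha.hasFDerivAt).fderiv
  simp only [dd, h]
  simp [map_ofNat]

theorem contDiff_dd {c : ℂ} {j : Fin n} {a : E n → ℂ} (ha : ContDiff ℝ ∞ a) :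
    ContDiff ℝ ∞ (dd c j a) := by
  have h : ContDiff ℝ ∞ (fderiv ℝ a) := ha.fderiv_right (by simp)
  unfold dd
  fun_prop

theorem hasCompactSupport_dd {c : ℂ} {j : Fin n} {a : E n → ℂ} (ha : HasCompactSupport a) :
    HasCompactSupport (dd c j a) := by
  have h := ha.fderiv (𝕜 := ℝ)
  refine h.mono fun y hy => ?_
  rw [mem_support] at hy ⊢
  contrapose! hy
  simp [dd, hy]

theorem IsTest.dd {c : ℂ} {j : Fin n} {a : E n → ℂ} (ha : IsTest a) : IsTest (dd c j a) :=
  ⟨contDiff_dd ha.1, hasCompactSupport_dd ha.2⟩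

theorem IsTest.mul {a b : E n → ℂ} (ha : IsTest a) (hb : ContDiff ℝ ∞ b) :
    IsTest (fun y => b y * a y) :=
  ⟨hb.mul ha.1, ha.2.mul_left⟩

theorem IsTest.mul_right {a b : E n → ℂ} (ha : IsTest a) (hb : ContDiff ℝ ∞ b) :
    IsTest (fun y => a y * b y) :=
  ⟨ha.1.mul hb, ha.2.mul_right⟩

theorem contDiff_conj {a : E n → ℂ} (ha : ContDiff ℝ ∞ a) :
    ContDiff ℝ ∞ (fun y => conj (a y)) :=
  (Complex.conjCLE : ℂ →L[ℝ] ℂ).contDiff.comp ha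

theorem IsTest.conj {a : E n → ℂ} (ha : IsTest a) : IsTest (fun y => conj (a y)) :=
  ⟨contDiff_conj ha.1, ha.2.comp_left (g := fun z => (starRingEnd ℂ) z) (by simp)⟩

theorem IsTest.add {a b : E n → ℂ} (ha : IsTest a) (hb : IsTest b) :
    IsTest (fun y => a y + b y) := ⟨ha.1.add hb.1, ha.2.add hb.2⟩

theorem IsTest.neg {a : E n → ℂ} (ha : IsTest a) :
    IsTest (fun y => - a y) := ⟨ha.1.neg, ha.2.comp_left (g := fun z => - z) (by simp)⟩

theorem IsTest.sub {a b : E n → ℂ} (ha : IsTest a) (hb : IsTest b) :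
    IsTest (fun y => a y - b y) := by
  simpa [sub_eq_add_neg] using ha.add hb.neg

theorem IsTest.sum {ι : Type*} (s : Finset ι) {a : ι → E n → ℂ} (ha : ∀ i, IsTest (a i)) :
    IsTest (fun y => ∑ i ∈ s, a i y) := by
  induction s using Finset.induction_on with
  | empty => exact ⟨by simpa using contDiff_const, by
      simp only [Finset.sum_empty]; exact HasCompactSupport.zero⟩
  | insert i s hi ih => simpa [Finset.sum_insert hi] using (ha i).add ih

theorem IsTest.integrable {a : E n → ℂ} (ha : IsTest a) : Integrable a :=
  ha.1.continuous.integrable_of_hasCompactSupport ha.2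

theorem IsTest.memLp {a : E n → ℂ} (ha : IsTest a) : MemLp a 2 :=
  ha.1.continuous.memLp_of_hasCompactSupport ha.2

theorem diffAt {a : E n → ℂ} (ha : ContDiff ℝ ∞ a) (y : E n) : DifferentiableAt ℝ a y :=
  (ha.differentiable (by simp)) y

/-- Integration by parts. -/
theorem integral_dd_mul {c : ℂ} {j : Fin n} {a b : E n → ℂ}
    (ha : ContDiff ℝ 1 a) (hb : ContDiff ℝ 1 b) (hc : HasCompactSupport b) :
    ∫ y, a y * dd c j b y = - ∫ y, dd c j a y * b y := by
  have ha' : Continuous (fderiv ℝ a) := ha.continuous_fderiv (by simp)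
  have hb' : Continuous (fderiv ℝ b) := hb.continuous_fderiv (by simp)
  have key : ∀ u : E n, Integrable (fun y => a y * fderiv ℝ b y u) ∧
      Integrable (fun y => fderiv ℝ a y u * b y) ∧
      ∫ y, a y * fderiv ℝ b y u = - ∫ y, fderiv ℝ a y u * b y := by
    intro u
    have hcb : HasCompactSupport (fun y => fderiv ℝ b y u) := hc.fderiv_apply (𝕜 := ℝ) u
    have h1 : Integrable (fun y => a y * fderiv ℝ b y u) :=
      (ha.continuous.mul (hb'.clm_apply continuous_const)).integrable_of_hasCompactSupport
        hcb.mul_left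
    have h2 : Integrable (fun y => fderiv ℝ a y u * b y) :=
      ((ha'.clm_apply continuous_const).mul hb.continuous).integrable_of_hasCompactSupport
        hc.mul_left
    refine ⟨h1, h2, ?_⟩
    refine integral_mul_fderiv_eq_neg_fderiv_mul_of_integrable h2 h1 ?_
      (fun x _ => ha.differentiable (by simp) x) (fun x _ => hb.differentiable (by simp) x)
    exact (ha.continuous.mul hb.continuous).integrable_of_hasCompactSupport hc.mul_left
  obtain ⟨i1, i2, e1⟩ := key (single j 1)
  obtain ⟨i3, i4, e2⟩ := key (single j I)
  have l : ∀ y, a y * dd c j b y = (1 / 2) * (a y * fderiv ℝ b y (single j 1)) +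
      (c / 2) * (a y * fderiv ℝ b y (single j I)) := fun y => by
    simp only [dd]; ring
  have r : ∀ y, dd c j a y * b y = (1 / 2) * (fderiv ℝ a y (single j 1) * b y) +
      (c / 2) * (fderiv ℝ a y (single j I) * b y) := fun y => by
    simp only [dd]; ring
  simp_rw [l, r]
  rw [integral_add (i1.const_mul _) (i3.const_mul _), integral_add (i2.const_mul _) (i4.const_mul _)]
  simp only [integral_const_mul, e1, e2]
  ring

theorem fderiv_fderiv_apply {a : E n → ℂ} (ha : ContDiff ℝ ∞ a) (y u v : E n) :
    fderiv ℝ (fun y => fderiv ℝ a y u) y v = fderiv ℝ (fderiv ℝ a) y v u := by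
  have h : ContDiff ℝ ∞ (fderiv ℝ a) := ha.fderiv_right (by simp)
  have := (h.differentiable (by simp) y).hasFDerivAt.clm_apply (hasFDerivAt_const u y)
  rw [this.fderiv]
  simp

theorem fderiv_dd {c : ℂ} {j : Fin n} {a : E n → ℂ} (ha : ContDiff ℝ ∞ a) (y v : E n) :
    fderiv ℝ (dd c j a) y v = (1 / 2) * (fderiv ℝ (fderiv ℝ a) y v (single j 1) +
      c * fderiv ℝ (fderiv ℝ a) y v (single j I)) := by
  have h : ContDiff ℝ ∞ (fderiv ℝ a) := ha.fderiv_right (by simp)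
  have d : ∀ u : E n, DifferentiableAt ℝ (fun y => fderiv ℝ a y u) y := fun u => by
    have : ContDiff ℝ ∞ (fun y => fderiv ℝ a y u) := by fun_prop
    exact this.differentiable (by simp) y
  have f : HasFDerivAt (dd c j a) _ y := ((d (single j 1)).hasFDerivAt.add
    ((d (single j I)).hasFDerivAt.const_mul c)).const_mul (1 / 2)
  rw [f.fderiv]
  simp only [← fderiv_fderiv_apply ha]
  simp
  ring

theorem dd_comm {c c' : ℂ} {j k : Fin n} {a : E n → ℂ} (ha : ContDiff ℝ ∞ a) (y : E n) :
    dd c j (dd c' k a) y = dd c' k (dd c j a) y := by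
  have hs : ∀ u v, fderiv ℝ (fderiv ℝ a) y u v = fderiv ℝ (fderiv ℝ a) y v u :=
    (ha.contDiffAt.isSymmSndFDerivAt (by simp; exact WithTop.coe_le_coe.2 le_top))
  have e : ∀ (c : ℂ) (j : Fin n) (b : E n → ℂ), dd c j b y = (1 / 2) *
      (fderiv ℝ b y (single j 1) + c * fderiv ℝ b y (single j I)) :=
    fun _ _ _ => rfl
  rw [e, e]
  simp only [fderiv_dd ha]
  rw [hs (single j 1), hs (single j 1), hs (single j I),
    hs (single j I) (single k I)]
  ring

/-- The operator `e^{-φ/2} ∂̄_j e^{φ/2}`. -/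
def Top (φ : E n → ℂ) (j : Fin n) (a : E n → ℂ) (y : E n) : ℂ :=
  db j a y + (1 / 2) * db j φ y * a y

/-- The formal adjoint of `Top`. -/
def Tst (φ : E n → ℂ) (j : Fin n) (a : E n → ℂ) (y : E n) : ℂ :=
  - dz j a y + (1 / 2) * dz j φ y * a y

/-- The Levi matrix. -/
def lev (φ : E n → ℂ) (j k : Fin n) : E n → ℂ := dz j (db k φ)

theorem contDiff_Top {φ : E n → ℂ} (hφ : ContDiff ℝ ∞ φ) {j : Fin n} {a : E n → ℂ}
    (ha : ContDiff ℝ ∞ a) : ContDiff ℝ ∞ (Top φ j a) :=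
  (contDiff_dd ha).add ((contDiff_const.mul (contDiff_dd hφ)).mul ha)

theorem contDiff_Tst {φ : E n → ℂ} (hφ : ContDiff ℝ ∞ φ) {j : Fin n} {a : E n → ℂ}
    (ha : ContDiff ℝ ∞ a) : ContDiff ℝ ∞ (Tst φ j a) :=
  (contDiff_dd ha).neg.add ((contDiff_const.mul (contDiff_dd hφ)).mul ha)

theorem IsTest.Top {φ : E n → ℂ} (hφ : ContDiff ℝ ∞ φ) {j : Fin n} {a : E n → ℂ}
    (ha : IsTest a) : IsTest (Top φ j a) :=
  ⟨contDiff_Top hφ ha.1, (ha.dd.add (ha.mul (contDiff_const.mul (contDiff_dd hφ)))).2⟩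

theorem IsTest.Tst {φ : E n → ℂ} (hφ : ContDiff ℝ ∞ φ) {j : Fin n} {a : E n → ℂ}
    (ha : IsTest a) : IsTest (Tst φ j a) :=
  ⟨contDiff_Tst hφ ha.1, (ha.dd.neg.add (ha.mul (contDiff_const.mul (contDiff_dd hφ)))).2⟩

theorem integrable_conj_mul {a b : E n → ℂ} (ha : IsTest a) (hb : ContDiff ℝ ∞ b) :
    Integrable (fun y => conj (a y) * b y) :=
  (ha.conj.mul_right hb).integrable

theorem conj_dz {φ : E n → ℂ} (hφ : ContDiff ℝ ∞ φ) (hr : ∀ y, conj (φ y) = φ y) {j : Fin n}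
    (y : E n) : conj (dz j φ y) = db j φ y := by
  have := dd_conj (c := I) (j := j) (diffAt hφ y)
  simp only [hr, conj_I] at this
  exact this.symm

/-- `Tst` and `Top` are formally adjoint. -/
theorem adj {φ : E n → ℂ} (hφ : ContDiff ℝ ∞ φ) (hr : ∀ y, conj (φ y) = φ y) {j : Fin n}
    {a b : E n → ℂ} (ha : IsTest a) (hb : ContDiff ℝ ∞ b) :
    ∫ y, conj (Tst φ j a y) * b y = ∫ y, conj (a y) * Top φ j b y := by
  have h := integral_dd_mul (c := I) (j := j) (hb.of_le (by simp))
    (ha.conj.1.of_le (by simp)) ha.conj.2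
  have e : ∀ y, dd I j (fun y => conj (a y)) y = conj (dz j a y) := fun y => by
    rw [dd_conj (diffAt ha.1 y), conj_I]
  simp only [e] at h
  have i1 : Integrable (fun y => b y * conj (dz j a y)) := (ha.dd.conj.mul hb).integrable
  have i2 : Integrable (fun y => dd I j b y * conj (a y)) :=
    (ha.conj.mul (contDiff_dd hb)).integrable
  have i3 : Integrable (fun y => (1 / 2) * db j φ y * (conj (a y) * b y)) :=
    ((ha.conj.mul_right hb).mul (contDiff_const.mul (contDiff_dd hφ))).integrable
  have l : ∀ y, conj (Tst φ j a y) * b y =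
      -(b y * conj (dz j a y)) + (1 / 2) * db j φ y * (conj (a y) * b y) := fun y => by
    simp only [Tst, map_add, map_neg, map_mul, conj_dz hφ hr, map_div₀, map_one, map_ofNat]
    ring
  have r : ∀ y, conj (a y) * Top φ j b y =
      dd I j b y * conj (a y) + (1 / 2) * db j φ y * (conj (a y) * b y) := fun y => by
    simp only [Top]
    ring
  simp_rw [l, r]
  rw [integral_add i1.fun_neg i3, integral_add i2 i3, integral_neg, h, neg_neg]

theorem adj' {φ : E n → ℂ} (hφ : ContDiff ℝ ∞ φ) (hr : ∀ y, conj (φ y) = φ y) {j : Fin n}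
    {a b : E n → ℂ} (ha : IsTest a) (hb : ContDiff ℝ ∞ b) :
    ∫ y, conj (Top φ j b y) * a y = ∫ y, conj (b y) * Tst φ j a y := by
  have h := congrArg conj (adj hφ hr (j := j) ha hb)
  rw [← integral_conj, ← integral_conj] at h
  simp only [map_mul, conj_conj] at h
  simp_rw [mul_comm (conj (Top φ j b _)), mul_comm (conj (b _))]
  exact h.symm

theorem Top_Tst {φ : E n → ℂ} (hφ : ContDiff ℝ ∞ φ) {j k : Fin n} {a : E n → ℂ}
    (ha : ContDiff ℝ ∞ a) (y : E n) :
    Top φ k (Tst φ j a) y = Tst φ j (Top φ k a) y + lev φ j k y * a y := by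
  have d1 := fun c (i : Fin n) => diffAt (contDiff_dd (c := c) (j := i) ha) y
  have d2 := fun c (i : Fin n) => diffAt (contDiff_dd (c := c) (j := i) hφ) y
  have d3 := diffAt ha y
  have e1 : db k (Tst φ j a) y = - db k (dz j a) y + ((1 / 2) * db k (dz j φ) y * a y
      + (1 / 2) * dz j φ y * db k a y) := by
    have e : Tst φ j a = fun y => - dz j a y + (1 / 2) * dz j φ y * a y := rfl
    rw [e, dd_add (d1 _ _).fun_neg (((d2 _ _).const_mul _).fun_mul d3), dd_neg,
      dd_mul ((d2 _ _).const_mul _) d3, dd_const_mul _ (d2 _ _)]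
  have e2 : dz j (Top φ k a) y = dz j (db k a) y + ((1 / 2) * dz j (db k φ) y * a y
      + (1 / 2) * db k φ y * dz j a y) := by
    have e : Top φ k a = fun y => db k a y + (1 / 2) * db k φ y * a y := rfl
    rw [e, dd_add (d1 _ _) (((d2 _ _).const_mul _).fun_mul d3),
      dd_mul ((d2 _ _).const_mul _) d3, dd_const_mul _ (d2 _ _)]
  have e3 : Top φ k (Tst φ j a) y = db k (Tst φ j a) y + (1 / 2) * db k φ y * Tst φ j a y := rfl
  have e4 : Tst φ j (Top φ k a) y = -dz j (Top φ k a) y + (1 / 2) * dz j φ y * Top φ k a y := rfl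
  rw [e3, e4, e1, e2, dd_comm (j := k) ha, dd_comm (j := k) hφ]
  simp only [lev, Top, Tst]
  ring

theorem Top_Top {φ : E n → ℂ} (hφ : ContDiff ℝ ∞ φ) {j k : Fin n} {a : E n → ℂ}
    (ha : ContDiff ℝ ∞ a) (y : E n) :
    Top φ k (Top φ j a) y = Top φ j (Top φ k a) y := by
  have d1 := fun c (i : Fin n) => diffAt (contDiff_dd (c := c) (j := i) ha) y
  have d2 := fun c (i : Fin n) => diffAt (contDiff_dd (c := c) (j := i) hφ) y
  have d3 := diffAt ha y
  have e2 : ∀ j k, db j (Top φ k a) y = db j (db k a) y + ((1 / 2) * db j (db k φ) y * a y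
      + (1 / 2) * db k φ y * db j a y) := fun j k => by
    have e : Top φ k a = fun y => db k a y + (1 / 2) * db k φ y * a y := rfl
    rw [e, dd_add (d1 _ _) (((d2 _ _).const_mul _).fun_mul d3),
      dd_mul ((d2 _ _).const_mul _) d3, dd_const_mul _ (d2 _ _)]
  have e3 : ∀ j k, Top φ k (Top φ j a) y = db k (Top φ j a) y +
    (1 / 2) * db k φ y * Top φ j a y := fun _ _ => rfl
  rw [e3, e3, e2, e2, dd_comm (j := k) ha, dd_comm hφ (j := k)]
  simp only [Top]
  ring

theorem IsTest.integrable_sq {a : E n → ℂ} (ha : IsTest a) : Integrable (fun y => ‖a y‖ ^ 2) :=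
  (by fun_prop : Continuous fun z : ℂ => ‖z‖ ^ 2).comp ha.1.continuous
    |>.integrable_of_hasCompactSupport (ha.2.comp_left (g := fun z => ‖z‖ ^ 2) (by simp))

/-- The Bochner–Kodaira–Hörmander inequality for test forms. -/
theorem bochner {φ : E n → ℂ} (hφ : ContDiff ℝ ∞ φ) (hr : ∀ y, conj (φ y) = φ y)
    {X : Fin n → E n → ℂ} (hX : ∀ j, IsTest (X j)) :
    ∫ y, (∑ j, ∑ k, lev φ j k y * X j y * conj (X k y)).re ≤
      (∫ y, ‖∑ j, Tst φ j (X j) y‖ ^ 2) +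
      (1 / 2) * ∑ j, ∑ k, ∫ y, ‖Top φ k (X j) y - Top φ j (X k) y‖ ^ 2 := by
  have t1 : ∀ j, IsTest (Tst φ j (X j)) := fun j => (hX j).Tst hφ
  have t2 : ∀ j k, IsTest (Top φ k (X j)) := fun j k => (hX j).Top hφ
  have hlev : ∀ j k, ContDiff ℝ ∞ (lev φ j k) := fun j k => contDiff_dd (contDiff_dd hφ)
  have i1 : ∀ j k, Integrable (fun y => lev φ j k y * X j y * conj (X k y)) := fun j k =>
    ((hX k).conj.mul ((hlev j k).mul (hX j).1)).integrable
  have i2 : ∀ j k, Integrable (fun y => conj (Tst φ k (X k) y) * Tst φ j (X j) y) := fun j k =>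
    integrable_conj_mul (t1 k) (t1 j).1
  have i3 : ∀ j k, Integrable (fun y => conj (Top φ j (X k) y) * Top φ k (X j) y) := fun j k =>
    integrable_conj_mul (t2 k j) (t2 j k).1
  have key : ∀ j k, ∫ y, lev φ j k y * X j y * conj (X k y) =
      (∫ y, conj (Tst φ k (X k) y) * Tst φ j (X j) y) -
      ∫ y, conj (Top φ j (X k) y) * Top φ k (X j) y := by
    intro j k
    rw [adj hφ hr (hX k) (t1 j).1, adj' hφ hr (t2 j k) (hX k).1, ← integral_sub
      (integrable_conj_mul (hX k) (contDiff_Top hφ (t1 j).1))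
      (integrable_conj_mul (hX k) (contDiff_Tst hφ (t2 j k).1))]
    congr 1
    ext y
    rw [Top_Tst hφ (hX j).1]
    ring
  have l : ∫ y, (∑ j, ∑ k, lev φ j k y * X j y * conj (X k y)).re =
      (∑ j, ∑ k, ∫ y, lev φ j k y * X j y * conj (X k y)).re := by
    have := integral_re (𝕜 := ℂ) (μ := volume) (f := fun y => ∑ j, ∑ k, lev φ j k y * X j y * conj (X k y))
      (integrable_finsetSum _ fun j _ => integrable_finsetSum _ fun k _ => i1 j k)
    simp only [RCLike.re_eq_complex_re] at this
    rw [this, integral_finsetSum _ fun j _ => integrable_finsetSum _ fun k _ => i1 j k]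
    simp_rw [integral_finsetSum _ fun k _ => i1 _ k]
  have a1 : (∑ j, ∑ k, ∫ y, conj (Tst φ k (X k) y) * Tst φ j (X j) y).re =
      ∫ y, ‖∑ j, Tst φ j (X j) y‖ ^ 2 := by
    have : ∀ y, ((‖∑ j, Tst φ j (X j) y‖ ^ 2 : ℝ) : ℂ) =
        ∑ j, ∑ k, conj (Tst φ k (X k) y) * Tst φ j (X j) y := fun y => by
      push_cast
      rw [← Complex.conj_mul', map_sum, Finset.sum_mul_sum, Finset.sum_comm]
    rw [← Complex.ofReal_re (∫ y, ‖∑ j, Tst φ j (X j) y‖ ^ 2), ← integral_complex_ofReal]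
    simp_rw [this]
    rw [integral_finsetSum _ fun j _ => integrable_finsetSum _ fun k _ => i2 j k]
    simp_rw [integral_finsetSum _ fun k _ => i2 _ k]
  have a2 : (∑ j, ∑ k, ∫ y, conj (Top φ j (X k) y) * Top φ k (X j) y).re =
      (∑ j, ∑ k, ∫ y, ‖Top φ k (X j) y‖ ^ 2) -
      (1 / 2) * ∑ j, ∑ k, ∫ y, ‖Top φ k (X j) y - Top φ j (X k) y‖ ^ 2 := by
    have p : ∀ j k, ∫ y, ‖Top φ k (X j) y - Top φ j (X k) y‖ ^ 2 =
        (∫ y, ‖Top φ k (X j) y‖ ^ 2) + (∫ y, ‖Top φ j (X k) y‖ ^ 2) -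
        2 * (∫ y, conj (Top φ j (X k) y) * Top φ k (X j) y).re := by
      intro j k
      have hre := integral_re (𝕜 := ℂ) (μ := volume) (i3 j k)
      simp only [RCLike.re_eq_complex_re] at hre
      rw [← hre, ← integral_const_mul, ← integral_add (t2 j k).integrable_sq (t2 k j).integrable_sq]
      erw [← integral_sub ((t2 j k).integrable_sq.add (t2 k j).integrable_sq)
          ((i3 j k).re.const_mul 2)]
      congr 1
      ext y
      simp only [Complex.sq_norm, Complex.normSq_sub, mul_comm (conj _)]
      rfl
    simp_rw [p, Finset.sum_sub_distrib, sum_add_distrib, ← mul_sum, ← Complex.re_sum]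
    rw [Finset.sum_comm (f := fun j k => ∫ y, ‖Top φ j (X k) y‖ ^ 2)]
    ring
  have pos : 0 ≤ ∑ j, ∑ k, ∫ y, ‖Top φ k (X j) y‖ ^ 2 :=
    Finset.sum_nonneg fun j _ => Finset.sum_nonneg fun k _ => integral_nonneg fun y => by positivity
  rw [l]
  simp_rw [key, Finset.sum_sub_distrib, Complex.sub_re]
  rw [a1, a2]
  linarith

/-- Convolution of a function with a smooth kernel. -/
def cv (f ρ : E n → ℂ) (y : E n) : ℂ := ∫ z, f z * ρ (y - z)

theorem cv_eq (f ρ : E n → ℂ) : cv f ρ = convolution f ρ (ContinuousLinearMap.mul ℝ ℂ) volume := rfl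

theorem contDiff_cv {f ρ : E n → ℂ} (hf : LocallyIntegrable f) (hρ : IsTest ρ) :
    ContDiff ℝ ∞ (cv f ρ) := by
  rw [cv_eq]
  exact hρ.2.contDiff_convolution_right _ hf hρ.1

theorem isTest_cv {f ρ : E n → ℂ} (hf : LocallyIntegrable f) (hc : HasCompactSupport f)
    (hρ : IsTest ρ) : IsTest (cv f ρ) :=
  ⟨contDiff_cv hf hρ, by rw [cv_eq]; exact hc.convolution _ hρ.2⟩

theorem integrable_cv {f ρ : E n → ℂ} (hf : LocallyIntegrable f) (hρ : HasCompactSupport ρ)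
    (hc : Continuous ρ) (y : E n) : Integrable (fun z => f z * ρ (y - z)) :=
  (hρ.convolutionExists_right (ContinuousLinearMap.mul ℝ ℂ) hf hc y)

theorem dd_cv {c : ℂ} {j : Fin n} {f ρ : E n → ℂ} (hf : LocallyIntegrable f) (hρ : IsTest ρ)
    (y : E n) : dd c j (cv f ρ) y = cv f (dd c j ρ) y := by
  have h1 : ContDiff ℝ 1 ρ := hρ.1.of_le (by simp)
  have h := (hρ.2.hasFDerivAt_convolution_right (ContinuousLinearMap.mul ℝ ℂ) hf h1 y).fderiv
  have hint : ∀ v, fderiv ℝ (cv f ρ) y v = ∫ z, f z * fderiv ℝ ρ (y - z) v := by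
    intro v
    rw [cv_eq, h, convolution_precompR_apply _ hf (hρ.2.fderiv ℝ)
      (h1.continuous_fderiv one_ne_zero)]
    rfl
  have hi : ∀ v, Integrable (fun z => f z * fderiv ℝ ρ (y - z) v) := by
    intro v
    refine integrable_cv (ρ := fun x => fderiv ℝ ρ x v) hf ?_ ?_ y
    · exact (hρ.2.fderiv_apply ℝ v)
    · exact (h1.continuous_fderiv one_ne_zero).clm_apply continuous_const
  simp only [dd, cv]
  rw [hint, hint, ← integral_const_mul c, ← integral_add (hi _) ((hi _).const_mul _),
    ← integral_const_mul]
  congr 1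
  ext z
  ring

theorem dd_reflect {c : ℂ} {j : Fin n} {ρ : E n → ℂ} (y z : E n) :
    dd c j (fun z => ρ (y - z)) z = - dd c j ρ (y - z) := by
  simp only [dd]
  have : fderiv ℝ (fun z => ρ (y - z)) z = - fderiv ℝ ρ (y - z) := by
    ext v
    by_cases hd : DifferentiableAt ℝ ρ (y - z)
    · have h := hd.hasFDerivAt.comp z ((hasFDerivAt_id z).const_sub y)
      have h' : fderiv ℝ (fun z => ρ (y - z)) z = _ := h.fderiv
      rw [h']
      simp
    · have hd' : ¬ DifferentiableAt ℝ (fun z => ρ (y - z)) z := by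
        intro h
        apply hd
        have h2 : DifferentiableAt ℝ (fun w : E n => y - w) (y - z) := by fun_prop
        have h3 : DifferentiableAt ℝ (fun z => ρ (y - z)) (y - (y - z)) := by simpa using h
        have := DifferentiableAt.comp (y - z) h3 h2
        refine this.congr_of_eventuallyEq (Eventually.of_forall fun w => ?_)
        simp
      rw [fderiv_zero_of_not_differentiableAt hd, fderiv_zero_of_not_differentiableAt hd']
      simp
  rw [this]
  simp
  ring

/-- Young's inequality with a probability kernel. -/
theorem young {ρ : E n → ENNReal} (hρ : Measurable ρ) (h1 : ∫⁻ z, ρ z = 1) {g h : E n → ENNReal}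
    (hg : AEMeasurable g) (hh : ∀ y, h y ≤ ∫⁻ z, ρ (y - z) * g z) :
    ∫⁻ y, h y ^ 2 ≤ ∫⁻ y, g y ^ 2 := by
  have key : ∀ y, h y ^ 2 ≤ ∫⁻ z, ρ (y - z) * g z ^ 2 := by
    intro y
    have hm : Measurable fun z => ρ (y - z) := hρ.comp (measurable_const.sub measurable_id)
    have hone : ∫⁻ z, ρ (y - z) = 1 := by
      rw [lintegral_sub_left_eq_self ρ y, h1]
    let ν : Measure (E n) := volume.withDensity fun z => ρ (y - z)
    have hν : IsProbabilityMeasure ν := ⟨by simp [ν, hone]⟩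
    have hgν : AEMeasurable g ν := hg.mono_ac (withDensity_absolutelyContinuous _ _)
    have hle := eLpNorm_le_eLpNorm_of_exponent_le (μ := ν) (f := g) (p := 1) (q := 2) (by norm_num)
      hgν.aestronglyMeasurable
    rw [eLpNorm_one_eq_lintegral_enorm, eLpNorm_eq_lintegral_rpow_enorm_toReal (by norm_num)
      (by norm_num)] at hle
    have e1 : ∫⁻ z, g z ∂ν = ∫⁻ z, ρ (y - z) * g z := by
      rw [lintegral_withDensity_eq_lintegral_mul₀ hm.aemeasurable hg]; rfl
    have e2 : ∫⁻ z, g z ^ 2 ∂ν = ∫⁻ z, ρ (y - z) * g z ^ 2 := by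
      rw [lintegral_withDensity_eq_lintegral_mul₀ hm.aemeasurable (hg.pow_const 2)]; rfl
    simp only [enorm_eq_self, ENNReal.toReal_ofNat, ENNReal.rpow_ofNat] at hle
    rw [e1, e2] at hle
    calc h y ^ 2 ≤ (∫⁻ z, ρ (y - z) * g z) ^ 2 := by gcongr; exact hh y
      _ ≤ ((∫⁻ z, ρ (y - z) * g z ^ 2) ^ (1 / 2 : ℝ)) ^ 2 := by gcongr
      _ = _ := by
        rw [← ENNReal.rpow_natCast, ← ENNReal.rpow_mul]; simp
  calc ∫⁻ y, h y ^ 2 ≤ ∫⁻ y, ∫⁻ z, ρ (y - z) * g z ^ 2 := lintegral_mono key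
    _ = ∫⁻ z, ∫⁻ y, ρ (y - z) * g z ^ 2 := by
      apply lintegral_lintegral_swap
      apply AEMeasurable.mul
      · exact (hρ.comp (measurable_fst.sub measurable_snd)).aemeasurable
      · exact ((hg.pow_const 2).comp_snd)
    _ = ∫⁻ z, g z ^ 2 := by
      congr 1; ext z
      have hm : Measurable fun y => ρ (y - z) := hρ.comp (measurable_id.sub measurable_const)
      rw [lintegral_mul_const _ hm, lintegral_sub_right_eq_self ρ z, h1, one_mul]

theorem eLpNorm_two_sq {f : E n → ℂ} : eLpNorm f 2 volume ^ 2 = ∫⁻ y, ‖f y‖ₑ ^ 2 := by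
  rw [eLpNorm_eq_lintegral_rpow_enorm_toReal (by norm_num) (by norm_num),
    ← ENNReal.rpow_natCast, ← ENNReal.rpow_mul]
  simp

/-- A mollifying kernel supported in the ball of radius `ε`. -/
structure Moll (ε : ℝ) (ρ : E n → ℝ) : Prop where
  smooth : ContDiff ℝ ∞ ρ
  cpt : HasCompactSupport ρ
  nonneg : ∀ y, 0 ≤ ρ y
  int : ∫ y, ρ y = 1
  supp : ∀ y, ρ y ≠ 0 → ‖y‖ < ε

theorem Moll.exists {ε : ℝ} (hε : 0 < ε) : ∃ ρ : E n → ℝ, Moll ε ρ := by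
  let b : ContDiffBump (0 : E n) := ⟨ε / 2, ε, by positivity, by linarith⟩
  refine ⟨b.normed volume, ?_, b.hasCompactSupport_normed, b.nonneg_normed, b.integral_normed, ?_⟩
  · exact b.contDiff_normed
  · intro y hy
    have : y ∈ Function.support (b.normed volume) := hy
    rw [b.support_normed_eq] at this
    simpa using this

theorem Moll.isTest {ε : ℝ} {ρ : E n → ℝ} (h : Moll ε ρ) : IsTest (fun y => (ρ y : ℂ)) :=
  ⟨ofRealCLM.contDiff.comp h.smooth, h.cpt.comp_left (g := fun x : ℝ => (x : ℂ)) (by simp)⟩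

theorem Moll.lint {ε : ℝ} {ρ : E n → ℝ} (h : Moll ε ρ) : ∫⁻ y, ofReal (ρ y) = 1 := by
  rw [← ofReal_integral_eq_lintegral_ofReal
    (h.smooth.continuous.integrable_of_hasCompactSupport h.cpt)
    (Eventually.of_forall h.nonneg), h.int, ENNReal.ofReal_one]

theorem Moll.young {ε : ℝ} {ρ : E n → ℝ} (h : Moll ε ρ) {g : E n → ℝ} (hg : AEMeasurable g)
    {u : E n → ℂ} (hu : ∀ y, ‖u y‖ ≤ ∫ z, ρ (y - z) * g z) (h0 : ∀ y, 0 ≤ g y) :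
    eLpNorm u 2 ≤ eLpNorm g 2 := by
  have h2 : ∫⁻ y, ‖u y‖ₑ ^ 2 ≤ ∫⁻ y, ofReal (g y) ^ 2 := by
    refine HypArr.young (ρ := fun z => ofReal (ρ z))
      h.smooth.continuous.measurable.ennreal_ofReal h.lint hg.ennreal_ofReal ?_
    intro y
    rw [← ofReal_norm]
    calc ofReal ‖u y‖ ≤ ofReal (∫ z, ρ (y - z) * g z) :=
          ofReal_le_ofReal (hu y)
      _ ≤ ∫⁻ z, ofReal (ρ (y - z) * g z) := by
          by_cases hi : Integrable (fun z => ρ (y - z) * g z)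
          · rw [ofReal_integral_eq_lintegral_ofReal hi
              (Eventually.of_forall fun z => mul_nonneg (h.nonneg _) (h0 _))]
          · rw [integral_undef hi]; simp
      _ = _ := by
          congr 1; ext z; rw [ENNReal.ofReal_mul (h.nonneg _)]
  have h3 : ∫⁻ y, ofReal (g y) ^ 2 = ∫⁻ y, ‖g y‖ₑ ^ 2 := by
    congr 1; ext y; rw [Real.enorm_eq_ofReal (h0 y)]
  rw [h3] at h2
  rw [eLpNorm_eq_lintegral_rpow_enorm_toReal (by norm_num) (by norm_num),
    eLpNorm_eq_lintegral_rpow_enorm_toReal (by norm_num) (by norm_num)]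
  simp only [ENNReal.toReal_ofNat, ENNReal.rpow_ofNat]
  gcongr

theorem IsTest.mul_memLp {χ W : E n → ℂ} (hχ : IsTest χ) (hW : MemLp W 2) :
    Integrable (fun z => χ z * W z) :=
  hχ.memLp.integrable_mul hW

theorem approx_eq {ι : Type*} [Fintype ι] {κ c : ι → ℂ} {j : ι → Fin n} {m : ι → E n → ℂ}
    (hm : ∀ l, ContDiff ℝ ∞ (m l)) {W : ι → E n → ℂ} (hW : ∀ l, MemLp (W l) 2) {s : E n → ℂ}
    (hs : MemLp s 2)
    (hweak : ∀ a, IsTest a → ∑ l, ∫ z, (-(κ l * dd (c l) (j l) a z) + m l z * a z) * W l z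
      = ∫ z, a z * s z)
    {χ : E n → ℂ} (hχ : IsTest χ) {η K ε : ℝ} (hη : 0 ≤ η) (hK : 0 ≤ K)
    (hκ : ∀ l, ‖κ l‖ ≤ K)
    (hdχ : ∀ l z, ‖dd (c l) (j l) χ z‖ ≤ η) (hχ1 : ∀ z, ‖χ z‖ ≤ 1) {ρ : E n → ℝ} (hρ : Moll ε ρ)
    (hosc : ∀ l y z, ρ (y - z) ≠ 0 → χ z ≠ 0 → ‖m l y - m l z‖ ≤ η) :
    eLpNorm (fun y => ∑ l, (κ l * dd (c l) (j l) (cv (fun z => χ z * W l z) (fun z => (ρ z : ℂ))) y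
      + m l y * cv (fun z => χ z * W l z) (fun z => (ρ z : ℂ)) y)) 2 ≤
      eLpNorm s 2 + ofReal (η * (K + 1)) * ∑ l, eLpNorm (W l) 2 := by
  set r : E n → ℂ := fun z => (ρ z : ℂ) with hr
  have hrt : IsTest r := hρ.isTest
  have hloc : ∀ l, LocallyIntegrable (fun z => χ z * W l z) :=
    fun l => (hχ.mul_memLp (hW l)).locallyIntegrable
  have hrefl : ∀ y, ContDiff ℝ ∞ (fun z => r (y - z)) :=
    fun y => hrt.1.comp (contDiff_const.sub contDiff_id)
  set g : E n → ℝ := fun z => ‖s z‖ + η * (K + 1) * ∑ l, ‖W l z‖ with hg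
  have hgm : AEStronglyMeasurable g := by
    refine hs.1.norm.add (AEStronglyMeasurable.const_mul ?_ _)
    exact Finset.aestronglyMeasurable_fun_sum _ fun l _ => (hW l).1.norm
  have hgn : eLpNorm g 2 ≤ eLpNorm s 2 + ofReal (η * (K + 1)) * ∑ l, eLpNorm (W l) 2 := by
    have h1 : eLpNorm g 2 ≤ eLpNorm (fun z => ‖s z‖) 2
        + eLpNorm (fun z => η * (K + 1) * ∑ l, ‖W l z‖) 2 := by
      refine eLpNorm_add_le hs.1.norm (AEStronglyMeasurable.const_mul ?_ _) (by norm_num)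
      exact Finset.aestronglyMeasurable_fun_sum _ fun l _ => (hW l).1.norm
    refine h1.trans ?_
    rw [eLpNorm_norm]
    gcongr
    have h2 : eLpNorm (fun z => η * (K + 1) * ∑ l, ‖W l z‖) 2 =
        ofReal (η * (K + 1)) * eLpNorm (fun z => ∑ l, ‖W l z‖) 2 := by
      have := eLpNorm_const_smul (η * (K + 1)) (fun z => ∑ l, ‖W l z‖) 2 (volume : Measure (E n))
      rw [Real.enorm_eq_ofReal (by positivity)] at this
      exact this
    rw [h2]
    gcongr
    have e : (fun z => ∑ l, ‖W l z‖) = ∑ l, fun z => ‖W l z‖ := by ext z; simp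
    rw [e]
    refine (eLpNorm_sum_le (fun l _ => (hW l).1.norm) (by norm_num)).trans (le_of_eq ?_)
    simp [eLpNorm_norm]
  refine le_trans (hρ.young hgm.aemeasurable ?_ ?_) hgn
  swap
  · intro y; positivity
  intro y
  -- the test function at `y`
  have ha : IsTest (fun z => χ z * r (y - z)) := hχ.mul_right (hrefl y)
  have hda : ∀ l z, dd (c l) (j l) (fun z => χ z * r (y - z)) z
      = dd (c l) (j l) χ z * r (y - z) - χ z * dd (c l) (j l) r (y - z) := by
    intro l z
    rw [dd_mul (diffAt hχ.1 _) (diffAt (hrefl y) _), dd_reflect]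
    ring
  have I1 : ∀ l, Integrable (fun z => χ z * W l z * dd (c l) (j l) r (y - z)) := fun l =>
    integrable_cv (hloc l) hrt.dd.2 hrt.dd.1.continuous y
  have I2 : ∀ l, Integrable (fun z => χ z * W l z * r (y - z)) := fun l =>
    integrable_cv (hloc l) hrt.2 hrt.1.continuous y
  have I3 : ∀ l, Integrable (fun z => (dd (c l) (j l) χ z * r (y - z)) * W l z) := fun l =>
    (hχ.dd.mul_right (hrefl y)).mul_memLp (hW l)
  have I4 : ∀ l, Integrable (fun z => (m l z * (χ z * r (y - z))) * W l z) := fun l =>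
    (ha.mul (hm l)).mul_memLp (hW l)
  have I5 : Integrable (fun z => (χ z * r (y - z)) * s z) := ha.mul_memLp hs
  have hw := hweak _ ha
  have expand : ∀ l, ∫ z, (-(κ l * dd (c l) (j l) (fun z => χ z * r (y - z)) z)
      + m l z * (χ z * r (y - z))) * W l z =
      κ l * (∫ z, χ z * W l z * dd (c l) (j l) r (y - z))
       - κ l * (∫ z, (dd (c l) (j l) χ z * r (y - z)) * W l z)
       + ∫ z, (m l z * (χ z * r (y - z))) * W l z := by
    intro l
    have I7 : Integrable (fun z => κ l * (χ z * W l z * dd (c l) (j l) r (y - z))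
        - κ l * ((dd (c l) (j l) χ z * r (y - z)) * W l z)) :=
      ((I1 l).const_mul _).sub ((I3 l).const_mul _)
    rw [← integral_const_mul, ← integral_const_mul, ← integral_sub ((I1 l).const_mul _)
      ((I3 l).const_mul _), ← integral_add I7 (I4 l)]
    congr 1; ext z
    rw [hda]
    ring
  simp only [expand] at hw
  have key : ∑ l, (κ l * dd (c l) (j l) (cv (fun z => χ z * W l z) r) y
      + m l y * cv (fun z => χ z * W l z) r y) =
      ∫ z, r (y - z) * (χ z * s z + ∑ l, (κ l * dd (c l) (j l) χ z * W l z
        + (m l y - m l z) * χ z * W l z)) := by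
    have e1 : ∑ l, (κ l * dd (c l) (j l) (cv (fun z => χ z * W l z) r) y
        + m l y * cv (fun z => χ z * W l z) r y) =
      (∫ z, (χ z * r (y - z)) * s z) + ∑ l, (κ l * (∫ z, (dd (c l) (j l) χ z * r (y - z)) * W l z)
       + (m l y * (∫ z, χ z * W l z * r (y - z)) - ∫ z, (m l z * (χ z * r (y - z))) * W l z)) := by
      rw [← hw, ← sum_add_distrib]
      refine sum_congr rfl fun l _ => ?_
      rw [dd_cv (hloc l) hrt]
      simp only [cv]
      ring
    have e2 : ∀ l, (κ l * (∫ z, (dd (c l) (j l) χ z * r (y - z)) * W l z)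
       + (m l y * (∫ z, χ z * W l z * r (y - z)) - ∫ z, (m l z * (χ z * r (y - z))) * W l z))
       = ∫ z, (κ l * ((dd (c l) (j l) χ z * r (y - z)) * W l z) + (m l y * (χ z * W l z * r (y - z))
         - (m l z * (χ z * r (y - z))) * W l z)) := by
      intro l
      have I7 : Integrable (fun z => m l y * (χ z * W l z * r (y - z))
          - (m l z * (χ z * r (y - z))) * W l z) := ((I2 l).const_mul _).sub (I4 l)
      rw [← integral_const_mul, ← integral_const_mul, ← integral_sub ((I2 l).const_mul _) (I4 l),
        ← integral_add ((I3 l).const_mul _) I7]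
    have I6 : ∀ l, Integrable (fun z => κ l * ((dd (c l) (j l) χ z * r (y - z)) * W l z) +
        (m l y * (χ z * W l z * r (y - z)) - (m l z * (χ z * r (y - z))) * W l z)) := fun l =>
      ((I3 l).const_mul _).add (((I2 l).const_mul _).sub (I4 l))
    rw [e1]
    simp only [e2]
    rw [← integral_finsetSum _ (fun l _ => I6 l),
      ← integral_add I5 (integrable_finsetSum _ fun l _ => I6 l)]
    congr 1; ext z
    rw [mul_add, mul_sum]
    congr 1
    · ring
    · refine sum_congr rfl fun l _ => ?_
      ring
  rw [key]
  have hpt : ∀ z, ‖r (y - z) * (χ z * s z + ∑ l, (κ l * dd (c l) (j l) χ z * W l z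
        + (m l y - m l z) * χ z * W l z))‖ ≤ ρ (y - z) * g z := by
    intro z
    rw [norm_mul]
    have hr1 : ‖r (y - z)‖ = ρ (y - z) := by
      simp [hr, abs_of_nonneg (hρ.nonneg _)]
    rw [hr1]
    by_cases h0 : ρ (y - z) = 0
    · simp [h0]
    have : ∀ l, ‖κ l * dd (c l) (j l) χ z * W l z + (m l y - m l z) * χ z * W l z‖
        ≤ η * (K + 1) * ‖W l z‖ := by
      intro l
      rw [← add_mul, norm_mul]
      gcongr
      refine (norm_add_le _ _).trans ?_
      rw [norm_mul, norm_mul]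
      have t1 : ‖κ l‖ * ‖dd (c l) (j l) χ z‖ ≤ K * η := by
        gcongr
        · exact hκ l
        · exact hdχ l z
      have t2 : ‖m l y - m l z‖ * ‖χ z‖ ≤ η * 1 := by
        by_cases hz : χ z = 0
        · simp [hz, hη]
        · gcongr
          · exact hosc l y z h0 hz
          · exact hχ1 z
      linarith
    gcongr
    · exact hρ.nonneg _
    refine (norm_add_le _ _).trans ?_
    simp only [hg]
    gcongr
    · rw [norm_mul]
      exact mul_le_of_le_one_left (norm_nonneg _) (hχ1 z)
    · rw [mul_sum]
      exact (norm_sum_le _ _).trans (Finset.sum_le_sum fun l _ => this l)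
  refine norm_integral_le_of_norm_le ?_ (Eventually.of_forall hpt)
  have : LocallyIntegrable g := by
    refine (hs.norm.locallyIntegrable (by norm_num)).add ?_
    refine LocallyIntegrable.smul (c := η * (K + 1)) ?_
    exact locallyIntegrable_finsetSum _ fun l _ => ((hW l).norm.locallyIntegrable (by norm_num))
  have hc := (hρ.cpt.convolutionExists_right (ContinuousLinearMap.mul ℝ ℝ) this
    hρ.smooth.continuous y).integrable
  refine hc.congr (Eventually.of_forall fun z => ?_)
  simp [mul_comm]


theorem norm_dd_le {c : ℂ} (hc : ‖c‖ ≤ 1) (j : Fin n) (a : E n → ℂ) (y : E n) :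
    ‖dd c j a y‖ ≤ ‖fderiv ℝ a y‖ := by
  simp only [dd]
  have h1 : ‖fderiv ℝ a y (single j 1)‖ ≤ ‖fderiv ℝ a y‖ := by
    simpa [Pi.norm_single] using (fderiv ℝ a y).le_opNorm (single j 1)
  have h2 : ‖fderiv ℝ a y (single j I)‖ ≤ ‖fderiv ℝ a y‖ := by
    simpa [Pi.norm_single] using (fderiv ℝ a y).le_opNorm (single j I)
  have h3 : ‖c * fderiv ℝ a y (single j I)‖ ≤ ‖fderiv ℝ a y‖ := by
    rw [norm_mul]
    exact (mul_le_of_le_one_left (norm_nonneg _) hc).trans h2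
  rw [norm_mul]
  have h4 := (norm_add_le (fderiv ℝ a y (single j 1))
    (c * fderiv ℝ a y (single j I)))
  norm_num
  linarith

theorem exists_cutoff {η : ℝ} (hη : 0 < η) {K : Set (E n)} (hK : IsCompact K) :
    ∃ χ : E n → ℂ, IsTest χ ∧ (∀ z, ‖χ z‖ ≤ 1) ∧ (∀ z ∈ K, χ z = 1) ∧
      ∀ z, ‖fderiv ℝ χ z‖ ≤ η := by
  let b : ContDiffBump (0 : E n) := ⟨1, 2, by norm_num, by norm_num⟩
  let β : E n → ℂ := fun z => (b z : ℂ)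
  have hβ : IsTest β := ⟨ofRealCLM.contDiff.comp b.contDiff,
    b.hasCompactSupport.comp_left (g := fun x : ℝ => (x : ℂ)) (by simp)⟩
  obtain ⟨C, hC⟩ : ∃ C, ∀ z, ‖fderiv ℝ β z‖ ≤ C :=
    (hβ.2.fderiv ℝ).exists_bound_of_continuous (hβ.1.continuous_fderiv (by simp))
  obtain ⟨R₀, hR₀⟩ := hK.isBounded.exists_norm_le
  have hC0 : 0 ≤ C := (norm_nonneg _).trans (hC 0)
  set R : ℝ := max 1 (max R₀ (C / η)) with hR
  have hR1 : 0 < R := lt_of_lt_of_le one_pos (le_max_left _ _)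
  have hR2 : R₀ ≤ R := (le_max_left _ _).trans (le_max_right _ _)
  have hR3 : C / η ≤ R := (le_max_right _ _).trans (le_max_right _ _)
  refine ⟨fun z => β (R⁻¹ • z), ⟨?_, ?_⟩, ?_, ?_, ?_⟩
  · exact hβ.1.comp (contDiff_const_smul _)
  · exact hβ.2.comp_smul (inv_ne_zero hR1.ne')
  · intro z
    simp only [β, norm_real, Real.norm_eq_abs, abs_of_nonneg b.nonneg]
    exact b.le_one
  · intro z hz
    simp only [β]
    rw [b.one_of_mem_closedBall]
    · simp
    · simp only [b, Metric.mem_closedBall, dist_zero_right, norm_smul, norm_inv, Real.norm_eq_abs,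
        abs_of_pos hR1]
      rw [inv_mul_le_iff₀ hR1, mul_one]
      exact (hR₀ z hz).trans hR2
  · intro z
    have h := ((diffAt hβ.1 (R⁻¹ • z)).hasFDerivAt.comp z
      ((hasFDerivAt_id z).const_smul (R⁻¹))).fderiv
    have h' : fderiv ℝ (fun z => β (R⁻¹ • z)) z = _ := h
    rw [h']
    refine (ContinuousLinearMap.opNorm_comp_le _ _).trans ?_
    have e1 : ‖R⁻¹ • ContinuousLinearMap.id ℝ (E n)‖ ≤ R⁻¹ := by
      rw [norm_smul, norm_inv, Real.norm_eq_abs, abs_of_pos hR1]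
      exact mul_le_of_le_one_right (by positivity) ContinuousLinearMap.norm_id_le
    calc _ ≤ C * R⁻¹ := by
          gcongr
          exact hC _
      _ ≤ η := by
          rw [div_le_iff₀ hη] at hR3
          rw [mul_inv_le_iff₀ hR1]
          linarith

theorem exists_osc {m : E n → ℂ} (hm : Continuous m) {χ : E n → ℂ} (hχ : IsTest χ) {η : ℝ}
    (hη : 0 < η) : ∃ ε₀ > 0, ∀ y z, ‖y - z‖ < ε₀ → χ z ≠ 0 → ‖m y - m z‖ ≤ η := by
  have h := hχ.2.isCompact.uniformContinuousAt_of_continuousAt m (fun a _ => hm.continuousAt)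
    (Metric.dist_mem_uniformity hη)
  obtain ⟨ε₀, h0, hε⟩ := Metric.mem_uniformity_dist.1 h
  refine ⟨ε₀, h0, fun y z hyz hz => ?_⟩
  have hzt : z ∈ tsupport χ := subset_tsupport _ hz
  have := hε (a := z) (b := y) (by rw [dist_comm, dist_eq_norm]; exact hyz) hzt
  rw [← dist_eq_norm, dist_comm]
  exact le_of_lt this

theorem Moll.mono {ε ε' : ℝ} (h : ε ≤ ε') {ρ : E n → ℝ} (hρ : Moll ε ρ) : Moll ε' ρ :=
  ⟨hρ.1, hρ.2, hρ.3, hρ.4, fun y hy => (hρ.5 y hy).trans_le h⟩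

theorem Moll.int_sub {ε : ℝ} {ρ : E n → ℝ} (hρ : Moll ε ρ) (y : E n) : ∫ z, ρ (y - z) = 1 := by
  rw [integral_sub_left_eq_self ρ volume y, hρ.int]

theorem Moll.integrable_sub {ε : ℝ} {ρ : E n → ℝ} (hρ : Moll ε ρ) (y : E n) :
    Integrable fun z => ρ (y - z) :=
  (hρ.smooth.continuous.integrable_of_hasCompactSupport hρ.cpt).comp_sub_left y

/-- Mollification of continuous compactly supported functions converges in `L²`. -/
theorem exists_moll_cont {g : E n → ℂ} (hg : Continuous g) (hc : HasCompactSupport g) {κ : ℝ}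
    (hκ : 0 < κ) : ∃ ε₀ > 0, ∀ ρ, Moll ε₀ ρ →
      eLpNorm (fun y => cv g (fun z => (ρ z : ℂ)) y - g y) 2 ≤ ofReal κ := by
  set B : Set (E n) := Metric.cthickening 1 (tsupport g) with hB
  have hBc : IsCompact B := hc.isCompact.cthickening
  have hv : volume B ≠ ⊤ := hBc.measure_lt_top.ne
  set V : ℝ := (volume B).toReal ^ (1 / 2 : ℝ) with hV
  have hV0 : 0 ≤ V := by positivity
  set η := κ / (V + 1) with hη
  have hη0 : 0 < η := by positivity
  have huc := hc.uniformContinuous_of_continuous hg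
  obtain ⟨ε₁, h1, hε₁⟩ := Metric.uniformContinuous_iff.1 huc η hη0
  refine ⟨min ε₁ 1, lt_min h1 one_pos, fun ρ hρ => ?_⟩
  have hind : eLpNorm (B.indicator fun _ => η) 2 volume ≤ ofReal κ := by
    rw [eLpNorm_indicator_const hBc.measurableSet (by norm_num) (by norm_num),
      Real.enorm_eq_ofReal hη0.le, ← ENNReal.ofReal_toReal hv]
    rw [ENNReal.ofReal_rpow_of_nonneg (by positivity) (by norm_num),
      ← ENNReal.ofReal_mul hη0.le]
    apply ofReal_le_ofReal
    have : η * V ≤ κ := by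
      rw [hη, div_mul_eq_mul_div, div_le_iff₀ (by positivity)]
      nlinarith
    simpa [hV] using this
  refine le_trans (hρ.young (aemeasurable_const.indicator hBc.measurableSet) ?_ ?_) hind
  swap
  · intro y
    exact Set.indicator_nonneg (fun _ _ => hη0.le) _
  intro y
  have hI : Integrable (fun z => g z * (ρ (y - z) : ℂ)) :=
    integrable_cv (hg.integrable_of_hasCompactSupport hc).locallyIntegrable hρ.isTest.2
      hρ.isTest.1.continuous y
  have e : cv g (fun z => (ρ z : ℂ)) y - g y = ∫ z, (g z - g y) * (ρ (y - z) : ℂ) := by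
    have h2 : ∫ z, (ρ (y - z) : ℂ) = 1 := by
      rw [integral_complex_ofReal, hρ.int_sub]; simp
    have h3 : Integrable (fun z => (ρ (y - z) : ℂ)) := (hρ.integrable_sub y).ofReal
    simp only [sub_mul]
    rw [integral_sub hI (h3.const_mul _), integral_const_mul, h2, mul_one]
    rfl
  rw [e]
  refine norm_integral_le_of_norm_le ?_ (Eventually.of_forall fun z => ?_)
  · have : Integrable (fun z => η * ρ (y - z)) := (hρ.integrable_sub y).const_mul _
    refine (this.indicator hBc.measurableSet).congr (Eventually.of_forall fun z => ?_)
    by_cases hz : z ∈ B <;> simp [hz, mul_comm]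
  · rw [norm_mul, norm_real, Real.norm_eq_abs, abs_of_nonneg (hρ.nonneg _), mul_comm]
    by_cases h0 : ρ (y - z) = 0
    · simp [h0]
    have hlt := hρ.supp _ h0
    gcongr
    · exact hρ.nonneg _
    by_cases hz : z ∈ B
    · simp only [hz, Set.indicator_of_mem]
      rw [← dist_eq_norm]
      refine (hε₁ ?_).le
      rw [dist_comm, dist_eq_norm]
      exact hlt.trans_le (min_le_left _ _)
    · have hz1 : z ∉ tsupport g := fun h => hz (Metric.self_subset_cthickening _ h)
      have hz2 : y ∉ tsupport g := by
        intro h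
        apply hz
        refine Metric.mem_cthickening_of_dist_le z y 1 _ h ?_
        rw [dist_comm, dist_eq_norm]
        exact (hlt.trans_le (min_le_right _ _)).le
      rw [image_eq_zero_of_notMem_tsupport hz1, image_eq_zero_of_notMem_tsupport hz2]
      simp [hz]

theorem exists_moll_L2 {W : E n → ℂ} (hW : MemLp W 2) {κ : ℝ} (hκ : 0 < κ) :
    ∃ K : Set (E n), IsCompact K ∧ ∃ ε₀ > 0, ∀ χ, IsTest χ → (∀ z, ‖χ z‖ ≤ 1) →
      (∀ z ∈ K, χ z = 1) → ∀ ρ, Moll ε₀ ρ →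
      eLpNorm (fun y => cv (fun z => χ z * W z) (fun z => (ρ z : ℂ)) y - W y) 2
        ≤ ofReal κ := by
  obtain ⟨g, hgc, hgW, hg, hgL⟩ := hW.exists_hasCompactSupport_eLpNorm_sub_le (by norm_num)
    (ε := ofReal (κ / 3)) (by positivity)
  obtain ⟨ε₀, h0, hε₀⟩ := exists_moll_cont hg hgc (κ := κ / 3) (by positivity)
  refine ⟨tsupport g, hgc.isCompact, ε₀, h0, fun χ hχ hχ1 hχK ρ hρ => ?_⟩
  have hχg : ∀ z, χ z * g z = g z := by
    intro z
    by_cases hz : z ∈ tsupport g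
    · rw [hχK z hz, one_mul]
    · rw [image_eq_zero_of_notMem_tsupport hz, mul_zero]
  have hl1 : LocallyIntegrable (fun z => χ z * (W z - g z)) :=
    (hχ.mul_memLp (hW.sub hgL)).locallyIntegrable
  have hl2 : LocallyIntegrable g := (hg.integrable_of_hasCompactSupport hgc).locallyIntegrable
  have e : (fun y => cv (fun z => χ z * W z) (fun z => (ρ z : ℂ)) y - W y) =
      (cv (fun z => χ z * (W z - g z)) (fun z => (ρ z : ℂ))
        + fun y => cv g (fun z => (ρ z : ℂ)) y - g y) - (W - g) := by
    ext y
    have i1 := integrable_cv hl1 hρ.isTest.2 hρ.isTest.1.continuous y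
    have i2 := integrable_cv hl2 hρ.isTest.2 hρ.isTest.1.continuous y
    have : cv (fun z => χ z * W z) (fun z => (ρ z : ℂ)) y =
        cv (fun z => χ z * (W z - g z)) (fun z => (ρ z : ℂ)) y + cv g (fun z => (ρ z : ℂ)) y := by
      simp only [cv]
      rw [← integral_add i1 i2]
      congr 1; ext z
      rw [mul_sub, hχg]; ring
    simp only [Pi.add_apply, Pi.sub_apply, this]
    ring
  have m1 : AEStronglyMeasurable (cv (fun z => χ z * (W z - g z)) (fun z => (ρ z : ℂ))) :=
    (contDiff_cv hl1 hρ.isTest).continuous.aestronglyMeasurable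
  have m2 : AEStronglyMeasurable (fun y => cv g (fun z => (ρ z : ℂ)) y - g y) :=
    ((contDiff_cv hl2 hρ.isTest).continuous.sub hg).aestronglyMeasurable
  have b1 : eLpNorm (cv (fun z => χ z * (W z - g z)) (fun z => (ρ z : ℂ))) 2
      ≤ ofReal (κ / 3) := by
    refine le_trans ?_ hgW
    rw [← eLpNorm_norm (W - g)]
    refine hρ.young (hW.sub hgL).1.norm.aemeasurable (fun y => ?_) (fun y => norm_nonneg _)
    refine norm_integral_le_of_norm_le ?_ (Eventually.of_forall fun z => ?_)
    · have := ((hW.sub hgL).norm.locallyIntegrable (by norm_num))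
      have hc := (hρ.cpt.convolutionExists_right (ContinuousLinearMap.mul ℝ ℝ) this
        hρ.smooth.continuous y).integrable
      refine hc.congr (Eventually.of_forall fun z => ?_)
      simp [mul_comm]
    · rw [norm_mul, norm_mul, norm_real, Real.norm_eq_abs, abs_of_nonneg (hρ.nonneg _),
        mul_comm]
      gcongr
      · exact hρ.nonneg _
      · exact mul_le_of_le_one_left (norm_nonneg _) (hχ1 z)
  rw [e]
  calc _ ≤ ofReal (κ / 3) + ofReal (κ / 3) + ofReal (κ / 3) := by
        refine (eLpNorm_sub_le (m1.add m2) (hW.sub hgL).1 (by norm_num)).trans ?_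
        gcongr
        refine (eLpNorm_add_le m1 m2 (by norm_num)).trans ?_
        gcongr
        exact hε₀ ρ hρ
    _ = ofReal κ := by
        rw [← ofReal_add (by positivity) (by positivity),
          ← ofReal_add (by positivity) (by positivity)]
        congr 1; ring

/-- Simultaneous approximation of weak solutions by tests. -/
theorem approx {φ : E n → ℂ} (hφ : ContDiff ℝ ∞ φ) {W : Fin n → E n → ℂ}
    (hW : ∀ j, MemLp (W j) 2) {s : E n → ℂ} (hs : MemLp s 2)
    (h1 : ∀ a, IsTest a → ∑ j, ∫ z, (dz j a z + (1 / 2) * dz j φ z * a z) * W j z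
      = ∫ z, a z * s z)
    (h2 : ∀ j k a, IsTest a → (∫ z, (-db k a z + (1 / 2) * db k φ z * a z) * W j z)
      = ∫ z, (-db j a z + (1 / 2) * db j φ z * a z) * W k z) {κ : ℝ} (hκ : 0 < κ) :
    ∃ X : Fin n → E n → ℂ, (∀ j, IsTest (X j)) ∧
      (∀ j, eLpNorm (fun y => X j y - W j y) 2 ≤ ofReal κ) ∧
      eLpNorm (fun y => ∑ j, Tst φ j (X j) y) 2 ≤ eLpNorm s 2 + ofReal κ ∧
      ∀ j k, eLpNorm (fun y => Top φ k (X j) y - Top φ j (X k) y) 2 ≤ ofReal κ := by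
  have hS : ∑ j, eLpNorm (W j) 2 ≠ ⊤ := ENNReal.sum_ne_top.2 fun j _ => (hW j).2.ne
  set S : ℝ := (∑ j, eLpNorm (W j) 2).toReal with hSdef
  have hS0 : 0 ≤ S := ENNReal.toReal_nonneg
  have hSof : ofReal S = ∑ j, eLpNorm (W j) 2 := ENNReal.ofReal_toReal hS
  set η : ℝ := κ / (4 * (S + 1)) with hη
  have hη0 : 0 < η := by positivity
  have hηS : η * (1 + 1) * (S + S) ≤ κ := by
    rw [hη, div_mul_eq_mul_div, div_mul_eq_mul_div, div_le_iff₀ (by positivity)]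
    nlinarith
  choose K hK ε₁ hε₁ hmoll using fun j => exists_moll_L2 (hW j) hκ
  obtain ⟨χ, hχ, hχ1, hχK, hχd⟩ := exists_cutoff hη0 (isCompact_iUnion hK)
  have hmz : ∀ j : Fin n, ContDiff ℝ ∞ fun z => (1 / 2) * dz j φ z :=
    fun j => contDiff_const.mul (contDiff_dd hφ)
  have hmb : ∀ j : Fin n, ContDiff ℝ ∞ fun z => (1 / 2) * db j φ z :=
    fun j => contDiff_const.mul (contDiff_dd hφ)
  choose ε₂ hε₂ hoz using fun j => exists_osc (hmz j).continuous hχ hη0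
  choose ε₃ hε₃ hob using fun j => exists_osc (hmb j).continuous hχ hη0
  obtain ⟨ε, hε, hle⟩ : ∃ ε > 0, ∀ j, ε ≤ ε₁ j ∧ ε ≤ ε₂ j ∧ ε ≤ ε₃ j := by
    rcases isEmpty_or_nonempty (Fin n) with he | he
    · exact ⟨1, one_pos, fun j => (he.false j).elim⟩
    refine ⟨univ.inf' Finset.univ_nonempty fun j => min (ε₁ j) (min (ε₂ j) (ε₃ j)), ?_, ?_⟩
    · simp only [gt_iff_lt, Finset.lt_inf'_iff]
      exact fun j _ => lt_min (hε₁ j) (lt_min (hε₂ j) (hε₃ j))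
    · intro j
      have := Finset.inf'_le (fun j => min (ε₁ j) (min (ε₂ j) (ε₃ j))) (mem_univ j)
      exact ⟨this.trans (min_le_left _ _), this.trans ((min_le_right _ _).trans (min_le_left _ _)),
        this.trans ((min_le_right _ _).trans (min_le_right _ _))⟩
  obtain ⟨ρ, hρ⟩ := Moll.exists (n := n) hε
  have hloc : ∀ l, LocallyIntegrable (fun z => χ z * W l z) :=
    fun l => (hχ.mul_memLp (hW l)).locallyIntegrable
  refine ⟨fun j => cv (fun z => χ z * W j z) (fun z => (ρ z : ℂ)), fun j => ?_, fun j => ?_, ?_, ?_⟩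
  · exact isTest_cv (hloc j) (hχ.2.mul_right) hρ.isTest
  · exact hmoll j χ hχ hχ1 (fun z hz => hχK z (Set.mem_iUnion.2 ⟨j, hz⟩)) ρ (hρ.mono (hle j).1)
  · have := approx_eq (ι := Fin n) (κ := fun _ => -1) (c := fun _ => -I) (j := fun l => l)
      (m := fun l z => (1 / 2) * dz l φ z) hmz hW hs (by
        intro a ha
        rw [← h1 a ha]
        simp) hχ hη0.le zero_le_one (by simp)
      (fun l z => (norm_dd_le (by simp) _ _ _).trans (hχd z)) hχ1 hρ
      (fun l y z h0 hz => hoz l y z ((hρ.supp _ h0).trans_le (hle l).2.1) hz)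
    rw [← hSof, ← ENNReal.ofReal_mul (by positivity)] at this
    refine le_trans (le_of_eq ?_) (this.trans ?_)
    · congr 1; ext y
      refine sum_congr rfl fun l _ => ?_
      simp only [Tst]; ring
    · gcongr
      nlinarith
  · intro j k
    have := approx_eq (ι := Bool) (κ := fun b => cond b 1 (-1)) (c := fun _ => I)
      (j := fun b => cond b k j)
      (m := fun b z => cond b ((1 / 2) * db k φ z) (-((1 / 2) * db j φ z)))
      (by rintro (_ | _); exacts [(hmb j).neg, hmb k])
      (W := fun b => cond b (W j) (W k)) (by rintro (_ | _); exacts [hW k, hW j])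
      (s := fun _ => 0) (by simp) (by
        intro a ha
        have h := h2 j k a ha
        simp only [Fintype.sum_bool, cond_true, cond_false, mul_zero, integral_zero]
        have e : ∀ z, (-(-1 * db j a z) + -(1 / 2 * db j φ z) * a z) * W k z
          = - ((-db j a z + 1 / 2 * db j φ z * a z) * W k z) := fun z => by ring
        simp only [e, one_mul]
        rw [integral_neg, ← h]
        ring) hχ hη0.le zero_le_one (by rintro (_ | _) <;> simp)
      (fun l z => (norm_dd_le (by simp) _ _ _).trans (hχd z)) hχ1 hρ
      (by
        rintro (_ | _) y z h0 hz
        · have := hob j y z ((hρ.supp _ h0).trans_le (hle j).2.2) hz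
          simp only [cond_false]
          rw [neg_sub_neg, norm_sub_rev]
          exact this
        · exact hob k y z ((hρ.supp _ h0).trans_le (hle k).2.2) hz)
    simp only [Fintype.sum_bool, cond_true, cond_false] at this
    have hj : eLpNorm (W j) 2 + eLpNorm (W k) 2 ≤ ofReal (S + S) := by
      rw [ofReal_add hS0 hS0, hSof]
      gcongr
      · exact single_le_sum (f := fun j => eLpNorm (W j) 2 volume) (fun _ _ => zero_le)
          (mem_univ j)
      · exact single_le_sum (f := fun j => eLpNorm (W j) 2 volume) (fun _ _ => zero_le)
          (mem_univ k)
    refine le_trans (le_of_eq ?_) (this.trans ?_)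
    · congr 1; ext y
      simp only [Top]; ring
    · simp only [eLpNorm_zero', zero_add]
      calc _ ≤ ofReal (η * (1 + 1)) * ofReal (S + S) := by gcongr
        _ = ofReal (η * (1 + 1) * (S + S)) := (ENNReal.ofReal_mul (by positivity)).symm
        _ ≤ _ := ofReal_le_ofReal hηS

abbrev L2 (n : ℕ) := Lp ℂ 2 (volume : Measure (E n))

abbrev L2v (n : ℕ) := PiLp 2 (fun _ : Fin n => L2 n)

theorem inner_toLp {f g : E n → ℂ} (hf : MemLp f 2) (hg : MemLp g 2) :
    inner ℂ (hf.toLp f) (hg.toLp g) = ∫ y, conj (f y) * g y := by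
  rw [L2.inner_def]
  refine integral_congr_ae ?_
  filter_upwards [hf.coeFn_toLp, hg.coeFn_toLp] with y h1 h2
  rw [h1, h2, RCLike.inner_apply, mul_comm]

theorem toLp_zero' {f : E n → ℂ} (hf : MemLp f 2) (h : ∀ y, f y = 0) : hf.toLp f = 0 := by
  have : f = 0 := funext h
  subst this
  exact MemLp.toLp_zero hf

theorem inner_toLp_left {f : E n → ℂ} (hf : MemLp f 2) (g : L2 n) :
    inner ℂ (hf.toLp f) g = ∫ y, conj (f y) * g y := by
  conv_lhs => rw [← Lp.toLp_coeFn g (Lp.memLp g)]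
  rw [inner_toLp]

theorem norm_toLp_sq {f : E n → ℂ} (hf : MemLp f 2) : ‖hf.toLp f‖ ^ 2 = ∫ y, ‖f y‖ ^ 2 := by
  rw [@norm_sq_eq_re_inner ℂ, inner_toLp]
  have : ∀ y, conj (f y) * f y = ((‖f y‖ ^ 2 : ℝ) : ℂ) := fun y => by
    rw [mul_comm, mul_conj, normSq_eq_norm_sq]
  simp only [this]
  rw [integral_complex_ofReal]
  simp

theorem integral_sq_le {f : E n → ℂ} (hf : MemLp f 2) {A : ℝ} (hA : 0 ≤ A)
    (h : eLpNorm f 2 ≤ ofReal A) : ∫ y, ‖f y‖ ^ 2 ≤ A ^ 2 := by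
  rw [← norm_toLp_sq hf, Lp.norm_toLp]
  gcongr
  exact ENNReal.toReal_le_of_le_ofReal hA h

theorem Tst_Tst {φ : E n → ℂ} (hφ : ContDiff ℝ ∞ φ) {j k : Fin n} {a : E n → ℂ}
    (ha : ContDiff ℝ ∞ a) (y : E n) :
    Tst φ k (Tst φ j a) y = Tst φ j (Tst φ k a) y := by
  have d1 := fun c (i : Fin n) => diffAt (contDiff_dd (c := c) (j := i) ha) y
  have d2 := fun c (i : Fin n) => diffAt (contDiff_dd (c := c) (j := i) hφ) y
  have d3 := diffAt ha y
  have e2 : ∀ j k, dz j (Tst φ k a) y = - dz j (dz k a) y + ((1 / 2) * dz j (dz k φ) y * a y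
      + (1 / 2) * dz k φ y * dz j a y) := fun j k => by
    have e : Tst φ k a = fun y => - dz k a y + (1 / 2) * dz k φ y * a y := rfl
    have c1 : DifferentiableAt ℝ (fun y => (1 / 2) * dz k φ y) y := (d2 _ _).const_mul _
    have c2 : DifferentiableAt ℝ (fun y => (1 / 2) * dz k φ y * a y) y := c1.mul d3
    have c3 : DifferentiableAt ℝ (fun y => - dz k a y) y := (d1 _ _).fun_neg
    rw [e, dd_add c3 c2, dd_neg, dd_mul c1 d3, dd_const_mul _ (d2 _ _)]
  have u : ∀ j k, Tst φ k (Tst φ j a) y = - dz k (Tst φ j a) y + (1 / 2) * dz k φ y * Tst φ j a y :=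
    fun _ _ => rfl
  rw [u, u, e2, e2, dd_comm ha, dd_comm hφ]
  simp only [Tst]
  ring

section
variable {φ : E n → ℂ}

/-- The class of `Tst φ j a` in `L²`. -/
def TL (hφ : ContDiff ℝ ∞ φ) (a : {a : E n → ℂ // IsTest a}) (j : Fin n) : L2 n :=
  (a.2.Tst hφ (j := j)).memLp.toLp (Tst φ j a.1)

def sig (hφ : ContDiff ℝ ∞ φ) (p : {a : E n → ℂ // IsTest a} × Fin n × Fin n) : L2v n :=
  WithLp.toLp 2 (single p.2.1 (TL hφ p.1 p.2.2) - single p.2.2 (TL hφ p.1 p.2.1))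

theorem inner_sig (hφ : ContDiff ℝ ∞ φ) (p : {a : E n → ℂ // IsTest a} × Fin n × Fin n) (Y : L2v n) :
    inner ℂ (sig hφ p) Y = inner ℂ (TL hφ p.1 p.2.2) (Y p.2.1)
      - inner ℂ (TL hφ p.1 p.2.1) (Y p.2.2) := by
  rw [PiLp.inner_apply]
  simp only [sig, Pi.sub_apply, inner_sub_left, Finset.sum_sub_distrib]
  congr 1
  · rw [Finset.sum_eq_single p.2.1]
    · simp
    · intro b _ hb; simp [Pi.single_eq_of_ne hb]
    · simp
  · rw [Finset.sum_eq_single p.2.2]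
    · simp
    · intro b _ hb; simp [Pi.single_eq_of_ne hb]
    · simp

def vec (X : Fin n → E n → ℂ) (h : ∀ j, MemLp (X j) 2) : L2v n :=
  WithLp.toLp 2 fun j => (h j).toLp (X j)

theorem inner_vec_left {X : Fin n → E n → ℂ} (h : ∀ j, MemLp (X j) 2) (Y : L2v n) :
    inner ℂ (vec X h) Y = ∑ j, ∫ y, conj (X j y) * Y j y := by
  rw [PiLp.inner_apply]
  exact sum_congr rfl fun j _ => inner_toLp_left (h j) _

theorem inner_vec {X Y : Fin n → E n → ℂ} (h : ∀ j, MemLp (X j) 2) (h' : ∀ j, MemLp (Y j) 2) :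
    inner ℂ (vec X h) (vec Y h') = ∑ j, ∫ y, conj (X j y) * Y j y := by
  rw [PiLp.inner_apply]
  exact sum_congr rfl fun j _ => inner_toLp (h j) (h' j)

/-- The a priori estimate for test forms. -/
theorem apriori (hφ : ContDiff ℝ ∞ φ) (hr : ∀ y, conj (φ y) = φ y) {v : Fin n → E n → ℂ} (hv : ∀ j, MemLp (v j) 2)
    {M : ℝ} (hM : 0 ≤ M)
    (hvM : ∀ X : Fin n → E n → ℂ, (∀ j, IsTest (X j)) →
      ‖∑ j, ∫ y, conj (v j y) * X j y‖ ^ 2 ≤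
        M * ∫ y, (∑ j, ∑ k, lev φ j k y * X j y * conj (X k y)).re)
    (hvc : ∀ a, IsTest a → ∀ j k, ∫ y, conj (v j y) * Tst φ k a y
      = ∫ y, conj (v k y) * Tst φ j a y)
    {ψ : Fin n → E n → ℂ} (hψ : ∀ j, IsTest (ψ j)) :
    ‖∑ j, ∫ y, conj (v j y) * ψ j y‖ ^ 2 ≤ M * ∫ y, ‖∑ j, Tst φ j (ψ j) y‖ ^ 2 := by
  set N : Submodule ℂ (L2v n) := (span ℂ (Set.range (sig hφ))).topologicalClosure with hN
  have : CompleteSpace N := (Submodule.isClosed_topologicalClosure _).completeSpace_coe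
  have hNo : Nᗮ = (span ℂ (Set.range (sig hφ)))ᗮ := Submodule.orthogonal_closure _
  have memNo : ∀ Y : L2v n, (∀ p, inner ℂ (sig hφ p) Y = 0) → Y ∈ Nᗮ := by
    intro Y hY
    rw [hNo, Submodule.mem_orthogonal]
    intro u hu
    induction hu using Submodule.span_induction with
    | mem x h => obtain ⟨p, rfl⟩ := h; exact hY p
    | zero => simp
    | add x y _ _ hx hy => rw [inner_add_left, hx, hy, add_zero]
    | smul a x _ hx => rw [inner_smul_left, hx, mul_zero]
  have hψL : ∀ j, MemLp (ψ j) 2 := fun j => (hψ j).memLp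
  obtain ⟨p, hp, W, hW, hpW⟩ := Submodule.exists_add_mem_mem_orthogonal (K := N) (vec ψ hψL)
  have hvN : vec v hv ∈ Nᗮ := by
    refine memNo _ fun q => ?_
    rw [inner_sig]
    have h := hvc q.1.1 q.1.2 q.2.1 q.2.2
    have e : ∀ i k, inner ℂ (TL hφ q.1 k) ((vec v hv) i)
        = conj (∫ y, conj (v i y) * Tst φ k q.1.1 y) := by
      intro i k
      rw [← integral_conj]
      refine (inner_toLp _ (hv i)).trans ?_
      congr 1; ext y; simp [mul_comm]
    rw [e, e, h, sub_self]
  have hvW : inner ℂ (vec v hv) W = ∑ j, ∫ y, conj (v j y) * ψ j y := by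
    rw [← inner_vec hv hψL, hpW, inner_add_right,
      Submodule.inner_left_of_mem_orthogonal hp hvN, zero_add]
  set s : E n → ℂ := fun y => ∑ j, Tst φ j (ψ j) y with hs
  have hsT : IsTest s := IsTest.sum _ fun j => (hψ j).Tst hφ
  -- weak equations of `W`
  have hw2 : ∀ j k a, IsTest a → (∫ z, (-db k a z + (1 / 2) * db k φ z * a z) * W j z)
      = ∫ z, (-db j a z + (1 / 2) * db j φ z * a z) * W k z := by
    intro j k a ha
    have h := Submodule.inner_right_of_mem_orthogonal
      (Submodule.le_topologicalClosure _ (Submodule.subset_span (Set.mem_range_self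
        ((⟨_, ha.conj⟩, j, k) : {a : E n → ℂ // IsTest a} × Fin n × Fin n)))) hW
    rw [inner_sig, sub_eq_zero] at h
    have e : ∀ i k, inner ℂ (TL hφ ⟨_, ha.conj⟩ k) (W i)
        = ∫ z, (-db k a z + (1 / 2) * db k φ z * a z) * W i z := by
      intro i k
      refine (inner_toLp_left _ _).trans ?_
      congr 1; ext z
      have := dd_conj (c := I) (j := k) (diffAt ha.conj.1 z)
      simp only [conj_conj, conj_I] at this
      simp only [Tst, map_add, map_neg, map_mul, conj_dz hφ hr, this, conj_conj]
      simp [show conj (2 : ℂ) = 2 from Complex.conj_ofNat 2]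
    rw [e, e] at h
    exact h
  have hw1 : ∀ a, IsTest a → ∑ j, ∫ z, (dz j a z + (1 / 2) * dz j φ z * a z) * W j z
      = ∫ z, a z * s z := by
    intro a ha
    have hb := ha.conj
    set b : E n → ℂ := fun z => conj (a z) with hbdef
    have hTb : ∀ j, IsTest (Top φ j b) := fun j => hb.Top hφ
    have hTN : vec (fun j => Top φ j b) (fun j => (hTb j).memLp) ∈ Nᗮ := by
      refine memNo _ fun q => ?_
      rw [inner_sig]
      have e : ∀ i k, inner ℂ (TL hφ q.1 k)
          ((vec (fun j => Top φ j b) (fun j => (hTb j).memLp)) i)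
          = ∫ y, conj (q.1.1 y) * Top φ k (Top φ i b) y := by
        intro i k
        rw [← adj hφ hr q.1.2 (hTb i).1]
        exact inner_toLp _ (hTb i).memLp
      rw [e, e, sub_eq_zero]
      congr 1; ext y
      rw [Top_Top hφ hb.1]
    have h1 : inner ℂ (vec (fun j => Top φ j b) (fun j => (hTb j).memLp)) W =
        ∑ j, ∫ y, conj (Top φ j b y) * ψ j y := by
      rw [← inner_vec _ hψL, hpW, inner_add_right,
        Submodule.inner_left_of_mem_orthogonal hp hTN, zero_add]
    rw [inner_vec_left] at h1
    have e1 : ∀ j z, conj (Top φ j b z) = dz j a z + (1 / 2) * dz j φ z * a z := by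
      intro j z
      have := dd_conj (c := -I) (j := j) (diffAt hb.1 z)
      simp only [hbdef, conj_conj, map_neg, conj_I, neg_neg] at this
      have h3 : conj (db j φ z) = dz j φ z := by rw [← conj_dz hφ hr, conj_conj]
      simp only [Top, map_add, map_mul, h3, hbdef, conj_conj, this]
      simp [show conj (2 : ℂ) = 2 from Complex.conj_ofNat 2]
    have e2 : ∀ j, ∫ y, conj (Top φ j b y) * ψ j y = ∫ y, a y * Tst φ j (ψ j) y := by
      intro j
      rw [adj' hφ hr (hψ j) hb.1]
      simp [hbdef]
    simp only [e1] at h1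
    rw [h1]
    simp only [← e1, e2]
    rw [← integral_finsetSum]
    · simp only [hs, mul_sum]
    · intro j _
      exact (((hψ j).Tst hφ).mul ha.1).integrable
  set A : ℝ := (eLpNorm s 2 volume).toReal with hA
  have hAs : ∫ y, ‖s y‖ ^ 2 = A ^ 2 := by
    rw [← norm_toLp_sq hsT.memLp, Lp.norm_toLp]
  have hA0 : 0 ≤ A := ENNReal.toReal_nonneg
  have hAo : ofReal A = eLpNorm s 2 volume := ENNReal.ofReal_toReal hsT.memLp.2.ne
  set V : ℝ := ∑ j, ‖(hv j).toLp (v j)‖ with hV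
  have key : ∀ κ > 0, ‖inner ℂ (vec v hv) W‖ ≤
      sqrt (M * ((A + κ) ^ 2 + (1 / 2) * ∑ _j : Fin n, ∑ _k : Fin n, κ ^ 2)) + V * κ := by
    intro κ hκ
    obtain ⟨X, hX, hXW, hXs, hXc⟩ := approx hφ (fun j => Lp.memLp (W j)) hsT.memLp hw1 hw2 hκ
    have hXL : ∀ j, MemLp (X j) 2 := fun j => (hX j).memLp
    have b1 : ‖∑ j, ∫ y, conj (v j y) * X j y‖ ≤
        sqrt (M * ((A + κ) ^ 2 + (1 / 2) * ∑ _j : Fin n, ∑ _k : Fin n, κ ^ 2)) := by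
      refine Real.le_sqrt_of_sq_le ((hvM X hX).trans ?_)
      gcongr
      refine (bochner hφ hr hX).trans ?_
      gcongr with j _ k _
      · refine integral_sq_le (IsTest.sum _ fun j => (hX j).Tst hφ).memLp (by positivity) ?_
        rw [ofReal_add hA0 hκ.le, hAo]
        exact hXs
      · exact integral_sq_le (((hX j).Top hφ).sub ((hX k).Top hφ)).memLp hκ.le (hXc j k)
    have b2 : ‖inner ℂ (vec v hv) W - ∑ j, ∫ y, conj (v j y) * X j y‖ ≤ V * κ := by
      rw [← inner_vec hv hXL, ← inner_sub_right, PiLp.inner_apply, hV, sum_mul]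
      refine (norm_sum_le _ _).trans (Finset.sum_le_sum fun j _ => ?_)
      refine (norm_inner_le_norm _ _).trans ?_
      have e : ‖(W - vec X hXL) j‖ ≤ κ := by
        have : (W - vec X hXL) j = - ((hXL j).toLp (X j) - W j) := by
          simp [vec]
        rw [this, norm_neg]
        have h2 : (hXL j).toLp (X j) - W j = ((hXL j).sub (Lp.memLp (W j))).toLp _ := by
          rw [MemLp.toLp_sub (hXL j) (Lp.memLp (W j)), Lp.toLp_coeFn]
        rw [h2, Lp.norm_toLp]
        exact ENNReal.toReal_le_of_le_ofReal hκ.le (hXW j)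
      gcongr
      exact le_refl _
    calc _ = ‖(inner ℂ (vec v hv) W - ∑ j, ∫ y, conj (v j y) * X j y)
          + ∑ j, ∫ y, conj (v j y) * X j y‖ := by rw [sub_add_cancel]
      _ ≤ _ := (norm_add_le _ _).trans (by linarith)
  have lim : Tendsto (fun κ : ℝ => sqrt (M * ((A + κ) ^ 2 +
      (1 / 2) * ∑ _j : Fin n, ∑ _k : Fin n, κ ^ 2)) + V * κ) (nhdsWithin 0 (Set.Ioi 0))
      (nhds (sqrt (M * A ^ 2))) := by
    have : Continuous (fun κ : ℝ => sqrt (M * ((A + κ) ^ 2 +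
      (1 / 2) * ∑ _j : Fin n, ∑ _k : Fin n, κ ^ 2)) + V * κ) := by fun_prop
    have h := this.tendsto 0
    simp only [add_zero, mul_zero, ne_eq, OfNat.ofNat_ne_zero, not_false_eq_true, zero_pow,
      Finset.sum_const_zero] at h
    exact h.mono_left nhdsWithin_le_nhds
  have fin := ge_of_tendsto lim (Filter.eventually_of_mem self_mem_nhdsWithin key)
  rw [hvW] at fin
  rw [hAs]
  calc _ ≤ sqrt (M * A ^ 2) ^ 2 := by gcongr
    _ = _ := sq_sqrt (by positivity)

/-- Hörmander's estimate: `h` differs from the kernel of `∂̄` by a small element. -/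
theorem hormander (hφ : ContDiff ℝ ∞ φ) (hr : ∀ y, conj (φ y) = φ y) {v : Fin n → E n → ℂ} (hv : ∀ j, MemLp (v j) 2)
    {M : ℝ} (hM : 0 ≤ M)
    (hvM : ∀ X : Fin n → E n → ℂ, (∀ j, IsTest (X j)) →
      ‖∑ j, ∫ y, conj (v j y) * X j y‖ ^ 2 ≤
        M * ∫ y, (∑ j, ∑ k, lev φ j k y * X j y * conj (X k y)).re)
    {h : E n → ℂ} (hh : MemLp h 2)
    (hhv : ∀ a, IsTest a → ∀ j, ∫ y, conj (v j y) * a y = ∫ y, conj (h y) * Tst φ j a y) :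
    ∃ k₀ : E n → ℂ, MemLp k₀ 2 ∧ (∫ y, ‖h y - k₀ y‖ ^ 2) ≤ M ∧
      ∀ a, IsTest a → ∀ j, ∫ y, conj (Tst φ j a y) * k₀ y = 0 := by
  have hvc : ∀ a, IsTest a → ∀ j k, ∫ y, conj (v j y) * Tst φ k a y
      = ∫ y, conj (v k y) * Tst φ j a y := by
    intro a ha j k
    rw [hhv _ (ha.Tst hφ), hhv _ (ha.Tst hφ)]
    congr 1; ext y
    rw [Tst_Tst hφ ha.1]
  -- the range of the adjoint
  let R : Submodule ℂ (L2 n) :=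
    { carrier := {x | ∃ ψ : Fin n → {a : E n → ℂ // IsTest a}, x = ∑ j, TL hφ (ψ j) j}
      zero_mem' := by
        refine ⟨fun _ => ⟨fun _ => 0, contDiff_const, HasCompactSupport.zero⟩, ?_⟩
        symm
        refine Finset.sum_eq_zero fun j _ => ?_
        rw [TL]
        refine toLp_zero' _ fun y => ?_
        simp [Tst, dd_const]
      add_mem' := by
        rintro x y ⟨ψ, rfl⟩ ⟨ψ', rfl⟩
        refine ⟨fun j => ⟨_, (ψ j).2.add (ψ' j).2⟩, ?_⟩
        rw [← sum_add_distrib]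
        refine sum_congr rfl fun j _ => ?_
        rw [TL, TL, ← MemLp.toLp_add]
        refine MemLp.toLp_congr _ _ (Eventually.of_forall fun y => ?_)
        simp only [Tst, Pi.add_apply]
        rw [dd_add (diffAt (ψ j).2.1 _) (diffAt (ψ' j).2.1 _)]
        ring
      smul_mem' := by
        rintro c x ⟨ψ, rfl⟩
        refine ⟨fun j => ⟨fun y => c * (ψ j).1 y, (ψ j).2.mul contDiff_const⟩, ?_⟩
        rw [Finset.smul_sum]
        refine sum_congr rfl fun j _ => ?_
        rw [TL, ← MemLp.toLp_const_smul]
        refine MemLp.toLp_congr _ _ (Eventually.of_forall fun y => ?_)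
        simp only [Tst, Pi.smul_apply, smul_eq_mul]
        rw [dd_const_mul _ (diffAt (ψ j).2.1 _)]
        ring }
  have : CompleteSpace R.topologicalClosure :=
    (Submodule.isClosed_topologicalClosure _).completeSpace_coe
  obtain ⟨p, hp, k, hk, hpk⟩ :=
    Submodule.exists_add_mem_mem_orthogonal (K := R.topologicalClosure) (hh.toLp h)
  have est : ∀ x ∈ R, ‖inner ℂ p x‖ ^ 2 ≤ M * ‖x‖ ^ 2 := by
    intro x hx
    obtain ⟨ψ, hψ⟩ := hx
    have e1 : inner ℂ p x = inner ℂ (hh.toLp h) x := by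
      rw [hpk, inner_add_left, Submodule.inner_left_of_mem_orthogonal
        (Submodule.le_topologicalClosure _ (show x ∈ R from ⟨ψ, hψ⟩)) hk, add_zero]
    have e2 : inner ℂ (hh.toLp h) x = ∑ j, ∫ y, conj (v j y) * (ψ j).1 y := by
      rw [hψ, inner_sum]
      refine sum_congr rfl fun j _ => ?_
      rw [hhv _ (ψ j).2]
      exact inner_toLp _ _
    have hsT : IsTest (fun y => ∑ j, Tst φ j (ψ j).1 y) := IsTest.sum _ fun j => (ψ j).2.Tst hφ
    have e3 : x = hsT.memLp.toLp _ := by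
      rw [hψ]
      have : ∀ S : Finset (Fin n), ∑ j ∈ S, TL hφ (ψ j) j =
          (memLp_finsetSum S fun j _ => ((ψ j).2.Tst hφ (j := j)).memLp).toLp
            (fun y => ∑ j ∈ S, Tst φ j (ψ j).1 y) := by
        intro S
        induction S using Finset.induction_on with
        | empty =>
          symm
          rw [Finset.sum_empty]
          exact toLp_zero' _ fun y => by simp
        | insert a S ha ih =>
          rw [Finset.sum_insert ha, ih, TL, ← MemLp.toLp_add]
          refine MemLp.toLp_congr _ _ (Eventually.of_forall fun y => ?_)
          simp [Finset.sum_insert ha]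
      exact this univ
    rw [e1, e2]
    have := apriori hφ hr hv hM hvM hvc (fun j => (ψ j).2)
    rw [← norm_toLp_sq hsT.memLp, ← e3] at this
    exact this
  have est2 : ‖inner ℂ p p‖ ^ 2 ≤ M * ‖p‖ ^ 2 := by
    have hcl : IsClosed {x : L2 n | ‖inner ℂ p x‖ ^ 2 ≤ M * ‖x‖ ^ 2} :=
      isClosed_le (by fun_prop) (by fun_prop)
    have : (R.topologicalClosure : Set (L2 n)) ⊆ {x : L2 n | ‖inner ℂ p x‖ ^ 2 ≤ M * ‖x‖ ^ 2} :=
      closure_minimal est hcl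
    exact this hp
  have hpM : ‖p‖ ^ 2 ≤ M := by
    rw [inner_self_eq_norm_sq_to_K] at est2
    by_cases h0 : ‖p‖ = 0
    · rw [h0]; simpa using hM
    have : 0 < ‖p‖ ^ 2 := by positivity
    simp only [norm_pow, Complex.coe_algebraMap, norm_real, norm_norm] at est2
    have h2 : (‖p‖ ^ 2) * ‖p‖ ^ 2 ≤ M * ‖p‖ ^ 2 := by nlinarith
    exact le_of_mul_le_mul_right h2 this
  refine ⟨k, Lp.memLp k, ?_, ?_⟩
  · have e : ((hh.sub (Lp.memLp k)).toLp _) = p := by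
      rw [MemLp.toLp_sub hh (Lp.memLp k), Lp.toLp_coeFn, hpk, add_sub_cancel_right]
    rw [← e, norm_toLp_sq] at hpM
    exact hpM
  · intro a ha j
    have hmem : TL hφ ⟨a, ha⟩ j ∈ R := by
      refine ⟨fun i => if i = j then ⟨a, ha⟩ else ⟨fun _ => 0, contDiff_const,
        HasCompactSupport.zero⟩, ?_⟩
      rw [Finset.sum_eq_single j]
      · simp
      · intro b _ hb
        rw [TL]
        refine toLp_zero' _ fun y => ?_
        simp [Tst, dd_const, hb]
      · simp
    have := Submodule.inner_right_of_mem_orthogonal (Submodule.le_topologicalClosure _ hmem) hk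
    rw [← this]
    exact (inner_toLp_left _ _).symm
end

theorem sq_integral_mul_le {A B : E n → ℝ} (hA : MemLp A 2) (hB : MemLp B 2)
    (hA0 : ∀ y, 0 ≤ A y) (hB0 : ∀ y, 0 ≤ B y) :
    (∫ y, A y * B y) ^ 2 ≤ (∫ y, A y ^ 2) * ∫ y, B y ^ 2 := by
  have h := integral_mul_le_Lp_mul_Lq_of_nonneg (μ := (volume : Measure (E n)))
    (p := 2) (q := 2) ⟨by norm_num, by norm_num, by norm_num⟩
    (Eventually.of_forall hA0) (Eventually.of_forall hB0)
    (by simpa using hA) (by simpa using hB)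
  have i0 : 0 ≤ ∫ y, A y * B y := integral_nonneg fun y => mul_nonneg (hA0 y) (hB0 y)
  have i1 : 0 ≤ ∫ y, A y ^ 2 := integral_nonneg fun y => sq_nonneg _
  have i2 : 0 ≤ ∫ y, B y ^ 2 := integral_nonneg fun y => sq_nonneg _
  simp only [Real.rpow_two, ← Real.sqrt_eq_rpow] at h
  calc _ ≤ (sqrt (∫ y, A y ^ 2) * sqrt (∫ y, B y ^ 2)) ^ 2 := by gcongr
    _ = _ := by rw [mul_pow, sq_sqrt i1, sq_sqrt i2]

theorem norm_sum_mul_le (a b : Fin n → ℂ) :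
    ‖∑ j, conj (a j) * b j‖ ≤ sqrt (∑ j, ‖a j‖ ^ 2) * sqrt (∑ j, ‖b j‖ ^ 2) := by
  have := norm_inner_le_norm (𝕜 := ℂ) (WithLp.toLp 2 a : EuclideanSpace ℂ (Fin n)) (WithLp.toLp 2 b)
  simpa [EuclideanSpace.norm_eq, PiLp.inner_apply, mul_comm] using this

/-- Hörmander's estimate with weight `e^{-Φ}`. -/
theorem hor {Φ κ : E n → ℝ} (hΦ : ContDiff ℝ ∞ Φ) (hκ : Continuous κ) (hκ0 : ∀ y, 0 < κ y)
    (hlev : ∀ y (w : Fin n → ℂ), κ y * ∑ j, ‖w j‖ ^ 2 ≤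
      (∑ j, ∑ k, lev (fun y => (Φ y : ℂ)) j k y * w j * conj (w k)).re)
    {u : E n → ℂ} {η : Fin n → E n → ℂ}
    (hw : ∀ b, IsTest b → ∀ j, ∫ y, η j y * b y = - ∫ y, u y * db j b y)
    (hu : MemLp (fun y => u y * (exp (-Φ y / 2) : ℂ)) 2)
    (hη : ∀ j, MemLp (fun y => η j y * (exp (-Φ y / 2) : ℂ)) 2)
    {M : ℝ} (hi : Integrable (fun y => (∑ j, ‖η j y‖ ^ 2) * exp (-Φ y) / κ y))
    (hM : ∫ y, (∑ j, ‖η j y‖ ^ 2) * exp (-Φ y) / κ y ≤ M) :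
    ∃ G : E n → ℂ, LocallyIntegrable G ∧
      (∀ b, IsTest b → ∀ j, ∫ y, db j b y * G y = 0) ∧
      (Integrable fun y => ‖u y - G y‖ ^ 2 * exp (-Φ y)) ∧
      ∫ y, ‖u y - G y‖ ^ 2 * exp (-Φ y) ≤ M := by
  set φ : E n → ℂ := fun y => (Φ y : ℂ) with hφd
  have hφ : ContDiff ℝ ∞ φ := ofRealCLM.contDiff.comp hΦ
  have hr : ∀ y, conj (φ y) = φ y := fun y => Complex.conj_ofReal _
  set w : E n → ℂ := fun y => (exp (-Φ y / 2) : ℂ) with hwd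
  have hws : ContDiff ℝ ∞ w := by
    have : ContDiff ℝ ∞ (fun y => exp (-Φ y / 2)) := (hΦ.neg.div_const 2).exp
    exact ofRealCLM.contDiff.comp this
  have hwr : ∀ y, conj (w y) = w y := fun y => Complex.conj_ofReal _
  have hdw : ∀ c j y, dd c j w y = - (1 / 2) * dd c j φ y * w y := by
    intro c j y
    have h1 : HasFDerivAt Φ (fderiv ℝ Φ y) y := (hΦ.differentiable (by simp) y).hasFDerivAt
    have h2 := ofRealCLM.hasFDerivAt.comp y ((h1.neg.mul_const (1 / 2)).exp)
    have h3 := ofRealCLM.hasFDerivAt.comp y h1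
    have e2 : fderiv ℝ w y = _ := HasFDerivAt.fderiv (f := w) (h2.congr_of_eventuallyEq
      (Eventually.of_forall fun z => by simp [hwd, div_eq_mul_inv]))
    have e3 : fderiv ℝ φ y = _ := HasFDerivAt.fderiv (f := φ) h3
    simp only [dd]
    rw [e2, e3]
    simp [hwd, div_eq_mul_inv]
    ring
  have hM0 : 0 ≤ M := le_trans (integral_nonneg fun y => by have := hκ0 y; positivity) hM
  set v : Fin n → E n → ℂ := fun j y => η j y * w y with hvd
  have hnw : ∀ y, ‖w y‖ ^ 2 = exp (-Φ y) := by
    intro y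
    simp only [hwd, norm_real, Real.norm_eq_abs, Real.abs_exp]
    rw [← Real.exp_nat_mul]; congr 1; push_cast; ring
  have hvM : ∀ X : Fin n → E n → ℂ, (∀ j, IsTest (X j)) →
      ‖∑ j, ∫ y, conj (v j y) * X j y‖ ^ 2 ≤
        M * ∫ y, (∑ j, ∑ k, lev φ j k y * X j y * conj (X k y)).re := by
    intro X hX
    set A : E n → ℝ := fun y => sqrt (∑ j, ‖v j y‖ ^ 2) / sqrt (κ y) with hA
    set B : E n → ℝ := fun y => sqrt (κ y) * sqrt (∑ j, ‖X j y‖ ^ 2) with hB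
    have hA2 : ∀ y, A y ^ 2 = (∑ j, ‖η j y‖ ^ 2) * exp (-Φ y) / κ y := by
      intro y
      simp only [hA]
      rw [div_pow, sq_sqrt (by positivity), sq_sqrt (hκ0 y).le, sum_mul]
      simp only [hvd, norm_mul, mul_pow, hnw]
    have hB2 : ∀ y, B y ^ 2 = κ y * ∑ j, ‖X j y‖ ^ 2 := by
      intro y
      simp only [hB]
      rw [mul_pow, sq_sqrt (hκ0 y).le, sq_sqrt (by positivity)]
    have hAm : MemLp A 2 := by
      rw [memLp_two_iff_integrable_sq]
      · simpa only [hA2] using hi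
      · have hs : AEStronglyMeasurable (fun y => sqrt (κ y)) :=
          (Real.continuous_sqrt.comp hκ).aestronglyMeasurable
        refine AEStronglyMeasurable.div₀ ?_ hs
        refine Real.continuous_sqrt.comp_aestronglyMeasurable ?_
        refine Finset.aestronglyMeasurable_fun_sum _ fun j _ => ?_
        exact ((hη j).1.norm.pow 2)
    have hBc : Continuous B := by
      have := fun j => (hX j).1.continuous
      fun_prop
    have hBm : MemLp B 2 := by
      refine hBc.memLp_of_hasCompactSupport ?_
      have : HasCompactSupport (fun y => (fun j => X j y : Fin n → ℂ)) := by
        refine HasCompactSupport.of_support_subset_isCompact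
          (K := ⋃ j, tsupport (X j)) (isCompact_iUnion fun j => (hX j).2) ?_
        intro y hy
        rw [mem_support, Function.ne_iff] at hy
        obtain ⟨j, hj⟩ := hy
        exact Set.mem_iUnion.2 ⟨j, subset_tsupport _ hj⟩
      refine this.mono fun y hy => ?_
      rw [mem_support] at hy ⊢
      contrapose! hy
      simp [hB, show ∀ j, X j y = 0 from fun j => congrFun hy j]
    have int1 : ∀ j, Integrable (fun y => conj (v j y) * X j y) := fun j => by
      have h1 : MemLp (fun y => conj (v j y)) 2 :=
        (hη j).of_le (Complex.continuous_conj.comp_aestronglyMeasurable (hη j).1)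
          (Eventually.of_forall fun y => by simp [hvd, hwd])
      exact h1.integrable_mul (hX j).memLp
    have s1 : ‖∑ j, ∫ y, conj (v j y) * X j y‖ ≤ ∫ y, A y * B y := by
      rw [← integral_finsetSum _ fun j _ => int1 j]
      refine (norm_integral_le_integral_norm _).trans ?_
      refine integral_mono_of_nonneg (Eventually.of_forall fun y => norm_nonneg _)
        (hAm.integrable_mul hBm) (Eventually.of_forall fun y => ?_)
      refine (norm_sum_mul_le _ _).trans (le_of_eq ?_)
      have : sqrt (κ y) ≠ 0 := (Real.sqrt_pos.2 (hκ0 y)).ne'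
      simp only [hA, hB]
      field_simp
    have hint : Integrable fun y => (∑ j, ∑ k, lev φ j k y * X j y * conj (X k y)).re := by
      refine Integrable.re (𝕜 := ℂ) ?_
      refine integrable_finsetSum _ fun j _ => integrable_finsetSum _ fun k _ => ?_
      exact (((hX j).mul (contDiff_dd (contDiff_dd hφ))).mul_right (hX k).conj.1).integrable
    have hle : ∫ y, B y ^ 2 ≤ ∫ y, (∑ j, ∑ k, lev φ j k y * X j y * conj (X k y)).re :=
      integral_mono hBm.integrable_sq hint fun y => by rw [hB2]; exact hlev y _
    calc _ ≤ (∫ y, A y * B y) ^ 2 := by gcongr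
      _ ≤ (∫ y, A y ^ 2) * ∫ y, B y ^ 2 := sq_integral_mul_le hAm hBm
          (fun y => by positivity) (fun y => by positivity)
      _ ≤ _ := mul_le_mul (by simpa only [hA2] using hM) hle
          (integral_nonneg fun y => sq_nonneg _) hM0
  obtain ⟨k₀, hk, hkM, hkw⟩ := hormander hφ hr (v := v) hη hM0 hvM hu (by
    intro a ha j
    have hb : IsTest (fun y => conj (a y) * w y) := ha.conj.mul_right hws
    have h := congrArg (starRingEnd ℂ) (hw _ hb j)
    rw [map_neg, ← integral_conj, ← integral_conj] at h
    have e1 : ∀ y, conj (η j y * (conj (a y) * w y)) = conj (v j y) * a y := by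
      intro y; simp only [hvd, map_mul, hwr, conj_conj]; ring
    have e2 : ∀ y, conj (u y * db j (fun y => conj (a y) * w y) y) =
        - (conj (u y * w y) * Tst φ j a y) := by
      intro y
      rw [dd_mul (diffAt ha.conj.1 y) (diffAt hws y), hdw, dd_conj (diffAt ha.1 y),
        conj_I]
      have h3 : conj (db j φ y) = dz j φ y := by rw [← conj_dz hφ hr, conj_conj]
      simp only [map_mul, map_add, conj_conj, hwr, h3, Tst, map_neg, map_div₀, map_one,
        show conj (2 : ℂ) = 2 from Complex.conj_ofNat 2]
      ring
    simp only [e1, e2] at h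
    rw [integral_neg, neg_neg] at h
    exact h)
  set iw : E n → ℂ := fun y => (exp (Φ y / 2) : ℂ) with hiw
  have hiws : ContDiff ℝ ∞ iw := by
    have : ContDiff ℝ ∞ (fun y => exp (Φ y / 2)) := (hΦ.div_const 2).exp
    exact ofRealCLM.contDiff.comp this
  have hwiw : ∀ y, iw y * w y = 1 := by
    intro y
    simp only [hiw, hwd]
    rw [← Complex.ofReal_mul, ← Real.exp_add]
    simp [neg_div]
  have key : ∀ y, ‖u y - iw y * k₀ y‖ ^ 2 * exp (-Φ y) = ‖u y * w y - k₀ y‖ ^ 2 := by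
    intro y
    rw [← hnw, ← mul_pow, ← norm_mul]
    congr 2
    linear_combination (- k₀ y) * hwiw y
  refine ⟨fun y => iw y * k₀ y, ?_, ?_, ?_, ?_⟩
  · have : LocallyIntegrable k₀ := hk.locallyIntegrable (by norm_num)
    exact this.continuous_smul (g := iw) hiws.continuous
  · intro b hb j
    have ha : IsTest (fun y => conj (b y) * iw y) := hb.conj.mul_right hiws
    rw [← neg_eq_zero, ← integral_neg, ← hkw _ ha j]
    congr 1; ext y
    have hdi : dz j iw y = (1 / 2) * dz j φ y * iw y := by
      have h1 : iw y * dz j w y + dz j iw y * w y = 0 := by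
        have := dd_mul (c := -I) (j := j) (diffAt hiws y) (diffAt hws y)
        simp only [hwiw, dd_const] at this
        rw [this]; ring
      rw [hdw] at h1
      have := hwiw y
      have hw0 : w y ≠ 0 := right_ne_zero_of_mul (this ▸ one_ne_zero)
      apply mul_right_cancel₀ hw0
      linear_combination h1
    have hir : conj (iw y) = iw y := Complex.conj_ofReal _
    simp only [Tst]
    rw [dd_mul (diffAt hb.conj.1 y) (diffAt hiws y), hdi, dd_conj (diffAt hb.1 y)]
    have h3 : conj (dz j φ y) = db j φ y := conj_dz hφ hr y
    simp only [map_mul, map_add, conj_conj, hir, h3, map_neg, map_div₀, map_one,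
        show conj (2 : ℂ) = 2 from Complex.conj_ofNat 2, conj_I, neg_neg]
    ring
  · simp only [key]
    exact (hu.sub hk).integrable_norm_pow (by norm_num)
  · simp only [key]
    exact hkM

theorem dd_ofReal_comp {c : ℂ} {j : Fin n} {A : E n → ℝ} {ψ : ℝ → ℝ} {ψ' : ℝ} {y : E n}
    (hA : DifferentiableAt ℝ A y) (hψ : HasDerivAt ψ ψ' (A y)) :
    dd c j (fun y => ((ψ (A y) : ℝ) : ℂ)) y = ψ' * dd c j (fun y => (A y : ℂ)) y := by
  have h2 := ofRealCLM.hasFDerivAt.comp y (hψ.comp_hasFDerivAt y hA.hasFDerivAt)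
  have h3 := ofRealCLM.hasFDerivAt.comp y hA.hasFDerivAt
  have e2 : fderiv ℝ (fun y => ((ψ (A y) : ℝ) : ℂ)) y = _ := HasFDerivAt.fderiv h2
  have e3 : fderiv ℝ (fun y => (A y : ℂ)) y = _ := HasFDerivAt.fderiv h3
  simp only [dd]
  rw [e2, e3]
  simp
  ring

theorem lev_comp {A : E n → ℝ} {ψ ψ₁ ψ₂ : ℝ → ℝ} (hA : ContDiff ℝ ∞ A)
    (h1 : ∀ y, HasDerivAt ψ (ψ₁ (A y)) (A y)) (h2 : ∀ y, HasDerivAt ψ₁ (ψ₂ (A y)) (A y))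
    (j k : Fin n) (y : E n) :
    lev (fun y => ((ψ (A y) : ℝ) : ℂ)) j k y =
      ψ₂ (A y) * dz j (fun y => (A y : ℂ)) y * db k (fun y => (A y : ℂ)) y +
      ψ₁ (A y) * lev (fun y => (A y : ℂ)) j k y := by
  have hd : ∀ y, DifferentiableAt ℝ A y := fun y => hA.differentiable (by simp) y
  have hc : ContDiff ℝ ∞ (fun y => (A y : ℂ)) := ofRealCLM.contDiff.comp hA
  have e : db k (fun y => ((ψ (A y) : ℝ) : ℂ)) =
      fun y => ((ψ₁ (A y) : ℝ) : ℂ) * db k (fun y => (A y : ℂ)) y := by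
    ext y
    exact dd_ofReal_comp (hd y) (h1 y)
  have hd2 : DifferentiableAt ℝ (fun y => ((ψ₁ (A y) : ℝ) : ℂ)) y :=
    ofRealCLM.differentiableAt.comp y ((h2 y).differentiableAt.comp y (hd y))
  rw [lev, e, dd_mul hd2 (diffAt (contDiff_dd hc) y), dd_ofReal_comp (hd y) (h2 y), lev]

theorem re_levi_log_nonneg {f : E n → ℂ} (hf : ContDiff ℝ ∞ f) (hb : ∀ j y, db j f y = 0)
    {β c : ℝ} (hβ : 0 ≤ β) (hc : 0 < c) (y : E n) (w : Fin n → ℂ) :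
    0 ≤ (∑ j, ∑ k, lev (fun y => ((β * log (‖f y‖ ^ 2 + c) : ℝ) : ℂ)) j k y *
      w j * conj (w k)).re := by
  set A : E n → ℝ := fun y => ‖f y‖ ^ 2 + c with hA
  have hA0 : ∀ y, 0 < A y := fun y => by positivity
  have hAs : ContDiff ℝ ∞ A := (hf.norm_sq ℝ).add contDiff_const
  have hAc : (fun y => (A y : ℂ)) = fun y => f y * conj (f y) + c := by
    ext y; simp [hA, mul_conj, normSq_eq_norm_sq]
  have hfc := contDiff_conj hf
  have hdb : ∀ k, db k (fun y => (A y : ℂ)) = fun y => f y * conj (dz k f y) := by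
    intro k; ext y
    have h : DifferentiableAt ℝ (fun y => f y * conj (f y)) y := (diffAt hf y).mul (diffAt hfc y)
    rw [hAc, dd_add h (differentiableAt_const _), dd_mul (diffAt hf y) (diffAt hfc y), hb,
      dd_conj (diffAt hf y), dd_const, conj_I]
    ring
  have hdz : ∀ k, dz k (fun y => (A y : ℂ)) y = conj (f y) * dz k f y := by
    intro k
    have h : DifferentiableAt ℝ (fun y => f y * conj (f y)) y := (diffAt hf y).mul (diffAt hfc y)
    rw [hAc, dd_add h (differentiableAt_const _), dd_mul (diffAt hf y) (diffAt hfc y),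
      dd_conj (diffAt hf y), dd_const, map_neg, conj_I, neg_neg, hb]
    simp
    ring
  have hlA : ∀ j k, lev (fun y => (A y : ℂ)) j k y = dz j f y * conj (dz k f y) := by
    intro j k
    have h := contDiff_dd (c := -I) (j := k) hf
    have h0 : db j (dz k f) y = 0 := by
      rw [dd_comm hf]
      rw [show db j f = fun _ => 0 from funext fun y => hb j y, dd_const]
    rw [lev, hdb, dd_mul (diffAt hf y) (diffAt (contDiff_conj h) y), dd_conj (diffAt h y),
      map_neg, conj_I, neg_neg, h0]
    simp
  have hl := lev_comp (ψ := fun x => β * log x) (ψ₁ := fun x => β * x⁻¹)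
    (ψ₂ := fun x => β * (-(x ^ 2)⁻¹)) hAs
    (fun y => (Real.hasDerivAt_log (hA0 y).ne').const_mul β)
    (fun y => (hasDerivAt_inv (hA0 y).ne').const_mul β)
  have key : ∀ j k, lev (fun y => ((β * log (‖f y‖ ^ 2 + c) : ℝ) : ℂ)) j k y * w j * conj (w k) =
      ((β * c / A y ^ 2 : ℝ) : ℂ) * ((dz j f y * w j) * conj (dz k f y * w k)) := by
    intro j k
    have h2 := hl j k y
    rw [hdz, hdb, hlA] at h2
    refine (congrArg (fun z => z * w j * conj (w k)) h2).trans ?_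
    simp only [hA]
    have h3 : f y * conj (f y) = ((‖f y‖ ^ 2 : ℝ) : ℂ) := by
      simp [mul_conj, normSq_eq_norm_sq]
    have h4 : (((‖f y‖ ^ 2 + c : ℝ)) : ℂ) ≠ 0 := by exact_mod_cast (hA0 y).ne'
    push_cast at h3 h4 ⊢
    rw [map_mul]
    field_simp
    linear_combination (-dz j f y * conj (dz k f y) * w j * conj (w k) * β) * h3
  simp only [key, ← mul_sum]
  rw [← sum_mul, ← map_sum, mul_conj, ← Complex.ofReal_mul, Complex.ofReal_re]
  have := Complex.normSq_nonneg (∑ i, dz i f y * w i)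
  positivity

theorem dd_coord (c : ℂ) (j k : Fin n) (y : E n) :
    dd c j (fun y => y k) y = if j = k then (1 + c * I) / 2 else 0 := by
  have : fderiv ℝ (fun y : E n => y k) y = ContinuousLinearMap.proj k :=
    (ContinuousLinearMap.proj (R := ℝ) (φ := fun _ : Fin n => ℂ) k).hasFDerivAt.fderiv
  simp only [dd, this]
  by_cases h : j = k
  · subst h; simp; ring
  · simp [h, Ne.symm h]

theorem contDiff_coord (k : Fin n) : ContDiff ℝ ∞ (fun y : E n => y k) := contDiff_apply ℝ ℂ k

/-- The squared Euclidean norm. -/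
def sq (y : E n) : ℝ := ∑ j, ‖y j‖ ^ 2

theorem sq_nonneg' (y : E n) : 0 ≤ sq y := by unfold sq; positivity

theorem contDiff_sq : ContDiff ℝ ∞ (sq : E n → ℝ) :=
  ContDiff.sum fun j _ => (contDiff_coord j).norm_sq ℝ

theorem dd_sum {c : ℂ} {j : Fin n} {ι : Type*} (s : Finset ι) {a : ι → E n → ℂ} {y : E n}
    (ha : ∀ i, DifferentiableAt ℝ (a i) y) :
    dd c j (fun y => ∑ i ∈ s, a i y) y = ∑ i ∈ s, dd c j (a i) y := by
  simp only [dd]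
  rw [fderiv_fun_sum fun i _ => ha i]
  simp [mul_sum, sum_add_distrib, mul_add]

theorem levi_rpow_ge {τ δ : ℝ} (hτ : 0 < τ) (hτ1 : τ ≤ 1) (hδ : 0 < δ) (y : E n) (w : Fin n → ℂ) :
    τ ^ 2 * (sq y + δ) ^ (τ - 1) * ∑ j, ‖w j‖ ^ 2 ≤
    (∑ j, ∑ k, lev (fun y => (((sq y + δ) ^ τ : ℝ) : ℂ)) j k y * w j * conj (w k)).re := by
  set A : E n → ℝ := fun y => sq y + δ with hA
  have hA0 : ∀ y, 0 < A y := fun y => by have := sq_nonneg' y; positivity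
  have hAs : ContDiff ℝ ∞ A := contDiff_sq.add contDiff_const
  have hAc : (fun y => (A y : ℂ)) = fun y : E n => ∑ i, y i * conj (y i) + δ := by
    ext y; simp [hA, sq, mul_conj, normSq_eq_norm_sq]
  have hcc := fun i : Fin n => contDiff_conj (contDiff_coord i)
  have hmd : ∀ i y, DifferentiableAt ℝ (fun y : E n => y i * conj (y i)) y :=
    fun i y => (diffAt (contDiff_coord i) y).mul (diffAt (hcc i) y)
  have hsum : ∀ (c : ℂ) k y, dd c k (fun y => (A y : ℂ)) y =
      (1 + c * I) / 2 * conj (y k) + y k * conj ((1 + conj c * I) / 2) := by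
    intro c k y
    rw [hAc, dd_add (DifferentiableAt.fun_sum fun i _ => hmd i y) (differentiableAt_const _),
      dd_const, add_zero, dd_sum _ fun i => hmd i y]
    have : ∀ i, dd c k (fun y : E n => y i * conj (y i)) y = if k = i then
        (1 + c * I) / 2 * conj (y k) + y k * conj ((1 + conj c * I) / 2) else 0 := by
      intro i
      rw [dd_mul (diffAt (contDiff_coord i) y) (diffAt (hcc i) y), dd_conj (diffAt (contDiff_coord i) y),
        dd_coord, dd_coord]
      split_ifs with h
      · subst h; ring
      · simp
    simp only [this]
    simp
  have hdb : ∀ k, db k (fun y => (A y : ℂ)) = fun y => y k := by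
    intro k; ext y
    rw [hsum]
    simp
  have hdz : ∀ k, dz k (fun y => (A y : ℂ)) y = conj (y k) := by
    intro k
    rw [hsum]
    simp
  have hlA : ∀ j k, lev (fun y => (A y : ℂ)) j k y = if j = k then 1 else 0 := by
    intro j k
    rw [lev, hdb, dd_coord]
    simp
  have hl := lev_comp (ψ := fun x => x ^ τ) (ψ₁ := fun x => τ * x ^ (τ - 1))
    (ψ₂ := fun x => τ * ((τ - 1) * x ^ (τ - 1 - 1))) hAs
    (fun y => Real.hasDerivAt_rpow_const (Or.inl (hA0 y).ne'))
    (fun y => (Real.hasDerivAt_rpow_const (Or.inl (hA0 y).ne')).const_mul τ)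
  have hS : (A y) ^ (τ - 1) = (A y) ^ (τ - 1 - 1) * A y := by
    rw [Real.rpow_sub_one (hA0 y).ne' (τ - 1), div_mul_cancel₀ _ (hA0 y).ne']
  set B := (A y) ^ (τ - 1 - 1)
  have hB : 0 < B := Real.rpow_pos_of_pos (hA0 y) _
  have key : ∑ j, ∑ k, lev (fun y => (((sq y + δ) ^ τ : ℝ) : ℂ)) j k y * w j * conj (w k) =
      (((τ * ((τ - 1) * B)) * Complex.normSq (∑ j, conj (y j) * w j) +
        τ * (B * A y) * ∑ j, ‖w j‖ ^ 2 : ℝ) : ℂ) := by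
    have h2 : ∀ j k, lev (fun y => (((sq y + δ) ^ τ : ℝ) : ℂ)) j k y * w j * conj (w k) =
        ((τ * ((τ - 1) * B) : ℝ) : ℂ) * ((conj (y j) * w j) * conj (conj (y k) * w k)) +
        if j = k then ((τ * (B * A y) : ℝ) : ℂ) * (w j * conj (w k)) else 0 := by
      intro j k
      have h2 := hl j k y
      rw [hdz, hdb, hlA] at h2
      refine (congrArg (fun z => z * w j * conj (w k)) h2).trans ?_
      rw [← hS]
      split_ifs with h
      · simp only [map_mul, conj_conj, B]; ring
      · simp only [map_mul, conj_conj, B]; ring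
    simp only [h2, sum_add_distrib, ← mul_sum]
    rw [← sum_mul, ← map_sum, mul_conj]
    simp [mul_conj, normSq_eq_norm_sq, mul_sum]
  rw [key, Complex.ofReal_re]
  have cs : Complex.normSq (∑ j, conj (y j) * w j) ≤ sq y * ∑ j, ‖w j‖ ^ 2 := by
    have := norm_sum_mul_le y w
    rw [normSq_eq_norm_sq]
    calc _ ≤ (sqrt (∑ j, ‖y j‖ ^ 2) * sqrt (∑ j, ‖w j‖ ^ 2)) ^ 2 := by gcongr
      _ = _ := by rw [mul_pow, sq_sqrt (by positivity), sq_sqrt (by positivity)]; rfl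
  have hW : 0 ≤ ∑ j, ‖w j‖ ^ 2 := by positivity
  set W := ∑ j, ‖w j‖ ^ 2
  set N := Complex.normSq (∑ j, conj (y j) * w j)
  have : sq y = A y - δ := by simp [hA]
  show τ ^ 2 * A y ^ (τ - 1) * W ≤ _
  rw [hS]
  have h1 : N ≤ A y * W := cs.trans (by rw [this]; nlinarith)
  have h2 : τ * (1 - τ) * B * N ≤ τ * (1 - τ) * B * (A y * W) := by
    have : 0 ≤ 1 - τ := by linarith
    gcongr
  have h3 : 0 ≤ τ ^ 2 * B * (A y * W) := by have := (hA0 y).le; positivity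
  nlinarith

theorem dd_scale {c : ℂ} {j : Fin n} {a : E n → ℂ} (ha : Differentiable ℝ a) (s : ℝ) (y : E n) :
    dd c j (fun y => a (s • y)) y = s * dd c j a (s • y) := by
  have h := (ha (s • y)).hasFDerivAt.comp y ((hasFDerivAt_id (𝕜 := ℝ) y).const_smul s)
  have e : fderiv ℝ (fun y => a (s • y)) y = _ := HasFDerivAt.fderiv h
  simp only [dd]
  rw [e]
  simp
  ring

theorem dd_congr {c : ℂ} {j : Fin n} {a b : E n → ℂ} {y : E n} (h : a =ᶠ[nhds y] b) :
    dd c j a y = dd c j b y := by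
  simp only [dd, h.fderiv_eq]

theorem weak_identity [NeZero n] {u : E n → ℂ} (hu : ∀ y, y ≠ 0 → ContDiffAt ℝ ∞ u y)
    (hB : ∀ R : ℝ, ∃ C : ℝ, ∀ y, ‖y‖ ≤ R → ‖u y‖ ≤ C) {j : Fin n}
    (hη : LocallyIntegrable (db j u)) (b : E n → ℂ) (hb : IsTest b) :
    ∫ y, db j u y * b y = - ∫ y, u y * db j b y := by
  have hum : AEStronglyMeasurable u := by
    have h1 : ContinuousOn u {0}ᶜ := fun y hy => (hu y hy).continuousAt.continuousWithinAt
    have := h1.aestronglyMeasurable (μ := volume) (measurableSet_singleton (0 : E n)).compl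
    rwa [Measure.restrict_eq_self_of_ae_mem] at this
    exact Measure.ae_ne volume 0 
  let φ : ContDiffBump (0 : E n) := ⟨1, 2, one_pos, by norm_num⟩
  set χ : E n → ℂ := fun y => 1 - (φ y : ℂ) with hχ
  have hχs : ContDiff ℝ ∞ χ := contDiff_const.sub (ofRealCLM.contDiff.comp φ.contDiff)
  have hχ0 : ∀ y, ‖y‖ ≤ 1 → χ y = 0 := fun y hy => by
    simp [hχ, φ.one_of_mem_closedBall (x := y) (by simpa [φ] using hy)]
  have hχ1 : ∀ y, 2 ≤ ‖y‖ → χ y = 1 := fun y hy => by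
    simp [hχ, φ.zero_of_le_dist (x := y) (by simpa [φ] using hy)]
  have hχb : ∀ y, ‖χ y‖ ≤ 1 := fun y => by
    have h1 := φ.nonneg (x := y)
    have h2 := φ.le_one (x := y)
    rw [hχ]
    simp only
    rw [← Complex.ofReal_one, ← Complex.ofReal_sub, norm_real, Real.norm_eq_abs, abs_le]
    constructor <;> linarith
  have hdt : IsTest (db j χ) := by
    have : db j χ = fun y => - db j (fun y => (φ y : ℂ)) y := by
      ext y
      have hd : DifferentiableAt ℝ (fun y => (φ y : ℂ)) y :=
        diffAt (ofRealCLM.contDiff.comp φ.contDiff) y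
      rw [hχ, dd_sub (differentiableAt_const _) hd, dd_const, zero_sub]
    rw [this]
    have h : IsTest (fun y => (φ y : ℂ)) := ⟨ofRealCLM.contDiff.comp φ.contDiff,
      φ.hasCompactSupport.comp_left (g := fun x : ℝ => (x : ℂ)) (by simp)⟩
    exact h.dd.neg
  obtain ⟨D, hD⟩ : ∃ D, ∀ y, ‖db j χ y‖ ≤ D := hdt.2.exists_bound_of_continuous hdt.1.continuous
  obtain ⟨Cb, hCb⟩ : ∃ D, ∀ y, ‖b y‖ ≤ D := hb.2.exists_bound_of_continuous hb.1.continuous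
  obtain ⟨Cu, hCu⟩ := hB 2
  have hdb0 : ∀ y, 2 < ‖y‖ → db j χ y = 0 := by
    intro y hy
    have : χ =ᶠ[nhds y] fun _ => 1 := by
      filter_upwards [(isOpen_lt continuous_const continuous_norm).mem_nhds hy] with z hz
      exact hχ1 z (le_of_lt hz)
    rw [dd_congr this, dd_const]
  -- cut-off functions `χ (k y)`
  set X : ℕ → E n → ℂ := fun k y => χ ((k + 1 : ℝ) • y) with hX
  have hXs : ∀ k, ContDiff ℝ ∞ (X k) := fun k => hχs.comp (contDiff_const_smul _)
  have hXu : ∀ k, ContDiff ℝ ∞ (fun y => X k y * u y) := by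
    intro k
    rw [contDiff_iff_contDiffAt]
    intro y
    by_cases hy : y = 0
    · have : (fun y => X k y * u y) =ᶠ[nhds y] fun _ => 0 := by
        rw [hy]
        filter_upwards [ball_mem_nhds (0 : E n) (ε := 1 / (k + 1)) (by positivity)] with z hz
        rw [hX]
        simp only
        rw [hχ0, zero_mul]
        rw [norm_smul, Real.norm_of_nonneg (by positivity)]
        rw [mem_ball_zero_iff, lt_div_iff₀ (by positivity)] at hz
        linarith
      exact contDiffAt_const.congr_of_eventuallyEq this
    · exact (hXs k).contDiffAt.mul (hu y hy)
  have hXb : ∀ k y, ‖X k y‖ ≤ 1 := fun k y => hχb _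
  have hne : ∀ᵐ y : E n, y ≠ 0 := Measure.ae_ne volume 0
  have hlim : ∀ y : E n, y ≠ 0 → Tendsto (fun k => X k y) atTop (nhds 1) := by
    intro y hy
    refine tendsto_const_nhds.congr' ?_
    obtain ⟨N, hN⟩ := exists_nat_gt (2 / ‖y‖)
    have hy0 := norm_pos_iff.2 hy
    filter_upwards [Filter.eventually_ge_atTop N] with k hk
    refine (hχ1 _ ?_).symm
    rw [norm_smul, Real.norm_of_nonneg (by positivity)]
    rw [div_lt_iff₀ hy0] at hN
    have : (N : ℝ) ≤ k := by exact_mod_cast hk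
    nlinarith
  have hi1 : Integrable (fun y => db j u y * b y) := by
    have := hη.integrable_smul_left_of_hasCompactSupport (g := b) hb.1.continuous hb.2
    simpa [mul_comm] using this
  have hul : LocallyIntegrable u := by
    rw [locallyIntegrable_iff]
    intro K hK
    obtain ⟨R, hR⟩ := hK.isBounded.exists_norm_le
    obtain ⟨C, hC⟩ := hB R
    refine Measure.integrableOn_of_bounded (M := C) hK.measure_lt_top.ne hum ?_
    exact (ae_restrict_iff' hK.measurableSet).2 (Eventually.of_forall fun y hy => hC y (hR y hy))
  have hi2 : Integrable (fun y => u y * db j b y) := by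
    have := hul.integrable_smul_left_of_hasCompactSupport (g := db j b) hb.dd.1.continuous hb.dd.2
    simpa [mul_comm] using this
  have T1 : Tendsto (fun k => ∫ y, X k y * (db j u y * b y)) atTop
      (nhds (∫ y, db j u y * b y)) := by
    refine tendsto_integral_of_dominated_convergence (fun y => ‖db j u y * b y‖) ?_ hi1.norm ?_ ?_
    · exact fun k => (hXs k).continuous.aestronglyMeasurable.mul hi1.1
    · exact fun k => Eventually.of_forall fun y => by
        rw [norm_mul]; exact mul_le_of_le_one_left (norm_nonneg _) (hXb k y)
    · filter_upwards [hne] with y hy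
      simpa using (hlim y hy).mul_const (db j u y * b y)
  have T2 : Tendsto (fun k => ∫ y, X k y * (u y * db j b y)) atTop
      (nhds (∫ y, u y * db j b y)) := by
    refine tendsto_integral_of_dominated_convergence (fun y => ‖u y * db j b y‖) ?_ hi2.norm ?_ ?_
    · exact fun k => (hXs k).continuous.aestronglyMeasurable.mul hi2.1
    · exact fun k => Eventually.of_forall fun y => by
        rw [norm_mul]; exact mul_le_of_le_one_left (norm_nonneg _) (hXb k y)
    · filter_upwards [hne] with y hy
      simpa using (hlim y hy).mul_const (u y * db j b y)
  have hXd : ∀ k y, db j (X k) y = (k + 1 : ℝ) * db j χ ((k + 1 : ℝ) • y) := fun k y =>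
    dd_scale (hχs.differentiable (by simp)) _ _
  have hR : ∀ k, ∀ y, ‖db j (X k) y * u y * b y‖ ≤
      (closedBall (0 : E n) (2 / (k + 1))).indicator (fun _ => (k + 1) * D * Cu * Cb) y := by
    intro k y
    by_cases hy : y ∈ closedBall (0 : E n) (2 / (k + 1))
    · rw [Set.indicator_of_mem hy, norm_mul, norm_mul, hXd, norm_mul, norm_real,
        Real.norm_of_nonneg (by positivity)]
      have hD0 := (norm_nonneg _).trans (hD 0)
      have h1 : ‖u y‖ ≤ Cu := hCu y ((mem_closedBall_zero_iff.1 hy).trans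
        (div_le_self (by norm_num) (by linarith [Nat.cast_nonneg (α := ℝ) k])))
      have h2 := hD ((k + 1 : ℝ) • y)
      have h3 := hCb y
      have hCu0 := (norm_nonneg _).trans h1
      gcongr
    · rw [Set.indicator_of_notMem hy, hXd, hdb0]
      · simp
      · rw [mem_closedBall_zero_iff, not_le, div_lt_iff₀ (by positivity)] at hy
        rw [norm_smul, Real.norm_of_nonneg (by positivity)]
        linarith
  have T3 : Tendsto (fun k => ∫ y, db j (X k) y * u y * b y) atTop (nhds 0) := by
    set V := (volume (closedBall (0 : E n) 1)).toReal
    have hV : ∀ k : ℕ, (volume (closedBall (0 : E n) (2 / (k + 1)))).toReal =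
        (2 / (k + 1)) ^ (2 * n) * V := by
      intro k
      rw [Measure.addHaar_closedBall' _ _ (by positivity), ENNReal.toReal_mul,
        ENNReal.toReal_ofReal (by positivity)]
      congr 2
      simp [E, Module.finrank_pi_fintype, mul_comm]
    have hbound : ∀ k : ℕ, ‖∫ y, db j (X k) y * u y * b y‖ ≤
        (2 ^ (2 * n) * V * (D * Cu * Cb)) * (1 / ((k : ℝ) + 1)) := by
      intro k
      have hD0 := (norm_nonneg _).trans (hD 0)
      have hCu0 := (norm_nonneg _).trans (hCu 0 (by simp))
      have hCb0 := (norm_nonneg _).trans (hCb 0)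
      refine (norm_integral_le_of_norm_le (g := (closedBall (0 : E n) (2 / (k + 1))).indicator
        (fun _ => (k + 1) * D * Cu * Cb)) ?_ (Eventually.of_forall (hR k))).trans ?_
      · exact (integrable_indicator_iff Metric.isClosed_closedBall.measurableSet).2
          (integrableOn_const (isCompact_closedBall _ _).measure_lt_top.ne)
      · rw [integral_indicator Metric.isClosed_closedBall.measurableSet, setIntegral_const,
          Measure.real, hV]
        have hn : 1 ≤ n := NeZero.one_le
        have e : (1 / ((k : ℝ) + 1)) ^ (2 * n) ≤ (1 / ((k : ℝ) + 1)) ^ 2 :=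
          pow_le_pow_of_le_one (by positivity)
            (div_le_one_of_le₀ (by linarith [Nat.cast_nonneg (α := ℝ) k]) (by positivity)) (by omega)
        have hV0 : 0 ≤ V := ENNReal.toReal_nonneg
        rw [smul_eq_mul]
        calc _ = (2 ^ (2 * n) * V * (D * Cu * Cb)) * ((k + 1) * (1 / ((k : ℝ) + 1)) ^ (2 * n)) := by
              rw [show (2 : ℝ) / (k + 1) = 2 * (1 / (k + 1)) by ring, mul_pow]; ring
          _ ≤ (2 ^ (2 * n) * V * (D * Cu * Cb)) * ((k + 1) * (1 / ((k : ℝ) + 1)) ^ 2) := by gcongr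
          _ = _ := by congr 1; field_simp
    refine squeeze_zero_norm hbound ?_
    simpa using tendsto_one_div_add_atTop_nhds_zero_nat.const_mul (2 ^ (2 * n) * V * (D * Cu * Cb))
  have key : ∀ k, ∫ y, X k y * (db j u y * b y) =
      - (∫ y, X k y * (u y * db j b y)) - ∫ y, db j (X k) y * u y * b y := by
    intro k
    have h := integral_dd_mul (c := I) (j := j) ((hXu k).of_le (by simp)) (hb.1.of_le (by simp)) hb.2
    have j1 : Integrable (fun y => X k y * (db j u y * b y)) :=
      hi1.bdd_mul (hXs k).continuous.aestronglyMeasurable (Eventually.of_forall (hXb k))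
    have j2 : Integrable (fun y => db j (X k) y * u y * b y) := by
      have h1 := hul.integrable_smul_left_of_hasCompactSupport
        (g := fun y => db j (X k) y * b y) ((contDiff_dd (hXs k)).continuous.mul hb.1.continuous)
        (hb.mul_right (contDiff_dd (hXs k)) |>.2.mono' (by
          intro y hy; apply subset_tsupport; simp only [mem_support] at hy ⊢
          rwa [mul_comm])) 
      exact h1.congr (Eventually.of_forall fun y => by simp only [smul_eq_mul]; ring)
    have e : ∫ y, db j (fun y => X k y * u y) y * b y =
        (∫ y, X k y * (db j u y * b y)) + ∫ y, db j (X k) y * u y * b y := by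
      rw [← integral_add j1 j2]
      refine integral_congr_ae ?_
      filter_upwards [hne] with y hy
      rw [dd_mul (diffAt (hXs k) y) ((hu y hy).differentiableAt (by simp))]
      ring
    rw [e] at h
    simp only [mul_assoc] at h ⊢
    linear_combination h
  have := T2.neg.sub T3
  simp only [← key, sub_zero] at this
  exact tendsto_nhds_unique T1 this

/-- `F` has finite integral near `x`. -/
def FinAt (F : E n → ℝ≥0∞) (x : E n) : Prop := ∃ W ∈ nhds x, ∫⁻ y in W, F y ≠ ⊤

theorem FinAt.mono {F G : E n → ℝ≥0∞} {x : E n} (hG : FinAt G x) {C : ℝ≥0∞} (hC : C ≠ ⊤)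
    (h : ∀ᶠ y in nhds x, F y ≤ C * G y) : FinAt F x := by
  obtain ⟨W, hW, hi⟩ := hG
  refine ⟨interior W ∩ interior {y | F y ≤ C * G y},
    inter_mem (interior_mem_nhds.2 hW) (interior_mem_nhds.2 h), ?_⟩
  refine ne_top_of_le_ne_top (b := C * ∫⁻ y in W, G y) (mul_ne_top hC hi) ?_
  rw [← lintegral_const_mul' _ _ hC]
  have hm : MeasurableSet (interior W ∩ interior {y | F y ≤ C * G y}) :=
    (isOpen_interior.inter isOpen_interior).measurableSet
  refine (setLIntegral_mono' (g := fun y => C * G y) hm fun y hy => ?_).trans ?_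
  · have := interior_subset hy.2
    exact this
  exact lintegral_mono_set fun y hy => interior_subset hy.1

theorem FinAt.finset_sum {ι : Type*} {s : Finset ι} {F : ι → E n → ℝ≥0∞} {x : E n}
    (h : ∀ i ∈ s, FinAt (F i) x) (hm : ∀ i ∈ s, AEMeasurable (F i)) :
    FinAt (fun y => ∑ i ∈ s, F i y) x := by
  choose! W hW hi using h
  refine ⟨⋂ i ∈ s, W i, (Filter.biInter_finset_mem s).2 hW, ?_⟩
  rw [lintegral_finsetSum' _ fun i hi => (hm i hi).restrict]
  rw [ENNReal.sum_ne_top]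
  intro i his
  exact ne_top_of_le_ne_top (hi i his) (lintegral_mono_set (Set.biInter_subset_of_mem his))

theorem FinAt.compact {F : E n → ℝ≥0∞} {K : Set (E n)} (hK : IsCompact K)
    (h : ∀ x ∈ K, FinAt F x) : ∫⁻ y in K, F y ≠ ⊤ := by
  refine hK.induction_on (p := fun s => ∫⁻ y in s, F y ≠ ⊤) (by simp) ?_ ?_ ?_
  · exact fun s t hst ht => ne_top_of_le_ne_top ht (lintegral_mono_set hst)
  · exact fun s t hs ht => ne_top_of_le_ne_top (ENNReal.add_ne_top.2 ⟨hs, ht⟩) (lintegral_union_le _ _ _)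
  · intro x hx
    obtain ⟨W, hW, hi⟩ := h x hx
    exact ⟨W, mem_nhdsWithin_of_mem_nhds hW, hi⟩

theorem lintegral_smul (F : E n → ℝ≥0∞) {c : ℝ} (hc : 0 < c) (S : Set (E n)) :
    ∫⁻ y in S, F y = ofReal (c ^ (2 * n)) * ∫⁻ y in (fun y => c • y) ⁻¹' S, F (c • y) := by
  have h := Measure.map_addHaar_smul (volume : Measure (E n)) hc.ne'
  have hfr : finrank ℝ (E n) = 2 * n := by
    simp [E, Module.finrank_pi_fintype, mul_comm]
  have he : MeasurableEmbedding (fun y : E n => c • y) := (Homeomorph.smulOfNeZero c hc.ne').measurableEmbedding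
  have h2 : (volume : Measure (E n)) =
      ofReal (c ^ (2 * n)) • Measure.map (fun y : E n => c • y) volume := by
    rw [h, hfr, smul_smul, ← ENNReal.ofReal_mul (by positivity), abs_of_pos (by positivity),
      mul_inv_cancel₀ (by positivity), ENNReal.ofReal_one, one_smul]
  conv_lhs => rw [h2]
  rw [Measure.restrict_smul, lintegral_smul_measure, he.restrict_map, he.lintegral_map, smul_eq_mul]

theorem lintegral_iUnion_scale {h : E n → ℝ≥0∞} {c ρ : ℝ} (hc : 0 < c) (hρ : 0 ≤ ρ)
    (hh : ∀ y, y ≠ 0 → h (c • y) = ofReal ρ * h y) (hq : ρ * c ^ (2 * n) < 1)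
    {S : Set (E n)} (hS0 : (0 : E n) ∉ S) (hS : ∫⁻ y in S, h y ≠ ⊤) (hSm : MeasurableSet S):
    ∫⁻ y in ⋃ k : ℕ, {y | (c ^ k)⁻¹ • y ∈ S}, h y ≠ ⊤ := by
  set q := ofReal (ρ * c ^ (2 * n))
  have hp : ∀ (k : ℕ) (y : E n), y ≠ 0 → h (c ^ k • y) = ofReal ρ ^ k * h y := by
    intro k y hy0
    induction k with
    | zero => simp
    | succ k ih =>
      rw [pow_succ' c, ← smul_smul, hh _ (smul_ne_zero (pow_pos hc k).ne' hy0), ih, pow_succ', mul_assoc]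
  have hk : ∀ k : ℕ, ∫⁻ y in {y | (c ^ k)⁻¹ • y ∈ S}, h y = q ^ k * ∫⁻ y in S, h y := by
    intro k
    have hm : MeasurableSet ((fun y : E n => c ^ k • y) ⁻¹' {y | (c ^ k)⁻¹ • y ∈ S}) := by
      exact (measurable_const_smul _) (measurable_const_smul _ hSm)
    have e : ((fun y : E n => c ^ k • y) ⁻¹' {y | (c ^ k)⁻¹ • y ∈ S}) = S := by
      ext y; simp [smul_smul, hc.ne']
    rw [lintegral_smul h (pow_pos hc k), e]
    have h3 : ∀ y ∈ S, h (c ^ k • y) = ofReal ρ ^ k * h y := by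
      intro y hy
      have hy0 : y ≠ 0 := fun h => hS0 (h ▸ hy)
      exact hp k y hy0
    rw [setLIntegral_congr_fun hSm h3, lintegral_const_mul' _ _ (by simp), ← mul_assoc]
    congr 1
    simp only [q]
    rw [ENNReal.ofReal_mul hρ, mul_pow, mul_comm, ← ENNReal.ofReal_pow (pow_nonneg hc.le _), ← pow_mul, ← pow_mul,
      mul_comm k]
  refine ne_top_of_le_ne_top ?_ (lintegral_iUnion_le _ _)
  simp only [hk]
  rw [ENNReal.tsum_mul_right, ENNReal.tsum_geometric]
  refine mul_ne_top (ENNReal.inv_ne_top.2 ?_) hS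
  rw [Ne, tsub_eq_zero_iff_le, not_le, ← ENNReal.ofReal_one]
  exact (ENNReal.ofReal_lt_ofReal_iff one_pos).2 hq

theorem sq_smul (t : ℂ) (y : E n) : sq (t • y) = ‖t‖ ^ 2 * sq y := by
  simp [sq, mul_pow, mul_sum]

theorem sq_rsmul (t : ℝ) (y : E n) : sq (t • y) = t ^ 2 * sq y := by
  simp [sq, mul_pow, mul_sum]

theorem norm_sq_le_sq (y : E n) : ‖y‖ ^ 2 ≤ sq y := by
  have h : ‖y‖ ≤ sqrt (sq y) := by
    rw [pi_norm_le_iff_of_nonneg (Real.sqrt_nonneg _)]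
    intro i
    apply Real.le_sqrt_of_sq_le
    exact single_le_sum (f := fun j => ‖y j‖ ^ 2) (fun j _ => by positivity) (mem_univ i)
  calc _ ≤ sqrt (sq y) ^ 2 := by gcongr
    _ = _ := sq_sqrt (sq_nonneg' y)

theorem sq_pos {y : E n} (hy : y ≠ 0) : 0 < sq y :=
  lt_of_lt_of_le (pow_pos (norm_pos_iff.2 hy) 2) (norm_sq_le_sq y)

theorem exp_neg_rpow_le {τ : ℝ} (hτ : 0 < τ) (m : ℕ) :
    ∃ C : ℝ, 0 ≤ C ∧ ∀ s : ℝ, 1 ≤ s → exp (-s ^ τ) ≤ C * (s ^ m)⁻¹ := by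
  obtain ⟨k, hk⟩ := exists_nat_ge (m / τ)
  refine ⟨k.factorial, by positivity, fun s hs => ?_⟩
  have h0 : (0 : ℝ) ≤ s := by linarith
  have h1 := Real.pow_div_factorial_le_exp (s ^ τ) (by positivity) k
  have h2 : s ^ m ≤ (s ^ τ) ^ k := by
    rw [← Real.rpow_natCast (s ^ τ), ← Real.rpow_mul h0, ← Real.rpow_natCast]
    apply Real.rpow_le_rpow_of_exponent_le hs
    rw [div_le_iff₀ hτ] at hk; linarith
  have h3 : s ^ m / k.factorial ≤ exp (s ^ τ) := le_trans (by gcongr) h1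
  rw [Real.exp_neg, ← div_eq_mul_inv]
  rw [div_le_iff₀ (by positivity)] at h3
  rw [inv_le_iff_one_le_mul₀ (Real.exp_pos _)]
  rw [div_mul_eq_mul_div, le_div_iff₀ (by positivity), one_mul, mul_comm]
  linarith

theorem lintegral_weight_ne_top [NeZero n] {H : E n → ℝ} (hH0 : ∀ y, 0 ≤ H y) {p : ℝ}
    (hp : ∀ t : ℝ, 0 < t → ∀ y, y ≠ 0 → H (t • y) = t ^ p * H y) (hpn : 0 < p + 2 * n)
    (hF : ∀ x, x ≠ 0 → FinAt (fun y => ofReal (H y)) x) {τ : ℝ} (hτ : 0 < τ) :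
    ∫⁻ y, ofReal (H y * exp (-sq y ^ τ)) ≠ ⊤ := by
  set S : Set (E n) := {y | 1 ≤ ‖y‖} ∩ closedBall 0 2 with hS
  have hSc : IsCompact S :=
    (isCompact_closedBall _ _).inter_left (isClosed_le continuous_const continuous_norm)
  have hS0 : (0 : E n) ∉ S := by simp [hS]
  have hSf : ∫⁻ y in S, ofReal (H y) ≠ ⊤ :=
    FinAt.compact hSc fun x hx => hF x fun h => hS0 (h ▸ hx)
  have hmem : ∀ y, y ∈ S ↔ 1 ≤ ‖y‖ ∧ ‖y‖ ≤ 2 := by simp [hS]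
  obtain ⟨m, hm⟩ := exists_nat_gt ((p + 2 * n) / 2)
  set H2 : E n → ℝ := fun y => H y * (sq y ^ m)⁻¹ with hH2
  have hp2 : ∀ t : ℝ, 0 < t → ∀ y, y ≠ 0 → H2 (t • y) = t ^ (p - 2 * m) * H2 y := by
    intro t ht y hy
    simp only [hH2]
    rw [hp t ht y hy, sq_rsmul, mul_pow, mul_inv, Real.rpow_sub ht, ← pow_mul,
      show (2 * m : ℝ) = ((2 * m : ℕ) : ℝ) by push_cast; ring, Real.rpow_natCast]
    ring
  have hS2 : ∫⁻ y in S, ofReal (H2 y) ≠ ⊤ := by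
    refine ne_top_of_le_ne_top hSf (setLIntegral_mono' hSc.measurableSet fun y hy => ?_)
    apply ofReal_le_ofReal
    refine mul_le_of_le_one_right (hH0 y) (inv_le_one_of_one_le₀ (one_le_pow₀ ?_))
    exact (one_le_pow₀ ((hmem y).1 hy).1).trans (norm_sq_le_sq y)
  have A1 := lintegral_iUnion_scale (h := fun y => ofReal (H y)) (c := 1 / 2)
    (ρ := (1 / 2) ^ p) (by norm_num) (by positivity)
    (fun y hy => by rw [hp _ (by norm_num) y hy, ENNReal.ofReal_mul (by positivity)])
    (by
      rw [← Real.rpow_natCast (1 / 2 : ℝ) (2 * n), ← rpow_add (by norm_num)]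
      exact Real.rpow_lt_one (by norm_num) (by norm_num) (by push_cast; linarith)) hS0 hSf hSc.measurableSet
  have A2 := lintegral_iUnion_scale (h := fun y => ofReal (H2 y)) (c := 2)
    (ρ := 2 ^ (p - 2 * m)) (by norm_num) (by positivity)
    (fun y hy => by rw [hp2 _ (by norm_num) y hy, ENNReal.ofReal_mul (by positivity)])
    (by
      rw [← Real.rpow_natCast (2 : ℝ) (2 * n), ← rpow_add (by norm_num)]
      exact Real.rpow_lt_one_of_one_lt_of_neg (by norm_num) (by push_cast; linarith)) hS0 hS2 hSc.measurableSet
  obtain ⟨C, hC0, hC⟩ := exp_neg_rpow_le hτ m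
  set B1 : Set (E n) := {y | ‖y‖ < 1}
  have hB1 : MeasurableSet B1 := measurableSet_lt measurable_norm measurable_const
  have i1 : ∫⁻ y in B1, ofReal (H y * exp (-sq y ^ τ)) ≠ ⊤ := by
    refine ne_top_of_le_ne_top A1 ?_
    have h0 : (B1 \ {0} : Set (E n)) =ᵐ[volume] B1 := by
      exact sdiff_null_ae_eq_self (measure_singleton 0)
    rw [← setLIntegral_congr h0]
    refine (setLIntegral_mono' (MeasurableSet.diff hB1 (measurableSet_singleton 0)) fun y hy => ?_).trans
      (lintegral_mono_set ?_)
    · exact ofReal_le_ofReal (mul_le_of_le_one_right (hH0 y)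
        (Real.exp_le_one_iff.2 (by have := Real.rpow_nonneg (sq_nonneg' y) τ; linarith)))
    · rintro y ⟨hy, hy0⟩
      obtain ⟨k, hk1, hk2⟩ := exists_nat_pow_near_of_lt_one (norm_pos_iff.2 hy0)
        (le_of_lt (show ‖y‖ < 1 from hy)) (by norm_num : (0 : ℝ) < 1 / 2) (by norm_num)
      refine Set.mem_iUnion.2 ⟨k + 1, (hmem _).2 ?_⟩
      rw [norm_smul, norm_inv, norm_pow, Real.norm_of_nonneg (by norm_num : (0 : ℝ) ≤ 1 / 2),
        ← div_eq_inv_mul, le_div_iff₀ (by positivity), div_le_iff₀ (by positivity)]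
      rw [pow_succ] at hk1 ⊢
      constructor <;> linarith
  have i2 : ∫⁻ y in B1ᶜ, ofReal (H y * exp (-sq y ^ τ)) ≠ ⊤ := by
    refine ne_top_of_le_ne_top (mul_ne_top (ofReal_ne_top (r := C)) A2) ?_
    rw [← lintegral_const_mul' _ _ ofReal_ne_top]
    refine (setLIntegral_mono' hB1.compl fun y hy => ?_).trans (lintegral_mono_set ?_)
    · rw [← ENNReal.ofReal_mul hC0]
      apply ofReal_le_ofReal
      have hy1 : 1 ≤ sq y := (one_le_pow₀ (not_lt.1 (show ¬ ‖y‖ < 1 from hy))).trans (norm_sq_le_sq y)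
      calc _ ≤ H y * (C * (sq y ^ m)⁻¹) := by gcongr; exacts [hH0 y, hC _ hy1]
        _ = _ := by simp only [hH2]; ring
    · intro y hy
      obtain ⟨k, hk1, hk2⟩ := exists_nat_pow_near (not_lt.1 (show ¬ ‖y‖ < 1 from hy)) (by norm_num : (1 : ℝ) < 2)
      refine Set.mem_iUnion.2 ⟨k, (hmem _).2 ?_⟩
      rw [norm_smul, norm_inv, norm_pow, Real.norm_ofNat, ← div_eq_inv_mul,
        le_div_iff₀ (by positivity), div_le_iff₀ (by positivity)]
      rw [pow_succ] at hk2
      constructor <;> linarith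
  rw [← lintegral_add_compl _ hB1]
  exact ENNReal.add_ne_top.2 ⟨i1, i2⟩

/-- The majorant for the regularised weights. -/
theorem majorant {f : E n → ℂ} (hfc : Continuous f) {d : ℕ}
    (hfd : ∀ (t : ℂ) y, f (t • y) = t ^ d * f y) {β τ : ℝ} (hτ0 : 0 ≤ τ) (hτ1 : τ ≤ 1) (hβd : 1 - τ ≤ β * d)
    (hβ : 0 ≤ β) :
    ∃ C : ℝ, 0 ≤ C ∧ ∀ δ, 0 < δ → ∀ y, y ≠ 0 → f y ≠ 0 →
      (sq y + δ) ^ (1 - τ) * (‖f y‖ ^ 2 + δ ^ d) ^ (-β) ≤ C * (sq y ^ (1 - τ) * ‖f y‖ ^ (-2 * β)) := by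
  obtain ⟨C0, hC0⟩ : ∃ C0 : ℝ, ∀ y ∈ closedBall (0 : E n) 1, ‖f y‖ ≤ C0 :=
    (isCompact_closedBall _ _).exists_bound_of_continuousOn hfc.continuousOn
  have hC00 : 0 ≤ C0 := (norm_nonneg _).trans (hC0 0 (by simp))
  have hfb : ∀ y, ‖f y‖ ^ 2 ≤ C0 ^ 2 * sq y ^ d := by
    intro y
    by_cases hy : y = 0
    · subst hy
      have h1 := hfd 0 0
      rcases Nat.eq_zero_or_pos d with h | h
      · subst h
        have := hC0 0 (by simp)
        simp only [pow_zero, mul_one]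
        exact pow_le_pow_left₀ (norm_nonneg _) this 2
      · rw [zero_pow h.ne', zero_mul, zero_smul] at h1
        rw [h1, norm_zero, zero_pow two_ne_zero]
        have := sq_nonneg' (0 : E n)
        positivity
    have hy0 := norm_pos_iff.2 hy
    have h1 := hC0 ((‖y‖⁻¹ : ℂ) • y) (by simp [norm_smul, hy0.ne'])
    rw [hfd, norm_mul, norm_pow, norm_inv, norm_real, norm_norm, inv_pow,
      inv_mul_le_iff₀ (by positivity)] at h1
    calc ‖f y‖ ^ 2 ≤ (‖y‖ ^ d * C0) ^ 2 := by gcongr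
      _ = C0 ^ 2 * (‖y‖ ^ 2) ^ d := by ring
      _ ≤ _ := by gcongr; exact norm_sq_le_sq y
  refine ⟨2 * max 1 ((C0 ^ 2) ^ β), by positivity, fun δ hδ y hy hf => ?_⟩
  have hs := sq_pos hy
  set s := sq y
  have ha : 0 < ‖f y‖ ^ 2 := by positivity
  have hfp : ‖f y‖ ^ (-2 * β) = (‖f y‖ ^ 2) ^ (-β) := by
    rw [← Real.rpow_natCast, ← Real.rpow_mul (norm_nonneg _)]; norm_num
  rw [hfp]
  set a := ‖f y‖ ^ 2
  have h1τ : 0 ≤ 1 - τ := by linarith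
  have htwo : ∀ a b : ℝ, 0 < a → b ≤ a → 0 ≤ b → (a + b) ^ (1 - τ) ≤ 2 * a ^ (1 - τ) := by
    intro a b ha hab hb
    calc (a + b) ^ (1 - τ) ≤ (2 * a) ^ (1 - τ) := Real.rpow_le_rpow (by linarith) (by linarith) h1τ
      _ = 2 ^ (1 - τ) * a ^ (1 - τ) := mul_rpow (by norm_num) ha.le
      _ ≤ 2 ^ (1 : ℝ) * a ^ (1 - τ) := mul_le_mul_of_nonneg_right
          (Real.rpow_le_rpow_of_exponent_le (by norm_num) (by linarith)) (by positivity)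
      _ = _ := by rw [Real.rpow_one]
  by_cases hsd : δ ≤ s
  · have h1 : (s + δ) ^ (1 - τ) ≤ 2 * s ^ (1 - τ) := htwo _ _ hs hsd hδ.le
    have h2 : (a + δ ^ d) ^ (-β) ≤ a ^ (-β) :=
      Real.rpow_le_rpow_of_nonpos ha (by linarith [pow_pos hδ d]) (by linarith)
    calc _ ≤ (2 * s ^ (1 - τ)) * a ^ (-β) := by gcongr
      _ = 2 * 1 * (s ^ (1 - τ) * a ^ (-β)) := by ring
      _ ≤ _ := by gcongr; exact le_max_left _ _
  · push Not at hsd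
    have h1 : (s + δ) ^ (1 - τ) ≤ 2 * δ ^ (1 - τ) := by
      rw [add_comm]
      exact htwo _ _ hδ hsd.le hs.le
    have h2 : (a + δ ^ d) ^ (-β) ≤ (δ ^ d) ^ (-β) :=
      Real.rpow_le_rpow_of_nonpos (by positivity) (by linarith) (by linarith)
    -- `x = s / δ ≤ 1`
    have h3 : δ ^ (1 - τ) * (δ ^ d) ^ (-β) ≤ s ^ (1 - τ) * (s ^ d) ^ (-β) := by
      have e : ∀ r : ℝ, 0 < r → r ^ (1 - τ) * (r ^ d) ^ (-β) = r ^ ((1 - τ) - β * d) := by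
        intro r hr
        rw [← Real.rpow_natCast r d, ← Real.rpow_mul hr.le, ← rpow_add hr]
        ring_nf
      rw [e δ hδ, e s hs]
      exact Real.rpow_le_rpow_of_nonpos hs hsd.le (by linarith)
    have h4 : (s ^ d) ^ (-β) ≤ (C0 ^ 2) ^ β * a ^ (-β) := by
      rw [Real.rpow_neg (by positivity), Real.rpow_neg ha.le, ← div_eq_mul_inv,
        le_div_iff₀ (by positivity), inv_mul_le_iff₀ (by positivity), mul_comm,
        ← mul_rpow (by positivity) (by positivity)]
      exact Real.rpow_le_rpow ha.le (hfb y) hβ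
    calc _ ≤ (2 * δ ^ (1 - τ)) * (δ ^ d) ^ (-β) := by gcongr
      _ = 2 * (δ ^ (1 - τ) * (δ ^ d) ^ (-β)) := by ring
      _ ≤ 2 * (s ^ (1 - τ) * ((C0 ^ 2) ^ β * a ^ (-β))) := 
          mul_le_mul_of_nonneg_left (h3.trans (mul_le_mul_of_nonneg_left h4 (by positivity))) (by norm_num)
      _ = 2 * (C0 ^ 2) ^ β * (s ^ (1 - τ) * a ^ (-β)) := by ring
      _ ≤ _ := by gcongr; exact le_max_right _ _

theorem dd_scale_at {c : ℂ} {j : Fin n} {a : E n → ℂ} {s : ℝ} {y : E n}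
    (ha : DifferentiableAt ℝ a (s • y)) :
    dd c j (fun y => a (s • y)) y = s * dd c j a (s • y) := by
  have h := ha.hasFDerivAt.comp y ((hasFDerivAt_id (𝕜 := ℝ) y).const_smul s)
  have e : fderiv ℝ (fun y => a (s • y)) y = _ := HasFDerivAt.fderiv h
  simp only [dd]
  rw [e]
  simp
  ring

theorem FinAt.of_continuousAt {F : E n → ℝ} {x : E n} (h : ContinuousAt F x) :
    FinAt (fun y => ofReal (F y)) x := by
  have h1 : ∀ᶠ y in nhds x, F y < F x + 1 := h.eventually_lt continuousAt_const (by linarith)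
  refine FinAt.mono (G := fun _ => 1) ⟨ball x 1, ball_mem_nhds _ one_pos, ?_⟩
    (ofReal_ne_top (r := F x + 1)) ?_
  · simpa using measure_ball_lt_top.ne
  · filter_upwards [h1] with y hy
    rw [mul_one]
    exact ofReal_le_ofReal hy.le

theorem aestronglyMeasurable_of_off_zero [NeZero n] {u : E n → ℂ}
    (hu : ∀ y, y ≠ 0 → ContinuousAt u y) : AEStronglyMeasurable u := by
  have h1 : ContinuousOn u {0}ᶜ := fun y hy => (hu y hy).continuousWithinAt
  have := h1.aestronglyMeasurable (μ := volume) (measurableSet_singleton (0 : E n)).compl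
  rwa [restrict_compl_singleton] at this

theorem integrable_of_lintegral_ofReal {F : E n → ℝ} (hm : AEStronglyMeasurable F)
    (h0 : ∀ y, 0 ≤ F y) (h : ∫⁻ y, ofReal (F y) ≠ ⊤) : Integrable F :=
  ⟨hm, by rw [hasFiniteIntegral_iff_ofReal (Eventually.of_forall h0)]; exact h.lt_top⟩

/-- The regularised weight. -/
def wt (f : E n → ℂ) (d : ℕ) (β τ δ : ℝ) (y : E n) : ℝ :=
  β * log (‖f y‖ ^ 2 + δ ^ d) + (sq y + δ) ^ τ

theorem exp_neg_wt (f : E n → ℂ) (d : ℕ) (β τ : ℝ) {δ : ℝ} (hδ : 0 < δ) (y : E n) :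
    exp (-wt f d β τ δ y) = (‖f y‖ ^ 2 + δ ^ d) ^ (-β) * exp (-(sq y + δ) ^ τ) := by
  have h : 0 < ‖f y‖ ^ 2 + δ ^ d := by positivity
  rw [wt, neg_add, Real.exp_add, Real.rpow_def_of_pos h]
  congr 2
  ring

theorem contDiff_wt {f : E n → ℂ} (hf : ContDiff ℝ ∞ f) (d : ℕ) (β τ : ℝ) {δ : ℝ} (hδ : 0 < δ) :
    ContDiff ℝ ∞ (wt f d β τ δ) := by
  have h1 : ContDiff ℝ ∞ fun y => log (‖f y‖ ^ 2 + δ ^ d) :=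
    ((hf.norm_sq ℝ).add contDiff_const).log fun y => by positivity
  have h2 : ContDiff ℝ ∞ fun y : E n => (sq y + δ) ^ τ :=
    (contDiff_sq.add contDiff_const).rpow_const_of_ne fun y => by
      have := sq_nonneg' y; positivity
  exact (contDiff_const.mul h1).add h2

theorem levi_wt {f : E n → ℂ} (hf : ContDiff ℝ ∞ f) (hb : ∀ j y, db j f y = 0) (d : ℕ) {β τ δ : ℝ}
    (hβ : 0 ≤ β) (hτ : 0 < τ) (hτ1 : τ ≤ 1) (hδ : 0 < δ) (y : E n) (w : Fin n → ℂ) :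
    τ ^ 2 * (sq y + δ) ^ (τ - 1) * ∑ j, ‖w j‖ ^ 2 ≤
    (∑ j, ∑ k, lev (fun y => (wt f d β τ δ y : ℂ)) j k y * w j * conj (w k)).re := by
  have h1 := re_levi_log_nonneg hf hb hβ (pow_pos hδ d) y w
  have h2 := levi_rpow_ge hτ hτ1 hδ y w
  have c1 : ContDiff ℝ ∞ fun y => ((β * log (‖f y‖ ^ 2 + δ ^ d) : ℝ) : ℂ) :=
    ofRealCLM.contDiff.comp (contDiff_const.mul (((hf.norm_sq ℝ).add contDiff_const).log fun y => by positivity))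
  have c2 : ContDiff ℝ ∞ fun y : E n => (((sq y + δ) ^ τ : ℝ) : ℂ) :=
    ofRealCLM.contDiff.comp ((contDiff_sq.add contDiff_const).rpow_const_of_ne fun y => by
      have := sq_nonneg' y; positivity)
  have e : (fun y => (wt f d β τ δ y : ℂ)) = fun y => ((β * log (‖f y‖ ^ 2 + δ ^ d) : ℝ) : ℂ) +
      (((sq y + δ) ^ τ : ℝ) : ℂ) := by
    funext y; simp only [wt]; push_cast; ring
  have hl : ∀ j k, lev (fun y => (wt f d β τ δ y : ℂ)) j k y =
      lev (fun y => ((β * log (‖f y‖ ^ 2 + δ ^ d) : ℝ) : ℂ)) j k y +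
      lev (fun y => (((sq y + δ) ^ τ : ℝ) : ℂ)) j k y := by
    intro j k
    rw [e]
    have : db k (fun y => ((β * log (‖f y‖ ^ 2 + δ ^ d) : ℝ) : ℂ) + (((sq y + δ) ^ τ : ℝ) : ℂ)) =
      fun y => db k (fun y => ((β * log (‖f y‖ ^ 2 + δ ^ d) : ℝ) : ℂ)) y +
        db k (fun y => (((sq y + δ) ^ τ : ℝ) : ℂ)) y := by
      funext z
      exact dd_add (diffAt c1 z) (diffAt c2 z)
    simp only [lev]
    rw [this]
    exact dd_add (diffAt (contDiff_dd c1) y) (diffAt (contDiff_dd c2) y)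
  simp only [hl, add_mul, sum_add_distrib, Complex.add_re]
  linarith

theorem nadel_delta [NeZero n] {f : E n → ℂ} (hf : ContDiff ℝ ∞ f) (hb : ∀ j y, db j f y = 0) {d e : ℕ}
    (hfd : ∀ (t : ℂ) y, f (t • y) = t ^ d * f y) (hf0 : ∀ᵐ y, f y ≠ 0) {β τ : ℝ} (hβ : 0 ≤ β)
    (hβ1 : 1 ≤ β * d) (hτ : 0 < τ) (hτ1 : τ ≤ 1) (hβ2 : τ + β * d < e + n) {u : E n → ℂ}
    (hu : ∀ y, y ≠ 0 → ContDiffAt ℝ ∞ u y) (hue : ∀ t : ℂ, t ≠ 0 → ∀ y, u (t • y) = t ^ e * u y)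
    (hfin : ∀ j x, x ≠ 0 → FinAt (fun y => ofReal (‖db j u y‖ ^ 2 * ‖f y‖ ^ (-2 * β))) x) :
    ∃ M : ℝ, ∀ δ, 0 < δ → ∃ G : E n → ℂ, LocallyIntegrable G ∧
      (∀ b, IsTest b → ∀ j, ∫ y, db j b y * G y = 0) ∧
      (Integrable fun y => ‖u y - G y‖ ^ 2 * exp (-wt f d β τ δ y)) ∧
      ∫ y, ‖u y - G y‖ ^ 2 * exp (-wt f d β τ δ y) ≤ M := by
  have hud : ∀ y, y ≠ 0 → DifferentiableAt ℝ u y := fun y hy => (hu y hy).differentiableAt (by simp)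
  have huc : ∀ y, y ≠ 0 → ContinuousAt u y := fun y hy => (hu y hy).continuousAt
  have hum := aestronglyMeasurable_of_off_zero huc
  have hηc : ∀ j y, y ≠ 0 → ContinuousAt (db j u) y := by
    intro j y hy
    have h1 : ContinuousAt (fderiv ℝ u) y := ((hu y hy).fderiv_right (m := 0) (by simp)).continuousAt
    exact continuousAt_const.mul ((h1.clm_apply continuousAt_const).add
      (continuousAt_const.mul (h1.clm_apply continuousAt_const)))
  have hηm : ∀ j, AEStronglyMeasurable (db j u) := fun j => aestronglyMeasurable_of_off_zero (hηc j)
  have hη_hom : ∀ j (t : ℝ), 0 < t → ∀ y, y ≠ 0 → ‖db j u (t • y)‖ = t ^ ((e : ℝ) - 1) * ‖db j u y‖ := by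
    intro j t ht y hy
    have h1 : db j (fun y => u (t • y)) y = t * db j u (t • y) := dd_scale_at (hud _ (smul_ne_zero ht.ne' hy))
    have h2 : (fun y => u (t • y)) = fun y => ((t : ℂ) ^ e) * u y := by
      funext z
      rw [← hue t (by exact_mod_cast ht.ne')]
      rfl
    have h3 : db j (fun y => ((t : ℂ) ^ e) * u y) y = (t : ℂ) ^ e * db j u y := dd_const_mul _ (hud y hy)
    rw [h2, h3] at h1
    have h4 := congrArg norm h1
    rw [norm_mul, norm_mul, norm_pow, norm_real, Real.norm_of_nonneg ht.le] at h4
    rw [Real.rpow_sub ht, Real.rpow_one, Real.rpow_natCast, div_mul_eq_mul_div, h4]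
    field_simp
  set H : E n → ℝ := fun y => ∑ j, ‖db j u y‖ ^ 2 * (sq y ^ (1 - τ) * ‖f y‖ ^ (-2 * β)) with hH
  have hH0 : ∀ y, 0 ≤ H y := fun y => Finset.sum_nonneg fun j _ => by
    have := sq_nonneg' y; positivity
  have hHm : AEStronglyMeasurable H := by
    refine Finset.aestronglyMeasurable_fun_sum _ fun j _ => ((hηm j).norm.pow 2).mul ?_
    exact (contDiff_sq.continuous.measurable.pow_const _ |>.mul
      (hf.continuous.norm.measurable.pow_const _)).aestronglyMeasurable
  have hHfin : ∀ x, x ≠ 0 → FinAt (fun y => ofReal (H y)) x := by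
    intro x hx
    have hs : ContinuousAt (fun y : E n => sq y ^ (1 - τ)) x :=
      contDiff_sq.continuous.continuousAt.rpow_const (Or.inl (sq_pos hx).ne')
    have h1 : ∀ᶠ y in nhds x, sq y ^ (1 - τ) < sq x ^ (1 - τ) + 1 :=
      hs.eventually_lt continuousAt_const (by linarith)
    have h2 := FinAt.finset_sum (s := univ) (x := x)
      (F := fun j y => ofReal (‖db j u y‖ ^ 2 * ‖f y‖ ^ (-2 * β))) (fun j _ => hfin j x hx)
      (fun j _ => (((hηm j).norm.pow 2).aemeasurable.mul
        (hf.continuous.norm.measurable.pow_const _).aemeasurable).ennreal_ofReal)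
    refine h2.mono (ofReal_ne_top (r := sq x ^ (1 - τ) + 1)) ?_
    filter_upwards [h1] with y hy
    rw [← ENNReal.ofReal_sum_of_nonneg (fun j _ => by positivity),
      ← ENNReal.ofReal_mul (by have := sq_nonneg' x; positivity), mul_sum]
    refine ofReal_le_ofReal (Finset.sum_le_sum fun j _ => ?_)
    rw [mul_left_comm]
    exact mul_le_mul_of_nonneg_right hy.le (by positivity)
  have hHt := lintegral_weight_ne_top (p := 2 * ((e : ℝ) - 1) + 2 * (1 - τ) - 2 * β * d) hH0 (by
    intro t ht y hy
    have hf1 : ‖f (t • y)‖ = t ^ d * ‖f y‖ := by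
      have := hfd t y
      rw [show ((t : ℂ) • y) = t • y from rfl] at this
      rw [this, norm_mul, norm_pow, norm_real, Real.norm_of_nonneg ht.le]
    simp only [hH]
    rw [mul_sum]
    refine sum_congr rfl fun j _ => ?_
    have e1 : (t ^ ((e : ℝ) - 1)) ^ 2 = t ^ (2 * ((e : ℝ) - 1)) := by
      rw [← Real.rpow_natCast, ← Real.rpow_mul ht.le]; push_cast; ring_nf
    have e2 : (t ^ 2) ^ (1 - τ) = t ^ (2 * (1 - τ)) := by
      rw [← Real.rpow_natCast, ← Real.rpow_mul ht.le]; push_cast; ring_nf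
    have e3 : (t ^ d) ^ (-2 * β) = t ^ (-(2 * β * d)) := by
      rw [← Real.rpow_natCast, ← Real.rpow_mul ht.le]; ring_nf
    rw [hη_hom j t ht y hy, hf1, sq_rsmul, mul_rpow (by positivity) (sq_nonneg' y),
      mul_rpow (by positivity) (norm_nonneg _), mul_pow, e1, e2, e3, sub_eq_add_neg _ (2 * β * (d : ℝ)),
      rpow_add ht, rpow_add ht]
    ring) (by linarith) hHfin hτ
  have hHi : Integrable fun y => H y * exp (-sq y ^ τ) := by
    refine integrable_of_lintegral_ofReal (hHm.mul ?_) (fun y => mul_nonneg (hH0 y) (Real.exp_pos _).le) hHt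
    exact ((contDiff_sq.continuous.rpow_const fun y => Or.inr hτ.le).neg.rexp).aestronglyMeasurable
  have hu_hom : ∀ t : ℝ, 0 < t → ∀ y, y ≠ 0 → ‖u (t • y)‖ = t ^ e * ‖u y‖ := by
    intro t ht y _
    have := hue t (by exact_mod_cast ht.ne') y
    rw [show ((t : ℂ) • y) = t • y from rfl] at this
    rw [this, norm_mul, norm_pow, norm_real, Real.norm_of_nonneg ht.le]
  have hut := lintegral_weight_ne_top (H := fun y => ‖u y‖ ^ 2) (p := 2 * e) (fun y => by positivity) (by
    intro t ht y hy
    rw [hu_hom t ht y hy, mul_pow, mul_comm (2 : ℝ), Real.rpow_mul ht.le, Real.rpow_natCast]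
    norm_num) (by
      have : 0 < β * d := by linarith
      have : (0 : ℝ) < e + n := by linarith
      linarith) (fun x hx => FinAt.of_continuousAt ((huc x hx).norm.pow 2)) hτ
  have hui : Integrable fun y => ‖u y‖ ^ 2 * exp (-sq y ^ τ) := by
    refine integrable_of_lintegral_ofReal ((hum.norm.pow 2).mul ?_) (fun y => by positivity) hut
    exact ((contDiff_sq.continuous.rpow_const fun y => Or.inr hτ.le).neg.rexp).aestronglyMeasurable
  have huB : ∀ R : ℝ, ∃ C : ℝ, ∀ y, ‖y‖ ≤ R → ‖u y‖ ≤ C := by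
    intro R
    obtain ⟨C, hC⟩ := (isCompact_sphere (0 : E n) 1).exists_bound_of_continuousOn
      (f := u) (fun y hy => (huc y (by rintro rfl; simp at hy)).continuousWithinAt)
    refine ⟨max (R ^ e * C) ‖u 0‖, fun y hy => ?_⟩
    by_cases h : y = 0
    · subst h; exact le_max_right _ _
    · refine le_max_of_le_left ?_
      have hy0 := norm_pos_iff.2 h
      have h1 := hC (‖y‖⁻¹ • y) (by simp [norm_smul, hy0.ne'])
      have h2 := hu_hom ‖y‖ hy0 (‖y‖⁻¹ • y) (smul_ne_zero (inv_ne_zero hy0.ne') h)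
      rw [smul_smul, mul_inv_cancel₀ hy0.ne', one_smul] at h2
      rw [h2]
      have hC0 := (norm_nonneg _).trans h1
      have hR0 := hy0.le.trans hy
      gcongr
  obtain ⟨C, hC0, hC⟩ := majorant hf.continuous hfd hτ.le hτ1 (by linarith) hβ
  have hae : ∀ᵐ y : E n, y ≠ 0 := by simp [ae_iff]
  refine ⟨∫ y, C / τ ^ 2 * (H y * exp (-sq y ^ τ)), fun δ hδ => ?_⟩
  have hwc := contDiff_wt hf d β τ hδ
  have hsd : ∀ y : E n, 0 < sq y + δ := fun y => by have := sq_nonneg' y; positivity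
  set κ : E n → ℝ := fun y => τ ^ 2 * (sq y + δ) ^ (τ - 1) with hκ
  have hκ0 : ∀ y, 0 < κ y := fun y => by have := hsd y; positivity
  have hκc : Continuous κ := continuous_const.mul
    ((contDiff_sq.continuous.add continuous_const).rpow_const fun y => Or.inl (hsd y).ne')
  have hexpm : AEStronglyMeasurable (fun y => exp (-wt f d β τ δ y)) :=
    hwc.continuous.neg.rexp.aestronglyMeasurable
  have hle : ∀ᵐ y, (∑ j, ‖db j u y‖ ^ 2) * exp (-wt f d β τ δ y) / κ y ≤
      C / τ ^ 2 * (H y * exp (-sq y ^ τ)) := by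
    filter_upwards [hf0, hae] with y hy hy0
    have h1 := hC δ hδ y hy0 hy
    have h2 : exp (-(sq y + δ) ^ τ) ≤ exp (-sq y ^ τ) := by
      apply Real.exp_le_exp.2 (neg_le_neg (Real.rpow_le_rpow (sq_nonneg' y) (by linarith) hτ.le))
    have h3 : (κ y)⁻¹ = (τ ^ 2)⁻¹ * (sq y + δ) ^ (1 - τ) := by
      rw [hκ]
      simp only
      rw [mul_inv, ← Real.rpow_neg (hsd y).le, neg_sub]
    have hs := hsd y
    rw [exp_neg_wt f d β τ hδ, div_eq_mul_inv, h3]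
    calc _ = (∑ j, ‖db j u y‖ ^ 2) * (τ ^ 2)⁻¹ * ((sq y + δ) ^ (1 - τ) * (‖f y‖ ^ 2 + δ ^ d) ^ (-β)) *
          exp (-(sq y + δ) ^ τ) := by ring
      _ ≤ (∑ j, ‖db j u y‖ ^ 2) * (τ ^ 2)⁻¹ * (C * (sq y ^ (1 - τ) * ‖f y‖ ^ (-2 * β))) *
          exp (-sq y ^ τ) := by
        refine mul_le_mul (mul_le_mul_of_nonneg_left h1 (by positivity)) h2 (by positivity) ?_
        have := sq_nonneg' y
        positivity
      _ = _ := by simp only [hH]; rw [← sum_mul]; ring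
  have hdom := hHi.const_mul (C / τ ^ 2)
  have hnn : ∀ y, 0 ≤ (∑ j, ‖db j u y‖ ^ 2) * exp (-wt f d β τ δ y) / κ y := fun y => by
    have := hκ0 y; positivity
  have hsm : AEStronglyMeasurable fun y => (∑ j, ‖db j u y‖ ^ 2) :=
    Finset.aestronglyMeasurable_fun_sum _ fun j _ => (hηm j).norm.pow 2
  have hi : Integrable fun y => (∑ j, ‖db j u y‖ ^ 2) * exp (-wt f d β τ δ y) / κ y := by
    refine hdom.mono' ((hsm.mul hexpm).div₀ hκc.aestronglyMeasurable) ?_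
    filter_upwards [hle] with y hy
    rwa [Real.norm_of_nonneg (hnn y)]
  have hcast : ∀ (v : E n → ℂ) y, ‖v y * (exp (-wt f d β τ δ y / 2) : ℂ)‖ ^ 2 =
      ‖v y‖ ^ 2 * exp (-wt f d β τ δ y) := by
    intro v y
    rw [norm_mul, norm_real, Real.norm_of_nonneg (Real.exp_pos _).le, mul_pow,
      ← Real.exp_nat_mul]
    push_cast
    ring_nf
  have hem : AEStronglyMeasurable (fun y => (exp (-wt f d β τ δ y / 2) : ℂ)) :=
    (Complex.continuous_ofReal.comp (hwc.continuous.neg.div_const 2).rexp).aestronglyMeasurable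
  have hη2 : ∀ j, MemLp (fun y => db j u y * (exp (-wt f d β τ δ y / 2) : ℂ)) 2 := by
    intro j
    refine (memLp_two_iff_integrable_sq_norm ((hηm j).mul hem)).2 ?_
    simp only [Pi.mul_apply]
    simp_rw [hcast]
    refine (hi.const_mul (τ ^ 2 * δ ^ (τ - 1))).mono' (((hηm j).norm.pow 2).mul hexpm)
      (Eventually.of_forall fun y => ?_)
    rw [Real.norm_of_nonneg (by positivity)]
    have h1 : ‖db j u y‖ ^ 2 ≤ ∑ j, ‖db j u y‖ ^ 2 :=
      single_le_sum (f := fun j => ‖db j u y‖ ^ 2) (fun j _ => by positivity) (mem_univ j)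
    have h2 : κ y ≤ τ ^ 2 * δ ^ (τ - 1) := mul_le_mul_of_nonneg_left
      (Real.rpow_le_rpow_of_nonpos hδ (by linarith [sq_nonneg' y]) (by linarith)) (by positivity)
    have h3 := hκ0 y
    calc _ ≤ (∑ j, ‖db j u y‖ ^ 2) * exp (-wt f d β τ δ y) := by gcongr
      _ = κ y * ((∑ j, ‖db j u y‖ ^ 2) * exp (-wt f d β τ δ y) / κ y) := by field_simp
      _ ≤ _ := mul_le_mul_of_nonneg_right h2 (hnn y)
  have hηl : ∀ j, LocallyIntegrable (db j u) := by
    intro j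
    have h1 := (hη2 j).locallyIntegrable (by norm_num)
    have h2 : Continuous fun y => (exp (wt f d β τ δ y / 2) : ℂ) :=
      Complex.continuous_ofReal.comp (hwc.continuous.div_const 2).rexp
    have h3 := (locallyIntegrable_iff.2 fun k hk =>
      ((locallyIntegrable_iff.1 h1 k hk).continuousOn_mul h2.continuousOn hk))
    refine h3.congr (Eventually.of_forall fun y => ?_)
    simp only
    rw [mul_left_comm, ← Complex.ofReal_mul, ← Real.exp_add]
    ring_nf
    simp
  have hu2 : MemLp (fun y => u y * (exp (-wt f d β τ δ y / 2) : ℂ)) 2 := by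
    refine (memLp_two_iff_integrable_sq_norm (hum.mul hem)).2 ?_
    simp only [Pi.mul_apply]
    simp_rw [hcast]
    refine (hui.const_mul ((δ ^ d) ^ (-β))).mono' ((hum.norm.pow 2).mul hexpm)
      (Eventually.of_forall fun y => ?_)
    rw [Real.norm_of_nonneg (by positivity), exp_neg_wt f d β τ hδ]
    have h2 : exp (-(sq y + δ) ^ τ) ≤ exp (-sq y ^ τ) := by
      apply Real.exp_le_exp.2 (neg_le_neg (Real.rpow_le_rpow (sq_nonneg' y) (by linarith) hτ.le))
    have h3 : (‖f y‖ ^ 2 + δ ^ d) ^ (-β) ≤ (δ ^ d) ^ (-β) :=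
      Real.rpow_le_rpow_of_nonpos (by positivity) (by linarith [sq_nonneg ‖f y‖]) (by linarith)
    calc _ ≤ ‖u y‖ ^ 2 * ((δ ^ d) ^ (-β) * exp (-sq y ^ τ)) := by gcongr
      _ = _ := by ring
  refine hor hwc hκc hκ0 (levi_wt hf hb d hβ hτ hτ1 hδ)
    (fun b hb j => weak_identity hu huB (hηl j) b hb) hu2 hη2 hi ?_
  exact integral_mono_ae hi hdom hle

section

open Polynomial
variable {V V' : Type*} [AddCommGroup V] [Module ℂ V] [AddCommGroup V'] [Module ℂ V']

/-- `p` is a homogeneous polynomial function of degree `e`. -/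
def IsPol (e : ℕ) (p : V → ℂ) : Prop :=
  (∀ u w : V, ∃ Q : ℂ[X], ∀ t : ℂ, p (u + t • w) = Q.eval t) ∧ ∀ (t : ℂ) y, p (t • y) = t ^ e * p y

namespace IsPol

theorem zero {e : ℕ} : IsPol e (fun _ : V => (0 : ℂ)) := ⟨fun _ _ => ⟨0, by simp⟩, by simp⟩

theorem add {e : ℕ} {p q : V → ℂ} (hp : IsPol e p) (hq : IsPol e q) : IsPol e (fun y => p y + q y) := by
  refine ⟨fun u w => ?_, fun t y => by simp only [hp.2, hq.2]; ring⟩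
  obtain ⟨P, hP⟩ := hp.1 u w
  obtain ⟨Q, hQ⟩ := hq.1 u w
  exact ⟨P + Q, fun t => by simp only [hP, hQ, eval_add]⟩

theorem mul {a b : ℕ} {p q : V → ℂ} (hp : IsPol a p) (hq : IsPol b q) :
    IsPol (a + b) (fun y => p y * q y) := by
  refine ⟨fun u w => ?_, fun t y => by simp only [hp.2, hq.2]; ring⟩
  obtain ⟨P, hP⟩ := hp.1 u w
  obtain ⟨Q, hQ⟩ := hq.1 u w
  exact ⟨P * Q, fun t => by simp only [hP, hQ, eval_mul]⟩

theorem const (c : ℂ) : IsPol 0 (fun _ : V => c) := ⟨fun _ _ => ⟨C c, by simp⟩, by simp⟩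

theorem const_mul {e : ℕ} {p : V → ℂ} (hp : IsPol e p) (c : ℂ) : IsPol e (fun y => c * p y) := by
  simpa using (const c).mul hp

theorem linear (l : V →ₗ[ℂ] ℂ) : IsPol 1 (fun y => l y) :=
  ⟨fun u w => ⟨C (l u) + X * C (l w), fun t => by simp; ring⟩, by simp⟩

theorem pow {a : ℕ} {p : V → ℂ} (hp : IsPol a p) (k : ℕ) : IsPol (k * a) (fun y => p y ^ k) := by
  induction k with
  | zero => simpa using const 1
  | succ k ih =>
    have := ih.mul hp
    simpa only [pow_succ, Nat.succ_mul] using this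

theorem linear_pow (l : V →ₗ[ℂ] ℂ) (k : ℕ) : IsPol k (fun y => l y ^ k) := by
  simpa using (linear l).pow k

theorem comp {e : ℕ} {p : V → ℂ} (hp : IsPol e p) (T : V' →ₗ[ℂ] V) : IsPol e (fun y => p (T y)) :=
  ⟨fun u w => by simpa using hp.1 (T u) (T w), fun t y => by simp only [map_smul, hp.2]⟩

theorem sum {ι : Type*} {e : ℕ} (s : Finset ι) {p : ι → V → ℂ} (hp : ∀ i ∈ s, IsPol e (p i)) :
    IsPol e (fun y => ∑ i ∈ s, p i y) := by
  induction s using Finset.induction_on with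
  | empty => simpa using zero
  | insert a s ha ih =>
    simp only [Finset.sum_insert ha]
    exact (hp a (Finset.mem_insert_self _ _)).add (ih fun i hi => hp i (Finset.mem_insert_of_mem hi))

theorem prod {ι : Type*} (s : Finset ι) (l : ι → V →ₗ[ℂ] ℂ) :
    IsPol s.card (fun y => ∏ i ∈ s, l i y) := by
  induction s using Finset.induction_on with
  | empty => simpa using const 1
  | insert a s ha ih =>
    simp only [Finset.prod_insert ha]
    rw [Finset.card_insert_of_notMem ha, add_comm]
    exact (linear (l a)).mul ih

theorem exists_natDegree_le {e : ℕ} {p : V → ℂ} (hp : IsPol e p) (u w : V) :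
    ∃ Q : ℂ[X], Q.natDegree ≤ e ∧ ∀ t : ℂ, p (u + t • w) = Q.eval t := by
  obtain ⟨Q, hQ⟩ := hp.1 u w
  obtain ⟨P, hP⟩ := hp.1 w u
  refine ⟨Q, ?_, hQ⟩
  have h1 : ∀ t : ℂ, t ≠ 0 → (Q.eval t) * t ^ P.natDegree = t ^ e * (P.reverse).eval t := by
    intro t ht
    have h2 : Q.eval t = t ^ e * P.eval t⁻¹ := by
      rw [← hQ, ← hP, ← hp.2, smul_add, smul_smul, mul_inv_cancel₀ ht, one_smul, add_comm]
    let _ := invertibleOfNonzero (inv_ne_zero ht)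
    have h3 := eval₂_reverse_mul_pow (RingHom.id ℂ) t⁻¹ P
    rw [invOf_eq_inv, inv_inv, inv_pow] at h3
    simp only [eval₂_id] at h3
    have h4 : t ^ P.natDegree ≠ 0 := pow_ne_zero _ ht
    rw [h2, ← h3]
    field_simp
  have h2 : Q * X ^ P.natDegree = X ^ e * P.reverse := by
    apply Polynomial.eq_of_infinite_eval_eq
    refine Set.Infinite.mono (s := {0}ᶜ) (fun t ht => ?_) (Set.finite_singleton (0 : ℂ)).infinite_compl
    simpa using h1 t ht
  by_cases hQ0 : Q = 0
  · simp [hQ0]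
  have h3 := congrArg natDegree h2
  rw [natDegree_mul_X_pow _ hQ0] at h3
  have h4 : (X ^ e * P.reverse).natDegree ≤ e + P.natDegree :=
    natDegree_mul_le.trans (by
      have := reverse_natDegree_le P
      simp; omega)
  omega

end IsPol

/-- The `k`-th coefficient of a polynomial of degree at most `e`, by interpolation at `0, …, e`. -/
def lco (e k : ℕ) (q : ℂ → ℂ) : ℂ :=
  ∑ i ∈ range (e + 1), q i * (Lagrange.basis (range (e + 1)) (fun i : ℕ => (i : ℂ)) i).coeff k

theorem lco_eq {e : ℕ} {Q : ℂ[X]} (hQ : Q.natDegree ≤ e) (k : ℕ) {q : ℂ → ℂ} (hq : ∀ t, q t = Q.eval t) :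
    lco e k q = Q.coeff k := by
  have h := Lagrange.eq_interpolate (s := range (e + 1)) (v := fun i : ℕ => (i : ℂ))
    (f := Q) (fun i _ j _ h => by simpa using h) (by
      rw [Finset.card_range]
      exact lt_of_le_of_lt degree_le_natDegree (by exact_mod_cast Nat.lt_succ_of_le hQ))
  conv_rhs => rw [h]
  simp [Lagrange.interpolate_apply, lco, hq, finsetSum_coeff]

/-- The component of degree `j` in the complement of `v`, of a form of degree `e`. -/
def cmp (e j : ℕ) (v : V) : (V → ℂ) →ₗ[ℂ] (V → ℂ) where
  toFun p z := lco e (e - j) fun s => p (z + s • v)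
  map_add' p q := by funext z; simp [lco, add_mul, sum_add_distrib]
  map_smul' c p := by funext z; simp [lco, mul_sum, mul_assoc]

theorem cmp_apply (e j : ℕ) (v : V) (p : V → ℂ) (z : V) :
    cmp e j v p z = lco e (e - j) fun s => p (z + s • v) := rfl

theorem IsPol.eq_sum_cmp {e : ℕ} {p : V → ℂ} (hp : IsPol e p) (v z : V) (s : ℂ) :
    p (z + s • v) = ∑ j ∈ range (e + 1), s ^ (e - j) * cmp e j v p z := by
  obtain ⟨Q, hQ, hq⟩ := hp.exists_natDegree_le z v
  rw [hq, eval_eq_sum_range' (Nat.lt_succ_of_le hQ), ← Finset.sum_range_reflect]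
  refine sum_congr rfl fun j hj => ?_
  rw [cmp_apply, lco_eq hQ (e - j) hq, mul_comm]
  simp

/-- Uniqueness of coefficients. -/
theorem coeff_unique {e : ℕ} {a b : ℕ → ℂ}
    (h : ∀ s : ℂ, ∑ j ∈ range (e + 1), s ^ (e - j) * a j = ∑ j ∈ range (e + 1), s ^ (e - j) * b j)
    {j : ℕ} (hj : j ≤ e) : a j = b j := by
  have key : ∀ a : ℕ → ℂ, ∀ s : ℂ, ∑ j ∈ range (e + 1), s ^ (e - j) * a j =
      (∑ i ∈ range (e + 1), C (a (e - i)) * X ^ i : ℂ[X]).eval s := by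
    intro a s
    rw [← Finset.sum_range_reflect]
    simp only [eval_finsetSum, eval_mul, eval_C, eval_pow, eval_X]
    refine sum_congr rfl fun j hj => ?_
    rw [mem_range] at hj
    rw [mul_comm, show e + 1 - 1 - j = e - j by omega, show e - (e - j) = j by omega]
  have h2 : (∑ i ∈ range (e + 1), C (a (e - i)) * X ^ i : ℂ[X]) =
      ∑ i ∈ range (e + 1), C (b (e - i)) * X ^ i := by
    apply Polynomial.funext
    intro s
    rw [← key, ← key, h]
  have h3 := congrArg (fun P => P.coeff (e - j)) h2
  simp only [finsetSum_coeff, coeff_C_mul, coeff_X_pow, mul_ite, mul_one, mul_zero, Finset.sum_ite_eq,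
    mem_range] at h3
  rw [if_pos (by omega), if_pos (by omega), show e - (e - j) = j by omega] at h3
  exact h3

theorem cmp_unique {e : ℕ} {p : V → ℂ} (hp : IsPol e p) {v z : V} {b : ℕ → ℂ}
    (h : ∀ s : ℂ, p (z + s • v) = ∑ j ∈ range (e + 1), s ^ (e - j) * b j) {j : ℕ} (hj : j ≤ e) :
    cmp e j v p z = b j :=
  coeff_unique (a := fun j => cmp e j v p z) (fun s => by rw [← hp.eq_sum_cmp, h]) hj

theorem IsPol.cmp {e : ℕ} {p : V → ℂ} (hp : IsPol e p) (v : V) {j : ℕ} (hj : j ≤ e) :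
    IsPol j (HypArr.cmp e j v p) := by
  have h0 : ∀ u w : V, ∃ Q : ℂ[X], ∀ t : ℂ, HypArr.cmp e j v p (u + t • w) = Q.eval t := by
    intro u w
    choose Q hQ using fun i : ℕ => hp.1 (u + (i : ℂ) • v) w
    refine ⟨∑ i ∈ range (e + 1), Q i * C ((Lagrange.basis (range (e + 1))
      (fun i : ℕ => (i : ℂ)) i).coeff (e - j)), fun t => ?_⟩
    simp only [cmp_apply, lco, eval_finsetSum, eval_mul, eval_C]
    refine sum_congr rfl fun i _ => ?_
    rw [← hQ]
    congr 2
    abel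
  have h1 : ∀ t : ℂ, t ≠ 0 → ∀ z, HypArr.cmp e j v p (t • z) = t ^ j * HypArr.cmp e j v p z := by
    intro t ht z
    refine cmp_unique hp (b := fun j => t ^ j * HypArr.cmp e j v p z) (fun s => ?_) hj
    have : t • z + s • v = t • (z + (s / t) • v) := by
      rw [smul_add, smul_smul, mul_div_cancel₀ _ ht]
    rw [this, hp.2, hp.eq_sum_cmp, mul_sum]
    refine sum_congr rfl fun i hi => ?_
    have hi' : i ≤ e := by simpa [lt_succ_iff] using hi
    rw [div_pow]
    have : t ^ e = t ^ (e - i) * t ^ i := by rw [← pow_add]; congr 1; omega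
    rw [this]
    field_simp
  refine ⟨h0, fun t z => ?_⟩
  obtain ⟨Q, hQ⟩ := h0 0 z
  have h2 : Q = X ^ j * C (HypArr.cmp e j v p z) := by
    apply Polynomial.eq_of_infinite_eval_eq
    refine Set.Infinite.mono (s := {0}ᶜ) (fun t ht => ?_) (Set.finite_singleton (0 : ℂ)).infinite_compl
    have := h1 t ht z
    rw [Set.mem_ofPred_eq, ← hQ, zero_add, this]
    simp only [eval_mul, eval_pow, eval_X, eval_C]
  have := hQ t
  rw [zero_add, h2] at this
  simpa only [eval_mul, eval_pow, eval_X, eval_C] using this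

end

section

open Polynomial
variable {V : Type*} [AddCommGroup V] [Module ℂ V]

/-- Homogeneous polynomial functions of degree `e`. -/
def Pol (V : Type*) [AddCommGroup V] [Module ℂ V] (e : ℕ) : Submodule ℂ (V → ℂ) where
  carrier := {p | IsPol e p}
  add_mem' := fun hp hq => IsPol.add hp hq
  zero_mem' := IsPol.zero
  smul_mem' := fun c _ hp => IsPol.const_mul hp c

theorem mem_Pol {e : ℕ} {p : V → ℂ} : p ∈ Pol V e ↔ IsPol e p := Iff.rfl

/-- Functions vanishing to order `k` along `W`. -/
def VanS (W : Submodule ℂ V) (k : ℕ) : Submodule ℂ (V → ℂ) where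
  carrier := {p | ∀ w ∈ W, ∀ u, ∃ Q : ℂ[X], ∀ t : ℂ, p (w + t • u) = t ^ k * Q.eval t}
  add_mem' := by
    intro p q hp hq w hw u
    obtain ⟨P, hP⟩ := hp w hw u
    obtain ⟨Q, hQ⟩ := hq w hw u
    exact ⟨P + Q, fun t => by simp only [Pi.add_apply, hP, hQ, eval_add, mul_add]⟩
  zero_mem' := fun w _ u => ⟨0, by simp⟩
  smul_mem' := by
    intro c p hp w hw u
    obtain ⟨P, hP⟩ := hp w hw u
    exact ⟨C c * P, fun t => by simp only [Pi.smul_apply, hP, smul_eq_mul, eval_mul, eval_C]; ring⟩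

theorem mem_VanS {W : Submodule ℂ V} {k : ℕ} {p : V → ℂ} :
    p ∈ VanS W k ↔ ∀ w ∈ W, ∀ u, ∃ Q : ℂ[X], ∀ t : ℂ, p (w + t • u) = t ^ k * Q.eval t := Iff.rfl

section dec
variable {h : V →ₗ[ℂ] ℂ} {v : V} (hv : h v = 1)

/-- Projection to the kernel of `h` along `v`. -/
def prj (hv : h v = 1) : V →ₗ[ℂ] ker h :=
  LinearMap.codRestrict _ (LinearMap.id - h.smulRight v) (fun y => by simp [hv])

theorem prj_coe (y : V) : (prj hv y : V) = y - h y • v := rfl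

theorem prj_add (z : ker h) (s : ℂ) : prj hv (z + s • v) = z := by
  ext; have := z.2; rw [mem_ker] at this; simp [prj_coe, hv, this]

theorem eq_prj_add (y : V) : y = (prj hv y : V) + h y • v := by simp [prj_coe]

theorem h_add (hv : h v = 1) (z : ker h) (s : ℂ) : h (z + s • v) = s := by
  have := z.2; rw [mem_ker] at this; simp [hv, this]

/-- The form of degree `e` with the given components. -/
def glue (hv : h v = 1) (e : ℕ) (q : ℕ → ker h → ℂ) (y : V) : ℂ :=
  ∑ j ∈ range (e + 1), h y ^ (e - j) * q j (prj hv y)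

theorem IsPol.glue {e : ℕ} {q : ℕ → ker h → ℂ} (hq : ∀ j, j ≤ e → IsPol j (q j)) :
    IsPol e (glue hv e q) := by
  refine IsPol.sum _ fun j hj => ?_
  have hj' : j ≤ e := by simpa [lt_succ_iff] using hj
  have := (IsPol.linear_pow h (e - j)).mul ((hq j hj').comp (prj hv))
  rwa [Nat.sub_add_cancel hj'] at this

theorem IsPol.eq_glue {e : ℕ} {p : V → ℂ} (hp : IsPol e p) :
    p = HypArr.glue hv e fun j z => HypArr.cmp e j v p z := by
  funext y
  conv_lhs => rw [eq_prj_add hv y]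
  exact hp.eq_sum_cmp v _ _

theorem cmp_glue {e : ℕ} {q : ℕ → ker h → ℂ} (hq : ∀ j, j ≤ e → IsPol j (q j)) {j : ℕ}
    (hj : j ≤ e) (z : ker h) : cmp e j v (glue hv e q) z = q j z :=
  cmp_unique (b := fun j => q j z) (z := (z : V)) (v := v) (IsPol.glue hv hq) (fun s => by simp only [glue, h_add hv, prj_add]) hj

/-- The restricted components. -/
def rcmp (h : V →ₗ[ℂ] ℂ) (v : V) (e j : ℕ) : (V → ℂ) →ₗ[ℂ] (ker h → ℂ) where
  toFun p z := cmp e j v p z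
  map_add' p q := by funext z; simp
  map_smul' c p := by funext z; simp

theorem rcmp_apply (e j : ℕ) (p : V → ℂ) (z : ker h) : rcmp h v e j p z = cmp e j v p z := rfl

theorem IsPol.rcmp {e j : ℕ} {p : V → ℂ} (hp : IsPol e p) (hj : j ≤ e) : IsPol j (rcmp h v e j p) :=
  (hp.cmp v hj).comp (ker h).subtype

theorem IsPol.eq_glue' {e : ℕ} {p : V → ℂ} (hp : IsPol e p) :
    p = HypArr.glue hv e fun j => HypArr.rcmp h v e j p := hp.eq_glue hv

theorem rcmp_glue {e : ℕ} {q : ℕ → ker h → ℂ} (hq : ∀ j, j ≤ e → IsPol j (q j)) {j : ℕ}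
    (hj : j ≤ e) : rcmp h v e j (glue hv e q) = q j := funext fun z => cmp_glue hv hq hj z

/-- Forms with components in prescribed spaces. -/
def DS (h : V →ₗ[ℂ] ℂ) (v : V) (e : ℕ) (D : ℕ → Submodule ℂ (ker h → ℂ)) :
    Submodule ℂ (V → ℂ) :=
  Pol V e ⊓ ⨅ j : Fin (e + 1), (D j).comap (rcmp h v e j)

theorem mem_DS {e : ℕ} {D : ℕ → Submodule ℂ (ker h → ℂ)} {p : V → ℂ} :
    p ∈ DS h v e D ↔ IsPol e p ∧ ∀ j, j ≤ e → rcmp h v e j p ∈ D j := by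
  simp only [DS, Submodule.mem_inf, mem_Pol, mem_iInf, Submodule.mem_comap]
  refine and_congr_right fun _ => ⟨fun H j hj => H ⟨j, Nat.lt_succ_of_le hj⟩, fun H j => H j (lt_succ_iff.1 j.2)⟩

/-- Decomposition into components. -/
def DSmap (h : V →ₗ[ℂ] ℂ) (v : V) (e : ℕ) (D : ℕ → Submodule ℂ (ker h → ℂ)) :
    DS h v e D →ₗ[ℂ] (∀ j : Fin (e + 1), D j) where
  toFun p j := ⟨rcmp h v e j p, (mem_DS.1 p.2).2 j (lt_succ_iff.1 j.2)⟩
  map_add' p q := by ext; simp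
  map_smul' c p := by ext; simp

include hv in
theorem DSmap_bijective {e : ℕ} {D : ℕ → Submodule ℂ (ker h → ℂ)}
    (hD : ∀ j, j ≤ e → D j ≤ Pol _ j) : Function.Bijective (DSmap h v e D) := by
  constructor
  · intro p q hpq
    ext1
    rw [(mem_DS.1 p.2).1.eq_glue' hv, (mem_DS.1 q.2).1.eq_glue' hv]
    funext y
    refine sum_congr rfl fun j hj => ?_
    have := congrArg Subtype.val (congrFun hpq ⟨j, mem_range.1 hj⟩)
    have h2 : rcmp h v e j p = rcmp h v e j q := this
    simp only [h2]
  · intro q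
    let q' : ℕ → ker h → ℂ := fun j => if hj : j < e + 1 then q ⟨j, hj⟩ else 0
    have hq' : ∀ j, j ≤ e → IsPol j (q' j) := by
      intro j hj
      simp only [q', dif_pos (Nat.lt_succ_of_le hj)]
      exact hD j hj (q ⟨j, Nat.lt_succ_of_le hj⟩).2
    refine ⟨⟨glue hv e q', mem_DS.2 ⟨IsPol.glue hv hq', fun j hj => ?_⟩⟩, ?_⟩
    · rw [rcmp_glue hv hq' hj]
      simp only [q', dif_pos (Nat.lt_succ_of_le hj)]
      exact (q ⟨j, Nat.lt_succ_of_le hj⟩).2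
    · funext j
      ext1
      change rcmp h v e j (glue hv e q') = _
      rw [rcmp_glue hv hq' (lt_succ_iff.1 j.2)]
      simp only [q', dif_pos j.2]

include hv in
theorem finite_DS {e : ℕ} {D : ℕ → Submodule ℂ (ker h → ℂ)}
    (hD : ∀ j, j ≤ e → D j ≤ Pol _ j) (hf : ∀ j, j ≤ e → Module.Finite ℂ (D j)) :
    Module.Finite ℂ (DS h v e D) := by
  have : ∀ j : Fin (e + 1), Module.Finite ℂ (D j) := fun j => hf j (lt_succ_iff.1 j.2)
  exact Module.Finite.equiv (LinearEquiv.ofBijective _ (DSmap_bijective hv hD)).symm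

include hv in
theorem finrank_DS {e : ℕ} {D : ℕ → Submodule ℂ (ker h → ℂ)}
    (hD : ∀ j, j ≤ e → D j ≤ Pol _ j) (hf : ∀ j, j ≤ e → Module.Finite ℂ (D j)) :
    finrank ℂ (DS h v e D) = ∑ j ∈ range (e + 1), finrank ℂ (D j) := by
  have : ∀ j : Fin (e + 1), Module.Finite ℂ (D j) := fun j => hf j (lt_succ_iff.1 j.2)
  rw [(LinearEquiv.ofBijective _ (DSmap_bijective hv hD)).finrank_eq, Module.finrank_pi_fintype,
    Finset.sum_range]

theorem Pol_eq_DS (e : ℕ) : Pol V e = DS h v e (fun j => Pol _ j) := by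
  ext p
  rw [mem_DS, mem_Pol]
  exact ⟨fun hp => ⟨hp, fun j hj => hp.rcmp hj⟩, fun H => H.1⟩

include hv in
/-- Vanishing along a subspace containing `v`. -/
theorem mem_VanS_iff {W : Submodule ℂ V} (hvW : v ∈ W) {k e : ℕ} {p : V → ℂ} (hp : IsPol e p) :
    p ∈ VanS W k ↔ ∀ j, j ≤ e → rcmp h v e j p ∈ VanS (W.comap (ker h).subtype) k := by
  constructor
  · intro H j hj w hw u
    choose Q hQ using fun i : ℕ => H (w + (i : ℂ) • v) (W.add_mem hw (W.smul_mem _ hvW)) u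
    refine ⟨∑ i ∈ range (e + 1), Q i * C ((Lagrange.basis (range (e + 1))
      (fun i : ℕ => (i : ℂ)) i).coeff (e - j)), fun t => ?_⟩
    simp only [rcmp_apply, cmp_apply, lco, eval_finsetSum, eval_mul, eval_C, mul_sum]
    refine sum_congr rfl fun i _ => ?_
    rw [← mul_assoc, ← hQ]
    congr 2
    push_cast
    abel
  · intro H w hw u
    have hw' : (prj hv w : V) ∈ W := by
      rw [prj_coe]; exact W.sub_mem hw (W.smul_mem _ hvW)
    choose! Q hQ using fun j hj => H j hj (prj hv w) hw' (prj hv u)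
    refine ⟨∑ j ∈ range (e + 1), (C (h w) + X * C (h u)) ^ (e - j) * Q j, fun t => ?_⟩
    rw [hp.eq_glue' hv]
    simp only [glue, eval_finsetSum, mul_sum]
    refine sum_congr rfl fun j hj => ?_
    have hj' : j ≤ e := by simpa [lt_succ_iff] using hj
    rw [map_add, map_smul, map_add, map_smul, hQ j hj']
    simp
    ring

include hv in
/-- Vanishing along the line spanned by `v`. -/
theorem mem_VanS_span_iff {k e : ℕ} {p : V → ℂ} (hp : IsPol e p) :
    p ∈ VanS (span ℂ {v}) k ↔ ∀ j, j ≤ e → j < k → rcmp h v e j p = 0 := by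
  rw [mem_VanS_iff hv (mem_span_singleton_self v) hp]
  have hb : (span ℂ {v}).comap (ker h).subtype = ⊥ := by
    rw [eq_bot_iff]
    rintro ⟨z, hz⟩ hz2
    obtain ⟨c, hc⟩ := Submodule.mem_span_singleton.1 (Submodule.mem_comap.1 hz2)
    rw [mem_ker] at hz
    simp only [Submodule.subtype_apply] at hc
    rw [← hc, map_smul, hv, smul_eq_mul, mul_one] at hz
    rw [mem_bot]
    ext
    simp [← hc, hz]
  rw [hb]
  refine forall_congr' fun j => forall_congr' fun hj => ?_
  have hq := hp.rcmp (h := h) (v := v) hj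
  constructor
  · intro H hjk
    funext z
    obtain ⟨Q, hQ⟩ := H 0 (Submodule.zero_mem _) z
    have h2 : X ^ j * C (rcmp h v e j p z) = X ^ k * Q := by
      apply Polynomial.funext
      intro t
      have := hQ t
      rw [zero_add, hq.2] at this
      simpa only [eval_mul, eval_pow, eval_X, eval_C] using this
    have h3 := congrArg (fun P => P.coeff j) h2
    simp only [coeff_X_pow_mul', if_neg (not_le.2 hjk)] at h3
    simpa using h3
  · intro H w hw u
    rw [mem_bot] at hw
    subst hw
    by_cases hjk : j < k
    · exact ⟨0, by simp [H hjk]⟩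
    · refine ⟨X ^ (j - k) * C (rcmp h v e j p u), fun t => ?_⟩
      rw [zero_add, hq.2]
      simp only [eval_mul, eval_pow, eval_X, eval_C, ← mul_assoc, ← pow_add]
      congr 2
      omega

end dec

theorem exists_dual_eq_one {v : V} (hv : v ≠ 0) : ∃ h : V →ₗ[ℂ] ℂ, h v = 1 := by
  obtain ⟨f, hf⟩ : ∃ f : Module.Dual ℂ V, f v ≠ 0 := by
    by_contra! H
    exact hv ((Module.forall_dual_apply_eq_zero_iff ℂ v).1 H)
  exact ⟨(f v)⁻¹ • f, by simp [hf]⟩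

theorem finrank_ker_of_eq_one [Module.Finite ℂ V] {h : V →ₗ[ℂ] ℂ} {v : V} (hv : h v = 1) :
    finrank ℂ (ker h) + 1 = finrank ℂ V := by
  have h1 := h.finrank_range_add_finrank_ker
  have h2 : LinearMap.range h = ⊤ := LinearMap.range_eq_top.2 fun c => ⟨c • v, by simp [hv]⟩
  rw [h2, finrank_top, Module.finrank_self] at h1
  omega

theorem finite_Pol (V : Type*) [AddCommGroup V] [Module ℂ V] [Module.Finite ℂ V] (e : ℕ) :
    Module.Finite ℂ (Pol V e) := by
  induction hm : finrank ℂ V generalizing V e with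
  | zero =>
    have := Module.finrank_zero_iff.1 hm
    have : Module.Finite ℂ (V → ℂ) := inferInstance
    infer_instance
  | succ m ih =>
    have : Nontrivial V := Module.nontrivial_of_finrank_pos (R := ℂ) (by omega)
    obtain ⟨v, hv⟩ := exists_ne (0 : V)
    obtain ⟨h, hh⟩ := exists_dual_eq_one hv
    have h1 := finrank_ker_of_eq_one hh
    rw [Pol_eq_DS (h := h) (v := v)]
    exact finite_DS hh (fun _ _ => le_rfl) fun j _ => ih _ j (by omega)

/-- Dimension of the space of forms. -/
theorem finrank_Pol (V : Type*) [AddCommGroup V] [Module ℂ V] [Module.Finite ℂ V] {m : ℕ}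
    (hm : finrank ℂ V = m + 1) (e : ℕ) : finrank ℂ (Pol V e) = (e + m).choose m := by
  induction m generalizing V e with
  | zero =>
    have : Nontrivial V := Module.nontrivial_of_finrank_pos (R := ℂ) (by omega)
    obtain ⟨v, hv⟩ := exists_ne (0 : V)
    obtain ⟨h, hh⟩ := exists_dual_eq_one hv
    rw [add_zero, Nat.choose_zero_right]
    have hy : ∀ y, h y • v = y := by
      intro y
      obtain ⟨c, hc⟩ := (finrank_eq_one_iff_of_nonzero' v hv).1 hm y
      rw [← hc, map_smul, hh, smul_eq_mul, mul_one]
    refine (finrank_eq_one_iff_of_nonzero' (⟨fun y => h y ^ e, IsPol.linear_pow h e⟩ : Pol V e) fun H => ?_).2 ?_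
    · have := congrFun (congrArg Subtype.val H) v
      simp [hh] at this
    · rintro ⟨p, hp⟩
      refine ⟨p v, ?_⟩
      ext y
      have := hp.2 (h y) v
      rw [hy] at this
      rw [Submodule.coe_smul, Pi.smul_apply, smul_eq_mul, mul_comm]
      exact this.symm
  | succ m ih =>
    have : Nontrivial V := Module.nontrivial_of_finrank_pos (R := ℂ) (by omega)
    obtain ⟨v, hv⟩ := exists_ne (0 : V)
    obtain ⟨h, hh⟩ := exists_dual_eq_one hv
    have h1 := finrank_ker_of_eq_one hh
    rw [Pol_eq_DS (h := h) (v := v), finrank_DS hh (fun _ _ => le_rfl) fun j _ => finite_Pol _ j,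
      sum_congr rfl fun j _ => ih (ker h) (by omega) j]
    rw [show e + (m + 1) = e + m + 1 by ring, ← Nat.sum_range_add_choose e m]

end

theorem IsPol.contDiff {V : Type*} [NormedAddCommGroup V] [NormedSpace ℂ V] [FiniteDimensional ℂ V]
    {e : ℕ} {p : V → ℂ} (hp : IsPol e p) : ContDiff ℂ ∞ p := by
  induction hm : finrank ℂ V generalizing V e with
  | zero =>
    have := Module.finrank_zero_iff.1 hm
    have : p = fun _ => p 0 := by funext y; rw [Subsingleton.elim y 0]
    rw [this]
    exact contDiff_const
  | succ m ih =>
    have : Nontrivial V := Module.nontrivial_of_finrank_pos (R := ℂ) (by omega)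
    obtain ⟨v, hv⟩ := exists_ne (0 : V)
    obtain ⟨h, hh⟩ := exists_dual_eq_one hv
    have h1 := finrank_ker_of_eq_one hh
    rw [hp.eq_glue' hh]
    show ContDiff ℂ ∞ fun y => ∑ j ∈ range (e + 1), h y ^ (e - j) * HypArr.rcmp h v e j p (prj hh y)
    refine ContDiff.sum fun j hj => ?_
    have hj' : j ≤ e := by simpa [lt_succ_iff] using hj
    have h2 : ContDiff ℂ ∞ h := (toContinuousLinearMap h).contDiff
    have h3 : ContDiff ℂ ∞ (prj hh) := (toContinuousLinearMap (prj hh)).contDiff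
    exact (h2.pow _).mul ((ih (hp.rcmp hj') (by omega)).comp h3)

theorem fderiv_eq_sum {F : E n → ℂ} {x : E n} (hb : ∀ j, db j F x = 0) (v : E n) :
    fderiv ℝ F x v = ∑ j, v j * dz j F x := by
  have hv : v = ∑ j, ((v j).re • (single j 1 : E n) + (v j).im • (single j I : E n)) := by
    funext k
    simp only [Finset.sum_apply, Pi.add_apply, Pi.smul_apply, Pi.single_apply]
    rw [Finset.sum_eq_single k (fun j _ hj => by simp [Ne.symm hj]) (by simp)]
    simp [Complex.re_add_im]
  conv_lhs => rw [hv]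
  rw [map_sum]
  refine sum_congr rfl fun j _ => ?_
  have h := hb j
  simp only [dd] at h ⊢
  rw [map_add, map_smul, map_smul]
  have h2 : fderiv ℝ F x (single j I) = I * fderiv ℝ F x (single j 1) := by
    have hI := Complex.I_mul_I
    linear_combination (-2 * I) * h + (fderiv ℝ F x (single j I)) * hI
  rw [h2]
  simp only [Complex.real_smul]
  conv_rhs => rw [← Complex.re_add_im (v j)]
  have hI := Complex.I_mul_I
  linear_combination ((1/2) * (((v j).re : ℂ) + (v j).im * I) * fderiv ℝ F x (single j 1)) * hI

theorem hasDerivAt_line {F : E n → ℂ} (hF : ContDiff ℝ ∞ F) (hb : ∀ j x, db j F x = 0) (y : E n) (t : ℂ) :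
    HasDerivAt (fun t : ℂ => F (t • y)) (∑ j, y j * dz j F (t • y)) t := by
  have h1 : HasFDerivAt F (fderiv ℝ F (t • y)) (t • y) := (diffAt hF _).hasFDerivAt
  have h2 : HasFDerivAt (fun t : ℂ => t • y)
      ((toSpanSingleton ℂ y).restrictScalars ℝ) t :=
    ((toSpanSingleton ℂ y).hasFDerivAt (x := t)).restrictScalars ℝ
  have h3 := h1.comp t h2
  rw [hasDerivAt_iff_hasFDerivAt]
  refine hasFDerivAt_of_restrictScalars ℝ h3 ?_
  ext s
  simp only [ContinuousLinearMap.coe_restrictScalars', ContinuousLinearMap.toSpanSingleton_apply,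
    ContinuousLinearMap.comp_apply]
  rw [fderiv_eq_sum (fun j => hb j _)]
  simp only [Pi.smul_apply, smul_eq_mul, mul_sum, mul_assoc]

/-- The unnormalised degree `e` part of the Taylor expansion at the origin. -/
def tay : ℕ → (E n → ℂ) → E n → ℂ
  | 0, F, _ => F 0
  | e + 1, F, y => ∑ j, y j * tay e (dz j F) y

theorem isPol_tay (e : ℕ) (F : E n → ℂ) : IsPol e (tay e F) := by
  induction e generalizing F with
  | zero => exact IsPol.const _
  | succ e ih =>
    refine IsPol.sum _ fun j _ => ?_
    have := (IsPol.linear (LinearMap.proj (R := ℂ) (φ := fun _ : Fin n => ℂ) j)).mul (ih (dz j F))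
    rwa [add_comm] at this

theorem iteratedDeriv_line {F : E n → ℂ} (hF : ContDiff ℝ ∞ F) (hb : ∀ j x, db j F x = 0) (e : ℕ) (y : E n) :
    iteratedDeriv e (fun t : ℂ => F (t • y)) 0 = tay e F y := by
  induction e generalizing F with
  | zero => simp [tay]
  | succ e ih =>
    have hd : ∀ j, ContDiff ℝ ∞ (dz j F) := fun j => contDiff_dd hF
    have hdb : ∀ j k x, db k (dz j F) x = 0 := by
      intro j k x
      rw [dd_comm hF]
      have : db k F = fun _ => 0 := by funext x; exact hb k x
      rw [this, dd_const]
    rw [iteratedDeriv_succ']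
    have : deriv (fun t : ℂ => F (t • y)) = fun t => ∑ j, y j * dz j F (t • y) :=
      funext fun t => (hasDerivAt_line hF hb y t).deriv
    have hdiff : ∀ j, Differentiable ℂ fun t : ℂ => dz j F (t • y) := fun j t =>
      (hasDerivAt_line (hd j) (hdb j) y t).differentiableAt
    rw [this, iteratedDeriv_fun_sum fun j _ => ((hdiff j).const_mul _).contDiff.contDiffAt]
    refine sum_congr rfl fun j _ => ?_
    rw [iteratedDeriv_const_mul_field, ih (hd j) (hdb j)]

theorem integral_circle {φ : ℂ → ℂ} (hφ : Differentiable ℂ φ) (e : ℕ) :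
    ∫ θ in (0 : ℝ)..2 * pi, Complex.exp (θ * I) ^ (-(e : ℤ)) * φ (Complex.exp (θ * I))
      = 2 * pi * (iteratedDeriv e φ 0 / e.factorial) := by
  have h := DiffContOnCl.circleIntegral_one_div_sub_center_pow_smul (c := 0) one_pos e
    (hφ.diffContOnCl (s := ball 0 1))
  rw [circleIntegral] at h
  simp only [deriv_circleMap, circleMap, Complex.ofReal_one, one_mul, zero_add, sub_zero, smul_eq_mul] at h
  have hI := Complex.I_ne_zero
  have h2 : ∀ θ : ℝ, Complex.exp (θ * I) ^ (-(e : ℤ)) * φ (Complex.exp (θ * I)) =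
    (I)⁻¹ * (Complex.exp (↑θ * I) * I *
      (1 / Complex.exp (↑θ * I) ^ (e + 1) * φ (Complex.exp (↑θ * I)))) := by
    intro θ
    have := exp_ne_zero (θ * I)
    rw [zpow_neg, zpow_natCast, pow_succ]
    field_simp
  simp_rw [h2]
  rw [intervalIntegral.integral_const_mul, h]
  field_simp

/-- Jensen's inequality for a Taylor coefficient. -/
theorem sq_norm_coeff_le {φ : ℂ → ℂ} (hφ : Differentiable ℂ φ) (e : ℕ) (c : ℂ) :
    ‖c - iteratedDeriv e φ 0 / e.factorial‖ ^ 2 * (2 * pi) ≤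
      ∫ θ in (0 : ℝ)..2 * pi,
        ‖Complex.exp (θ * I) ^ e * c - φ (Complex.exp (θ * I))‖ ^ 2 := by
  have hpi := Real.pi_pos
  have he : Continuous fun θ : ℝ => Complex.exp (θ * I) := by fun_prop
  have hez : Continuous fun θ : ℝ => Complex.exp (θ * I) ^ (-(e : ℤ)) :=
    he.zpow₀ _ fun θ => Or.inl (exp_ne_zero _)
  set ψ : ℝ → ℂ := fun θ => c - Complex.exp (θ * I) ^ (-(e : ℤ)) * φ (Complex.exp (θ * I))
  have hψ : Continuous ψ := continuous_const.sub (hez.mul (hφ.continuous.comp he))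
  have h1 : ∀ θ : ℝ, ‖Complex.exp (θ * I) ^ e * c - φ (Complex.exp (θ * I))‖ = ‖ψ θ‖ := by
    intro θ
    have h0 := exp_ne_zero (θ * I)
    have : Complex.exp (θ * I) ^ e * c - φ (Complex.exp (θ * I)) =
      Complex.exp (θ * I) ^ e * ψ θ := by
      simp only [ψ, zpow_neg, zpow_natCast]
      field_simp
    rw [this, norm_mul, norm_pow, norm_exp_ofReal_mul_I, one_pow, one_mul]
  simp_rw [h1]
  have hint : ∫ θ in (0 : ℝ)..2 * pi, ψ θ = 2 * pi * (c - iteratedDeriv e φ 0 / e.factorial) := by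
    have h3 : IntervalIntegrable (fun θ : ℝ => Complex.exp (θ * I) ^ (-(e : ℤ)) *
        φ (Complex.exp (θ * I))) volume 0 (2 * pi) :=
      (hez.mul (hφ.continuous.comp he)).intervalIntegrable _ _
    simp only [ψ]
    rw [intervalIntegral.integral_sub intervalIntegrable_const h3, integral_circle hφ,
      intervalIntegral.integral_const, Complex.real_smul]
    push_cast
    ring
  have hc : ConvexOn ℝ Set.univ fun z : ℂ => ‖z‖ ^ 2 :=
    (convexOn_norm convex_univ).pow (fun _ _ => norm_nonneg _) 2
  have hfin : IsFiniteMeasure (volume.restrict (Ioc 0 (2 * pi))) := inferInstance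
  have h0 : NeZero (volume.restrict (Ioc 0 (2 * pi))) := ⟨by
    rw [Ne, Measure.restrict_eq_zero, Real.volume_Ioc]; simp [hpi]⟩
  have h2 := hc.map_average_le (μ := volume.restrict (Ioc 0 (2 * pi))) (f := ψ)
    (by fun_prop) isClosed_univ (by simp) ((hψ.intervalIntegrable 0 (2 * pi)).1)
    (((hψ.norm.pow 2).intervalIntegrable 0 (2 * pi)).1)
  rw [average_eq, average_eq, ← intervalIntegral.integral_of_le (by positivity),
    ← intervalIntegral.integral_of_le (by positivity), hint] at h2
  have hm : (volume.restrict (Ioc 0 (2 * pi))).real Set.univ = 2 * pi := by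
    rw [measureReal_def]
    simp [hpi.le]
  rw [hm] at h2
  have h3 : (2 * pi)⁻¹ • (2 * (pi : ℂ) * (c - iteratedDeriv e φ 0 / e.factorial)) =
      c - iteratedDeriv e φ 0 / e.factorial := by
    rw [Complex.real_smul]
    have : (pi : ℂ) ≠ 0 := by exact_mod_cast hpi.ne'
    push_cast
    field_simp
  rw [h3, smul_eq_mul, inv_mul_eq_div, le_div_iff₀ (by positivity)] at h2
  exact h2

theorem measurePreserving_smul {c : ℂ} (hc : ‖c‖ = 1) :
    MeasurePreserving (fun y : E n => c • y) volume volume := by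
  have h1 : MeasurePreserving (fun z : ℂ => c * z) volume volume :=
    (rotation ⟨c, by simp [Submonoid.unitSphere, hc]⟩ : ℂ ≃ₗᵢ[ℝ] ℂ).measurePreserving
  exact volume_preserving_pi fun _ => h1

theorem setLIntegral_rotate {c : ℂ} (hc : ‖c‖ = 1) (F : E n → ℝ≥0∞) (R : ℝ) :
    ∫⁻ y in ball 0 R, F (c • y) = ∫⁻ y in ball 0 R, F y := by
  have h0 : c ≠ 0 := by rintro rfl; simp at hc
  have hme : MeasurableEmbedding fun y : E n => c • y :=
    (Homeomorph.smulOfNeZero c h0).measurableEmbedding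
  have := (measurePreserving_smul (n := n) hc).setLIntegral_comp_preimage_emb hme F (ball 0 R)
  rw [← this]
  congr 2
  ext y
  simp [norm_smul, hc]

/-- Projection to homogeneous components does not increase rotation invariant weighted norms. -/
theorem lintegral_tay_le {u F : E n → ℂ} (hum : AEStronglyMeasurable u) {e : ℕ}
    (hue : ∀ t : ℂ, t ≠ 0 → ∀ y, u (t • y) = t ^ e * u y) (hF : ContDiff ℝ ∞ F)
    (hb : ∀ j x, db j F x = 0) {w : E n → ℝ≥0∞} (hw : AEMeasurable w)
    (hwi : ∀ c : ℂ, ‖c‖ = 1 → ∀ y, w (c • y) = w y) (R : ℝ) :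
    ∫⁻ y in ball 0 R, ofReal (‖u y - tay e F y / e.factorial‖ ^ 2) * w y ≤
      ∫⁻ y in ball 0 R, ofReal (‖u y - F y‖ ^ 2) * w y := by
  have hpi := Real.pi_pos
  set T := Ioc 0 (2 * pi)
  set μ := (volume : Measure (E n)).restrict (ball 0 R)
  have hFc := hF.continuous
  have hp : ∀ y, ofReal (‖u y - tay e F y / e.factorial‖ ^ 2) * w y * ofReal (2 * pi) ≤
      ∫⁻ θ in T, ofReal (‖Complex.exp ((θ : ℝ) * I) ^ e * u y -
        F (Complex.exp (θ * I) • y)‖ ^ 2) * w y := by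
    intro y
    have hφ : Differentiable ℂ fun t : ℂ => F (t • y) := fun t =>
      (hasDerivAt_line hF hb y t).differentiableAt
    have h1 := sq_norm_coeff_le hφ e (u y)
    rw [iteratedDeriv_line hF hb] at h1
    have hc : Continuous fun θ : ℝ => ‖Complex.exp (θ * I) ^ e * u y -
        F (Complex.exp (θ * I) • y)‖ ^ 2 := by fun_prop
    rw [lintegral_mul_const _ hc.measurable.ennreal_ofReal]
    rw [mul_right_comm, ← ENNReal.ofReal_mul (by positivity)]
    gcongr
    rw [← ofReal_integral_eq_lintegral_ofReal (hc.intervalIntegrable 0 (2 * pi)).1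
      (Eventually.of_forall fun _ => by positivity),
      ← intervalIntegral.integral_of_le (by positivity)]
    exact ofReal_le_ofReal h1
  have hT : volume T = ofReal (2 * pi) := by simp [T]
  have h0 : ofReal (2 * pi) ≠ 0 := by simp [hpi]
  rw [← ENNReal.mul_le_mul_iff_left h0 ofReal_ne_top,
    ← lintegral_mul_const' _ _ ofReal_ne_top]
  refine (lintegral_mono hp).trans ?_
  have hsw := lintegral_lintegral_swap (μ := μ) (ν := (volume : Measure ℝ).restrict T)
    (f := fun y θ => ofReal (‖Complex.exp ((θ : ℝ) * I) ^ e * u y -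
        F (Complex.exp (θ * I) • y)‖ ^ 2) * w y) (by
      have h1 : AEStronglyMeasurable (fun q : E n × ℝ => u q.1) (μ.prod (volume.restrict T)) :=
        hum.restrict.comp_fst
      have h2 : AEMeasurable (fun q : E n × ℝ => w q.1) (μ.prod (volume.restrict T)) :=
        hw.restrict.comp_fst
      have h3 : Continuous fun q : E n × ℝ => Complex.exp (q.2 * I) ^ e := by fun_prop
      have h4 : Continuous fun q : E n × ℝ => F (Complex.exp (q.2 * I) • q.1) := by fun_prop
      exact (((h3.aestronglyMeasurable.mul h1).sub h4.aestronglyMeasurable).norm.pow 2).aemeasurable.ennreal_ofReal.mul h2)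
  rw [hsw]
  have h5 : ∀ θ : ℝ, ∫⁻ y, ofReal (‖Complex.exp ((θ : ℝ) * I) ^ e * u y -
        F (Complex.exp (θ * I) • y)‖ ^ 2) * w y ∂μ =
      ∫⁻ y in ball 0 R, ofReal (‖u y - F y‖ ^ 2) * w y := by
    intro θ
    have hn : ‖Complex.exp (θ * I)‖ = 1 := norm_exp_ofReal_mul_I θ
    rw [← setLIntegral_rotate hn fun y => ofReal (‖u y - F y‖ ^ 2) * w y]
    refine lintegral_congr fun y => ?_
    rw [hwi _ hn, hue _ (exp_ne_zero _)]
  simp_rw [h5]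
  rw [lintegral_const, Measure.restrict_apply_univ, hT]

/-- Local mollification of a weakly holomorphic function. -/
theorem exists_holo_approx {G : E n → ℂ} (hG : LocallyIntegrable G)
    (hGb : ∀ b, IsTest b → ∀ j, ∫ y, db j b y * G y = 0) {R : ℝ}
    (hL : MemLp ((ball 0 (R + 1)).indicator G) 2) {κ : ℝ} (hκ : 0 < κ) :
    ∃ F : E n → ℂ, ContDiff ℝ ∞ F ∧ (∀ j x, db j F x = 0) ∧
      eLpNorm (fun y => F y - G y) 2 (volume.restrict (ball 0 R)) ≤ ofReal κ := by
  obtain ⟨K, hK, ε₀, hε, H⟩ := exists_moll_L2 hL hκ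
  obtain ⟨χ, hχ, hχ1, hχK, -⟩ := exists_cutoff (n := n) one_pos
    (hK.union (isCompact_closedBall (0 : E n) (R + 1)))
  obtain ⟨ρ, hρ⟩ := Moll.exists (n := n) (lt_min hε one_pos)
  have h1 := H χ hχ hχ1 (fun z hz => hχK z (Or.inl hz)) ρ (hρ.mono (min_le_left _ _))
  refine ⟨cv G fun z => (ρ z : ℂ), contDiff_cv hG hρ.isTest, fun j x => ?_, ?_⟩
  · rw [dd_cv hG hρ.isTest]
    have h2 := hGb (fun z => (ρ (x - z) : ℂ)) ⟨hρ.isTest.1.comp (contDiff_const.sub contDiff_id),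
      (hρ.isTest.2.comp_homeomorph (Homeomorph.subLeft x))⟩ j
    rw [cv]
    have h3 : ∀ z, db j (fun z => (ρ (x - z) : ℂ)) z = - db j (fun z => (ρ z : ℂ)) (x - z) :=
      fun z => dd_reflect (ρ := fun z => (ρ z : ℂ)) x z
    simp_rw [h3] at h2
    rw [← neg_eq_zero, ← integral_neg, ← h2]
    congr 1
    funext z
    ring
  · refine le_trans (le_of_eq (eLpNorm_congr_ae ?_)) ((eLpNorm_restrict_le _ _ _ _).trans h1)
    refine (ae_restrict_iff' measurableSet_ball).2 (Eventually.of_forall fun y hy => ?_)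
    have hy' : ‖y‖ < R := by simpa using hy
    have hyR : y ∈ ball (0 : E n) (R + 1) := by simp; linarith
    simp only [Set.indicator_of_mem hyR]
    congr 1
    simp only [cv]
    refine integral_congr_ae (Eventually.of_forall fun z => ?_)
    by_cases hz : ρ (y - z) = 0
    · simp [hz]
    · have h4 := (hρ.supp _ hz).trans_le (min_le_right _ _)
      have h5 : ‖z‖ < R + 1 := by
        have := norm_sub_norm_le z y
        rw [norm_sub_rev] at this
        linarith
      have h6 : z ∈ ball (0 : E n) (R + 1) := by simpa using h5
      have h7 : χ z = 1 := hχK z (Or.inr (Metric.ball_subset_closedBall h6))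
      simp only [Set.indicator_of_mem h6, h7, one_mul]

theorem exists_bound_homog {u : E n → ℂ} (hu : ∀ y, y ≠ 0 → ContinuousAt u y) {e : ℕ}
    (hue : ∀ t : ℂ, t ≠ 0 → ∀ y, u (t • y) = t ^ e * u y) (R : ℝ) :
    ∃ C, 0 ≤ C ∧ ∀ y, ‖y‖ ≤ R → ‖u y‖ ≤ C := by
  have hc : ContinuousOn u (Metric.sphere 0 1) := fun y hy =>
    (hu y (by rintro rfl; simp at hy)).continuousWithinAt
  obtain ⟨C, hC⟩ := (isCompact_sphere (0 : E n) 1).exists_bound_of_continuousOn hc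
  refine ⟨‖u 0‖ + |R| ^ e * |C|, by positivity, fun y hy => ?_⟩
  by_cases h0 : y = 0
  · subst h0
    exact le_add_of_nonneg_right (by positivity)
  · have hn : 0 < ‖y‖ := norm_pos_iff.2 h0
    have hn' : (‖y‖ : ℂ) ≠ 0 := by exact_mod_cast hn.ne'
    have h1 := hue _ hn' ((‖y‖ : ℂ)⁻¹ • y)
    rw [smul_inv_smul₀ hn'] at h1
    have h2 := hC ((‖y‖ : ℂ)⁻¹ • y) (by simp [norm_smul, hn.ne'])
    rw [h1, norm_mul, norm_pow, norm_real, norm_norm]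
    refine le_trans ?_ (le_add_of_nonneg_left (norm_nonneg _))
    exact mul_le_mul (pow_le_pow_left₀ hn.le (hy.trans (le_abs_self _)) _) (h2.trans (le_abs_self _))
      (norm_nonneg _) (by positivity)

theorem db_eq_zero {f : E n → ℂ} {y : E n} (hf : DifferentiableAt ℂ f y) (j : Fin n) : db j f y = 0 := by
  have h := hf.fderiv_restrictScalars ℝ
  have h2 : (single j I : E n) = I • single j 1 := by
    rw [← Pi.single_smul]; simp
  simp only [dd, h, ContinuousLinearMap.coe_restrictScalars', h2, map_smul, smul_eq_mul]
  rw [← mul_assoc, Complex.I_mul_I]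
  ring

theorem IsPol.contDiff_real {e : ℕ} {p : E n → ℂ} (hp : IsPol e p) : ContDiff ℝ ∞ p :=
  hp.contDiff.restrict_scalars ℝ

theorem IsPol.db {e : ℕ} {p : E n → ℂ} (hp : IsPol e p) (j : Fin n) (y : E n) : db j p y = 0 :=
  db_eq_zero ((hp.contDiff.differentiable (by simp)) y) j

theorem IsPol.eq_zero_of_ball {e : ℕ} {p : E n → ℂ} (hp : IsPol e p)
    (h : ∀ᵐ y ∂(volume.restrict (ball (0 : E n) 1)), p y = 0) : p = 0 := by
  have hc : Continuous p := hp.contDiff.continuous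
  have h2 : Set.EqOn p (fun _ => 0) (ball (0 : E n) 1) :=
    Measure.eqOn_open_of_ae_eq h Metric.isOpen_ball hc.continuousOn continuousOn_const
  funext y
  have hn : (0 : ℝ) < ‖y‖ + 1 := by positivity
  have h3 : (((‖y‖ + 1 : ℝ) : ℂ)) ≠ 0 := by exact_mod_cast hn.ne'
  have h4 := hp.2 ((‖y‖ + 1 : ℝ) : ℂ) ((((‖y‖ + 1 : ℝ) : ℂ))⁻¹ • y)
  rw [smul_inv_smul₀ h3] at h4
  rw [h4, h2, mul_zero]; · rfl
  rw [mem_ball_zero_iff, norm_smul, norm_inv, norm_real, Real.norm_of_nonneg hn.le,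
    inv_mul_lt_iff₀ hn]
  linarith

/-- Compactness of bounded sets of forms. -/
theorem exists_subseq_pol {e : ℕ} {P : ℕ → E n → ℂ} (hP : ∀ k, IsPol e (P k)) {A : ℝ≥0∞} (hA : A ≠ ⊤)
    (h : ∀ k, eLpNorm (P k) 2 (volume.restrict (ball 0 1)) ≤ A) :
    ∃ G, IsPol e G ∧ ∃ φ : ℕ → ℕ, StrictMono φ ∧
      ∀ y, Tendsto (fun k => P (φ k) y) atTop (nhds (G y)) := by
  have hfin := finite_Pol (E n) e
  set μ := (volume : Measure (E n)).restrict (ball 0 1)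
  have hμ : IsFiniteMeasure μ := ⟨by simpa [μ] using measure_ball_lt_top⟩
  have hL : ∀ p : Pol (E n) e, MemLp p.1 2 μ := by
    intro p
    have hc : Continuous p.1 := (mem_Pol.1 p.2).contDiff.continuous
    obtain ⟨C, hC⟩ := (isCompact_closedBall (0 : E n) 1).exists_bound_of_continuousOn hc.continuousOn
    refine MemLp.of_bound hc.aestronglyMeasurable C ?_
    exact (ae_restrict_iff' measurableSet_ball).2 (Eventually.of_forall fun y hy =>
      hC y (Metric.ball_subset_closedBall hy))
  let T : Pol (E n) e →ₗ[ℂ] Lp ℂ 2 μ :=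
    { toFun := fun p => (hL p).toLp p.1
      map_add' := fun p q => MemLp.toLp_add (hL p) (hL q)
      map_smul' := fun c p => MemLp.toLp_const_smul c (hL p) }
  let b := Module.finBasis ℂ (Pol (E n) e)
  let S := T.comp b.equivFun.symm.toLinearMap
  have hS : ker S = ⊥ := by
    rw [LinearMap.ker_eq_bot']
    intro c hc
    have h1 : T (b.equivFun.symm c) = 0 := hc
    have h2 : b.equivFun.symm c = 0 := by
      ext1
      refine (mem_Pol.1 (b.equivFun.symm c).2).eq_zero_of_ball ?_
      exact (MemLp.toLp_eq_toLp_iff (hL (b.equivFun.symm c)) (hL 0)).1 (by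
        rw [show (hL 0).toLp _ = T 0 from rfl, map_zero]; exact h1)
    exact (LinearEquiv.map_eq_zero_iff _).1 h2
  obtain ⟨K, hK, hKl⟩ := S.exists_antilipschitzWith hS
  let c : ℕ → Fin _ → ℂ := fun k => b.equivFun ⟨P k, hP k⟩
  have hc : ∀ k, ‖c k‖ ≤ K * A.toReal := by
    intro k
    have h1 := hKl.le_mul_dist (c k) 0
    rw [map_zero, dist_zero_right, dist_zero_right] at h1
    refine h1.trans (mul_le_mul_of_nonneg_left ?_ K.2)
    have h2 : S (c k) = (hL ⟨P k, hP k⟩).toLp _ := by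
      simp only [S, c, LinearMap.comp_apply, coe_coe, LinearEquiv.symm_apply_apply]
      rfl
    rw [h2, Lp.norm_toLp]
    exact ENNReal.toReal_mono hA (h k)
  obtain ⟨a, -, φ, hφ, ha⟩ := tendsto_subseq_of_bounded (Metric.isBounded_closedBall (x := (0 : Fin _ → ℂ))
    (r := K * A.toReal)) (fun k => by simpa using hc k : ∀ k, c k ∈ _)
  refine ⟨(b.equivFun.symm a).1, mem_Pol.1 (b.equivFun.symm a).2, φ, hφ, fun y => ?_⟩
  have h1 : ∀ k, P (φ k) y = ∑ i, c (φ k) i * (b i).1 y := by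
    intro k
    have : (⟨P (φ k), hP _⟩ : Pol (E n) e) = ∑ i, c (φ k) i • b i := by
      rw [← Module.Basis.equivFun_symm_apply]; simp [c]
    have := congrFun (congrArg Subtype.val this) y
    simpa using this
  have h2 : (b.equivFun.symm a).1 y = ∑ i, a i * (b i).1 y := by
    rw [Module.Basis.equivFun_symm_apply]; simp
  simp_rw [h1, h2]
  exact tendsto_finsetSum _ fun i _ => (((continuous_apply i).tendsto a).comp ha).mul_const _

theorem eLpNorm_two_sq' {μ : Measure (E n)} {f : E n → ℂ} : eLpNorm f 2 μ ^ 2 = ∫⁻ y, ‖f y‖ₑ ^ 2 ∂μ := by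
  rw [eLpNorm_eq_lintegral_rpow_enorm_toReal (by norm_num) (by norm_num),
    ← ENNReal.rpow_natCast, ← ENNReal.rpow_mul]
  simp

theorem ofReal_sq_norm (z : ℂ) : ofReal (‖z‖ ^ 2) = ‖z‖ₑ ^ 2 := by
  rw [ENNReal.ofReal_pow (norm_nonneg _), ofReal_norm]

theorem ofReal_sq_norm_sub_le (a b c : ℂ) :
    ofReal (‖a - c‖ ^ 2) ≤ 2 * ofReal (‖a - b‖ ^ 2) + 2 * ofReal (‖b - c‖ ^ 2) := by
  rw [show (2 : ℝ≥0∞) = ofReal 2 by simp, ← ENNReal.ofReal_mul (by norm_num),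
    ← ENNReal.ofReal_mul (by norm_num), ← ofReal_add (by positivity) (by positivity)]
  refine ofReal_le_ofReal ?_
  have h1 : ‖a - c‖ ≤ ‖a - b‖ + ‖b - c‖ := norm_sub_le_norm_sub_add_norm_sub _ _ _
  nlinarith [norm_nonneg (a - c), sq_nonneg (‖a - b‖ - ‖b - c‖)]

theorem wt_smul {f : E n → ℂ} {d : ℕ} (hfd : ∀ (t : ℂ) y, f (t • y) = t ^ d * f y) {β τ δ : ℝ} {c : ℂ}
    (hc : ‖c‖ = 1) (y : E n) : wt f d β τ δ (c • y) = wt f d β τ δ y := by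
  simp [wt, hfd, hc, sq_smul]

theorem exists_pol_approx [NeZero n] {f : E n → ℂ} (hf : ContDiff ℝ ∞ f) {d e : ℕ}
    (hfd : ∀ (t : ℂ) y, f (t • y) = t ^ d * f y) {β τ : ℝ} {u : E n → ℂ}
    (hu : ∀ y, y ≠ 0 → ContinuousAt u y) (hue : ∀ t : ℂ, t ≠ 0 → ∀ y, u (t • y) = t ^ e * u y)
    {M δ : ℝ} (hδ : 0 < δ) {G : E n → ℂ} (hG : LocallyIntegrable G)
    (hGb : ∀ b, IsTest b → ∀ j, ∫ y, db j b y * G y = 0)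
    (hGi : Integrable fun y => ‖u y - G y‖ ^ 2 * exp (-wt f d β τ δ y))
    (hGM : ∫ y, ‖u y - G y‖ ^ 2 * exp (-wt f d β τ δ y) ≤ M) {R : ℝ} (hR : 0 < R) :
    ∃ P, IsPol e P ∧ ∫⁻ y in ball 0 R, ofReal (‖u y - P y‖ ^ 2) *
      ofReal (exp (-wt f d β τ δ y)) ≤ 2 * ofReal M + 2 := by
  have hw : Continuous fun y => exp (-wt f d β τ δ y) :=
    Real.continuous_exp.comp (contDiff_wt hf d β τ hδ).continuous.neg
  have hum := aestronglyMeasurable_of_off_zero hu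
  obtain ⟨Cu, hCu0, hCu⟩ := exists_bound_homog hu hue (R + 1)
  obtain ⟨x0, -, hx0⟩ := (isCompact_closedBall (0 : E n) (R + 1)).exists_isMinOn
    ⟨0, by simp; linarith⟩ hw.continuousOn
  obtain ⟨x1, -, hx1⟩ := (isCompact_closedBall (0 : E n) (R + 1)).exists_isMaxOn
    ⟨0, by simp; linarith⟩ hw.continuousOn
  set c0 := exp (-wt f d β τ δ x0) with hc0
  set C0 := exp (-wt f d β τ δ x1) with hC0
  have hc0p : 0 < c0 := Real.exp_pos _
  have hC0p : 0 < C0 := Real.exp_pos _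
  have hL : MemLp ((ball 0 (R + 1)).indicator G) 2 := by
    have hm : AEStronglyMeasurable ((ball 0 (R + 1)).indicator G) :=
      hG.aestronglyMeasurable.indicator measurableSet_ball
    refine (memLp_two_iff_integrable_sq_norm hm).2 ?_
    have hi : Integrable ((ball (0 : E n) (R + 1)).indicator fun _ => 2 * Cu ^ 2) :=
      (integrable_indicator_iff measurableSet_ball).2 (integrableOn_const measure_ball_lt_top.ne)
    refine (hi.add (hGi.const_mul (2 / c0))).mono' (hm.norm.pow 2) (Eventually.of_forall fun y => ?_)
    rw [Real.norm_of_nonneg (by positivity), Pi.add_apply]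
    by_cases hy : y ∈ ball (0 : E n) (R + 1)
    · rw [Set.indicator_of_mem hy, Set.indicator_of_mem hy]
      have h1 : ‖u y‖ ≤ Cu := hCu y (by simpa using (mem_ball_zero_iff.1 hy).le)
      have h2 : c0 ≤ exp (-wt f d β τ δ y) := hx0 (Metric.ball_subset_closedBall hy)
      have h3 : ‖G y‖ ≤ ‖u y‖ + ‖u y - G y‖ := by
        have := norm_sub_le (u y) (u y - G y); simpa using this
      have h4 : ‖u y - G y‖ ^ 2 ≤ 1 / c0 * (‖u y - G y‖ ^ 2 * exp (-wt f d β τ δ y)) := by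
        rw [one_div, ← div_eq_inv_mul, le_div_iff₀ hc0p]
        exact mul_le_mul_of_nonneg_left h2 (by positivity)
      have h5 : 2 / c0 * (‖u y - G y‖ ^ 2 * exp (-wt f d β τ δ y)) =
        2 * (1 / c0 * (‖u y - G y‖ ^ 2 * exp (-wt f d β τ δ y))) := by ring
      rw [h5]
      nlinarith [norm_nonneg (G y), norm_nonneg (u y), norm_nonneg (u y - G y),
        sq_nonneg (‖u y‖ - ‖u y - G y‖)]
    · rw [Set.indicator_of_notMem hy, Set.indicator_of_notMem hy]
      rw [norm_zero, zero_add, zero_pow two_ne_zero]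
      positivity
  obtain ⟨F, hF, hFb, hFG⟩ := exists_holo_approx hG hGb hL (κ := 1 / (C0 + 1)) (by positivity)
  have hP : IsPol e fun y => tay e F y / e.factorial := by
    simpa only [div_eq_inv_mul] using (isPol_tay e F).const_mul (e.factorial : ℂ)⁻¹
  refine ⟨_, hP, ?_⟩
  have hwm : Measurable fun y => ofReal (exp (-wt f d β τ δ y)) :=
    hw.measurable.ennreal_ofReal
  refine (lintegral_tay_le hum hue hF hFb hwm.aemeasurable
    (fun c hc y => by rw [wt_smul hfd hc]) R).trans ?_
  have h6 : ∫⁻ y in ball 0 R, ofReal (‖u y - F y‖ ^ 2) * ofReal (exp (-wt f d β τ δ y))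
      ≤ ∫⁻ y in ball 0 R, (2 * ofReal (‖u y - G y‖ ^ 2 * exp (-wt f d β τ δ y)) +
        2 * ofReal C0 * ‖F y - G y‖ₑ ^ 2) := by
    refine setLIntegral_mono' measurableSet_ball fun y hy => ?_
    have hy' : y ∈ closedBall (0 : E n) (R + 1) := by
      rw [mem_ball_zero_iff] at hy; rw [mem_closedBall_zero_iff]; linarith
    refine (mul_le_mul_left (ofReal_sq_norm_sub_le (u y) (G y) (F y)) _).trans ?_
    rw [add_mul, mul_assoc, ← ENNReal.ofReal_mul (by positivity), norm_sub_rev (G y), ofReal_sq_norm (F y - G y),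
      mul_assoc, mul_assoc, mul_comm (‖F y - G y‖ₑ ^ 2)]
    gcongr
    exact hx1 hy'
  refine h6.trans ?_
  rw [lintegral_add_left' (hGi.aestronglyMeasurable.aemeasurable.ennreal_ofReal.const_mul 2).restrict,
    lintegral_const_mul' _ _ (by simp), lintegral_const_mul' _ _ (mul_ne_top (by simp) ofReal_ne_top),
    ← eLpNorm_two_sq']
  gcongr
  · refine (setLIntegral_le_lintegral _ _).trans ?_
    rw [← ofReal_integral_eq_lintegral_ofReal hGi (Eventually.of_forall fun y => by positivity)]
    exact ofReal_le_ofReal hGM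
  · rw [mul_assoc]
    conv_rhs => rw [← mul_one 2]
    gcongr
    refine (mul_le_mul_right (pow_le_pow_left' hFG 2) _).trans ?_
    rw [← ENNReal.ofReal_pow (by positivity), ← ENNReal.ofReal_mul hC0p.le, ENNReal.ofReal_le_one]
    rw [div_pow, one_pow, mul_one_div, div_le_one (by positivity)]
    nlinarith

/-- Solution of the `∂̄` problem for homogeneous data with optimal weights. -/
theorem nadel [NeZero n] {f : E n → ℂ} {d e : ℕ} (hf : IsPol d f) (hf0 : ∀ᵐ y, f y ≠ 0) {β : ℝ} (hβ : 0 ≤ β)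
    (hβ1 : 1 ≤ β * d) (hβ2 : β * d < e + n) {u : E n → ℂ} (hu : ∀ y, y ≠ 0 → ContDiffAt ℝ ∞ u y)
    (hue : ∀ t : ℂ, t ≠ 0 → ∀ y, u (t • y) = t ^ e * u y)
    (hfin : ∀ j x, x ≠ 0 → FinAt (fun y => ofReal (‖db j u y‖ ^ 2 * ‖f y‖ ^ (-2 * β))) x) :
    ∃ G, IsPol e G ∧ ∀ x, x ≠ 0 → FinAt (fun y => ofReal (‖u y - G y‖ ^ 2 * ‖f y‖ ^ (-2 * β))) x := by
  have hd : d ≠ 0 := by rintro rfl; norm_num at hβ1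
  have huc : ∀ y, y ≠ 0 → ContinuousAt u y := fun y hy => (hu y hy).continuousAt
  have hum := aestronglyMeasurable_of_off_zero huc
  have hfc : Continuous f := hf.contDiff.continuous
  set τ : ℝ := min 1 ((e + n - β * d) / 2) with hτd
  have hτ : 0 < τ := lt_min one_pos (by linarith)
  have hτ1 : τ ≤ 1 := min_le_left _ _
  have hτ2 : τ + β * d < e + n := by
    have := min_le_right 1 ((e + n - β * d) / 2)
    linarith
  obtain ⟨M, hM⟩ := nadel_delta hf.contDiff_real hf.db hf.2 hf0 hβ hβ1 hτ hτ1 hτ2 hu hue hfin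
  set δ : ℕ → ℝ := fun k => 1 / ((k : ℝ) + 1) with hδd
  have hδ0 : ∀ k, 0 < δ k := fun k => by positivity
  have hδ1 : ∀ k, δ k ≤ 1 := fun k => by
    rw [hδd]; simp only; rw [div_le_one (by positivity)]; linarith [Nat.cast_nonneg (α := ℝ) k]
  have hδt : Tendsto δ atTop (nhds 0) := tendsto_one_div_add_atTop_nhds_zero_nat
  set A : ℝ≥0∞ := 2 * ofReal M + 2
  have hA : A ≠ ⊤ := by simp [A, ENNReal.mul_eq_top]
  have hex : ∀ k : ℕ, ∃ P, IsPol e P ∧ ∫⁻ y in ball 0 ((k : ℝ) + 1), ofReal (‖u y - P y‖ ^ 2) *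
      ofReal (exp (-wt f d β τ (δ k) y)) ≤ A := by
    intro k
    obtain ⟨G, hG, hGb, hGi, hGM⟩ := hM (δ k) (hδ0 k)
    exact exists_pol_approx hf.contDiff_real hf.2 huc hue (hδ0 k) hG hGb hGi hGM (by positivity)
  choose P hP hPA using hex
  -- uniform bound on the unit ball
  obtain ⟨Cf, hCf⟩ := (isCompact_closedBall (0 : E n) 1).exists_bound_of_continuousOn hfc.continuousOn
  obtain ⟨Cs, hCs⟩ := (isCompact_closedBall (0 : E n) 1).exists_bound_of_continuousOn
    (contDiff_sq (n := n)).continuous.continuousOn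
  set c1 : ℝ := (Cf ^ 2 + 1) ^ (-β) * exp (-(Cs + 1) ^ τ) with hc1
  have hCs0 : 0 ≤ Cs := (norm_nonneg _).trans (hCs 0 (by simp))
  have hc1p : 0 < c1 := by positivity
  have hc1w : ∀ k, ∀ y ∈ ball (0 : E n) 1, c1 ≤ exp (-wt f d β τ (δ k) y) := by
    intro k y hy
    have hy' := Metric.ball_subset_closedBall hy
    rw [exp_neg_wt f d β τ (hδ0 k)]
    have h1 : ‖f y‖ ^ 2 + δ k ^ d ≤ Cf ^ 2 + 1 :=
      add_le_add (pow_le_pow_left₀ (norm_nonneg _) (hCf y hy') 2) (pow_le_one₀ (hδ0 k).le (hδ1 k))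
    have h2 : sq y + δ k ≤ Cs + 1 := add_le_add ((le_abs_self _).trans (hCs y hy')) (hδ1 k)
    have h3 := hδ0 k
    have h4 := sq_nonneg' y
    refine mul_le_mul (Real.rpow_le_rpow_of_nonpos (by positivity) h1 (by linarith)) ?_ (by positivity) (by positivity)
    exact Real.exp_le_exp.2 (neg_le_neg (Real.rpow_le_rpow (by positivity) h2 hτ.le))
  obtain ⟨Cu, hCu0, hCu⟩ := exists_bound_homog huc hue 1
  set B : ℝ≥0∞ := (ofReal c1)⁻¹ * A
  have hB : B ≠ ⊤ := mul_ne_top (by simp [hc1p]) hA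
  set B2 : ℝ≥0∞ := 2 * (ofReal (Cu ^ 2) * volume (ball (0 : E n) 1)) + 2 * B
  have hB2 : B2 ≠ ⊤ := by
    simp [B2, ENNReal.mul_eq_top, hB, measure_ball_lt_top.ne]
  have hPb : ∀ k, eLpNorm (P k) 2 (volume.restrict (ball 0 1)) ≤ B2 + 1 := by
    intro k
    have h1 : ∫⁻ y in ball 0 1, ofReal (‖u y - P k y‖ ^ 2) ≤ B := by
      have h2 : ofReal c1 * ∫⁻ y in ball 0 1, ofReal (‖u y - P k y‖ ^ 2) ≤ A := by
        rw [← lintegral_const_mul' _ _ ofReal_ne_top]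
        refine le_trans ?_ ((lintegral_mono_set (Metric.ball_subset_ball (ε₁ := 1) ?_)).trans (hPA k))
        · refine setLIntegral_mono' measurableSet_ball fun y hy => ?_
          rw [mul_comm]
          gcongr
          exact hc1w k y hy
        · linarith [Nat.cast_nonneg (α := ℝ) k]
      refine le_trans (le_of_eq ?_) (mul_le_mul_right h2 (ofReal c1)⁻¹)
      rw [← mul_assoc, ENNReal.inv_mul_cancel (by simp [hc1p]) ofReal_ne_top, one_mul]
    have h3 : eLpNorm (P k) 2 (volume.restrict (ball 0 1)) ^ 2 ≤ B2 := by
      rw [eLpNorm_two_sq']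
      have h4 : ∫⁻ y in ball 0 1, ‖P k y‖ₑ ^ 2 ≤ ∫⁻ y in ball 0 1,
          (2 * ofReal (Cu ^ 2) + 2 * ofReal (‖u y - P k y‖ ^ 2)) := by
        refine setLIntegral_mono' measurableSet_ball fun y hy => ?_
        rw [← ofReal_sq_norm]
        have h5 := ofReal_sq_norm_sub_le 0 (u y) (P k y)
        simp only [zero_sub, norm_neg] at h5
        refine h5.trans ?_
        gcongr
        exact hCu y (mem_ball_zero_iff.1 hy).le
      refine h4.trans ?_
      rw [lintegral_add_left measurable_const, lintegral_const, Measure.restrict_apply_univ,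
        lintegral_const_mul' _ _ (by simp), mul_assoc]
      exact add_le_add le_rfl (mul_le_mul_right h1 _)
    by_contra! H
    have h6 : 1 ≤ B2 + 1 := le_add_self
    have h7 : B2 + 1 ≤ (B2 + 1) ^ 2 := by
      conv_lhs => rw [← mul_one (B2 + 1)]
      rw [pow_two]
      gcongr
    have h8 : B2 < B2 + 1 := ENNReal.lt_add_right hB2 one_ne_zero
    exact absurd (h3.trans_lt (h8.trans_le (h7.trans (pow_le_pow_left' H.le 2)))) (lt_irrefl _)
  obtain ⟨G, hG, φ, hφ, hlim⟩ := exists_subseq_pol hP (A := B2 + 1) (by simp [hB2]) hPb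
  refine ⟨G, hG, ?_⟩
  set H : ℕ → E n → ℝ≥0∞ := fun k => (ball 0 ((φ k : ℝ) + 1)).indicator fun y =>
    ofReal (‖u y - P (φ k) y‖ ^ 2) * ofReal (exp (-wt f d β τ (δ (φ k)) y))
  have hHm : ∀ k, AEMeasurable (H k) := by
    intro k
    have h1 : Continuous (P (φ k)) := (hP _).contDiff.continuous
    have h2 : Continuous fun y => exp (-wt f d β τ (δ (φ k)) y) :=
      Real.continuous_exp.comp (contDiff_wt hf.contDiff_real d β τ (hδ0 _)).continuous.neg
    exact (((hum.sub h1.aestronglyMeasurable).norm.pow 2).aemeasurable.ennreal_ofReal.mul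
      h2.measurable.ennreal_ofReal.aemeasurable).indicator measurableSet_ball
  have hHA : ∀ k, ∫⁻ y, H k y ≤ A := fun k => by
    rw [lintegral_indicator measurableSet_ball]; exact hPA _
  have hFatou : ∫⁻ y, ofReal (‖u y - G y‖ ^ 2) *
      ofReal ((‖f y‖ ^ 2) ^ (-β) * exp (-(sq y) ^ τ)) ≤ A := by
    refine le_trans (le_of_eq (lintegral_congr_ae ?_)) ((lintegral_liminf_le' hHm).trans
      ((Filter.liminf_le_liminf (v := fun _ => A) (Eventually.of_forall hHA)).trans_eq
        (Filter.liminf_const (f := atTop) A)))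
    filter_upwards [hf0] with y hy
    refine (Tendsto.liminf_eq ?_).symm
    have h1 : Tendsto (fun k => δ (φ k)) atTop (nhds 0) := hδt.comp hφ.tendsto_atTop
    have h2 : Tendsto (fun k => ofReal (‖u y - P (φ k) y‖ ^ 2) *
        ofReal (exp (-wt f d β τ (δ (φ k)) y))) atTop
        (nhds (ofReal (‖u y - G y‖ ^ 2) *
          ofReal ((‖f y‖ ^ 2) ^ (-β) * exp (-(sq y) ^ τ)))) := by
      refine ENNReal.Tendsto.mul (ENNReal.tendsto_ofReal ((tendsto_const_nhds.sub (hlim y)).norm.pow 2))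
        (Or.inr ofReal_ne_top) (ENNReal.tendsto_ofReal ?_) (Or.inr ofReal_ne_top)
      have h3 : ∀ k, exp (-wt f d β τ (δ (φ k)) y) =
        (‖f y‖ ^ 2 + δ (φ k) ^ d) ^ (-β) * exp (-(sq y + δ (φ k)) ^ τ) := fun k =>
        exp_neg_wt f d β τ (hδ0 _) y
      simp_rw [h3]
      have h4 : 0 < ‖f y‖ := norm_pos_iff.2 hy
      have h5 : Tendsto (fun k => ‖f y‖ ^ 2 + δ (φ k) ^ d) atTop (nhds (‖f y‖ ^ 2)) := by
        simpa [hd] using (h1.pow d).const_add (‖f y‖ ^ 2)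
      have h6 : Tendsto (fun k => sq y + δ (φ k)) atTop (nhds (sq y)) := by
        simpa using h1.const_add (sq y)
      exact (h5.rpow_const (Or.inl (by positivity))).mul
        ((Real.continuous_exp.tendsto _).comp (h6.rpow_const (Or.inr hτ.le)).neg)
    refine h2.congr' ?_
    obtain ⟨k0, hk0⟩ : ∃ k0 : ℕ, ‖y‖ < k0 := exists_nat_gt ‖y‖
    filter_upwards [Filter.eventually_ge_atTop k0] with k hk
    have h7 : (k0 : ℝ) ≤ φ k := by exact_mod_cast hk.trans (hφ.le_apply)
    have h8 : y ∈ ball (0 : E n) ((φ k : ℝ) + 1) := by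
      rw [mem_ball_zero_iff]
      linarith
    simp only [H]
    rw [Set.indicator_of_mem h8]
  intro x hx
  have hFA : FinAt (fun y => ofReal (‖u y - G y‖ ^ 2) *
      ofReal ((‖f y‖ ^ 2) ^ (-β) * exp (-(sq y) ^ τ))) x :=
    ⟨Set.univ, univ_mem, ne_top_of_le_ne_top hA (by simpa using hFatou)⟩
  have hcont : Continuous fun y : E n => exp ((sq y) ^ τ) :=
    Real.continuous_exp.comp ((contDiff_sq (n := n)).continuous.rpow_const fun _ => Or.inr hτ.le)
  have hev : ∀ᶠ y in nhds x, exp ((sq y) ^ τ) < exp ((sq x) ^ τ) + 1 :=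
    hcont.continuousAt.eventually_lt continuousAt_const (by simp)
  refine hFA.mono (C := ofReal (exp ((sq x) ^ τ) + 1)) ofReal_ne_top ?_
  filter_upwards [hev] with y hy
  rw [← ENNReal.ofReal_mul (by positivity), ← ENNReal.ofReal_mul (by positivity)]
  refine ofReal_le_ofReal ?_
  have h1 : (‖f y‖ ^ 2) ^ (-β) = ‖f y‖ ^ (-2 * β) := by
    rw [← Real.rpow_natCast, ← Real.rpow_mul (norm_nonneg _)]
    congr 1
    push_cast
    ring
  rw [h1, Real.exp_neg]
  have h2 := Real.exp_pos ((sq y) ^ τ)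
  calc ‖u y - G y‖ ^ 2 * ‖f y‖ ^ (-2 * β)
      = exp ((sq y) ^ τ) * (‖u y - G y‖ ^ 2 * (‖f y‖ ^ (-2 * β) * (exp ((sq y) ^ τ))⁻¹)) := by
        field_simp
    _ ≤ _ := mul_le_mul_of_nonneg_right hy.le (by positivity)

theorem FinAt.sum_mul {κ : Type*} [Fintype κ] {w : E n → ℝ} (hw : Measurable w) (hw0 : ∀ y, 0 ≤ w y) {x : E n}
    {a b : κ → E n → ℂ} (hb : ∀ k, Continuous (b k)) {v : E n → ℂ}
    (hv : ∀ᶠ y in nhds x, v y = ∑ k, a k y * b k y) (ha : ∀ k, ContinuousAt (a k) x)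
    (h : ∀ k, a k =ᶠ[nhds x] 0 ∨ FinAt (fun y => ofReal (‖b k y‖ ^ 2 * w y)) x) :
    FinAt (fun y => ofReal (‖v y‖ ^ 2 * w y)) x := by
  set S : Finset κ := univ.filter fun k => ¬ a k =ᶠ[nhds x] 0 with hS
  have h1 : FinAt (fun y => ∑ k ∈ S, ofReal (‖b k y‖ ^ 2 * w y)) x := by
    refine FinAt.finset_sum (fun k hk => (h k).resolve_left (mem_filter.1 hk).2) fun k _ => ?_
    exact (((hb k).norm.pow 2).measurable.mul hw).ennreal_ofReal.aemeasurable
  have h2 : ∃ M : ℝ, 0 ≤ M ∧ ∀ k, ∀ᶠ y in nhds x, ‖a k y‖ ≤ M := by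
    refine ⟨∑ k, (‖a k x‖ + 1), by positivity, fun k => ?_⟩
    have h3 : ∀ᶠ y in nhds x, ‖a k y‖ < ‖a k x‖ + 1 :=
      (ha k).norm.eventually_lt continuousAt_const (by simp)
    filter_upwards [h3] with y hy
    exact hy.le.trans (single_le_sum (f := fun k => ‖a k x‖ + 1) (fun _ _ => by positivity) (mem_univ k))
  obtain ⟨M, hM, hMa⟩ := h2
  refine h1.mono (C := ofReal (S.card * M ^ 2)) ofReal_ne_top ?_
  have h4 : ∀ᶠ y in nhds x, ∀ k, k ∉ S → a k y = 0 := by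
    refine eventually_all.2 fun k => ?_
    by_cases hk : k ∈ S
    · exact Eventually.of_forall fun y hy => absurd hk hy
    · have : a k =ᶠ[nhds x] 0 := by simpa [hS] using hk
      filter_upwards [this] with y hy _ using hy
  filter_upwards [hv, h4, eventually_all.2 hMa] with y hvy hy0 hyM
  rw [← ENNReal.ofReal_sum_of_nonneg (fun k _ => mul_nonneg (by positivity) (hw0 y)),
    ← ENNReal.ofReal_mul (by positivity)]
  refine ofReal_le_ofReal ?_
  rw [← Finset.sum_mul, ← mul_assoc]
  refine mul_le_mul_of_nonneg_right ?_ (hw0 y)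
  have h5 : v y = ∑ k ∈ S, a k y * b k y := by
    rw [hvy]
    refine (Finset.sum_subset (Finset.subset_univ S) fun k _ hk => ?_).symm
    rw [hy0 k hk, zero_mul]
  have h6 : ‖v y‖ ≤ ∑ k ∈ S, M * ‖b k y‖ := by
    rw [h5]
    refine (norm_sum_le _ _).trans (Finset.sum_le_sum fun k _ => ?_)
    rw [norm_mul]
    exact mul_le_mul_of_nonneg_right (hyM k) (norm_nonneg _)
  calc ‖v y‖ ^ 2 ≤ (∑ k ∈ S, M * ‖b k y‖) ^ 2 := by gcongr
    _ ≤ S.card * ∑ k ∈ S, (M * ‖b k y‖) ^ 2 := sq_sum_le_card_mul_sum_sq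
    _ = _ := by simp only [mul_pow, ← mul_sum]; ring

theorem continuousAt_db {u : E n → ℂ} {x : E n} (hu : ContDiffAt ℝ ∞ u x) (j : Fin n) :
    ContinuousAt (db j u) x := by
  have h : ContinuousAt (fderiv ℝ u) x := (hu.fderiv_right (m := 0) (by simp)).continuousAt
  exact continuousAt_const.mul ((h.clm_apply continuousAt_const).add
    (continuousAt_const.mul (h.clm_apply continuousAt_const)))

/-- Gluing of homogeneous polynomials modulo square-integrability. -/
theorem cech [NeZero n] {κ : Type*} [Fintype κ] {f : E n → ℂ} {d e : ℕ} (hf : IsPol d f) (hf0 : ∀ᵐ y, f y ≠ 0)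
    {β : ℝ} (hβ : 0 ≤ β) (hβ1 : 1 ≤ β * d) (hβ2 : β * d < e + n) {q : κ → E n → ℂ} (hq : ∀ k, IsPol e (q k))
    {ρ : κ → E n → ℝ} (hρ : ∀ k y, y ≠ 0 → ContDiffAt ℝ ∞ (ρ k) y)
    (hρs : ∀ k (t : ℂ), t ≠ 0 → ∀ y, ρ k (t • y) = ρ k y) (hρ1 : ∀ y, y ≠ 0 → ∑ k, ρ k y = 1)
    (hyp : ∀ x, x ≠ 0 → ∃ l, ∀ k, ρ k =ᶠ[nhds x] 0 ∨
      FinAt (fun y => ofReal (‖q k y - q l y‖ ^ 2 * ‖f y‖ ^ (-2 * β))) x) :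
    ∃ G, IsPol e G ∧ ∀ x, x ≠ 0 → ∀ l, (∀ k, ρ k =ᶠ[nhds x] 0 ∨
      FinAt (fun y => ofReal (‖q k y - q l y‖ ^ 2 * ‖f y‖ ^ (-2 * β))) x) →
      FinAt (fun y => ofReal (‖G y - q l y‖ ^ 2 * ‖f y‖ ^ (-2 * β))) x := by
  set u : E n → ℂ := fun y => ∑ k, (ρ k y : ℂ) * q k y with hu
  have hρc : ∀ k y, y ≠ 0 → ContDiffAt ℝ ∞ (fun y => (ρ k y : ℂ)) y := fun k y hy =>
    (ofRealCLM.contDiff.contDiffAt).comp y (hρ k y hy)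
  have hqc : ∀ k, ContDiff ℝ ∞ (q k) := fun k => (hq k).contDiff_real
  have huc : ∀ y, y ≠ 0 → ContDiffAt ℝ ∞ u y := fun y hy =>
    ContDiffAt.sum fun k _ => (hρc k y hy).mul (hqc k).contDiffAt
  have hw : Measurable fun y => ‖f y‖ ^ (-2 * β) := hf.contDiff.continuous.norm.measurable.pow_const _
  have hw0 : ∀ y, 0 ≤ ‖f y‖ ^ (-2 * β) := fun y => by positivity
  have hne : ∀ {x : E n}, x ≠ 0 → ∀ᶠ y in nhds x, y ≠ 0 := fun hx => isOpen_ne.mem_nhds hx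
  have hul : ∀ l y, y ≠ 0 → u y - q l y = ∑ k, (ρ k y : ℂ) * (q k y - q l y) := by
    intro l y hy
    have : (∑ k, (ρ k y : ℂ)) = 1 := by exact_mod_cast congrArg ((↑) : ℝ → ℂ) (hρ1 y hy)
    simp only [mul_sub, Finset.sum_sub_distrib, ← sum_mul, this, one_mul, hu]
  have hdb : ∀ l j y, y ≠ 0 → db j u y = ∑ k, db j (fun y => (ρ k y : ℂ)) y * (q k y - q l y) := by
    intro l j y hy
    have hd : ∀ k, DifferentiableAt ℝ (fun y => (ρ k y : ℂ) * (q k y - q l y)) y := fun k =>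
      ((hρc k y hy).mul ((hqc k).sub (hqc l)).contDiffAt).differentiableAt (by simp)
    have h1 : u =ᶠ[nhds y] fun y => q l y + ∑ k, (ρ k y : ℂ) * (q k y - q l y) := by
      filter_upwards [hne hy] with z hz
      rw [← hul l z hz]; ring
    rw [dd_congr h1, dd_add (diffAt (hqc l) y) (DifferentiableAt.fun_sum fun k _ => hd k), (hq l).db, zero_add,
      dd_sum _ hd]
    refine sum_congr rfl fun k _ => ?_
    rw [dd_mul ((hρc k y hy).differentiableAt (by simp)) (diffAt ((hqc k).sub (hqc l)) y),
      dd_sub (diffAt (hqc k) y) (diffAt (hqc l) y), (hq k).db, (hq l).db]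
    ring
  have hb : ∀ l k, Continuous fun y => q k y - q l y := fun l k =>
    (hqc k).continuous.sub (hqc l).continuous
  have hz : ∀ {k x}, ρ k =ᶠ[nhds x] 0 → (fun y => (ρ k y : ℂ)) =ᶠ[nhds x] 0 := by
    intro k x h
    filter_upwards [h] with y hy
    simp [hy]
  obtain ⟨G, hG, hGu⟩ := nadel hf hf0 hβ hβ1 hβ2 huc (by
      intro t ht y
      simp only [hu, hρs _ t ht, (hq _).2 t y, mul_sum]
      exact sum_congr rfl fun k _ => by ring) (by
      intro j x hx
      obtain ⟨l, hl⟩ := hyp x hx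
      refine FinAt.sum_mul hw hw0 (hb l) ?_ (fun k => continuousAt_db (hρc k x hx) j) fun k => ?_
      · filter_upwards [hne hx] with y hy using hdb l j y hy
      · refine (hl k).imp_left fun h => ?_
        have h2 := (hz h).eventuallyEq_nhds
        filter_upwards [h2] with y hy
        rw [dd_congr hy]
        exact dd_const 0)
  refine ⟨G, hG, fun x hx l hl => ?_⟩
  have h1 : FinAt (fun y => ofReal (‖u y - q l y‖ ^ 2 * ‖f y‖ ^ (-2 * β))) x := by
    refine FinAt.sum_mul (v := fun y => u y - q l y) hw hw0 (hb l) ?_ (fun k => (hρc k x hx).continuousAt) fun k => (hl k).imp_left hz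
    filter_upwards [hne hx] with y hy using hul l y hy
  have h2 := hGu x hx
  have hum : AEStronglyMeasurable u := aestronglyMeasurable_of_off_zero fun y hy => (huc y hy).continuousAt
  have h3 : FinAt (fun y => ∑ i : Fin 2, (![fun y => ofReal (‖u y - q l y‖ ^ 2 * ‖f y‖ ^ (-2 * β)),
      fun y => ofReal (‖u y - G y‖ ^ 2 * ‖f y‖ ^ (-2 * β))] : Fin 2 → E n → ℝ≥0∞) i y) x := by
    refine FinAt.finset_sum (fun i _ => by fin_cases i; exacts [h1, h2]) fun i _ => ?_
    have : ∀ p : E n → ℂ, Continuous p → AEMeasurable fun y =>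
        ofReal (‖u y - p y‖ ^ 2 * ‖f y‖ ^ (-2 * β)) := fun p hp =>
      ((((hum.sub hp.aestronglyMeasurable).norm.pow 2).aemeasurable).mul hw.aemeasurable).ennreal_ofReal
    fin_cases i
    · exact this _ (hqc l).continuous
    · exact this _ hG.contDiff.continuous
  refine h3.mono (C := 2) (by simp) (Eventually.of_forall fun y => ?_)
  simp only [Fin.sum_univ_two, Matrix.cons_val_zero, Matrix.cons_val_one]
  rw [show (2 : ℝ≥0∞) = ofReal 2 by simp, ← ofReal_add (by positivity) (by positivity),
    ← ENNReal.ofReal_mul (by norm_num)]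
  refine ofReal_le_ofReal ?_
  rw [← add_mul, ← mul_assoc]
  refine mul_le_mul_of_nonneg_right ?_ (hw0 y)
  have h5 : ‖G y - q l y‖ ≤ ‖u y - q l y‖ + ‖u y - G y‖ := by
    have := norm_sub_le (u y - q l y) (u y - G y)
    simpa using this
  nlinarith [norm_nonneg (G y - q l y), sq_nonneg (‖u y - q l y‖ - ‖u y - G y‖)]

theorem exists_eq_pow_mul {R : ℝ} (hR : 0 < R) {k : ℕ} {C : ℝ} {φ : ℂ → ℂ}
    (hφ : DifferentiableOn ℂ φ (ball 0 R)) (h : ∀ᶠ t in nhdsWithin 0 {0}ᶜ, ‖φ t‖ ≤ C * ‖t‖ ^ k) :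
    ∃ ψ, DifferentiableOn ℂ ψ (ball 0 R) ∧ ∀ t, φ t = t ^ k * ψ t := by
  induction k generalizing φ with
  | zero => exact ⟨φ, hφ, fun t => by simp⟩
  | succ k ih =>
    have hb : ball (0 : ℂ) R ∈ nhds 0 := ball_mem_nhds _ hR
    have hc : ContinuousAt φ 0 := (hφ.differentiableAt hb).continuousAt
    have h0 : φ 0 = 0 := by
      have h1 : Tendsto φ (nhdsWithin 0 {0}ᶜ) (nhds (φ 0)) := hc.tendsto.mono_left nhdsWithin_le_nhds
      have h2 : Tendsto (fun t : ℂ => C * ‖t‖ ^ (k + 1)) (nhdsWithin 0 {0}ᶜ) (nhds 0) := by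
        have : Continuous fun t : ℂ => C * ‖t‖ ^ (k + 1) := by fun_prop
        simpa using (this.tendsto 0).mono_left nhdsWithin_le_nhds
      exact tendsto_nhds_unique h1 (squeeze_zero_norm' h h2)
    obtain ⟨ψ, hψ, hE⟩ := ih ((Complex.differentiableOn_dslope hb).2 hφ) (by
      filter_upwards [h, self_mem_nhdsWithin] with t ht ht0
      have ht1 : 0 < ‖t‖ := norm_pos_iff.2 ht0
      rw [dslope_of_ne _ ht0, slope_def_field, h0, sub_zero, sub_zero, norm_div, div_le_iff₀ ht1]
      linarith [ht, show C * ‖t‖ ^ (k + 1) = C * ‖t‖ ^ k * ‖t‖ by ring])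
    refine ⟨ψ, hψ, fun t => ?_⟩
    have h3 := sub_smul_dslope φ 0 t
    rw [h0, sub_zero, sub_zero, smul_eq_mul, hE] at h3
    rw [← h3]; ring

/-- Mean value bound for functions vanishing to order `k`. -/
theorem sq_norm_le_average {R : ℝ} (hR : 1 < R) {k : ℕ} {C : ℝ} {φ : ℂ → ℂ}
    (hφ : DifferentiableOn ℂ φ (ball 0 R)) (h : ∀ᶠ t in nhdsWithin 0 {0}ᶜ, ‖φ t‖ ≤ C * ‖t‖ ^ k)
    {t : ℂ} (ht : ‖t‖ ≤ 1 / 2) :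
    ‖φ t‖ ^ 2 ≤ ‖t‖ ^ (2 * k) * ∫ θ in (0 : ℝ)..2 * pi, ‖φ (Complex.exp (θ * I))‖ ^ 2 := by
  obtain ⟨ψ, hψ, hE⟩ := exists_eq_pow_mul (by linarith) hφ h
  have hsub : closedBall (0 : ℂ) 1 ⊆ ball 0 R := Metric.closedBall_subset_ball hR
  have h1 := DifferentiableOn.circleIntegral_sub_inv_smul (R := 1) (c := (0 : ℂ)) (w := t) (f := fun z => ψ z ^ 2)
    ((hψ.mono hsub).pow 2) (by rw [mem_ball_zero_iff]; linarith)
  have h2 : ‖∮ z in C(0, 1), (z - t)⁻¹ • ψ z ^ 2‖ ≤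
      ∫ θ in (0 : ℝ)..2 * pi, 2 * ‖φ (Complex.exp (θ * I))‖ ^ 2 := by
    rw [circleIntegral]
    refine intervalIntegral.norm_integral_le_of_norm_le (by positivity) (Eventually.of_forall fun θ _ => ?_) ?_
    · have h3 : ‖Complex.exp (θ * I)‖ = 1 := norm_exp_ofReal_mul_I θ
      have h4 : 1 / 2 ≤ ‖Complex.exp (θ * I) - t‖ := by
        have := norm_sub_norm_le (Complex.exp (θ * I)) t
        linarith
      have h5 : ‖Complex.exp (θ * I) - t‖⁻¹ ≤ 2 := by
        rw [inv_le_comm₀ (by linarith) two_pos]; linarith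
      simp only [deriv_circleMap, circleMap_zero, smul_eq_mul, norm_mul, norm_inv, norm_pow, h3,
        Complex.norm_I, mul_one, Complex.ofReal_one, one_mul, hE, one_pow]
      gcongr
    · refine Continuous.intervalIntegrable ?_ _ _
      have h6 : ContinuousOn φ (ball 0 R) := hφ.continuousOn
      have h7 : Continuous fun θ : ℝ => φ (Complex.exp (θ * I)) :=
        h6.comp_continuous (by fun_prop) fun θ => hsub (by simp [norm_exp_ofReal_mul_I])
      exact continuous_const.mul (h7.norm.pow 2)
  rw [h1, norm_smul, norm_pow] at h2
  have h8 : ‖(2 * pi * I : ℂ)‖ = 2 * pi := by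
    simp [abs_of_pos Real.pi_pos]
  rw [h8, intervalIntegral.integral_const_mul] at h2
  rw [hE t, norm_mul, mul_pow, norm_pow, ← pow_mul, mul_comm k 2]
  refine mul_le_mul_of_nonneg_left ?_ (by positivity)
  have h9 := Real.pi_gt_three
  nlinarith [sq_nonneg ‖ψ t‖]

theorem norm_le_of_order {R : ℝ} (hR : 1 < R) {k : ℕ} {C M : ℝ} {φ : ℂ → ℂ}
    (hφ : DifferentiableOn ℂ φ (ball 0 R)) (h : ∀ᶠ t in nhdsWithin 0 {0}ᶜ, ‖φ t‖ ≤ C * ‖t‖ ^ k)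
    (hM : ∀ t, ‖t‖ = 1 → ‖φ t‖ ≤ M) {t : ℂ} (ht : ‖t‖ ≤ 1 / 2) : ‖φ t‖ ≤ 3 * M * ‖t‖ ^ k := by
  have hM0 : 0 ≤ M := (norm_nonneg _).trans (hM 1 (by simp))
  have h1 := sq_norm_le_average hR hφ h ht
  have h2 : ‖∫ θ in (0 : ℝ)..2 * pi, ‖φ (Complex.exp (θ * I))‖ ^ 2‖ ≤ M ^ 2 * |2 * pi - 0| := by
    refine intervalIntegral.norm_integral_le_of_norm_le_const fun θ _ => ?_
    rw [Real.norm_of_nonneg (by positivity)]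
    exact pow_le_pow_left₀ (norm_nonneg _) (hM _ (norm_exp_ofReal_mul_I θ)) 2
  rw [sub_zero, abs_of_pos (by positivity)] at h2
  have h3 : 2 * pi ≤ 9 := by linarith [Real.pi_lt_four]
  refine le_of_sq_le_sq ?_ (by positivity)
  calc ‖φ t‖ ^ 2 ≤ ‖t‖ ^ (2 * k) * (M ^ 2 * 9) := by
        refine h1.trans (mul_le_mul_of_nonneg_left (((le_abs_self _).trans h2).trans ?_) (by positivity))
        gcongr
    _ = _ := by ring

section

/-- A linear projection onto `V`. -/
def pr (V : Submodule ℂ (E n)) : E n →ₗ[ℂ] E n :=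
  V.projection (Classical.choose V.exists_isCompl) (Classical.choose_spec V.exists_isCompl)

variable (V : Submodule ℂ (E n))

theorem pr_mem (y : E n) : pr V y ∈ V := Submodule.projection_apply_mem _ y

variable {V} in
theorem pr_of_mem {v : E n} (hv : v ∈ V) : pr V v = v :=
  Submodule.projection_apply_left (Classical.choose_spec V.exists_isCompl) ⟨v, hv⟩

theorem pr_pr (y : E n) : pr V (pr V y) = pr V y := pr_of_mem (pr_mem V y)

/-- The component of a vector transverse to `V`. -/
def co : E n →ₗ[ℂ] E n := LinearMap.id - pr V

theorem co_apply (y : E n) : co V y = y - pr V y := rfl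

theorem pr_add_co (y : E n) : pr V y + co V y = y := by rw [co_apply]; abel

theorem pr_co (y : E n) : pr V (co V y) = 0 := by rw [co_apply, map_sub, pr_pr, sub_self]

theorem co_co (y : E n) : co V (co V y) = co V y := by rw [co_apply V (co V y), pr_co, sub_zero]

variable {V} in
theorem co_eq_zero_iff {y : E n} : co V y = 0 ↔ y ∈ V := by
  rw [co_apply, sub_eq_zero]
  exact ⟨fun h => h ▸ pr_mem V y, fun h => (pr_of_mem h).symm⟩

/-- The dilation by `c` in the directions transverse to `V`. -/
def dil (c : ℂ) : E n →ₗ[ℂ] E n := pr V + c • co V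

theorem dil_apply (c : ℂ) (y : E n) : dil V c y = pr V y + c • co V y := rfl

theorem pr_dil (c : ℂ) (y : E n) : pr V (dil V c y) = pr V y := by
  rw [dil_apply, map_add, map_smul, pr_pr, pr_co, smul_zero, add_zero]

theorem co_dil (c : ℂ) (y : E n) : co V (dil V c y) = c • co V y := by
  rw [dil_apply, map_add, map_smul, co_co, co_eq_zero_iff.2 (pr_mem V y), zero_add]

theorem dil_dil (c c' : ℂ) (y : E n) : dil V c (dil V c' y) = dil V (c * c') y := by
  rw [dil_apply, pr_dil, co_dil, dil_apply, mul_smul]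

theorem dil_one (y : E n) : dil V 1 y = y := by rw [dil_apply, one_smul, pr_add_co]

theorem det_dil (c : ℂ) : LinearMap.det (dil V c) = c ^ (n - finrank ℂ V) := by
  have hK := Classical.choose_spec V.exists_isCompl
  set K := Classical.choose V.exists_isCompl
  have h1 : finrank ℂ K = n - finrank ℂ V := by
    have := Submodule.finrank_add_eq_of_isCompl hK
    rw [Module.finrank_pi, Fintype.card_fin] at this
    omega
  have h2 : dil V c = (V.prodEquivOfIsCompl K hK).toLinearMap ∘ₗ
      ((LinearMap.id : V →ₗ[ℂ] V).prodMap (c • (LinearMap.id : K →ₗ[ℂ] K))) ∘ₗ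
        (V.prodEquivOfIsCompl K hK).symm.toLinearMap := by
    refine LinearMap.ext fun y => ?_
    obtain ⟨⟨v, k⟩, rfl⟩ := (V.prodEquivOfIsCompl K hK).surjective y
    have h3 : pr V (v + k : E n) = v := by
      rw [map_add, pr_of_mem v.2]
      have : pr V (k : E n) = 0 := Submodule.projection_apply_right hK k
      rw [this, add_zero]
    simp only [LinearMap.comp_apply, coe_coe, LinearEquiv.symm_apply_apply]
    simp only [Submodule.coe_prodEquivOfIsCompl', LinearMap.prodMap_apply, LinearMap.id_apply, LinearMap.smul_apply,
      dil_apply, co_apply, h3, Submodule.coe_smul]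
    congr 2
    abel
  rw [h2, LinearMap.det_conj, LinearMap.det_prodMap, LinearMap.det_id, one_mul, LinearMap.det_smul,
    LinearMap.det_id, mul_one, h1]

theorem continuous_lin {F : Type*} [AddCommGroup F] [Module ℂ F] [TopologicalSpace F] [IsTopologicalAddGroup F]
    [ContinuousSMul ℂ F] (l : E n →ₗ[ℂ] F) : Continuous l := l.continuous_of_finiteDimensional

variable {V} in
theorem lintegral_dil {c : ℂ} (hc : c ≠ 0) (F : E n → ℝ≥0∞) (S : Set (E n)) :
    ∫⁻ y in S, F y = ofReal (‖c‖ ^ (2 * (n - finrank ℂ V))) *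
      ∫⁻ y in dil V c ⁻¹' S, F (dil V c y) := by
  set T : E n →ₗ[ℝ] E n := (dil V c).restrictScalars ℝ with hT
  have hTc : ∀ y, T y = dil V c y := fun _ => rfl
  set γ := n - finrank ℂ V
  have hdet : LinearMap.det T = ‖c‖ ^ (2 * γ) := by
    rw [hT, LinearMap.det_restrictScalars, det_dil, Algebra.norm_complex_apply, normSq_eq_norm_sq, norm_pow]
    ring
  have hpos : 0 < ‖c‖ ^ (2 * γ) := pow_pos (norm_pos_iff.2 hc) _
  have hm := Measure.map_linearMap_addHaar_eq_smul_addHaar (volume : Measure (E n)) (f := T) (by rw [hdet]; exact hpos.ne')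
  rw [hdet, abs_of_pos (inv_pos.2 hpos)] at hm
  have he : MeasurableEmbedding (dil V c) := by
    let e : E n ≃ₜ E n :=
      { toFun := dil V c
        invFun := dil V c⁻¹
        left_inv := fun y => by rw [dil_dil, inv_mul_cancel₀ hc, dil_one]
        right_inv := fun y => by rw [dil_dil, mul_inv_cancel₀ hc, dil_one]
        continuous_toFun := continuous_lin _
        continuous_invFun := continuous_lin _ }
    exact e.measurableEmbedding
  have h2 : (volume : Measure (E n)) = ofReal (‖c‖ ^ (2 * γ)) • Measure.map (dil V c) volume := by
    have : Measure.map (dil V c) volume = Measure.map T volume := rfl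
    rw [this, hm, smul_smul, ← ENNReal.ofReal_mul hpos.le, mul_inv_cancel₀ hpos.ne', ENNReal.ofReal_one, one_smul]
  conv_lhs => rw [h2]
  rw [Measure.restrict_smul, lintegral_smul_measure, he.restrict_map, he.lintegral_map, smul_eq_mul]

end

section

theorem exists_leading {R : ℝ} (hR : 1 < R) {k : ℕ} {C M : ℝ} {φ : ℂ → ℂ}
    (hφ : DifferentiableOn ℂ φ (ball 0 R)) (h : ∀ᶠ t in nhdsWithin 0 {0}ᶜ, ‖φ t‖ ≤ C * ‖t‖ ^ k)
    (hM : ∀ t, ‖t‖ = 1 → ‖φ t‖ ≤ M) :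
    ∃ a : ℂ, ∀ t : ℂ, ‖t‖ ≤ 1 / 2 → ‖φ t - a * t ^ k‖ ≤ 12 * M * ‖t‖ ^ (k + 1) := by
  have hR0 : 0 < R := by linarith
  obtain ⟨ψ, hψ, hE⟩ := exists_eq_pow_mul hR0 hφ h
  have hψd : DifferentiableAt ℂ ψ 0 := hψ.differentiableAt (ball_mem_nhds _ hR0)
  have ha : ‖ψ 0‖ ≤ 3 * M := by
    refine le_of_tendsto (hψd.continuousAt.norm.tendsto.mono_left nhdsWithin_le_nhds)
      (?_ : ∀ᶠ t in nhdsWithin 0 {0}ᶜ, ‖ψ t‖ ≤ 3 * M)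
    filter_upwards [self_mem_nhdsWithin, nhdsWithin_le_nhds (closedBall_mem_nhds (0 : ℂ) (ε := 1 / 2) (by norm_num))]
      with t ht0 ht
    have h1 := norm_le_of_order hR hφ h hM (t := t) (by simpa using ht)
    rw [hE t, norm_mul, norm_pow, mul_comm] at h1
    exact le_of_mul_le_mul_right h1 (pow_pos (norm_pos_iff.2 ht0) k)
  refine ⟨ψ 0, fun t ht => ?_⟩
  have h2 := norm_le_of_order hR (k := k + 1) (M := 4 * M) (C := ‖deriv ψ 0‖ + 1)
    (φ := fun t => φ t - ψ 0 * t ^ k) (hφ.sub ((differentiable_id.pow k).const_mul (ψ 0)).differentiableOn) ?_ ?_ ht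
  · linarith
  · have h3 : (fun t => ψ t - ψ 0) =O[nhds 0] fun t => t - 0 := hψd.isBigO_sub
    have h4 := hψd.hasDerivAt.isLittleO
    filter_upwards [nhdsWithin_le_nhds (h4.bound one_pos)] with t ht
    have h5 : ‖ψ t - ψ 0‖ ≤ (‖deriv ψ 0‖ + 1) * ‖t‖ := by
      simp only [sub_zero, smul_eq_mul, one_mul] at ht
      have := norm_add_le (ψ t - ψ 0 - t * deriv ψ 0) (t * deriv ψ 0)
      rw [sub_add_cancel, norm_mul] at this
      linarith
    rw [hE t, show t ^ k * ψ t - ψ 0 * t ^ k = t ^ k * (ψ t - ψ 0) by ring, norm_mul, norm_pow, pow_succ]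
    nlinarith [pow_nonneg (norm_nonneg t) k]
  · intro s hs
    refine (norm_sub_le _ _).trans ?_
    rw [norm_mul, norm_pow, hs, one_pow, mul_one]
    linarith [hM s hs]

section
variable {ι K : Type*} [AddCommGroup K] [Module ℂ K] (L : ι → K →ₗ[ℂ] ℂ)

/-- The flat cut out by the forms with index in `I`. -/
def flat (I : Set ι) : Submodule ℂ K := ⨅ i ∈ I, ker (L i)

variable {L} in
theorem mem_flat {I : Set ι} {y : K} : y ∈ flat L I ↔ ∀ i ∈ I, L i y = 0 := by
  simp [flat]

/-- The number of hyperplanes containing `V`. -/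
def mlt [Fintype ι] (V : Submodule ℂ K) : ℕ := (univ.filter fun i => V ≤ ker (L i)).card

end

variable {ι : Type*} (L : ι → E n →ₗ[ℂ] ℂ)

/-- Vanishing to order `k` along `V` near `x`, for germs. -/
def Ord (V : Submodule ℂ (E n)) (k : ℕ) (x : E n) (g : E n → ℂ) : Prop :=
  ∃ C : ℝ, ∀ᶠ y in nhds x, ‖g y‖ ≤ C * ‖co V y‖ ^ k

theorem Ord.zero (V : Submodule ℂ (E n)) {x : E n} {g : E n → ℂ} (hg : ContinuousAt g x) : Ord V 0 x g := by
  refine ⟨‖g x‖ + 1, ?_⟩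
  have h3 : ∀ᶠ y in nhds x, ‖g y‖ < ‖g x‖ + 1 := hg.norm.eventually_lt continuousAt_const (by simp)
  filter_upwards [h3] with y hy
  simpa using hy.le

theorem Ord.eventually {V : Submodule ℂ (E n)} {k : ℕ} {x : E n} {g : E n → ℂ} (h : Ord V k x g) :
    ∀ᶠ y in nhds x, Ord V k y g := by
  obtain ⟨C, hC⟩ := h
  filter_upwards [hC.eventually_nhds] with y hy using ⟨C, hy⟩

theorem exists_norm_lin_le (l : E n →ₗ[ℂ] E n) : ∃ A : ℝ, 0 < A ∧ ∀ y, ‖l y‖ ≤ A * ‖y‖ := by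
  refine ⟨‖toContinuousLinearMap l‖ + 1, by positivity, fun y => ?_⟩
  have := (toContinuousLinearMap l).le_opNorm y
  rw [LinearMap.coe_toContinuousLinearMap'] at this
  nlinarith [norm_nonneg y]

theorem dil_near {V : Submodule ℂ (E n)} {x : E n} (hx : x ∈ V) {U : Set (E n)} (hU : U ∈ nhds x) :
    ∀ᶠ y in nhds x, ∀ c : ℂ, ‖c‖ ≤ 2 → dil V c y ∈ U := by
  obtain ⟨r, hr, hrU⟩ := Metric.mem_nhds_iff.1 hU
  obtain ⟨A, hA, hA'⟩ := exists_norm_lin_le (pr V)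
  obtain ⟨B, hB, hB'⟩ := exists_norm_lin_le (co V)
  filter_upwards [ball_mem_nhds x (ε := r / (A + 2 * B)) (by positivity)] with y hy c hc
  apply hrU
  rw [mem_ball_iff_norm] at hy ⊢
  have h1 : dil V c y - x = pr V (y - x) + c • co V (y - x) := by
    rw [map_sub, map_sub, pr_of_mem hx, co_eq_zero_iff.2 hx, dil_apply, sub_zero]; abel
  rw [h1]
  refine (norm_add_le _ _).trans_lt ?_
  rw [norm_smul]
  rw [lt_div_iff₀ (by positivity)] at hy
  have h2 : ‖c‖ * ‖co V (y - x)‖ ≤ 2 * (B * ‖y - x‖) :=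
    mul_le_mul hc (hB' _) (norm_nonneg _) (by norm_num)
  nlinarith [hA' (y - x)]

theorem differentiableOn_dil {V : Submodule ℂ (E n)} {U : Set (E n)} {g : E n → ℂ}
    (hg : DifferentiableOn ℂ g U) {y : E n} (hy : ∀ c : ℂ, ‖c‖ ≤ 2 → dil V c y ∈ U) :
    DifferentiableOn ℂ (fun c => g (dil V c y)) (ball 0 2) := by
  have h1 : Differentiable ℂ fun c : ℂ => dil V c y := by
    show Differentiable ℂ fun c : ℂ => pr V y + c • (co V y)
    fun_prop
  exact hg.comp h1.differentiableOn fun c hc => hy c (mem_ball_zero_iff.1 hc).le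

theorem ae_prod_ne_zero [Fintype ι] (hL : ∀ i, L i ≠ 0) : ∀ᵐ y : E n, ∏ i, L i y ≠ 0 := by
  simp only [Finset.prod_ne_zero_iff, mem_univ, true_imp_iff]
  rw [ae_all_iff]
  intro i
  have h1 : (ker (L i)).restrictScalars ℝ ≠ ⊤ := by
    intro h
    apply hL i
    rw [← LinearMap.ker_eq_top]
    exact (Submodule.restrictScalars_eq_top_iff ℝ ℂ (E n)).1 h
  have h2 := Measure.addHaar_submodule (volume : Measure (E n)) _ h1
  rw [ae_iff]
  refine measure_mono_null (fun y hy => ?_) h2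
  simpa using hy

theorem isPol_prod [Fintype ι] : IsPol (card ι) (fun y => ∏ i, L i y) := by
  exact IsPol.prod univ L

theorem lin_dil {V : Submodule ℂ (E n)} {l : E n →ₗ[ℂ] ℂ} (h : V ≤ ker l) (c : ℂ) (y : E n) :
    l (dil V c y) = c * l y := by
  have h1 : ∀ z, l (pr V z) = 0 := fun z => h (pr_mem V z)
  have h2 : l y = l (co V y) := by
    conv_lhs => rw [← pr_add_co V y, map_add, h1, zero_add]
  rw [dil_apply, map_add, h1, zero_add, map_smul, smul_eq_mul, h2]

end

section

variable {ι : Type*} {L : ι → E n →ₗ[ℂ] ℂ}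

theorem Ord.of_leading {V : Submodule ℂ (E n)} {x : E n} (hx : x ∈ V) {g : E n → ℂ} {k : ℕ} {B : ℝ}
    (h : ∀ᶠ y in nhds x, ∀ t : ℂ, ‖t‖ ≤ 1 / 2 → ‖g (dil V t y)‖ ≤ B * ‖t‖ ^ (k + 1)) : Ord V (k + 1) x g := by
  obtain ⟨r, hr, hrU⟩ := Metric.eventually_nhds_iff_ball.1 h
  obtain ⟨A, hA, hA'⟩ := exists_norm_lin_le (pr V)
  obtain ⟨A2, hA2, hA2'⟩ := exists_norm_lin_le (co V)
  refine ⟨B / (r / 2) ^ (k + 1), ?_⟩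
  filter_upwards [ball_mem_nhds x (ε := r / (2 * A)) (by positivity),
    ball_mem_nhds x (ε := r / 4 / A2) (by positivity), ball_mem_nhds x hr] with z hz hz2 hz3
  rw [mem_ball_iff_norm, lt_div_iff₀ (by positivity)] at hz hz2
  rcases eq_or_ne (co V z) 0 with h0 | h0
  · have h1 := hrU z hz3 0 (by simp)
    rw [dil_apply, h0, smul_zero, add_zero, pr_of_mem (co_eq_zero_iff.1 h0)] at h1
    simpa [h0] using h1
  have hs : 0 < ‖co V z‖ := norm_pos_iff.2 h0
  have h2 : dil V ((r / 2 / ‖co V z‖ : ℝ) : ℂ) z - x = pr V (z - x) + ((r / 2 / ‖co V z‖ : ℝ) : ℂ) • co V z := by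
    rw [map_sub, pr_of_mem hx, dil_apply]; abel
  have h3 : ‖((r / 2 / ‖co V z‖ : ℝ) : ℂ) • co V z‖ = r / 2 := by
    rw [norm_smul, Complex.norm_of_nonneg (by positivity)]; field_simp
  have h4 : dil V ((r / 2 / ‖co V z‖ : ℝ) : ℂ) z ∈ ball x r := by
    rw [mem_ball_iff_norm, h2]
    refine (norm_add_le _ _).trans_lt ?_
    rw [h3]
    nlinarith [hA' (z - x)]
  have h5 : ‖co V z‖ ≤ A2 * ‖z - x‖ := by
    have := hA2' (z - x)
    rwa [map_sub, co_eq_zero_iff.2 hx, sub_zero] at this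
  have hn : ‖((‖co V z‖ / (r / 2) : ℝ) : ℂ)‖ = ‖co V z‖ / (r / 2) := Complex.norm_of_nonneg (by positivity)
  have h6 := hrU _ h4 ((‖co V z‖ / (r / 2) : ℝ) : ℂ) (by
    rw [hn, div_le_iff₀ (by positivity)]
    linarith)
  rw [dil_dil, ← Complex.ofReal_mul, hn, show ‖co V z‖ / (r / 2) * (r / 2 / ‖co V z‖) = 1 by field_simp,
    Complex.ofReal_one, dil_one, div_pow] at h6
  calc _ ≤ _ := h6
    _ = _ := by ring

theorem volume_dil {V : Submodule ℂ (E n)} {t : ℝ} (ht : 0 < t) (B : Set (E n)) :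
    volume (dil V ((t⁻¹ : ℝ) : ℂ) ⁻¹' B) = ofReal (t ^ (2 * (n - finrank ℂ V))) * volume B := by
  have h1 : (t : ℂ) ≠ 0 := by exact_mod_cast ht.ne'
  have := lintegral_dil (V := V) h1 (fun _ => 1) (dil V ((t⁻¹ : ℝ) : ℂ) ⁻¹' B)
  simp only [lintegral_one, Measure.restrict_apply_univ] at this
  rw [this, Complex.norm_of_nonneg ht.le, ← Set.preimage_comp]
  congr 2
  ext y
  simp only [Set.mem_preimage, Function.comp, dil_dil]
  rw [Complex.ofReal_inv, inv_mul_cancel₀ h1, dil_one]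

theorem norm_prod_dil_le [Fintype ι] {V : Submodule ℂ (E n)} {K t : ℝ} (hK : 1 ≤ K) (ht : 0 < t) {y : E n}
    (h1 : ∀ i, ‖L i y‖ ≤ K) (h2 : ∀ i, ‖L i (dil V (t : ℂ) y)‖ ≤ K) :
    ‖∏ i, L i (dil V (t : ℂ) y)‖ ≤ t ^ mlt L V * K ^ card ι := by
  have hK0 : 0 < K := by linarith
  rw [norm_prod, mlt, Finset.card_filter, ← Finset.prod_pow_eq_pow_sum, card, Finset.card_eq_sum_ones,
    ← Finset.prod_pow_eq_pow_sum, ← Finset.prod_mul_distrib]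
  refine Finset.prod_le_prod (fun _ _ => norm_nonneg _) fun i _ => ?_
  split_ifs with h
  · rw [lin_dil h, norm_mul, Complex.norm_of_nonneg ht.le, pow_one, pow_one]
    exact mul_le_mul_of_nonneg_left (h1 i) ht.le
  · simpa using h2 i

theorem Ord.succ [Fintype ι] (hL : ∀ i, L i ≠ 0) {β : ℝ} (hβ : 0 ≤ β) {V : Submodule ℂ (E n)} {x : E n}
    (hx : x ∈ V) (hγ : finrank ℂ V < n) {U : Set (E n)} (hU : U ∈ nhds x) {g : E n → ℂ}
    (hg : DifferentiableOn ℂ g U)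
    (hF : FinAt (fun y => ofReal (‖g y‖ ^ 2 * ‖∏ i, L i y‖ ^ (-2 * β))) x) {j : ℕ}
    (hj : (j : ℝ) + (n - finrank ℂ V : ℕ) ≤ β * mlt L V) (ho : Ord V j x g) : Ord V (j + 1) x g := by
  obtain ⟨C, hC⟩ := ho
  obtain ⟨W, hW, hWF⟩ := hF
  have hgx : ContinuousAt g x := (hg.differentiableAt hU).continuousAt
  have hB : ∀ᶠ y in nhds x, ‖g y‖ < ‖g x‖ + 1 := hgx.norm.eventually_lt continuousAt_const (by simp)
  have hK : ∀ᶠ y in nhds x, ∀ i, ‖L i y‖ ≤ 1 + ∑ i, ‖L i x‖ := by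
    rw [eventually_all]
    intro i
    have h1 : ContinuousAt (fun y => ‖L i y‖) x := (continuous_lin (L i)).norm.continuousAt
    have h2 := single_le_sum (f := fun i => ‖L i x‖) (fun _ _ => norm_nonneg _) (mem_univ i)
    filter_upwards [h1.eventually_lt (g := fun _ => 1 + ∑ i, ‖L i x‖) continuousAt_const (by linarith)] with y hy using hy.le
  set K : ℝ := 1 + ∑ i, ‖L i x‖
  have hK1 : 1 ≤ K := by
    have := Finset.sum_nonneg (s := univ) (f := fun i => ‖L i x‖) fun _ _ => norm_nonneg _
    simp only [K]; linarith
  set B : ℝ := ‖g x‖ + 1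
  have hM := dil_near hx (inter_mem (inter_mem (interior_mem_nhds.2 hU) hW) (hC.and (hB.and hK)))
  have key : ∀ y, (∀ c : ℂ, ‖c‖ ≤ 2 → dil V c y ∈ interior U ∩ W ∩ {y | ‖g y‖ ≤ C * ‖co V y‖ ^ j ∧
      ‖g y‖ < B ∧ ∀ i, ‖L i y‖ ≤ K}) →
      ∃ a : ℂ, ∀ t : ℂ, ‖t‖ ≤ 1 / 2 → ‖g (dil V t y) - a * t ^ j‖ ≤ 12 * B * ‖t‖ ^ (j + 1) := by
    intro y hy
    refine exists_leading (φ := fun c => g (dil V c y)) one_lt_two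
      (differentiableOn_dil hg fun c hc => interior_subset (hy c hc).1.1) (C := C * ‖co V y‖ ^ j) ?_ ?_
    · filter_upwards [nhdsWithin_le_nhds (closedBall_mem_nhds (0 : ℂ) (ε := 2) (by norm_num))] with c hc
      have h1 := (hy c (by simpa using hc)).2.1
      rw [co_dil, norm_smul, mul_pow] at h1
      linarith
    · intro c hc
      exact (hy c (by rw [hc]; norm_num)).2.2.1.le
  choose! a ha using key
  by_cases hcase : ∀ᶠ y in nhds x, a y = 0
  · refine Ord.of_leading hx (B := 12 * B) ?_
    filter_upwards [hM, hcase] with y hy h0 t ht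
    simpa [h0] using ha y hy t ht
  exfalso
  obtain ⟨y₀, h0, hy₀⟩ := ((Filter.not_eventually.1 hcase).and_eventually hM.eventually_nhds).exists
  have h0' : 0 < ‖a y₀‖ := norm_pos_iff.2 h0
  have hB0 : 0 < B := by positivity
  obtain ⟨t₁, ht₁, ht₁2, ht₁3⟩ : ∃ t₁ : ℝ, 0 < t₁ ∧ t₁ ≤ 1 / 2 ∧ 12 * B * t₁ ≤ ‖a y₀‖ / 8 := by
    refine ⟨min (1 / 2) (‖a y₀‖ / 8 / (12 * B)), by positivity, min_le_left _ _, ?_⟩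
    have := min_le_right (1 / 2) (‖a y₀‖ / 8 / (12 * B))
    rwa [le_div_iff₀' (by positivity)] at this
  have hnt : ∀ t : ℝ, 0 < t → ‖(t : ℂ)‖ = t := fun t ht => Complex.norm_of_nonneg ht.le
  have happ : ∀ y, (∀ c : ℂ, ‖c‖ ≤ 2 → dil V c y ∈ interior U ∩ W ∩ {y | ‖g y‖ ≤ C * ‖co V y‖ ^ j ∧
      ‖g y‖ < B ∧ ∀ i, ‖L i y‖ ≤ K}) → ∀ t : ℝ, 0 < t → t ≤ t₁ →
      ‖g (dil V (t : ℂ) y) - a y * (t : ℂ) ^ j‖ ≤ ‖a y₀‖ / 8 * t ^ j := by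
    intro y hy t ht htt
    have h1 := ha y hy t (by rw [hnt t ht]; linarith)
    rw [hnt t ht, pow_succ] at h1
    have h2 : 0 < t ^ j := by positivity
    have h3 : 12 * B * t ≤ ‖a y₀‖ / 8 := by nlinarith
    nlinarith
  have hna : ∀ y, ∀ t : ℝ, 0 < t → ‖a y * (t : ℂ) ^ j‖ = ‖a y‖ * t ^ j := fun y t ht => by
    rw [norm_mul, norm_pow, hnt t ht]
  have hy₀' := hy₀.self_of_nhds
  have hcont : ContinuousAt (fun y => ‖g (dil V (t₁ : ℂ) y)‖) y₀ := by
    have h1 := (hy₀' t₁ (by rw [hnt _ ht₁]; linarith)).1.1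
    have h2 : ContinuousAt g (dil V (t₁ : ℂ) y₀) := (hg.differentiableAt (mem_interior_iff_mem_nhds.1 h1)).continuousAt
    exact (ContinuousAt.comp (f := fun y => dil V (t₁ : ℂ) y) h2 (continuous_lin _).continuousAt).norm
  have hlow : ∀ᶠ y in nhds y₀, 6 / 8 * ‖a y₀‖ * t₁ ^ j < ‖g (dil V (t₁ : ℂ) y)‖ := by
    refine continuousAt_const.eventually_lt hcont ?_
    have h1 := happ y₀ hy₀' t₁ ht₁ le_rfl
    have h2 := norm_sub_norm_le (a y₀ * (t₁ : ℂ) ^ j) (a y₀ * (t₁ : ℂ) ^ j - g (dil V (t₁ : ℂ) y₀))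
    rw [sub_sub_cancel, hna _ _ ht₁, norm_sub_rev] at h2
    have h3 : 0 < ‖a y₀‖ * t₁ ^ j := by positivity
    linarith
  obtain ⟨r, hr, hrB⟩ := Metric.eventually_nhds_iff_ball.1 (hy₀.and hlow)
  have hglow : ∀ y ∈ ball y₀ r, ∀ t : ℝ, 0 < t → t ≤ t₁ → ‖a y₀‖ / 4 * t ^ j ≤ ‖g (dil V (t : ℂ) y)‖ := by
    intro y hy t ht htt
    obtain ⟨h1, h2⟩ := hrB y hy
    have h3 := happ y h1 t₁ ht₁ le_rfl
    have h4 := norm_sub_norm_le (g (dil V (t₁ : ℂ) y)) (g (dil V (t₁ : ℂ) y) - a y * (t₁ : ℂ) ^ j)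
    rw [sub_sub_cancel, hna _ _ ht₁] at h4
    have h5 : ‖a y₀‖ * (5 / 8) ≤ ‖a y‖ := by
      have : 0 < t₁ ^ j := by positivity
      refine le_of_mul_le_mul_right (?_ : _ * t₁ ^ j ≤ _) this
      linarith
    have h6 := happ y h1 t ht htt
    have h7 := norm_sub_norm_le (a y * (t : ℂ) ^ j) (a y * (t : ℂ) ^ j - g (dil V (t : ℂ) y))
    rw [sub_sub_cancel, hna _ _ ht, norm_sub_rev] at h7
    have h8 : 0 < t ^ j := by positivity
    nlinarith
  set S : ℝ → Set (E n) := fun t => dil V ((t⁻¹ : ℝ) : ℂ) ⁻¹' ball y₀ r with hS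
  have hSz : ∀ t : ℝ, 0 < t → ∀ z, z = dil V (t : ℂ) (dil V ((t⁻¹ : ℝ) : ℂ) z) := by
    intro t ht z
    rw [dil_dil, ← Complex.ofReal_mul, mul_inv_cancel₀ ht.ne', Complex.ofReal_one, dil_one]
  have hSm : ∀ t, MeasurableSet (S t) := fun t => ((continuous_lin _).isOpen_preimage _ Metric.isOpen_ball).measurableSet
  have hSW : ∀ t : ℝ, 0 < t → t ≤ t₁ → S t ⊆ W := by
    intro t ht htt z hz
    rw [hSz t ht z]
    exact ((hrB _ hz).1 t (by rw [hnt t ht]; linarith)).1.2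
  set c : ℝ := (‖a y₀‖ / 4) ^ 2 * (K ^ card ι) ^ (-2 * β) with hc
  have hc0 : 0 < c := by positivity
  have hfin : ∀ t : ℝ, 0 < t → t ≤ t₁ →
      ofReal c * volume (ball y₀ r) ≤
        ∫⁻ y in S t, ofReal (‖g y‖ ^ 2 * ‖∏ i, L i y‖ ^ (-2 * β)) := by
    intro t ht htt
    have h1 : ∀ᵐ y ∂(volume : Measure (E n)).restrict (S t),
        ofReal ((‖a y₀‖ / 4 * t ^ j) ^ 2 * (t ^ mlt L V * K ^ card ι) ^ (-2 * β)) ≤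
        ofReal (‖g y‖ ^ 2 * ‖∏ i, L i y‖ ^ (-2 * β)) := by
      filter_upwards [ae_restrict_mem (hSm t), ae_restrict_of_ae (ae_prod_ne_zero L hL)] with z hz hz0
      apply ofReal_le_ofReal
      have h2 := hrB _ hz
      rw [hSz t ht z] at hz0 ⊢
      refine mul_le_mul (pow_le_pow_left₀ (by positivity) (hglow _ hz t ht htt) 2) ?_ (by positivity) (by positivity)
      refine Real.rpow_le_rpow_of_nonpos (norm_pos_iff.2 hz0) (norm_prod_dil_le hK1 ht ?_ ?_) (by linarith)
      · have := (h2.1 1 (by norm_num)).2.2.2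
        rwa [dil_one] at this
      · exact (h2.1 t (by rw [hnt t ht]; linarith)).2.2.2
    refine le_trans ?_ (lintegral_mono_ae h1)
    rw [lintegral_const, Measure.restrict_apply_univ, volume_dil ht, ← mul_assoc]
    refine mul_le_mul_left ?_ _
    rw [← ENNReal.ofReal_mul (by positivity)]
    apply ofReal_le_ofReal
    have h3 : (1 : ℝ) ≤ t ^ (2 * (j + (n - finrank ℂ V : ℕ) - β * mlt L V) : ℝ) :=
      Real.one_le_rpow_of_pos_of_le_one_of_nonpos ht (by linarith) (by linarith)
    have h4 : t ^ (2 * (j + (n - finrank ℂ V : ℕ) - β * mlt L V) : ℝ) =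
        t ^ (2 * j) * t ^ (2 * (n - finrank ℂ V)) * (t ^ mlt L V) ^ (-2 * β) := by
      rw [← Real.rpow_natCast t (2 * j), ← Real.rpow_natCast t (2 * (n - _)), ← Real.rpow_natCast t (mlt L V),
        ← Real.rpow_mul ht.le, ← rpow_add ht, ← rpow_add ht]
      congr 1
      push_cast
      ring
    rw [mul_rpow (by positivity) (by positivity)]
    calc c = c * 1 := (mul_one c).symm
      _ ≤ c * _ := mul_le_mul_of_nonneg_left h3 hc0.le
      _ = _ := by rw [h4, hc]; ring
  have hlim : Tendsto (fun t => ∫⁻ y in S t, ofReal (‖g y‖ ^ 2 * ‖∏ i, L i y‖ ^ (-2 * β))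
      ∂(volume : Measure (E n)).restrict W) (nhdsWithin 0 (Set.Ioi 0)) (nhds 0) := by
    refine tendsto_setLIntegral_zero hWF ?_
    refine tendsto_of_tendsto_of_tendsto_of_le_of_le' tendsto_const_nhds
      (h := fun t => ofReal (t ^ (2 * (n - finrank ℂ V))) * volume (ball y₀ r)) ?_
      (Eventually.of_forall fun _ => zero_le) ?_
    · rw [← zero_mul (volume (ball y₀ r))]
      refine ENNReal.Tendsto.mul_const ?_ (Or.inr measure_ball_lt_top.ne)
      rw [← ENNReal.ofReal_zero]
      refine (ENNReal.continuous_ofReal.tendsto 0).comp ?_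
      have : Tendsto (fun t : ℝ => t ^ (2 * (n - finrank ℂ V))) (nhds 0) (nhds 0) := by
        have h := (continuous_pow (M := ℝ) (2 * (n - finrank ℂ V))).tendsto 0
        rwa [zero_pow (by omega)] at h
      exact this.mono_left nhdsWithin_le_nhds
    · filter_upwards [self_mem_nhdsWithin] with t ht
      rw [← volume_dil ht]
      exact Measure.restrict_apply_le _ _
  have hbad : ofReal c * volume (ball y₀ r) ≤ 0 := by
    refine ge_of_tendsto hlim ?_
    filter_upwards [Ioc_mem_nhdsGT ht₁] with t ht
    rw [Measure.restrict_restrict (hSm t), Set.inter_eq_self_of_subset_left (hSW t ht.1 ht.2)]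
    exact hfin t ht.1 ht.2
  have hpos : 0 < ofReal c * volume (ball y₀ r) :=
    ENNReal.mul_pos (by simpa using hc0) (Metric.measure_ball_pos _ _ hr).ne'
  exact absurd hbad (not_le.2 hpos)

/-- Integrability forces vanishing along the flats. -/
theorem Ord.of_finAt [Fintype ι] (hL : ∀ i, L i ≠ 0) {β : ℝ} (hβ : 0 ≤ β) {V : Submodule ℂ (E n)} {x : E n}
    (hx : x ∈ V) (hγ : finrank ℂ V < n) {U : Set (E n)} (hU : U ∈ nhds x) {g : E n → ℂ}
    (hg : DifferentiableOn ℂ g U)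
    (hF : FinAt (fun y => ofReal (‖g y‖ ^ 2 * ‖∏ i, L i y‖ ^ (-2 * β))) x) {k : ℕ}
    (hk : (k : ℝ) - 1 + (n - finrank ℂ V : ℕ) ≤ β * mlt L V) : Ord V k x g := by
  induction k with
  | zero => exact Ord.zero V (hg.differentiableAt hU).continuousAt
  | succ k ih =>
    push_cast at hk
    exact (ih (by linarith)).succ hL hβ hx hγ hU hg hF (by linarith)

end

theorem lintegral_shell_le {V : Submodule ℂ (E n)} {U : Set (E n)} {g : E n → ℂ} (hg : DifferentiableOn ℂ g U)
    {S : Set (E n)} (hSm : MeasurableSet S) (hSr : ∀ y ∈ S, ∀ θ : ℝ, dil V (Complex.exp (θ * I)) y ∈ S)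
    (hSU : ∀ y ∈ S, ∀ c : ℂ, ‖c‖ ≤ 2 → dil V c y ∈ U) {C : ℝ} {k : ℕ} (hO : ∀ z ∈ U, ‖g z‖ ≤ C * ‖co V z‖ ^ k)
    {h : E n → ℝ} (hh0 : ∀ y, 0 ≤ h y) (hhm : Measurable h) {s : ℝ}
    (hhs : ∀ c : ℂ, c ≠ 0 → ∀ y, h (dil V c y) = ‖c‖ ^ (-s) * h y) {c : ℂ} (hc0 : c ≠ 0) (hc : ‖c‖ ≤ 1 / 2) :
    ∫⁻ y in dil V c⁻¹ ⁻¹' S, ofReal (‖g y‖ ^ 2 * h y) ≤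
      ofReal (‖c‖ ^ (2 * ((n - finrank ℂ V : ℕ) + k) - s : ℝ) * (2 * pi)) *
        ∫⁻ y in S, ofReal (‖g y‖ ^ 2 * h y) := by
  have hcn : 0 < ‖c‖ := norm_pos_iff.2 hc0
  have hpre : dil V c ⁻¹' (dil V c⁻¹ ⁻¹' S) = S := by
    rw [← Set.preimage_comp]
    ext y
    simp [Function.comp, dil_dil, inv_mul_cancel₀ hc0, dil_one]
  rw [lintegral_dil (V := V) hc0, hpre]
  have hexp : ∀ θ : ℝ, ‖Complex.exp (θ * I)‖ = 1 := norm_exp_ofReal_mul_I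
  have hcirc : ∀ θ : ℝ, ∫⁻ y in S, ofReal (‖g (dil V (Complex.exp (θ * I)) y)‖ ^ 2 * h y) =
      ∫⁻ y in S, ofReal (‖g y‖ ^ 2 * h y) := by
    intro θ
    rw [lintegral_dil (V := V) (exp_ne_zero (θ * I)) (fun y => ofReal (‖g y‖ ^ 2 * h y)),
      hexp, one_pow, ENNReal.ofReal_one, one_mul]
    have h1 : dil V (Complex.exp (θ * I)) ⁻¹' S = S := by
      ext y
      refine ⟨fun hy => ?_, fun hy => hSr y hy θ⟩
      have h2 := hSr _ hy (-θ)
      rw [dil_dil, ← Complex.exp_add, Complex.ofReal_neg, neg_mul, neg_add_cancel, Complex.exp_zero, dil_one] at h2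
      exact h2
    rw [h1]
    simp_rw [hhs _ (exp_ne_zero _), hexp, Real.one_rpow, one_mul]
  have hcont : ∀ y ∈ S, Continuous fun θ : ℝ => ‖g (dil V (Complex.exp (θ * I)) y)‖ ^ 2 := by
    intro y hy
    have h1 := (differentiableOn_dil hg (hSU y hy)).continuousOn
    have h2 : Continuous fun θ : ℝ => Complex.exp (θ * I) := by fun_prop
    exact ((h1.comp_continuous h2 fun θ => by rw [mem_ball_zero_iff, hexp]; norm_num).norm).pow 2
  have hpt : ∀ y ∈ S, ofReal (‖g (dil V c y)‖ ^ 2 * h (dil V c y)) ≤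
      ofReal (‖c‖ ^ (2 * (k : ℝ) - s)) *
        ∫⁻ θ in Ioc 0 (2 * pi), ofReal (‖g (dil V (Complex.exp (θ * I)) y)‖ ^ 2 * h y) := by
    intro y hy
    have h1 := sq_norm_le_average one_lt_two (k := k) (C := C * ‖co V y‖ ^ k) (differentiableOn_dil hg (hSU y hy)) (by
      filter_upwards [nhdsWithin_le_nhds (closedBall_mem_nhds (0 : ℂ) (ε := 2) (by norm_num))] with t ht
      have h1 := hO _ (hSU y hy t (by simpa using ht))
      rw [co_dil, norm_smul, mul_pow] at h1
      linarith) hc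
    have h3 : ∫⁻ θ in Ioc 0 (2 * pi), ofReal (‖g (dil V (Complex.exp (θ * I)) y)‖ ^ 2 * h y) =
        ofReal ((∫ θ in (0 : ℝ)..2 * pi, ‖g (dil V (Complex.exp (θ * I)) y)‖ ^ 2) * h y) := by
      rw [← intervalIntegral.integral_mul_const, intervalIntegral.integral_of_le (by positivity),
        ofReal_integral_eq_lintegral_ofReal]
      · exact (((hcont y hy).mul continuous_const).intervalIntegrable 0 (2 * pi)).1
      · exact Eventually.of_forall fun θ => mul_nonneg (sq_nonneg _) (hh0 y)
    rw [h3, ← ENNReal.ofReal_mul (by positivity), hhs c hc0]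
    apply ofReal_le_ofReal
    rw [Real.rpow_sub hcn, Real.rpow_neg hcn.le, div_eq_mul_inv]
    have h4 : ‖c‖ ^ (2 * (k : ℝ)) = ‖c‖ ^ (2 * k) := by exact_mod_cast Real.rpow_natCast ‖c‖ (2 * k)
    rw [h4]
    have h5 : 0 ≤ (‖c‖ ^ s)⁻¹ * h y := mul_nonneg (by positivity) (hh0 y)
    calc _ ≤ _ := mul_le_mul_of_nonneg_right h1 h5
      _ = _ := by ring
  refine (mul_le_mul_right (setLIntegral_mono' hSm hpt) _).trans ?_
  rw [lintegral_const_mul' _ _ ofReal_ne_top, lintegral_lintegral_swap]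
  · simp_rw [hcirc]
    rw [lintegral_const, Measure.restrict_apply_univ, Real.volume_Ioc, sub_zero,
      mul_comm (∫⁻ y in S, ofReal (‖g y‖ ^ 2 * h y)), ← mul_assoc, ← mul_assoc, ← ENNReal.ofReal_mul (by positivity),
      ← ENNReal.ofReal_mul (by positivity)]
    refine mul_le_mul_left (le_of_eq ?_) _
    congr 2
    rw [← Real.rpow_natCast, ← rpow_add hcn]
    congr 1
    push_cast
    ring
  · rw [Measure.prod_restrict]
    have h1 : ContinuousOn (fun p : E n × ℝ => ‖g (dil V (Complex.exp (p.2 * I)) p.1)‖ ^ 2)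
        (S ×ˢ Ioc 0 (2 * pi)) := by
      have h2 : Continuous fun p : E n × ℝ => dil V (Complex.exp (p.2 * I)) p.1 := by
        have h3 := continuous_lin (pr V)
        have h4 := continuous_lin (co V)
        show Continuous fun p : E n × ℝ => pr V p.1 + Complex.exp (p.2 * I) • (co V p.1)
        fun_prop
      exact (hg.continuousOn.comp h2.continuousOn fun p hp => hSU p.1 hp.1 _ (by rw [hexp]; norm_num)).norm.pow 2
    have h5 : AEMeasurable (fun p : E n × ℝ => h p.1)
        (((volume : Measure (E n)).prod volume).restrict (S ×ˢ Ioc 0 (2 * pi))) :=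
      (hhm.comp measurable_fst).aemeasurable
    exact ((h1.aemeasurable (hSm.prod measurableSet_Ioc)).mul h5).ennreal_ofReal

/-- Integrability at a point of `V` from integrability off `V` and a vanishing order. -/
theorem FinAt.of_shells {V : Submodule ℂ (E n)} (hV : finrank ℂ V < n) {x : E n} (hx : x ∈ V) {g : E n → ℂ}
    {U : Set (E n)} (hU : U ∈ nhds x) (hg : DifferentiableOn ℂ g U) {k : ℕ} (hO : Ord V k x g)
    {h : E n → ℝ} (hh0 : ∀ y, 0 ≤ h y) (hhm : Measurable h) {s : ℝ}
    (hhs : ∀ c : ℂ, c ≠ 0 → ∀ y, h (dil V c y) = ‖c‖ ^ (-s) * h y)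
    (hs : s < 2 * ((n - finrank ℂ V : ℕ) + k))
    (hoff : ∀ᶠ y in nhds x, y ∉ V → FinAt (fun y => ofReal (‖g y‖ ^ 2 * h y)) y) :
    FinAt (fun y => ofReal (‖g y‖ ^ 2 * h y)) x := by
  obtain ⟨C, hC⟩ := hO
  set F : E n → ℝ≥0∞ := fun y => ofReal (‖g y‖ ^ 2 * h y) with hF
  obtain ⟨r, hr, hrB⟩ := Metric.eventually_nhds_iff_ball.1
    ((dil_near hx (inter_mem hU hC)).and hoff)
  have hprc := continuous_lin (pr V)
  have hcoc := continuous_lin (co V)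
  set δ := r / 3
  have hδ : 0 < δ := by positivity
  set S : Set (E n) := {y | ‖pr V y - x‖ ≤ δ ∧ δ / 2 ≤ ‖co V y‖ ∧ ‖co V y‖ ≤ δ} with hS
  have hSb : ∀ y ∈ S, y ∈ ball x r := by
    rintro y ⟨h1, -, h2⟩
    rw [mem_ball_iff_norm]
    have h3 : y - x = (pr V y - x) + co V y := by rw [co_apply]; abel
    rw [h3]
    refine (norm_add_le _ _).trans_lt ?_
    simp only [δ] at h1 h2
    linarith
  have hSc : IsClosed S := by
    exact (isClosed_le (hprc.sub continuous_const).norm continuous_const).inter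
      ((isClosed_le continuous_const hcoc.norm).inter (isClosed_le hcoc.norm continuous_const))
  have hSK : IsCompact S := Metric.isCompact_of_isClosed_isBounded hSc
    (Metric.isBounded_ball.subset fun y hy => hSb y hy)
  have hSfin : ∫⁻ y in S, F y ≠ ⊤ := FinAt.compact hSK fun y hy => (hrB y (hSb y hy)).2 fun hyV => by
    have := hy.2.1
    rw [co_eq_zero_iff.2 hyV, norm_zero] at this
    linarith
  have hSr : ∀ y ∈ S, ∀ θ : ℝ, dil V (Complex.exp (θ * I)) y ∈ S := by
    intro y hy θ
    simp only [hS, Set.mem_ofPred_eq, pr_dil, co_dil, norm_smul, norm_exp_ofReal_mul_I, one_mul]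
    exact hy
  set c : ℕ → ℂ := fun m => ((2 : ℝ) ^ m : ℝ)⁻¹ with hc
  have hcn : ∀ m, ‖c m‖ = (2 ^ m)⁻¹ := fun m => by
    rw [hc]; simp
  have hc0 : ∀ m, c m ≠ 0 := fun m => by simp [hc]
  set e : ℝ := 2 * ((n - finrank ℂ V : ℕ) + k) - s with he
  have he0 : 0 < e := by linarith
  set q : ℝ := (2⁻¹ : ℝ) ^ e
  have hq0 : 0 < q := by positivity
  have hq1 : q < 1 := Real.rpow_lt_one (by norm_num) (by norm_num) he0
  have hshell : ∀ m, ∫⁻ y in dil V (c m)⁻¹ ⁻¹' S, F y ≤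
      ofReal q ^ m * (ofReal (2 * pi) * ∫⁻ y in S, F y) := by
    intro m
    rcases Nat.eq_zero_or_pos m with rfl | hm
    · have h1 : dil V (c 0)⁻¹ ⁻¹' S = S := by ext y; simp [hc, dil_one]
      rw [h1, pow_zero, one_mul]
      refine le_mul_of_one_le_left' ?_
      rw [← ENNReal.ofReal_one]
      exact ofReal_le_ofReal (by linarith [Real.pi_gt_three])
    · have h2 : ‖c m‖ ≤ 1 / 2 := by
        rw [hcn, one_div]
        refine inv_anti₀ two_pos ?_
        exact le_self_pow₀ one_le_two hm.ne'
      refine (lintegral_shell_le (hg.mono Set.inter_subset_left) hSc.measurableSet hSr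
        (fun y hy => (hrB y (hSb y hy)).1) (fun z hz => hz.2) hh0 hhm hhs (hc0 m) h2).trans (le_of_eq ?_)
      rw [ENNReal.ofReal_mul (Real.rpow_nonneg (norm_nonneg _) _), mul_assoc, ← ENNReal.ofReal_pow hq0.le]
      congr 2
      rw [hcn, ← inv_pow, ← Real.rpow_natCast, ← Real.rpow_natCast, ← Real.rpow_mul (by positivity),
        ← Real.rpow_mul (by positivity), mul_comm]
  refine ⟨{y | ‖pr V y - x‖ < δ} ∩ {y | ‖co V y‖ < δ}, ?_, ?_⟩
  · refine inter_mem ((isOpen_lt (by fun_prop) continuous_const).mem_nhds ?_)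
      ((isOpen_lt (by fun_prop) continuous_const).mem_nhds ?_)
    · simpa [pr_of_mem hx] using hδ
    · simpa [co_eq_zero_iff.2 hx] using hδ
  have hcov : {y | ‖pr V y - x‖ < δ} ∩ {y | ‖co V y‖ < δ} ⊆ (V : Set (E n)) ∪ ⋃ m, dil V (c m)⁻¹ ⁻¹' S := by
    rintro y ⟨h1, h2⟩
    by_cases hy : y ∈ V
    · exact Or.inl hy
    right
    have h3 : 0 < ‖co V y‖ := norm_pos_iff.2 fun h => hy (co_eq_zero_iff.1 h)
    obtain ⟨m, hm1, hm2⟩ := exists_nat_pow_near (x := δ / ‖co V y‖) (y := 2) (by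
      rw [le_div_iff₀ h3]; linarith [h2.out]) one_lt_two
    rw [le_div_iff₀ h3] at hm1
    rw [div_lt_iff₀ h3, pow_succ] at hm2
    refine Set.mem_iUnion.2 ⟨m, ?_⟩
    simp only [hS, Set.mem_preimage, Set.mem_ofPred_eq, pr_dil, co_dil, norm_smul, norm_inv, hcn, inv_inv]
    exact ⟨h1.le, by linarith, hm1⟩
  refine ne_top_of_le_ne_top ?_ ((lintegral_mono_set hcov).trans (lintegral_union_le _ _ _))
  have hVnull : ∫⁻ y in (V : Set (E n)), F y = 0 := by
    have h1 : V.restrictScalars ℝ ≠ ⊤ := by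
      intro h
      have : V = ⊤ := (Submodule.restrictScalars_eq_top_iff ℝ ℂ (E n)).1 h
      rw [this, finrank_top] at hV
      simp [E] at hV
    have h2 := Measure.addHaar_submodule (volume : Measure (E n)) _ h1
    exact setLIntegral_measure_zero _ _ h2
  rw [hVnull, zero_add]
  refine ne_top_of_le_ne_top ?_ ((lintegral_iUnion_le _ _).trans (ENNReal.tsum_le_tsum hshell))
  rw [ENNReal.tsum_mul_right, ENNReal.tsum_geometric]
  refine mul_ne_top ?_ (mul_ne_top ofReal_ne_top hSfin)
  refine ENNReal.inv_ne_top.2 (tsub_pos_of_lt ?_).ne'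
  rw [← ENNReal.ofReal_one]
  exact ENNReal.ofReal_lt_ofReal_iff_of_nonneg hq0.le |>.2 hq1

section

variable {ι : Type*} {L : ι → E n →ₗ[ℂ] ℂ}

theorem flat_le_ker {K : Type*} [AddCommGroup K] [Module ℂ K] {L : ι → K →ₗ[ℂ] ℂ} {I : Set ι} {i : ι} (hi : i ∈ I) : flat L I ≤ ker (L i) := iInf₂_le i hi

theorem finrank_flat_lt (hL : ∀ i, L i ≠ 0) {I : Set ι} (hI : I.Nonempty) : finrank ℂ (flat L I) < n := by
  obtain ⟨i, hi⟩ := hI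
  have h1 : flat L I ≠ ⊤ := fun h => by
    have := flat_le_ker (L := L) hi
    rw [h, top_le_iff, LinearMap.ker_eq_top] at this
    exact hL i this
  have := Submodule.finrank_lt h1
  simpa [E] using this

/-- Integrability at a point follows from vanishing along the flats through it. -/
theorem FinAt.of_ord [Fintype ι] (hL : ∀ i, L i ≠ 0) {β : ℝ} {g : E n → ℂ} {U : Set (E n)}
    (hg : DifferentiableOn ℂ g U) {x : E n} (hU : U ∈ nhds x)
    (hO : ∀ I : Set ι, I.Nonempty → x ∈ flat L I → ∃ k : ℕ, Ord (flat L I) k x g ∧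
      β * mlt L (flat L I) < (n - finrank ℂ (flat L I) : ℕ) + k) :
    FinAt (fun y => ofReal (‖g y‖ ^ 2 * ‖∏ i, L i y‖ ^ (-2 * β))) x := by
  induction hN : (univ.filter fun i => L i x = 0).card using Nat.strong_induction_on generalizing x with
  | _ N ih =>
  set s : Finset ι := univ.filter fun i => L i x = 0 with hs
  have hms : ∀ i, i ∈ s ↔ L i x = 0 := fun i => by simp [hs]
  have hcL : ∀ i, Continuous (L i) := fun i => continuous_lin (L i)
  have hnz : ∀ᶠ y in nhds x, ∀ i, i ∉ s → L i y ≠ 0 := by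
    rw [eventually_all]
    intro i
    by_cases hi : i ∈ s
    · simp [hi]
    · filter_upwards [(hcL i).continuousAt.eventually_ne (fun h => hi ((hms i).2 h))] with y hy _ using hy
  have hsplit : ∀ y, ∏ i, L i y = (∏ i ∈ s, L i y) * ∏ i ∈ sᶜ, L i y := fun y =>
    (Finset.prod_mul_prod_compl s _).symm
  have hrx : ∏ i ∈ sᶜ, L i x ≠ 0 := Finset.prod_ne_zero_iff.2 fun i hi h =>
    Finset.mem_compl.1 hi ((hms i).2 h)
  have hrc : ContinuousAt (fun y => ‖∏ i ∈ sᶜ, L i y‖ ^ (-2 * β)) x :=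
    ((continuous_finsetProd _ fun i _ => hcL i).norm.continuousAt).rpow_const (Or.inl (norm_ne_zero_iff.2 hrx))
  rcases s.eq_empty_or_nonempty with h0 | hne
  · refine FinAt.of_continuousAt (ContinuousAt.mul ((hg.differentiableAt hU).continuousAt.norm.pow 2) ?_)
    rw [h0, Finset.compl_empty] at hrc
    exact hrc
  have hr0 : 0 < ‖∏ i ∈ sᶜ, L i x‖ ^ (-2 * β) := by positivity
  set ρ := ‖∏ i ∈ sᶜ, L i x‖ ^ (-2 * β)
  set h : E n → ℝ := fun y => ‖∏ i ∈ s, L i y‖ ^ (-2 * β) with hh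
  have hh0 : ∀ y, 0 ≤ h y := fun y => by positivity
  have heq : ∀ y, ‖∏ i, L i y‖ ^ (-2 * β) = h y * ‖∏ i ∈ sᶜ, L i y‖ ^ (-2 * β) := fun y => by
    rw [hsplit, norm_mul, mul_rpow (norm_nonneg _) (norm_nonneg _)]
  have hup : ∀ᶠ y in nhds x, ‖∏ i ∈ sᶜ, L i y‖ ^ (-2 * β) < 2 * ρ := hrc.eventually_lt continuousAt_const (by simp only [ρ]; linarith)
  have hlo : ∀ᶠ y in nhds x, ρ / 2 < ‖∏ i ∈ sᶜ, L i y‖ ^ (-2 * β) := continuousAt_const.eventually_lt hrc (by simp only [ρ]; linarith)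
  suffices hF : FinAt (fun y => ofReal (‖g y‖ ^ 2 * h y)) x by
    refine hF.mono (C := ofReal (2 * ρ)) ofReal_ne_top ?_
    filter_upwards [hup] with y hy
    rw [← ENNReal.ofReal_mul (by positivity), heq]
    apply ofReal_le_ofReal
    nlinarith [mul_nonneg (sq_nonneg ‖g y‖) (hh0 y)]
  set V := flat L (s : Set ι) with hV
  have hxV : x ∈ V := mem_flat.2 fun i hi => (hms i).1 hi
  have hVs : ∀ i, V ≤ ker (L i) ↔ i ∈ s :=
    fun i => ⟨fun h => (hms i).2 (h hxV), fun h => flat_le_ker (mem_coe.2 h)⟩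
  have hμ : mlt L V = s.card := by
    rw [mlt]; congr 1; ext i; simp [hVs]
  obtain ⟨k, hk, hkβ⟩ := hO s hne hxV
  rw [← hV] at hk hkβ
  refine FinAt.of_shells (finrank_flat_lt hL hne) hxV hU hg hk hh0 ?_ (s := 2 * β * mlt L V) ?_ (by linarith) ?_
  · exact ((continuous_finsetProd _ fun i _ => hcL i).norm.measurable).pow_const _
  · intro c hc y
    have h1 : ∏ i ∈ s, L i (dil V c y) = c ^ mlt L V * ∏ i ∈ s, L i y := by
      rw [hμ, ← Finset.prod_const, ← Finset.prod_mul_distrib]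
      exact Finset.prod_congr rfl fun i hi => lin_dil ((hVs i).2 hi) c y
    simp only [hh]
    rw [h1, norm_mul, norm_pow, mul_rpow (by positivity) (norm_nonneg _), ← Real.rpow_natCast,
      ← Real.rpow_mul (norm_nonneg _)]
    congr 2
    ring
  · have hOe : ∀ᶠ y in nhds x, ∀ I : Set ι, I.Nonempty → x ∈ flat L I → ∃ k : ℕ, Ord (flat L I) k y g ∧
        β * mlt L (flat L I) < (n - finrank ℂ (flat L I) : ℕ) + k := by
      rw [eventually_all]
      intro I
      by_cases hI : I.Nonempty ∧ x ∈ flat L I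
      · obtain ⟨k, hk, hkβ⟩ := hO I hI.1 hI.2
        filter_upwards [hk.eventually] with y hy _ _ using ⟨k, hy, hkβ⟩
      · exact Eventually.of_forall fun y h1 h2 => absurd ⟨h1, h2⟩ hI
    filter_upwards [hOe, hnz, (eventually_eventually_nhds (p := fun y => y ∈ U)).2 hU, hlo.eventually_nhds] with y hy hny hUy hloy hyV
    have hsub : (univ.filter fun i => L i y = 0) ⊂ s := by
      refine (Finset.ssubset_iff_of_subset fun i hi => ?_).2 ?_
      · by_contra his
        exact hny i his (mem_filter.1 hi).2
      · by_contra! hcon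
        exact hyV (mem_flat.2 fun i hi => (mem_filter.1 (hcon i hi)).2)
    have h2 := ih _ (hN ▸ Finset.card_lt_card hsub) hUy (fun I hI hyI => hy I hI (mem_flat.2 fun i hi => ?_)) rfl
    · refine h2.mono (C := ofReal (2 / ρ)) ofReal_ne_top ?_
      filter_upwards [hloy] with z hz
      rw [← ENNReal.ofReal_mul (by positivity), heq]
      apply ofReal_le_ofReal
      have h3 := mul_nonneg (sq_nonneg ‖g z‖) (hh0 z)
      have h4 : 1 ≤ 2 / ρ * ‖∏ i ∈ sᶜ, L i z‖ ^ (-2 * β) := by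
        rw [div_mul_eq_mul_div, le_div_iff₀ hr0]; linarith
      calc _ = (‖g z‖ ^ 2 * h z) * 1 := (mul_one _).symm
        _ ≤ _ := mul_le_mul_of_nonneg_left h4 h3
        _ = _ := by ring
    · exact (hms i).1 (hsub.1 (mem_filter.2 ⟨mem_univ _, mem_flat.1 hyI i hi⟩))

end

section

open Polynomial in
theorem coeff_eq_zero_of_norm_le {Q : ℂ[X]} {k : ℕ} {C : ℝ} (h : ∀ᶠ t in nhds (0 : ℂ), ‖Q.eval t‖ ≤ C * ‖t‖ ^ k)
    {i : ℕ} (hi : i < k) : Q.coeff i = 0 := by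
  obtain ⟨ψ, hψ, hE⟩ := exists_eq_pow_mul (R := 1) one_pos Q.differentiable.differentiableOn (h.filter_mono nhdsWithin_le_nhds)
  by_contra hne
  have hQ : Q ≠ 0 := fun h => hne (by rw [h, coeff_zero])
  obtain ⟨P, hP, hdvd⟩ := exists_eq_pow_rootMultiplicity_mul_and_not_dvd Q hQ 0
  set m := Q.rootMultiplicity 0
  rw [C_0, sub_zero] at hP hdvd
  have hm : m < k := by
    by_contra hmk
    rw [hP, coeff_X_pow_mul', if_neg (by omega)] at hne
    exact hne rfl
  have h0 : P.eval 0 ≠ 0 := fun h => hdvd (X_dvd_iff.2 (by rw [coeff_zero_eq_eval_zero, h]))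
  have h1 : ∀ t, t ≠ 0 → P.eval t = t ^ (k - m) * ψ t := by
    intro t ht
    have h2 := hE t
    rw [hP, eval_mul, eval_pow, eval_X] at h2
    have h3 : t ^ k = t ^ m * t ^ (k - m) := by rw [← pow_add]; congr 1; omega
    rw [h3, mul_assoc] at h2
    exact mul_left_cancel₀ (pow_ne_zero _ ht) h2
  have hc : ContinuousAt (fun t : ℂ => t ^ (k - m) * ψ t) 0 :=
    (continuous_pow _).continuousAt.mul (hψ.differentiableAt (ball_mem_nhds _ one_pos)).continuousAt
  have h4 : Tendsto (fun t => P.eval t) (nhdsWithin 0 {0}ᶜ) (nhds (P.eval 0)) :=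
    (P.continuous.tendsto 0).mono_left nhdsWithin_le_nhds
  have h5 : Tendsto (fun t => P.eval t) (nhdsWithin 0 {0}ᶜ) (nhds ((0 : ℂ) ^ (k - m) * ψ 0)) := by
    refine (hc.tendsto.mono_left nhdsWithin_le_nhds).congr' ?_
    filter_upwards [self_mem_nhdsWithin] with t ht using (h1 t ht).symm
  have h6 := tendsto_nhds_unique h4 h5
  rw [zero_pow (by omega), zero_mul] at h6
  exact h0 h6

theorem IsPol.differentiable {e : ℕ} {p : E n → ℂ} (hp : IsPol e p) : Differentiable ℂ p :=
  hp.contDiff.differentiable (by simp)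

theorem Ord.of_vanS {e : ℕ} {p : E n → ℂ} (hp : IsPol e p) {V : Submodule ℂ (E n)} {k : ℕ} (h : p ∈ VanS V k)
    {x : E n} (hx : x ∈ V) : Ord V k x p := by
  have hpx : ContinuousAt p x := hp.differentiable.continuous.continuousAt
  cases k with
  | zero => exact Ord.zero V hpx
  | succ k =>
  have hB : {y | ‖p y‖ < ‖p x‖ + 1} ∈ nhds x := hpx.norm.eventually_lt continuousAt_const (by simp)
  refine Ord.of_leading hx (B := 3 * (‖p x‖ + 1)) ?_
  filter_upwards [dil_near hx hB] with y hy t ht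
  obtain ⟨Q, hQ⟩ := h (pr V y) (pr_mem V y) (co V y)
  obtain ⟨M, hM⟩ := (isCompact_closedBall (0 : ℂ) 1).exists_bound_of_continuousOn Q.continuous.continuousOn
  refine norm_le_of_order (φ := fun c => p (dil V c y)) one_lt_two (C := M)
    (differentiableOn_dil (U := Set.univ) hp.differentiable.differentiableOn fun _ _ => trivial) ?_
    (fun c hc => (hy c (by rw [hc]; norm_num)).le) ht
  filter_upwards [nhdsWithin_le_nhds (closedBall_mem_nhds (0 : ℂ) one_pos)] with c hc
  rw [dil_apply, hQ, norm_mul, norm_pow, mul_comm]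
  exact mul_le_mul_of_nonneg_right (hM c hc) (by positivity)

open Polynomial in
theorem Ord.vanS {e : ℕ} {p : E n → ℂ} (hp : IsPol e p) {V : Submodule ℂ (E n)} {k : ℕ} {x : E n} (hx : x ∈ V)
    (h : Ord V k x p) : p ∈ VanS V k := by
  have key : ∀ w ∈ V, ∀ u, ∀ j ≤ e, e - j < k → cmp e j u p w = 0 := by
    intro w hw u j hj hjk
    have hnear : ∀ᶠ y in nhds x, y ∈ V → cmp e j u p y = 0 := by
      obtain ⟨C, hC⟩ := h
      filter_upwards [hC.eventually_nhds] with y hy hyV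
      obtain ⟨Q, hQ, hq⟩ := hp.exists_natDegree_le y u
      rw [cmp_apply, lco_eq hQ _ hq]
      have hc : Continuous fun t : ℂ => y + t • u := by fun_prop
      have h1 : Tendsto (fun t : ℂ => y + t • u) (nhds 0) (nhds y) := by
        simpa using hc.tendsto 0
      refine coeff_eq_zero_of_norm_le (C := C * ‖co V u‖ ^ k) ?_ hjk
      filter_upwards [h1.eventually hy] with t ht
      rw [← hq]
      refine ht.trans (le_of_eq ?_)
      rw [map_add, co_eq_zero_iff.2 hyV, zero_add, map_smul, norm_smul]
      ring
    obtain ⟨P, hP⟩ := (hp.cmp u hj).1 x (w - x)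
    have hc : Continuous fun t : ℂ => x + t • (w - x) := by fun_prop
    have h1 : Tendsto (fun t : ℂ => x + t • (w - x)) (nhds 0) (nhds x) := by
      simpa using hc.tendsto 0
    have h2 : ∀ᶠ t in nhds (0 : ℂ), ‖P.eval t‖ ≤ 0 * ‖t‖ ^ (P.natDegree + 1) := by
      filter_upwards [h1.eventually hnear] with t ht
      rw [← hP, ht (V.add_mem hx (V.smul_mem _ (V.sub_mem hw hx)))]
      simp
    have h3 : P = 0 := by
      ext i
      rcases lt_or_ge i (P.natDegree + 1) with hi | hi
      · rw [coeff_eq_zero_of_norm_le h2 hi, coeff_zero]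
      · rw [coeff_eq_zero_of_natDegree_lt (by omega), coeff_zero]
    have h4 := hP 1
    rw [h3, eval_zero, one_smul, add_sub_cancel] at h4
    exact h4
  intro w hw u
  refine ⟨∑ j ∈ (range (e + 1)).filter fun j => k ≤ e - j, X ^ (e - j - k) * C (cmp e j u p w), fun t => ?_⟩
  rw [hp.eq_sum_cmp, eval_finsetSum, mul_sum, Finset.sum_filter]
  refine sum_congr rfl fun j hj => ?_
  split_ifs with hk
  · rw [eval_mul, eval_pow, eval_X, eval_C, ← mul_assoc, ← pow_add]
    congr 2; omega
  · rw [key w hw u j (by simpa [lt_succ_iff] using hj) (by omega), mul_zero]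

/-- Exponents slightly below `α` see the same integer thresholds. -/
theorem exists_exponent {α b : ℝ} (hb : b < α) (N : ℕ) :
    ∃ β, b < β ∧ β < α ∧ ∀ m : ℕ, m ≤ N → 1 ≤ m → ((⌈α * m⌉ : ℤ) : ℝ) - 1 ≤ β * m := by
  have h1 : ∀ m ∈ range (N + 1), ∀ᶠ β in nhdsWithin α (Set.Iio α), 1 ≤ m → ((⌈α * m⌉ : ℤ) : ℝ) - 1 ≤ β * m := by
    intro m _
    have h2 : ((⌈α * m⌉ : ℤ) : ℝ) - 1 < α * m := by linarith [Int.ceil_lt_add_one (α * m)]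
    have hc : ContinuousAt (fun β : ℝ => β * m) α := by fun_prop
    filter_upwards [nhdsWithin_le_nhds (continuousAt_const.eventually_lt hc h2)] with β hβ _ using hβ.le
  have h3 := (Filter.eventually_all_finset (range (N + 1))).2 h1
  obtain ⟨β, hβ, hβ2⟩ := (h3.and (Ioo_mem_nhdsLT hb)).exists
  exact ⟨β, hβ2.1, hβ2.2, fun m hm => hβ m (by simpa [lt_succ_iff] using hm)⟩

variable {ι : Type*} [Fintype ι] (L : ι → E n →ₗ[ℂ] ℂ)

/-- The vanishing order along `V` imposed by the exponent `α`. -/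
def ordAt (α : ℝ) (V : Submodule ℂ (E n)) : ℕ := (⌈α * mlt L V⌉ - (n - finrank ℂ V : ℕ)).toNat

variable {L}

theorem mlt_le {K : Type*} [AddCommGroup K] [Module ℂ K] {L : ι → K →ₗ[ℂ] ℂ} (V : Submodule ℂ K) : mlt L V ≤ card ι := Finset.card_le_univ _

theorem mlt_pos {K : Type*} [AddCommGroup K] [Module ℂ K] {L : ι → K →ₗ[ℂ] ℂ} {I : Set ι} (hI : I.Nonempty) : 1 ≤ mlt L (flat L I) := by
  obtain ⟨i, hi⟩ := hI
  exact Finset.card_pos.2 ⟨i, by simpa using flat_le_ker hi⟩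

theorem Ord.of_finAt_exponent (hL : ∀ i, L i ≠ 0) {α β : ℝ} (hβ0 : 0 ≤ β)
    (hβ : ∀ m : ℕ, m ≤ card ι → 1 ≤ m → ((⌈α * m⌉ : ℤ) : ℝ) - 1 ≤ β * m) {x : E n} {U : Set (E n)}
    (hU : U ∈ nhds x) {g : E n → ℂ} (hg : DifferentiableOn ℂ g U)
    (hF : FinAt (fun y => ofReal (‖g y‖ ^ 2 * ‖∏ i, L i y‖ ^ (-2 * β))) x)
    {I : Set ι} (hI : I.Nonempty) (hx : x ∈ flat L I) : Ord (flat L I) (ordAt L α (flat L I)) x g := by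
  rcases Nat.eq_zero_or_pos (ordAt L α (flat L I)) with h0 | hp
  · rw [h0]; exact Ord.zero _ (hg.differentiableAt hU).continuousAt
  refine Ord.of_finAt hL hβ0 hx (finrank_flat_lt hL hI) hU hg hF ?_
  have h1 : ((ordAt L α (flat L I) : ℕ) : ℤ) = ⌈α * mlt L (flat L I)⌉ - (n - finrank ℂ (flat L I) : ℕ) := by
    rw [ordAt] at hp ⊢; omega
  have h2 : ((ordAt L α (flat L I) : ℕ) : ℝ) = (⌈α * mlt L (flat L I)⌉ : ℤ) - (n - finrank ℂ (flat L I) : ℕ) := by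
    exact_mod_cast h1
  rw [h2]
  have := hβ _ (mlt_le (flat L I)) (mlt_pos hI)
  linarith

theorem FinAt.of_ord_exponent (hL : ∀ i, L i ≠ 0) {α β : ℝ} (hβ : β < α) {x : E n} {U : Set (E n)}
    (hU : U ∈ nhds x) {g : E n → ℂ} (hg : DifferentiableOn ℂ g U)
    (h : ∀ I : Set ι, I.Nonempty → x ∈ flat L I → Ord (flat L I) (ordAt L α (flat L I)) x g) :
    FinAt (fun y => ofReal (‖g y‖ ^ 2 * ‖∏ i, L i y‖ ^ (-2 * β))) x := by
  refine FinAt.of_ord hL hg hU fun I hI hx => ⟨_, h I hI hx, ?_⟩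
  have h1 : ⌈α * mlt L (flat L I)⌉ ≤ ((n - finrank ℂ (flat L I) : ℕ) : ℤ) + ordAt L α (flat L I) := by
    rw [ordAt]; omega
  have h2 : ((⌈α * mlt L (flat L I)⌉ : ℤ) : ℝ) ≤ (n - finrank ℂ (flat L I) : ℕ) + ordAt L α (flat L I) := by
    exact_mod_cast h1
  have h3 : (1 : ℝ) ≤ mlt L (flat L I) := by exact_mod_cast mlt_pos hI
  have h4 := Int.le_ceil (α * mlt L (flat L I))
  nlinarith

/-- Integrability of a homogeneous polynomial against the weight, in terms of vanishing orders. -/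
theorem finAt_pol_iff (hL : ∀ i, L i ≠ 0) {α β : ℝ} (hβ0 : 0 ≤ β) (hβα : β < α)
    (hβ : ∀ m : ℕ, m ≤ card ι → 1 ≤ m → ((⌈α * m⌉ : ℤ) : ℝ) - 1 ≤ β * m) {x : E n} {e : ℕ} {p : E n → ℂ}
    (hp : IsPol e p) :
    FinAt (fun y => ofReal (‖p y‖ ^ 2 * ‖∏ i, L i y‖ ^ (-2 * β))) x ↔
      ∀ I : Set ι, I.Nonempty → x ∈ flat L I → p ∈ VanS (flat L I) (ordAt L α (flat L I)) :=
  ⟨fun h _ hI hx => Ord.vanS hp hx (Ord.of_finAt_exponent hL hβ0 hβ univ_mem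
    hp.differentiable.differentiableOn h hI hx),
   fun h => FinAt.of_ord_exponent hL hβα univ_mem hp.differentiable.differentiableOn
    fun I hI hx => Ord.of_vanS hp (h I hI hx) hx⟩

end

theorem exists_partition {κ : Type*} [Fintype κ] {φ : κ → E n → ℝ}
    (hφ : ∀ k y, y ≠ 0 → ContDiffAt ℝ ∞ (φ k) y) (hφs : ∀ k (t : ℂ), t ≠ 0 → ∀ y, φ k (t • y) = φ k y)
    (hpos : ∀ k y, 0 ≤ φ k y) (hcov : ∀ y, y ≠ 0 → ∃ k, 0 < φ k y) :
    ∃ ρ : κ → E n → ℝ, (∀ k y, y ≠ 0 → ContDiffAt ℝ ∞ (ρ k) y) ∧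
      (∀ k (t : ℂ), t ≠ 0 → ∀ y, ρ k (t • y) = ρ k y) ∧ (∀ y, y ≠ 0 → ∑ k, ρ k y = 1) ∧
      ∀ k y, y ≠ 0 → φ k y = 0 → ρ k =ᶠ[nhds y] 0 := by
  obtain ⟨ε, hε, hmin⟩ : ∃ ε : ℝ, 0 < ε ∧ ∀ y, y ≠ 0 → ε ≤ ∑ k, φ k y := by
    have hpos' : ∀ y, y ≠ 0 → 0 < ∑ k, φ k y := fun y hy => by
      obtain ⟨k, hk⟩ := hcov y hy
      exact Finset.sum_pos' (fun k _ => hpos k y) ⟨k, mem_univ _, hk⟩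
    rcases (Metric.sphere (0 : E n) 1).eq_empty_or_nonempty with h0 | hne
    · refine ⟨1, one_pos, fun y hy => absurd ?_ (Set.notMem_empty ((‖y‖ : ℂ)⁻¹ • y))⟩
      rw [← h0]
      simp [norm_smul, norm_ne_zero_iff.2 hy]
    · obtain ⟨y₀, hy₀, hm⟩ := (isCompact_sphere (0 : E n) 1).exists_isMinOn hne (f := fun y => ∑ k, φ k y) (by
        refine continuousOn_finsetSum _ fun k _ y hy => ((hφ k y ?_).continuousAt).continuousWithinAt
        rintro rfl
        simp at hy)
      have hy₀0 : y₀ ≠ 0 := by rintro rfl; simp at hy₀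
      refine ⟨_, hpos' y₀ hy₀0, fun y hy => ?_⟩
      have hn : (‖y‖ : ℂ)⁻¹ ≠ 0 := by simpa using hy
      have h1 := hm (a := (‖y‖ : ℂ)⁻¹ • y) (by simp [norm_smul, norm_ne_zero_iff.2 hy])
      simpa only [Set.mem_ofPred_eq, hφs _ _ hn] using h1
  set N : ℝ := card κ + 1
  have hN : 0 < N := by positivity
  set δ := ε / N
  have hδ : 0 < δ := by positivity
  set ψ : κ → E n → ℝ := fun k y => Real.smoothTransition (φ k y - δ) with hψ
  have hψ0 : ∀ k y, 0 ≤ ψ k y := fun k y => Real.smoothTransition.nonneg _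
  have hψc : ∀ k y, y ≠ 0 → ContDiffAt ℝ ∞ (ψ k) y := fun k y hy =>
    Real.smoothTransition.contDiffAt.comp y ((hφ k y hy).sub contDiffAt_const)
  have hψs : ∀ y, y ≠ 0 → 0 < ∑ k, ψ k y := by
    intro y hy
    by_contra hcon
    have h1 : ∀ k, φ k y ≤ δ := by
      intro k
      by_contra! hk
      exact hcon (Finset.sum_pos' (fun k _ => hψ0 k y)
        ⟨k, mem_univ _, Real.smoothTransition.pos_of_pos (by linarith)⟩)
    have h2 := Finset.sum_le_card_nsmul univ (fun k => φ k y) δ fun k _ => h1 k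
    rw [nsmul_eq_mul, Finset.card_univ] at h2
    have h3 := hmin y hy
    have h4 : N * δ = ε := by simp only [δ]; field_simp
    simp only [N] at h4
    linarith
  refine ⟨fun k y => ψ k y / ∑ k, ψ k y, fun k y hy => ?_, fun k t ht y => ?_, fun y hy => ?_, fun k y hy h0 => ?_⟩
  · exact (hψc k y hy).div (ContDiffAt.sum fun k _ => hψc k y hy) (hψs y hy).ne'
  · simp only [hψ, hφs _ t ht]
  · rw [← Finset.sum_div, div_self (hψs y hy).ne']
  · have h1 : ∀ᶠ z in nhds y, φ k z < δ :=
      ((hφ k y hy).continuousAt).eventually_lt continuousAt_const (by rw [h0]; exact hδ)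
    filter_upwards [h1] with z hz
    simp [hψ, Real.smoothTransition.zero_of_nonpos (by linarith : φ k z - δ ≤ 0)]

/-- Gluing of homogeneous polynomials over the complements of finitely many subspaces. -/
theorem exists_glue [NeZero n] {κ : Type*} [Fintype κ] (bad : κ → Finset (Submodule ℂ (E n)))
    (hcov : ∀ x : E n, x ≠ 0 → ∃ k, ∀ A ∈ bad k, x ∉ A) {d e : ℕ} {f : E n → ℂ} (hf : IsPol d f)
    (hf0 : ∀ᵐ y, f y ≠ 0) {β : ℝ} (hβ : 0 ≤ β) (hβ1 : 1 ≤ β * d) (hβ2 : β * d < e + n) {q : κ → E n → ℂ}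
    (hq : ∀ k, IsPol e (q k))
    (hyp : ∀ x : E n, x ≠ 0 → ∃ l, ∀ k, (∀ A ∈ bad k, x ∉ A) →
      FinAt (fun y => ofReal (‖q k y - q l y‖ ^ 2 * ‖f y‖ ^ (-2 * β))) x) :
    ∃ G, IsPol e G ∧ ∀ x : E n, x ≠ 0 → ∀ l, (∀ k, (∀ A ∈ bad k, x ∉ A) →
      FinAt (fun y => ofReal (‖q k y - q l y‖ ^ 2 * ‖f y‖ ^ (-2 * β))) x) →
      FinAt (fun y => ofReal (‖G y - q l y‖ ^ 2 * ‖f y‖ ^ (-2 * β))) x := by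
  set φ : κ → E n → ℝ := fun k y => ∏ A ∈ bad k, sq (co A y) / sq y with hφ
  have hsq : ∀ {y : E n}, y ≠ 0 → 0 < sq y := fun hy => sq_pos hy
  have hφ0 : ∀ k y, 0 ≤ φ k y := fun k y => Finset.prod_nonneg fun A _ => div_nonneg (sq_nonneg' _) (sq_nonneg' _)
  have hφp : ∀ k y, y ≠ 0 → (∀ A ∈ bad k, y ∉ A) → 0 < φ k y := fun k y hy h =>
    Finset.prod_pos fun A hA => div_pos (hsq fun h0 => h A hA (co_eq_zero_iff.1 h0)) (hsq hy)
  have h1 : ∀ k y, y ≠ 0 → ContDiffAt ℝ ∞ (φ k) y := by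
    intro k y hy
    refine contDiffAt_prod fun A _ => ContDiffAt.div ?_ contDiff_sq.contDiffAt (hsq hy).ne'
    have h1 : ContDiff ℝ ∞ fun y => co A y :=
      (toContinuousLinearMap ((co A).restrictScalars ℝ)).contDiff
    exact (contDiff_sq.comp h1).contDiffAt
  have h2 : ∀ k (t : ℂ), t ≠ 0 → ∀ y, φ k (t • y) = φ k y := by
    intro k t ht y
    refine Finset.prod_congr rfl fun A _ => ?_
    rw [map_smul, sq_smul, sq_smul, mul_div_mul_left _ _ (by simpa using ht)]
  obtain ⟨ρ, hρ, hρs, hρ1, hρ0⟩ := exists_partition h1 h2 hφ0 fun y hy => by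
    obtain ⟨k, hk⟩ := hcov y hy
    exact ⟨k, hφp k y hy hk⟩
  have hz : ∀ k x, x ≠ 0 → (∃ A ∈ bad k, x ∈ A) → ρ k =ᶠ[nhds x] 0 := by
    rintro k x hx ⟨A, hA, hxA⟩
    refine hρ0 k x hx (Finset.prod_eq_zero hA ?_)
    rw [co_eq_zero_iff.2 hxA]
    simp [sq]
  have conv : ∀ x, x ≠ 0 → ∀ l, (∀ k, (∀ A ∈ bad k, x ∉ A) →
      FinAt (fun y => ofReal (‖q k y - q l y‖ ^ 2 * ‖f y‖ ^ (-2 * β))) x) → ∀ k, ρ k =ᶠ[nhds x] 0 ∨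
      FinAt (fun y => ofReal (‖q k y - q l y‖ ^ 2 * ‖f y‖ ^ (-2 * β))) x := by
    intro x hx l hl k
    by_cases h : ∀ A ∈ bad k, x ∉ A
    · exact Or.inr (hl k h)
    · push Not at h
      exact Or.inl (hz k x hx h)
  obtain ⟨G, hG, hG'⟩ := cech hf hf0 hβ hβ1 hβ2 hq hρ hρs hρ1 fun x hx => by
    obtain ⟨l, hl⟩ := hyp x hx
    exact ⟨l, conv x hx l hl⟩
  exact ⟨G, hG, fun x hx l hl => hG' x hx l (conv x hx l hl)⟩

section

section general
variable {K K' : Type*} [AddCommGroup K] [Module ℂ K] [AddCommGroup K'] [Module ℂ K']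

theorem IsPol.vanS_zero {e : ℕ} {p : K → ℂ} (hp : IsPol e p) (W : Submodule ℂ K) : p ∈ VanS W 0 := fun w _ u => by
  obtain ⟨Q, hQ⟩ := hp.1 w u
  exact ⟨Q, fun t => by rw [hQ, pow_zero, one_mul]⟩

theorem IsPol.sub {e : ℕ} {p q : K → ℂ} (hp : IsPol e p) (hq : IsPol e q) : IsPol e (p - q) :=
  (Pol K e).sub_mem hp hq

theorem VanS_comp {W : Submodule ℂ K} {k : ℕ} {p : K → ℂ} (hp : p ∈ VanS W k) (T : K' →ₗ[ℂ] K)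
    {W' : Submodule ℂ K'} (hW : W'.map T ≤ W) : (fun y => p (T y)) ∈ VanS W' k := fun w hw u => by
  obtain ⟨Q, hQ⟩ := hp (T w) (hW (Submodule.mem_map_of_mem hw)) (T u)
  exact ⟨Q, fun t => by show p (T (w + t • u)) = _; rw [map_add, map_smul, hQ]⟩

theorem VanS_mono {W W' : Submodule ℂ K} (hW : W' ≤ W) {k k' : ℕ} (hk : k' ≤ k) : VanS W k ≤ VanS W' k' :=
  fun p hp w hw u => by
  obtain ⟨Q, hQ⟩ := hp w (hW hw) u
  refine ⟨Polynomial.X ^ (k - k') * Q, fun t => ?_⟩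
  rw [hQ, Polynomial.eval_mul, Polynomial.eval_pow, Polynomial.eval_X, ← mul_assoc, ← pow_add]
  congr 2; omega

variable {ι : Type*} [Fintype ι] {L : ι → K →ₗ[ℂ] ℂ}

theorem mlt_anti {V W : Submodule ℂ K} (h : V ≤ W) : mlt L W ≤ mlt L V :=
  Finset.card_le_card fun i hi => by
    simp only [mem_filter, mem_univ, true_and] at hi ⊢
    exact h.trans hi

theorem finrank_add_two_le [FiniteDimensional ℂ K] {l m : K →ₗ[ℂ] ℂ} (hm : m ≠ 0) (h : ∀ c : ℂ, l ≠ c • m) :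
    finrank ℂ ↥(ker l ⊓ ker m) + 2 = finrank ℂ K := by
  have h0 : l ≠ 0 := fun h0 => h 0 (by rw [h0, zero_smul])
  obtain ⟨v, hv⟩ : ∃ v, l v = 0 ∧ m v ≠ 0 := by
    by_contra! hcon
    obtain ⟨w, hw⟩ : ∃ w, l w ≠ 0 := by
      by_contra! hc
      exact h0 (LinearMap.ext hc)
    have hmw : ∀ y, m y = l y / l w * m w := by
      intro y
      have := hcon (y - (l y / l w) • w) (by rw [map_sub, map_smul, smul_eq_mul, div_mul_cancel₀ _ hw, sub_self])
      rwa [map_sub, map_smul, sub_eq_zero] at this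
    have hmw0 : m w ≠ 0 := fun h0 => hm (LinearMap.ext fun y => by rw [hmw, h0, mul_zero]; rfl)
    exact h (l w / m w) (LinearMap.ext fun y => by
      rw [LinearMap.smul_apply, hmw y, smul_eq_mul]; field_simp)
  obtain ⟨u, hu⟩ : ∃ u, l u ≠ 0 := by
    by_contra! hc
    exact h0 (LinearMap.ext hc)
  have hsurj : Function.Surjective (l.prod m) := by
    rintro ⟨a, b⟩
    refine ⟨(a / l u) • u + ((b - a / l u * m u) / m v) • v, ?_⟩
    ext
    · simp [hv.1, hu]
    · simp [hv.2]
  have h1 := LinearMap.finrank_range_add_finrank_ker (l.prod m)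
  rw [LinearMap.range_eq_top.2 hsurj, finrank_top, LinearMap.ker_prod] at h1
  simp at h1
  omega

theorem finrank_le_of_two_le_mlt [FiniteDimensional ℂ K] (hL : ∀ i, L i ≠ 0)
    (hnp : ∀ i j, i ≠ j → ∀ c : ℂ, L i ≠ c • L j)
    {V : Submodule ℂ K} (h : 2 ≤ mlt L V) :
    ∃ i j, i ≠ j ∧ V ≤ ker (L i) ⊓ ker (L j) ∧
      finrank ℂ ↥(ker (L i) ⊓ ker (L j)) + 2 = finrank ℂ K := by
  obtain ⟨i, hi, j, hj, hij⟩ := Finset.one_lt_card.1 h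
  simp only [mem_filter, mem_univ, true_and] at hi hj
  exact ⟨i, j, hij, le_inf hi hj, finrank_add_two_le (hL j) (hnp i j hij)⟩

theorem flat_of_two_le_mlt [FiniteDimensional ℂ K] (hL : ∀ i, L i ≠ 0) (hnp : ∀ i j, i ≠ j → ∀ c : ℂ, L i ≠ c • L j)
    {V : Submodule ℂ K} (h : 2 ≤ mlt L V) (hV : finrank ℂ V + 2 = finrank ℂ K) :
    ∃ I : Set ι, I.Nonempty ∧ V = flat L I := by
  obtain ⟨i, j, hij, hV2, hf⟩ := finrank_le_of_two_le_mlt hL hnp h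
  refine ⟨{i, j}, ⟨i, by simp⟩, ?_⟩
  have h1 : flat L {i, j} = ker (L i) ⊓ ker (L j) := by
    ext y; simp [mem_flat]
  rw [h1]
  exact eq_of_le_of_finrank_eq hV2 (by omega)

theorem mlt_le_one [FiniteDimensional ℂ K] (hL : ∀ i, L i ≠ 0) (hnp : ∀ i j, i ≠ j → ∀ c : ℂ, L i ≠ c • L j)
    {V : Submodule ℂ K} (hV : finrank ℂ K ≤ finrank ℂ V + 1) : mlt L V ≤ 1 := by
  by_contra! h
  obtain ⟨i, j, hij, hV2, hf⟩ := finrank_le_of_two_le_mlt hL hnp h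
  have := finrank_mono hV2
  omega

theorem flat_mono {ι : Type*} {L : ι → K →ₗ[ℂ] ℂ} {I J : Set ι} (h : I ⊆ J) : flat L J ≤ flat L I := fun _ hx =>
  mem_flat.2 fun i hi => mem_flat.1 hx i (h hi)

end general

variable {ι : Type*} [Fintype ι] {L : ι → E n →ₗ[ℂ] ℂ}

/-- Global interpolation of vanishing conditions along the nonzero flats. -/
theorem exists_glue_flats [NeZero n] (hL : ∀ i, L i ≠ 0) {α : ℝ} (hα0 : 0 < α) {e : ℕ} (hα : α * card ι ≤ e + n)
    {q : Submodule ℂ (E n) → E n → ℂ} (hq : ∀ A, IsPol e (q A))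
    (hyp : ∀ I J : Set ι, J.Nonempty → flat L I ≠ ⊥ → flat L I ≤ flat L J →
      q (flat L I) - q (flat L J) ∈ VanS (flat L J) (ordAt L α (flat L J))) :
    ∃ G, IsPol e G ∧ ∀ I : Set ι, I.Nonempty → flat L I ≠ ⊥ →
      G - q (flat L I) ∈ VanS (flat L I) (ordAt L α (flat L I)) := by
  by_cases hα1 : α * card ι ≤ 1
  · refine ⟨0, IsPol.zero, fun I hI _ => ?_⟩
    have h1 : ⌈α * mlt L (flat L I)⌉ ≤ 1 := Int.ceil_le.2 (by
      have : (mlt L (flat L I) : ℝ) ≤ card ι := by exact_mod_cast mlt_le _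
      push_cast; nlinarith)
    have h2 := finrank_flat_lt hL hI
    rw [show ordAt L α (flat L I) = 0 by rw [ordAt]; omega]
    exact (IsPol.zero.sub (hq _)).vanS_zero _
  push Not at hα1
  have hc : (0 : ℝ) < card ι := by
    by_contra! h
    nlinarith
  obtain ⟨β, hβ1, hβα, hβ⟩ := exists_exponent (α := α) (b := 1 / card ι) (by rwa [div_lt_iff₀ hc]) (card ι)
  have hβ0 : 0 ≤ β := (by positivity : (0 : ℝ) ≤ 1 / card ι).trans hβ1.le
  rw [div_lt_iff₀ hc] at hβ1
  have key : ∀ {p : E n → ℂ}, IsPol e p → ∀ x, _ ↔ _ := fun hp x => finAt_pol_iff (x := x) hL hβ0 hβα hβ hp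
  set bad : {I : Set ι // flat L I ≠ ⊥} → Finset (Submodule ℂ (E n)) :=
    fun k => (univ.image (flat L)).filter fun A => ¬ flat L k.1 ≤ A with hbad
  have hx1 : ∀ x : E n, x ∈ flat L {i | L i x = 0} := fun x => mem_flat.2 fun i hi => hi
  have hx2 : ∀ (x : E n) (J : Set ι), x ∈ flat L J → flat L {i | L i x = 0} ≤ flat L J := fun x J hJ =>
    flat_mono fun i hi => mem_flat.1 hJ i hi
  let l : ∀ x : E n, x ≠ 0 → {I : Set ι // flat L I ≠ ⊥} := fun x hx =>
    ⟨{i | L i x = 0}, fun h => hx ((mem_bot ℂ).1 (h ▸ hx1 x))⟩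
  have hgood : ∀ (x : E n) (k : {I : Set ι // flat L I ≠ ⊥}), (∀ A ∈ bad k, x ∉ A) → flat L k.1 ≤ flat L {i | L i x = 0} := by
    intro x k hk
    by_contra hcon
    exact hk _ (by simp [hbad, hcon]) (hx1 x)
  have hloc : ∀ (x : E n) (hx : x ≠ 0) k, (∀ A ∈ bad k, x ∉ A) →
      FinAt (fun y => ofReal (‖(q (flat L k.1) - q (flat L (l x hx).1)) y‖ ^ 2 * ‖∏ i, L i y‖ ^ (-2 * β))) x := by
    intro x hx k hk
    refine (key ((hq _).sub (hq _)) x).2 fun J hJ hxJ => ?_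
    have h1 := hyp k.1 J hJ k.2 ((hgood x k hk).trans (hx2 x J hxJ))
    have h2 := hyp (l x hx).1 J hJ (l x hx).2 (hx2 x J hxJ)
    have h3 := (VanS _ _).sub_mem h1 h2
    rwa [sub_sub_sub_cancel_right] at h3
  obtain ⟨G, hG, hG'⟩ := exists_glue bad (fun x hx => ⟨l x hx, fun A hA hxA => by
      simp only [hbad, mem_filter, Finset.mem_image, mem_univ, true_and] at hA
      obtain ⟨⟨J, rfl⟩, h⟩ := hA
      exact h (hx2 x J hxA)⟩)
    (isPol_prod L) (ae_prod_ne_zero L hL) hβ0 hβ1.le (by nlinarith) (fun k => hq (flat L k.1))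
    fun x hx => ⟨l x hx, hloc x hx⟩
  refine ⟨G, hG, fun J hJ hJ0 => ?_⟩
  obtain ⟨x, hxJ, hx⟩ := Submodule.exists_mem_ne_zero_of_ne_bot hJ0
  have h1 := (key (hG.sub (hq _)) x).1 (hG' x hx (l x hx) (hloc x hx)) J hJ hxJ
  have h3 := (VanS _ _).add_mem h1 (hyp (l x hx).1 J hJ (l x hx).2 (hx2 x J hxJ))
  rwa [sub_add_sub_cancel] at h3

theorem ordAt_eq_zero_of_mlt_le_one {α : ℝ} (hα : α < 1) {V : Submodule ℂ (E n)} (hV : mlt L V ≤ 1)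
    (hV2 : finrank ℂ V < n) : ordAt L α V = 0 := by
  have h1 : (mlt L V : ℝ) ≤ 1 := by exact_mod_cast hV
  have h2 : ⌈α * mlt L V⌉ ≤ 1 := Int.ceil_le.2 (by push_cast; nlinarith)
  rw [ordAt]
  omega

theorem exists_glue_dim_three' {L : ι → E 3 →ₗ[ℂ] ℂ} (hL : ∀ i, L i ≠ 0)
    (hnp : ∀ i j, i ≠ j → ∀ c : ℂ, L i ≠ c • L j) {α : ℝ} (hα0 : 0 < α) (hα1 : α < 1) {e : ℕ}
    (hα : α * card ι ≤ e + 3) {t : Submodule ℂ (E 3) → E 3 → ℂ} (ht : ∀ V, IsPol e (t V)) :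
    ∃ G, IsPol e G ∧ ∀ V : Submodule ℂ (E 3), finrank ℂ V = 1 → G - t V ∈ VanS V (ordAt L α V) := by
  have hE : finrank ℂ (E 3) = 3 := by simp [E]
  obtain ⟨G, hG, hG'⟩ := exists_glue_flats hL hα0 (by exact_mod_cast hα) ht fun I J hJ hI hIJ => by
    by_cases h2 : finrank ℂ (flat L J) ≤ 1
    · have h1 := finrank_mono hIJ
      have h3 := mt finrank_eq_zero.1 hI
      rw [eq_of_le_of_finrank_eq hIJ (by omega), sub_self]
      exact zero_mem _
    · rw [ordAt_eq_zero_of_mlt_le_one hα1 (mlt_le_one hL hnp (by omega)) (finrank_flat_lt hL hJ)]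
      exact ((ht _).sub (ht _)).vanS_zero _
  refine ⟨G, hG, fun V hV => ?_⟩
  by_cases h0 : mlt L V ≤ 1
  · rw [ordAt_eq_zero_of_mlt_le_one hα1 h0 (by omega)]
    exact (hG.sub (ht V)).vanS_zero V
  obtain ⟨I, hI, rfl⟩ := flat_of_two_le_mlt hL hnp (V := V) (by omega) (by omega)
  exact hG' I hI fun h => by rw [h, finrank_bot] at hV; omega

/-- Simultaneous interpolation along the lines of a three dimensional arrangement. -/
theorem exists_glue_dim_three {K : Type*} [AddCommGroup K] [Module ℂ K] (hK : finrank ℂ K = 3)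
    {L : ι → K →ₗ[ℂ] ℂ} (hL : ∀ i, L i ≠ 0)
    (hnp : ∀ i j, i ≠ j → ∀ c : ℂ, L i ≠ c • L j) {α : ℝ} (hα0 : 0 < α) (hα1 : α < 1) {e : ℕ}
    (hα : α * card ι ≤ e + 3) {t : Submodule ℂ K → K → ℂ} (ht : ∀ V, IsPol e (t V)) :
    ∃ G, IsPol e G ∧ ∀ V : Submodule ℂ K, finrank ℂ V = 1 → G - t V ∈ VanS V (⌈α * mlt L V⌉ - 2).toNat := by
  have : FiniteDimensional ℂ K := Module.finite_of_finrank_pos (by omega)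
  let T : E 3 ≃ₗ[ℂ] K := LinearEquiv.ofFinrankEq _ _ (by simp [E, hK])
  have hTs : ∀ y, T (T.symm y) = y := T.apply_symm_apply
  obtain ⟨G, hG, hG'⟩ := exists_glue_dim_three' (L := fun i => L i ∘ₗ T.toLinearMap)
    (fun i h => hL i (LinearMap.ext fun y => by simpa using LinearMap.congr_fun h (T.symm y)))
    (fun i j hij c h => hnp i j hij c (LinearMap.ext fun y => by simpa using LinearMap.congr_fun h (T.symm y)))
    hα0 hα1 hα (t := fun V y => t (V.map T.toLinearMap) (T y)) (fun V => (ht _).comp T.toLinearMap)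
  refine ⟨fun y => G (T.symm y), hG.comp T.symm.toLinearMap, fun V hV => ?_⟩
  have hf : finrank ℂ (V.map T.symm.toLinearMap) = 1 := by
    rw [← hV]; exact (T.symm.submoduleMap V).finrank_eq.symm
  have h1 := hG' _ hf
  have hm : mlt (fun i => L i ∘ₗ T.toLinearMap) (V.map T.symm.toLinearMap) = mlt L V := by
    rw [mlt, mlt]
    congr 1
    ext i
    simp only [mem_filter, mem_univ, true_and]
    rw [Submodule.map_le_iff_le_comap]
    refine ⟨fun h y hy => by simpa using h hy, fun h y hy => by simpa using h hy⟩
  rw [ordAt, hm, hf, show ((3 - 1 : ℕ) : ℤ) = 2 from rfl] at h1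
  have h2 : (V.map T.symm.toLinearMap).map T.toLinearMap = V := by
    rw [← Submodule.map_comp]; simp
  have h3 := VanS_comp h1 T.symm.toLinearMap (W' := V) le_rfl
  convert h3 using 1
  funext y
  simp only [Pi.sub_apply, h2, coe_coe, hTs]

end

section

variable {V : Type*} [AddCommGroup V] [Module ℂ V]

theorem exists_span_eq {U : Submodule ℂ V} (hU : finrank ℂ U = 1) : ∃ u, u ≠ 0 ∧ U = span ℂ {u} := by
  have : FiniteDimensional ℂ U := Module.finite_of_finrank_pos (by omega)
  obtain ⟨u, huU, hu⟩ := Submodule.exists_mem_ne_zero_of_ne_bot (p := U) (by rintro rfl; simp at hU)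
  exact ⟨u, hu, (eq_of_le_of_finrank_eq ((Submodule.span_singleton_le_iff_mem u _).2 huU)
    (by rw [finrank_span_singleton hu, hU])).symm⟩

theorem finrank_comap_ker [FiniteDimensional ℂ V] {W : Submodule ℂ V} {h : V →ₗ[ℂ] ℂ} {v : V} (hvW : v ∈ W) (hv : h v = 1) :
    finrank ℂ (W.comap (ker h).subtype) + 1 = finrank ℂ W := by
  rw [← finrank_ker_of_eq_one (h := h.domRestrict W) (v := ⟨v, hvW⟩) hv, LinearMap.ker_domRestrict,
    ← Submodule.finrank_map_subtype_eq, Submodule.map_comap_subtype, ← Submodule.finrank_map_subtype_eq W,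
    Submodule.map_comap_subtype, inf_comm]

section
variable {h : V →ₗ[ℂ] ℂ} {v : V} (hv : h v = 1)

theorem IsPol.exists_eq_mul_add {e : ℕ} {p : V → ℂ} (hp : IsPol (e + 1) p) :
    ∃ p', IsPol e p' ∧ ∀ y, p y = h y * p' y + p (prj hv y) := by
  refine ⟨HypArr.glue hv e (fun j => HypArr.rcmp h v (e + 1) j p), IsPol.glue hv fun j hj => hp.rcmp (by omega), fun y => ?_⟩
  have h1 := hp.eq_sum_cmp v (prj hv y : V)
  have h2 := h1 0
  rw [zero_smul, add_zero, Finset.sum_range_succ, Nat.sub_self, pow_zero, one_mul, Finset.sum_eq_zero, zero_add] at h2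
  · conv_lhs => rw [eq_prj_add hv y]
    rw [h1, Finset.sum_range_succ, Nat.sub_self, pow_zero, one_mul, h2, HypArr.glue, mul_sum]
    congr 1
    refine sum_congr rfl fun j hj => ?_
    rw [mem_range] at hj
    rw [show e + 1 - j = e - j + 1 by omega, pow_succ', mul_assoc]; rfl
  · intro j hj
    rw [mem_range] at hj
    rw [zero_pow (by omega), zero_mul]

theorem IsPol.prj_mem_VanS {e : ℕ} {p : V → ℂ} (hp : IsPol e p) :
    (fun y => p (prj hv y)) ∈ VanS (span ℂ {v}) e := by
  intro w hw u
  obtain ⟨a, rfl⟩ := Submodule.mem_span_singleton.1 hw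
  refine ⟨Polynomial.C (p (prj hv u)), fun t => ?_⟩
  have h1 : (prj hv (a • v + t • u) : V) = t • (prj hv u : V) := by
    rw [prj_coe, prj_coe, map_add, map_smul, map_smul, hv, smul_eq_mul, smul_eq_mul]
    module
  simp only [h1, hp.2, eval_C]

include hv in
theorem rcmp_mul {e j : ℕ} {p : V → ℂ} (hp : IsPol e p) (hj : j ≤ e) :
    rcmp h v (e + 1) j (fun y => h y * p y) = rcmp h v e j p := by
  have h1 : (fun y => h y * p y) = glue hv (e + 1) fun j => if j ≤ e then rcmp h v e j p else 0 := by
    funext y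
    conv_lhs => rw [hp.eq_glue' hv]
    rw [glue, glue, Finset.sum_range_succ _ (e + 1), if_neg (by omega), Pi.zero_apply, mul_zero, add_zero, mul_sum]
    refine sum_congr rfl fun j hj => ?_
    rw [mem_range] at hj
    rw [if_pos (by omega), show e + 1 - j = e - j + 1 by omega, pow_succ', mul_assoc]
  rw [h1, rcmp_glue hv (fun j hj => ?_) (by omega), if_pos hj]
  split_ifs with h
  · exact hp.rcmp h
  · exact IsPol.zero

/-- Forms of degree `e` vanishing to order `k` along `W`. -/
def PV (e : ℕ) (W : Submodule ℂ V) (k : ℕ) : Submodule ℂ (V → ℂ) := Pol V e ⊓ VanS W k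

include hv in
theorem PV_eq_DS {W : Submodule ℂ V} (hvW : v ∈ W) (k e : ℕ) :
    PV e W k = DS h v e fun j => PV j (W.comap (ker h).subtype) k := by
  ext p
  rw [mem_DS]
  refine ⟨fun hp => ⟨hp.1, fun j hj => ⟨IsPol.rcmp hp.1 hj, (mem_VanS_iff hv hvW hp.1).1 hp.2 j hj⟩⟩, fun hp =>
    ⟨hp.1, (mem_VanS_iff hv hvW hp.1).2 fun j hj => (hp.2 j hj).2⟩⟩

include hv in
theorem PV_span_eq_DS (k e : ℕ) :
    PV e (span ℂ {v}) k = DS h v e fun j => if j < k then ⊥ else Pol _ j := by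
  ext p
  rw [mem_DS]
  refine ⟨fun hp => ⟨hp.1, fun j hj => ?_⟩, fun hp => ⟨hp.1, (mem_VanS_span_iff hv hp.1).2 fun j hj hk => ?_⟩⟩
  · split_ifs with h
    · exact (mem_bot ℂ).2 ((mem_VanS_span_iff hv hp.1).1 hp.2 j hj h)
    · exact IsPol.rcmp hp.1 hj
  · have := hp.2 j hj
    rw [if_pos hk] at this
    exact (mem_bot ℂ).1 this

include hv in
theorem PV_sup_eq_DS {W : Submodule ℂ V} (hvW : v ∈ W) (k k' e : ℕ) :
    PV e (span ℂ {v}) k' ⊔ PV e W k =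
      DS h v e fun j => if j < k' then PV j (W.comap (ker h).subtype) k else Pol _ j := by
  refine le_antisymm (sup_le ?_ ?_) fun p hp => ?_
  · rw [PV_span_eq_DS hv]
    intro p hp
    rw [mem_DS] at hp ⊢
    refine ⟨hp.1, fun j hj => ?_⟩
    have := hp.2 j hj
    split_ifs with h
    · rw [if_pos h] at this
      rw [(mem_bot ℂ).1 this]
      exact zero_mem _
    · exact IsPol.rcmp hp.1 hj
  · rw [PV_eq_DS hv hvW]
    intro p hp
    rw [mem_DS] at hp ⊢
    refine ⟨hp.1, fun j hj => ?_⟩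
    split_ifs with h
    · exact hp.2 j hj
    · exact IsPol.rcmp hp.1 hj
  · rw [mem_DS] at hp
    have h1 : ∀ j, j ≤ e → IsPol j (if j < k' then 0 else rcmp h v e j p) := fun j hj => by
      split_ifs
      · exact IsPol.zero
      · exact hp.1.rcmp hj
    have h2 : ∀ j, j ≤ e → IsPol j (if j < k' then rcmp h v e j p else 0) := fun j hj => by
      split_ifs
      · exact hp.1.rcmp hj
      · exact IsPol.zero
    refine Submodule.mem_sup.2 ⟨glue hv e fun j => if j < k' then 0 else rcmp h v e j p, ?_,
      glue hv e fun j => if j < k' then rcmp h v e j p else 0, ?_, ?_⟩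
    · rw [PV_span_eq_DS hv, mem_DS]
      refine ⟨IsPol.glue hv h1, fun j hj => ?_⟩
      rw [rcmp_glue hv h1 hj]
      split_ifs
      · exact zero_mem _
      · exact hp.1.rcmp hj
    · rw [PV_eq_DS hv hvW, mem_DS]
      refine ⟨IsPol.glue hv h2, fun j hj => ?_⟩
      rw [rcmp_glue hv h2 hj]
      have := hp.2 j hj
      split_ifs with h
      · rwa [if_pos h] at this
      · exact zero_mem _
    · conv_rhs => rw [hp.1.eq_glue' hv]
      funext y
      rw [Pi.add_apply, glue, glue, glue, ← sum_add_distrib]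
      refine sum_congr rfl fun j hj => ?_
      split_ifs
      · rw [Pi.zero_apply, mul_zero, zero_add]
      · rw [Pi.zero_apply, mul_zero, add_zero]

theorem finrank_DS_add [FiniteDimensional ℂ V] {e : ℕ} {D : ℕ → Submodule ℂ (ker h → ℂ)}
    (hv : h v = 1) (hD : ∀ j, j ≤ e → D j ≤ Pol _ j) {c : ℕ → ℕ}
    (hc : ∀ j, j ≤ e → finrank ℂ (Pol (ker h) j) = finrank ℂ (D j) + c j) :
    finrank ℂ (Pol V e) = finrank ℂ (DS h v e D) + ∑ j ∈ range (e + 1), c j := by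
  have hf := fun j => finite_Pol (ker h) j
  rw [Pol_eq_DS (h := h) (v := v) e, finrank_DS hv (fun _ _ => le_rfl) fun j _ => hf j,
    finrank_DS hv hD fun j hj => Submodule.finiteDimensional_of_le (hD j hj), ← sum_add_distrib]
  exact sum_congr rfl fun j hj => hc j (by rw [mem_range] at hj; omega)

end

theorem finrank_PV_line {m : ℕ} (hV : finrank ℂ V = m + 2) {U : Submodule ℂ V} (hU : finrank ℂ U = 1) (k e : ℕ) :
    finrank ℂ (Pol V e) = finrank ℂ (PV e U k) +
      ∑ j ∈ range (e + 1), if j < k then (j + m).choose m else 0 := by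
  have : FiniteDimensional ℂ V := Module.finite_of_finrank_pos (by omega)
  obtain ⟨v, hv0, rfl⟩ := exists_span_eq hU
  obtain ⟨h, hv⟩ := exists_dual_eq_one hv0
  have hK := finrank_ker_of_eq_one hv
  rw [PV_span_eq_DS hv]
  refine finrank_DS_add hv (fun j _ => ?_) fun j _ => ?_
  · split_ifs
    · exact bot_le
    · exact le_rfl
  · by_cases hj : j < k
    · rw [if_pos hj, if_pos hj, finrank_bot, zero_add, finrank_Pol _ (m := m) (by omega)]
    · rw [if_neg hj, if_neg hj, add_zero]

theorem finrank_PV_plane (hV : finrank ℂ V = 4) {W : Submodule ℂ V} (hW : finrank ℂ W = 2) (k e : ℕ) :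
    finrank ℂ (Pol V e) = finrank ℂ (PV e W k) +
      ∑ j ∈ range (e + 1), ∑ i ∈ range (j + 1), if i < k then (i + 1) else 0 := by
  have : FiniteDimensional ℂ V := Module.finite_of_finrank_pos (by omega)
  obtain ⟨v, hvW, hv0⟩ := Submodule.exists_mem_ne_zero_of_ne_bot (p := W) (by rintro rfl; simp at hW)
  obtain ⟨h, hv⟩ := exists_dual_eq_one hv0
  have hK := finrank_ker_of_eq_one hv
  have hWK := finrank_comap_ker hvW hv
  rw [PV_eq_DS hv hvW]
  refine finrank_DS_add (D := fun j => PV j _ k) hv (fun j _ => inf_le_left) fun j _ => ?_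
  simpa only [Nat.choose_one_right] using finrank_PV_line (m := 1) (by omega) (U := W.comap (ker h).subtype) (by omega) k j

theorem finrank_PV_sup (hV : finrank ℂ V = 4) {U W : Submodule ℂ V} (hU : finrank ℂ U = 1)
    (hW : finrank ℂ W = 2) (hUW : U ≤ W) (k k' e : ℕ) :
    finrank ℂ (Pol V e) = finrank ℂ ↥(PV e U k' ⊔ PV e W k) +
      ∑ j ∈ range (e + 1), if j < k' then ∑ i ∈ range (j + 1), if i < k then (i + 1) else 0 else 0 := by
  have : FiniteDimensional ℂ V := Module.finite_of_finrank_pos (by omega)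
  obtain ⟨v, hv0, rfl⟩ := exists_span_eq hU
  have hvW := hUW (mem_span_singleton_self v)
  obtain ⟨h, hv⟩ := exists_dual_eq_one hv0
  have hK := finrank_ker_of_eq_one hv
  have hWK := finrank_comap_ker hvW hv
  rw [PV_sup_eq_DS hv hvW]
  refine finrank_DS_add hv (fun j _ => ?_) fun j _ => ?_
  · split_ifs
    · exact inf_le_left
    · exact le_rfl
  · by_cases hj : j < k'
    · rw [if_pos hj, if_pos hj]
      simpa only [Nat.choose_one_right] using finrank_PV_line (m := 1) (by omega) (U := W.comap (ker h).subtype) (by omega) k j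
    · rw [if_neg hj, if_neg hj, add_zero]

theorem sum_ite_lt_choose {k N : ℕ} (hk : k ≤ N) (m : ℕ) :
    ∑ j ∈ range N, (if j < k then (j + m).choose m else 0) = (k + m).choose (m + 1) := by
  rw [← Finset.sum_filter, show (range N).filter (fun j => j < k) = range k by ext; simp; omega]
  rcases k with _ | k
  · simp
  · rw [Nat.sum_range_add_choose, add_right_comm]

theorem sum_sum_ite_lt {k N : ℕ} (hk : k ≤ N + 1) :
    ∑ j ∈ range N, (∑ i ∈ range (j + 1), if i < k then (i + 1) else 0) + 2 * (k + 1).choose 3 =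
      N * (k + 1).choose 2 := by
  have h1 : ∀ {k j : ℕ}, k ≤ j + 1 → ∑ i ∈ range (j + 1), (if i < k then (i + 1) else 0) = (k + 1).choose 2 := fun h => by
    simpa only [Nat.choose_one_right] using sum_ite_lt_choose h 1
  induction N with
  | zero => interval_cases k <;> rfl
  | succ N ih =>
    by_cases h : k ≤ N + 1
    · rw [Finset.sum_range_succ, h1 h, add_right_comm, ih h]; ring
    obtain rfl : k = N + 1 + 1 := by omega
    have h2 : ∀ j ∈ range (N + 1), ∑ i ∈ range (j + 1), (if i < (N + 1) + 1 then (i + 1) else 0) = (j + 2).choose 2 := fun j hj => by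
      rw [mem_range] at hj
      rw [← h1 (le_refl (j + 1))]
      refine sum_congr rfl fun i hi => ?_
      rw [mem_range] at hi
      rw [if_pos hi, if_pos (by omega)]
    rw [sum_congr rfl h2]
    have h3 := sum_ite_lt_choose (le_refl (N + 1)) 2
    rw [sum_congr rfl fun j hj => if_pos (mem_range.1 hj)] at h3
    rw [h3]
    have h4 := Nat.choose_succ_right_eq ((N + 1) + 2) 2
    rw [Nat.add_sub_cancel] at h4
    show ((N + 1) + 2).choose 3 + 2 * ((N + 1) + 2).choose 3 = (N + 1) * ((N + 1) + 2).choose 2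
    linarith

end

/-- The Euler characteristic of an exact sequence attached to a family of subspaces. -/
theorem finrank_iInf_of_exact {X κ P : Type*} [AddCommGroup X] [Module ℂ X] [FiniteDimensional ℂ X] [Fintype κ] [Fintype P]
    (F : κ → Submodule ℂ X) (s t : P → κ)
    (mid : ∀ g : κ → X, (∀ p, g (s p) - g (t p) ∈ F (s p) ⊔ F (t p)) → ∃ G, ∀ k, G - g k ∈ F k)
    (surj : ∀ b : P → X, ∃ g : κ → X, ∀ p, g (s p) - g (t p) - b p ∈ F (s p) ⊔ F (t p)) :
    (finrank ℂ ↥(⨅ k, F k) : ℤ) = finrank ℂ X - ∑ k, ((finrank ℂ X : ℤ) - finrank ℂ (F k)) +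
      ∑ p, ((finrank ℂ X : ℤ) - finrank ℂ ↥(F (s p) ⊔ F (t p))) := by
  let Φ : (κ → X) →ₗ[ℂ] ∀ p, X ⧸ (F (s p) ⊔ F (t p)) := LinearMap.pi fun p =>
    (Submodule.mkQ (F (s p) ⊔ F (t p))) ∘ₗ (LinearMap.proj (R := ℂ) (φ := fun _ : κ => X) (s p) - LinearMap.proj (t p))
  let Ψ : (X × ∀ k, F k) →ₗ[ℂ] (κ → X) := LinearMap.pi fun k =>
    LinearMap.fst ℂ _ _ - (F k).subtype ∘ₗ LinearMap.proj k ∘ₗ LinearMap.snd ℂ _ _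
  let Θ : ↥(⨅ k, F k) →ₗ[ℂ] (X × ∀ k, F k) :=
    (Submodule.subtype _).prod (LinearMap.pi fun k => Submodule.inclusion (iInf_le F k))
  have hΦ : ∀ g, g ∈ ker Φ ↔ ∀ p, g (s p) - g (t p) ∈ F (s p) ⊔ F (t p) := fun g => by
    rw [mem_ker, funext_iff]
    exact forall_congr' fun p => Submodule.Quotient.mk_eq_zero _
  have hΦs : LinearMap.range Φ = ⊤ := LinearMap.range_eq_top.2 fun b => by
    obtain ⟨g, hg⟩ := surj fun p => (b p).out
    refine ⟨g, funext fun p => ?_⟩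
    have h1 := (Submodule.Quotient.eq _).2 (hg p)
    exact h1.trans (Submodule.Quotient.mk_out _)
  have hΨ : LinearMap.range Ψ = ker Φ := by
    ext g
    rw [hΦ]
    constructor
    · rintro ⟨⟨G, f⟩, rfl⟩ p
      show G - (f (s p) : X) - (G - (f (t p) : X)) ∈ _
      rw [sub_sub_sub_cancel_left]
      exact Submodule.sub_mem _ (Submodule.mem_sup_right (f _).2) (Submodule.mem_sup_left (f _).2)
    · intro hg
      obtain ⟨G, hG⟩ := mid g hg
      exact ⟨(G, fun k => ⟨G - g k, hG k⟩), funext fun k => sub_sub_cancel _ _⟩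
  have hΘ : LinearMap.range Θ = ker Ψ := by
    ext ⟨G, f⟩
    rw [mem_ker, funext_iff]
    constructor
    · rintro ⟨x, hx⟩ k
      rw [← hx]
      exact sub_self _
    · intro h
      have h1 : ∀ k, G = f k := fun k => sub_eq_zero.1 (h k)
      exact ⟨⟨G, (mem_iInf _).2 fun k => by rw [h1 k]; exact (f k).2⟩,
        Prod.ext rfl (funext fun k => Subtype.ext (h1 k))⟩
  have hΘi : Function.Injective Θ := fun x y h => Subtype.ext (congrArg Prod.fst h)
  have e1 := LinearMap.finrank_range_add_finrank_ker Φ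
  have e2 := LinearMap.finrank_range_add_finrank_ker Ψ
  rw [hΨ, ← hΘ, LinearMap.finrank_range_of_inj hΘi, Module.finrank_prod, Module.finrank_pi_fintype] at e2
  rw [hΦs, finrank_top, Module.finrank_pi_fintype, Module.finrank_pi_fintype, Finset.sum_const, Finset.card_univ, smul_eq_mul] at e1
  have e3 : ∀ p, ((finrank ℂ (X ⧸ (F (s p) ⊔ F (t p))) : ℕ) : ℤ) =
      (finrank ℂ X : ℤ) - finrank ℂ ↥(F (s p) ⊔ F (t p)) := fun p => by
    have := Submodule.finrank_quotient_add_finrank (F (s p) ⊔ F (t p))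
    omega
  simp only [← e3, Finset.sum_sub_distrib, Finset.sum_const, Finset.card_univ, smul_eq_mul, nsmul_eq_mul]
  zify at e1 e2
  linarith

section
variable {V : Type*} [AddCommGroup V] [Module ℂ V]

theorem VanS_mul {W : Submodule ℂ V} {a b : ℕ} {p q : V → ℂ} (hp : p ∈ VanS W a) (hq : q ∈ VanS W b) :
    (fun y => p y * q y) ∈ VanS W (a + b) := fun w hw u => by
  obtain ⟨P, hP⟩ := hp w hw u
  obtain ⟨Q, hQ⟩ := hq w hw u
  exact ⟨P * Q, fun t => by show p (w + t • u) * q (w + t • u) = _; rw [hP, hQ, Polynomial.eval_mul]; ring⟩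

theorem linear_pow_mem_VanS {W : Submodule ℂ V} {l : V →ₗ[ℂ] ℂ} (h : W ≤ ker l) (k : ℕ) :
    (fun y => l y ^ k) ∈ VanS W k := fun w hw u => ⟨Polynomial.C (l u ^ k), fun t => by
  have h1 : l w = 0 := h hw
  show l (w + t • u) ^ k = _
  rw [map_add, map_smul, h1, zero_add, smul_eq_mul, mul_pow, eval_C]⟩

theorem PV_mul {W : Submodule ℂ V} {a b e e' : ℕ} {p q : V → ℂ} (hp : p ∈ PV e W a) (hq : q ∈ PV e' W b) :
    (fun y => p y * q y) ∈ PV (e + e') W (a + b) :=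
  ⟨IsPol.mul hp.1 hq.1, VanS_mul hp.2 hq.2⟩

theorem IsPol.PV_zero {e : ℕ} {p : V → ℂ} (hp : IsPol e p) (W : Submodule ℂ V) : p ∈ PV e W 0 := ⟨hp, hp.vanS_zero W⟩

theorem eq_span_of_mem {U : Submodule ℂ V} (hU : finrank ℂ U = 1) {v : V} (hvU : v ∈ U) (hv : v ≠ 0) :
    U = span ℂ {v} := by
  have : FiniteDimensional ℂ U := Module.finite_of_finrank_pos (by omega)
  exact (eq_of_le_of_finrank_eq ((Submodule.span_singleton_le_iff_mem v _).2 hvU)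
    (by rw [finrank_span_singleton hv, hU])).symm

theorem IsPol.exists_sub_mem_PV {U : Submodule ℂ V} (hU : finrank ℂ U = 1) {h : V →ₗ[ℂ] ℂ} {v : V} (hvU : v ∈ U)
    (hv : h v = 1) {e k : ℕ} {p : V → ℂ} (hp : IsPol (e + 1) p) (hk : k ≤ e + 1) :
    ∃ p', IsPol e p' ∧ (fun y => p y - h y * p' y) ∈ PV (e + 1) U k := by
  obtain ⟨p', hp', h1⟩ := hp.exists_eq_mul_add hv
  refine ⟨p', hp', ?_⟩
  have h2 : (fun y => p y - h y * p' y) = fun y => p (prj hv y) := funext fun y => by rw [h1 y, add_sub_cancel_left]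
  rw [h2, eq_span_of_mem hU hvU fun h0 => by simp [h0] at hv]
  exact ⟨(hp.comp (ker h).subtype).comp (prj hv), VanS_mono le_rfl hk (hp.prj_mem_VanS hv)⟩

theorem IsPol.exists_sub_pow_mem_PV {U : Submodule ℂ V} (hU : finrank ℂ U = 1) {h : V →ₗ[ℂ] ℂ} {v : V} (hvU : v ∈ U)
    (hv : h v = 1) {e k : ℕ} (hk : k ≤ e) (m : ℕ) {p : V → ℂ} (hp : IsPol (m + e) p) :
    ∃ p', IsPol e p' ∧ (fun y => p y - h y ^ m * p' y) ∈ PV (m + e) U k := by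
  induction m generalizing p with
  | zero => 
    rw [Nat.zero_add] at hp ⊢
    exact ⟨p, hp, by simp only [pow_zero, one_mul, sub_self]; exact zero_mem _⟩
  | succ m ih =>
    rw [Nat.succ_add] at hp ⊢
    obtain ⟨p₁, hp₁, h1⟩ := hp.exists_sub_mem_PV hU hvU hv (k := k) (by omega)
    obtain ⟨p₂, hp₂, h2⟩ := ih hp₁
    refine ⟨p₂, hp₂, ?_⟩
    have h4 := PV_mul ((IsPol.linear h).PV_zero U) h2
    rw [Nat.zero_add, Nat.add_comm 1 (m + e)] at h4
    have h3 := (PV _ U k).add_mem h1 h4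
    convert h3 using 1
    funext y
    rw [Pi.add_apply]; ring

theorem eventually_exists_mem_PV {U : Submodule ℂ V} (hU : finrank ℂ U = 1) (k : ℕ) (T : Finset (Submodule ℂ V))
    (hT : ∀ A ∈ T, finrank ℂ A = 1) (hUT : U ∉ T) :
    ∀ᶠ e in atTop, ∀ p, IsPol e p → ∃ q, q - p ∈ PV e U k ∧ ∀ A ∈ T, q ∈ PV e A k := by
  induction T using Finset.induction_on with
  | empty => exact Eventually.of_forall fun e p hp => ⟨p, by rw [sub_self]; exact zero_mem _, by simp⟩
  | insert B T hB ih =>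
    have ih' := ih (fun A hA => hT A (Finset.mem_insert_of_mem hA)) fun h => hUT (Finset.mem_insert_of_mem h)
    obtain ⟨N, hN⟩ := Filter.eventually_atTop.1 (ih'.and (Filter.eventually_ge_atTop k))
    obtain ⟨v, hv0, hv⟩ := exists_span_eq hU
    have hvB : v ∉ B := fun h => hUT (Finset.mem_insert.2 (Or.inl (by
      rw [hv, eq_span_of_mem (hT B (Finset.mem_insert_self _ _)) h hv0])))
    obtain ⟨l, hlv, hlB⟩ := Submodule.exists_le_ker_of_notMem hvB
    have hl1 : ((l v)⁻¹ • l) v = 1 := by simp [hlv]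
    have hl2 : B ≤ ker ((l v)⁻¹ • l) := fun y hy => by
      have : l y = 0 := hlB hy
      simp [this]
    refine Filter.eventually_atTop.2 ⟨k + N, fun e he p hp => ?_⟩
    obtain ⟨d, rfl⟩ : ∃ d, e = k + d := ⟨e - k, by omega⟩
    obtain ⟨p', hp', h1⟩ := hp.exists_sub_pow_mem_PV hU (v := v) (by rw [hv]; exact mem_span_singleton_self v) hl1
      (hN d (by omega)).2 k
    obtain ⟨q, hq, hqT⟩ := (hN d (by omega)).1 p' hp'
    have hq' : IsPol d q := by simpa using hq.1.add hp'
    refine ⟨fun y => ((l v)⁻¹ • l) y ^ k * q y, ?_, fun A hA => ?_⟩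
    · have h2 := (PV _ U k).sub_mem (by simpa only [zero_add] using PV_mul ((IsPol.linear_pow ((l v)⁻¹ • l) k).PV_zero U) hq) h1
      convert h2 using 1
      funext y
      simp only [Pi.sub_apply]; ring
    · rcases Finset.mem_insert.1 hA with rfl | hA
      · exact PV_mul (a := k) (b := 0) ⟨IsPol.linear_pow _ k, linear_pow_mem_VanS hl2 k⟩ (hq'.PV_zero A)
      · simpa only [zero_add] using PV_mul ((IsPol.linear_pow ((l v)⁻¹ • l) k).PV_zero A) (hqT A hA)

/-- Interpolation along finitely many lines in large degree. -/
theorem eventually_exists_sub_mem_PV (k : ℕ) (T : Finset (Submodule ℂ V)) (hT : ∀ A ∈ T, finrank ℂ A = 1) :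
    ∀ᶠ e in atTop, ∀ p : Submodule ℂ V → V → ℂ, (∀ A, IsPol e (p A)) →
      ∃ q, IsPol e q ∧ ∀ A ∈ T, q - p A ∈ PV e A k := by
  have h1 : ∀ᶠ e in atTop, ∀ U ∈ T, ∀ p, IsPol e p → ∃ q, q - p ∈ PV e U k ∧ ∀ A ∈ T.erase U, q ∈ PV e A k :=
    (Filter.eventually_all_finset T).2 fun U hU => eventually_exists_mem_PV (hT U hU) k _
      (fun A hA => hT A (Finset.mem_of_mem_erase hA)) (Finset.notMem_erase U T)
  filter_upwards [h1] with e he p hp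
  have h2 : ∀ U : Submodule ℂ V, ∃ q, U ∈ T → q - p U ∈ PV e U k ∧ ∀ A ∈ T.erase U, q ∈ PV e A k := fun U => by
    by_cases hU : U ∈ T
    · obtain ⟨q, hq⟩ := he U hU (p U) (hp U)
      exact ⟨q, fun _ => hq⟩
    · exact ⟨0, fun h => absurd h hU⟩
  choose q hq using h2
  refine ⟨∑ U ∈ T, q U, (Pol V e).sum_mem fun U hU => ?_, fun A hA => ?_⟩
  · have := (Pol V e).add_mem (hq U hU).1.1 (hp U)
    rwa [sub_add_cancel] at this
  · rw [← Finset.sum_erase_add _ _ hA, add_sub_assoc]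
    refine Submodule.add_mem _ (Submodule.sum_mem _ fun U hU => ?_) (hq A hA).1
    exact (hq U (Finset.mem_of_mem_erase hU)).2 A (Finset.mem_erase.2 ⟨(Finset.ne_of_mem_erase hU).symm, hA⟩)

end

section

section general
variable {K : Type*} [AddCommGroup K] [Module ℂ K]

theorem mem_PV_sup_of_mul {h : K →ₗ[ℂ] ℂ} {v : K} (hv : h v = 1) {W : Submodule ℂ K} (hvW : v ∈ W) {k k' e : ℕ} {p : K → ℂ}
    (hp : IsPol e p) (H : (fun y => h y * p y) ∈ PV (e + 1) (span ℂ {v}) k' ⊔ PV (e + 1) W k) :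
    p ∈ PV e (span ℂ {v}) k' ⊔ PV e W k := by
  rw [PV_sup_eq_DS hv hvW, mem_DS] at H ⊢
  exact ⟨hp, fun j hj => by rw [← rcmp_mul hv hp hj]; exact H.2 j (by omega)⟩

theorem exists_generic {ι : Type*} [Finite ι] (L : ι → K →ₗ[ℂ] ℂ) :
    ∃ (h : K →ₗ[ℂ] ℂ) (c : Submodule ℂ K → K), ∀ I, flat L I ≠ ⊥ → c (flat L I) ∈ flat L I ∧ h (c (flat L I)) = 1 := by
  have h1 : ∀ A : Submodule ℂ K, ∃ v, A ≠ ⊥ → v ∈ A ∧ v ≠ 0 := fun A => by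
    by_cases hA : A = ⊥
    · exact ⟨0, fun h => absurd hA h⟩
    · obtain ⟨v, h⟩ := Submodule.exists_mem_ne_zero_of_ne_bot hA
      exact ⟨v, fun _ => h⟩
  choose c hc using h1
  obtain ⟨f, hf⟩ := Module.exists_dual_forall_apply_ne_zero (K := ℂ)
    (fun I : {I : Set ι // flat L I ≠ ⊥} => c (flat L I.1)) fun I => (hc _ I.2).2
  exact ⟨f, fun A => (f (c A))⁻¹ • c A, fun I hI => ⟨Submodule.smul_mem _ _ (hc _ hI).1, by
    rw [map_smul, smul_eq_mul, inv_mul_cancel₀ (hf ⟨I, hI⟩)]⟩⟩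

theorem eq_zero_of_ker {h l : K →ₗ[ℂ] ℂ} {v : K} (hv : h v = 1) (hl : ∀ y : ker h, l y = 0) (hlv : l v = 0) : l = 0 :=
  LinearMap.ext fun y => by rw [eq_prj_add hv y, map_add, map_smul, hl, hlv, smul_zero, add_zero, LinearMap.zero_apply]

end general

variable {ι : Type*} [Fintype ι] {L : ι → E 4 →ₗ[ℂ] ℂ} {α : ℝ}

/-- Solvability of the compatibility problem in degree `e`. -/
def Solv (L : ι → E 4 →ₗ[ℂ] ℂ) (α : ℝ) (e : ℕ) : Prop :=
  ∀ b : Submodule ℂ (E 4) → Submodule ℂ (E 4) → E 4 → ℂ, (∀ V W, IsPol e (b V W)) →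
    ∃ g : Submodule ℂ (E 4) → E 4 → ℂ, (∀ A, IsPol e (g A)) ∧ ∀ I J, finrank ℂ (flat L I) = 1 →
      finrank ℂ (flat L J) = 2 → flat L I ≤ flat L J →
      g (flat L I) - g (flat L J) - b (flat L I) (flat L J) ∈
        PV e (flat L I) (ordAt L α (flat L I)) ⊔ PV e (flat L J) (ordAt L α (flat L J))

theorem ordAt_le (hα0 : 0 < α) {e : ℕ} (hα : α * card ι ≤ e + 4) (V : Submodule ℂ (E 4)) :
    ordAt L α V ≤ e + finrank ℂ V := by
  have h1 : ⌈α * mlt L V⌉ ≤ e + 4 := Int.ceil_le.2 (by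
    have : (mlt L V : ℝ) ≤ card ι := by exact_mod_cast mlt_le V
    push_cast; nlinarith)
  rw [ordAt]; omega

theorem Solv.of_succ (hL : ∀ i, L i ≠ 0) (hnp : ∀ i j, i ≠ j → ∀ c : ℂ, L i ≠ c • L j) (hα0 : 0 < α) (hα1 : α < 1)
    {e : ℕ} (hα : α * card ι ≤ e + 4) (ih : Solv L α (e + 1)) : Solv L α e := by
  intro b hb
  have hE : finrank ℂ (E 4) = 4 := by simp [E]
  obtain ⟨h, c, hc⟩ := exists_generic L
  obtain ⟨g, hg, hg'⟩ := ih (fun V W y => h y * b V W y) fun V W => by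
    rw [Nat.add_comm]; exact (IsPol.linear h).mul (hb V W)
  have htop : flat L ∅ ≠ ⊥ := fun h0 => by
    have : flat L ∅ = ⊤ := by simp [flat]
    rw [this] at h0
    rw [← finrank_top, h0, finrank_bot] at hE; omega
  have hv := (hc ∅ htop).2
  set v := c (flat L ∅)
  have hK : finrank ℂ (ker h) = 3 := by
    have := finrank_ker_of_eq_one hv; omega
  let cl : Submodule ℂ (ker h) → Submodule ℂ (E 4) := fun U =>
    flat L {i | U.map (ker h).subtype ≤ ker (L i)}
  have hne : ∀ i j, flat L {i, j} ≠ ⊥ := fun i j h0 => by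
    have h1 : ker ((L i).prod (L j)) = ⊥ := by
      rw [← h0]; ext y; simp [mem_flat]
    have := LinearMap.finrank_le_finrank_of_injective (LinearMap.ker_eq_bot.1 h1)
    simp [hE] at this
  have hcij : ∀ i j, L i (c (flat L {i, j})) = 0 ∧ L j (c (flat L {i, j})) = 0 := fun i j => by
    have := mem_flat.1 (hc {i, j} (hne i j)).1
    exact ⟨this i (by simp), this j (by simp)⟩
  obtain ⟨G, hG, hG'⟩ := exists_glue_dim_three hK (L := fun i => L i ∘ₗ (ker h).subtype) (e := e + 1)
    (t := fun U y => g (cl U) y)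
    (fun i h0 => hL i (eq_zero_of_ker (hc {i, i} (hne i i)).2 (fun y => LinearMap.congr_fun h0 y) (hcij i i).1))
    (fun i j hij s h0 => hnp i j hij s (sub_eq_zero.1 (eq_zero_of_ker (hc {i, j} (hne i j)).2
      (fun y => sub_eq_zero.2 (LinearMap.congr_fun h0 y)) (by
        rw [LinearMap.sub_apply, LinearMap.smul_apply, (hcij i j).1, (hcij i j).2, smul_zero, sub_zero]))))
    hα0 hα1 (by push_cast; linarith) fun U => (hg _).comp (ker h).subtype
  have hp : ∀ A, IsPol (e + 1) fun y => g A y - G (prj hv y) := fun A => (hg A).sub (hG.comp (prj hv))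
  have key : ∀ A, ∃ p', IsPol e p' ∧ ∀ I, A = flat L I → finrank ℂ A = 1 ∨ finrank ℂ A = 2 →
      (fun y => g A y - G (prj hv y) - h y * p' y) ∈ PV (e + 1) A (ordAt L α A) := by
    intro A
    by_cases hA : ∃ I, A = flat L I ∧ (finrank ℂ A = 1 ∨ finrank ℂ A = 2)
    · obtain ⟨I, rfl, hI⟩ := hA
      have hI0 : flat L I ≠ ⊥ := fun h0 => by rw [h0, finrank_bot] at hI; omega
      obtain ⟨hcI, hcI'⟩ := hc I hI0
      rcases hI with hI | hI
      · obtain ⟨p', hp', h1⟩ := (hp (flat L I)).exists_sub_mem_PV hI hcI hcI'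
          (k := ordAt L α (flat L I)) ((ordAt_le hα0 hα _).trans_eq (by rw [hI]))
        exact ⟨p', hp', fun _ _ _ => h1⟩
      · obtain ⟨p', hp', h1⟩ := (hp (flat L I)).exists_eq_mul_add hcI'
        refine ⟨p', hp', fun _ _ _ => ?_⟩
        have h2 := finrank_comap_ker hcI hcI'
        set U := (flat L I).comap (ker h).subtype with hU
        have hUm : U.map (ker h).subtype ≤ flat L I := Submodule.map_comap_le _ _
        have hcl : cl U = flat L I := by
          have h3 : cl U ≤ flat L I := flat_mono fun i hi y hy => mem_flat.1 (hUm hy) i hi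
          have h4 : U.map (ker h).subtype ≤ cl U := fun y hy => mem_flat.2 fun i hi => hi hy
          have h5 : cl U ≠ ⊥ := fun h0 => by
            have h6 := (Submodule.finrank_map_subtype_eq (ker h) U).symm
            rw [h0, le_bot_iff] at h4
            rw [h4, finrank_bot] at h6; omega
          obtain ⟨h6, h7⟩ := hc _ h5
          have h8 : finrank ℂ ((cl U).comap (ker h).subtype) + 1 = finrank ℂ (cl U) :=
            finrank_comap_ker h6 h7
          have h9 := finrank_mono (Submodule.map_le_iff_le_comap.1 h4)
          exact Submodule.eq_of_le_of_finrank_le h3 (by omega)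
        have h3 := hG' U (by omega)
        have hm : mlt L (flat L I) ≤ mlt (fun i => L i ∘ₗ (ker h).subtype) U :=
          Finset.card_le_card fun i hi => by
            simp only [mem_filter, mem_univ, true_and] at hi ⊢
            exact fun y hy => hi hy
        have hm' : ⌈α * mlt L (flat L I)⌉ ≤ ⌈α * mlt (fun i => L i ∘ₗ (ker h).subtype) U⌉ :=
          Int.ceil_mono (mul_le_mul_of_nonneg_left (by exact_mod_cast hm) hα0.le)
        have h4 := VanS_mono le_rfl (show ordAt L α (flat L I) ≤ _ by rw [ordAt, hI]; exact Int.toNat_le_toNat (by omega)) h3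
        have h5 := VanS_comp h4 (prj hcI') (W' := flat L I) (by
          rintro _ ⟨y, hy, rfl⟩
          exact (flat L I).sub_mem hy ((flat L I).smul_mem _ hcI))
        have h6 : (fun y => g (flat L I) y - G (prj hv y) - h y * p' y) =
            -fun y => (G - fun y : ker h => g (cl U) y) (prj hcI' y) := by
          funext y
          have h7 : prj hv (prj hcI' y : E 4) = prj hcI' y := by
            have := prj_add hv (prj hcI' y) 0
            rwa [zero_smul, add_zero] at this
          rw [h1 y, h7, hcl, Pi.neg_apply, Pi.sub_apply]; ring
        rw [h6]
        refine (PV _ _ _).neg_mem ⟨?_, h5⟩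
        exact (hG.sub ((hg _).comp (ker h).subtype)).comp (prj hcI')
    · exact ⟨0, IsPol.zero, fun I h1 h2 => absurd ⟨I, h1, h2⟩ hA⟩
  choose g' hg1 hg2 using key
  refine ⟨g', hg1, fun I J hI hJ hIJ => ?_⟩
  have hI0 : flat L I ≠ ⊥ := fun h0 => by rw [h0, finrank_bot] at hI; omega
  obtain ⟨hcI, hcI'⟩ := hc I hI0
  have h1 := hg' I J hI hJ hIJ
  have h2 := Submodule.mem_sup_left (T := PV (e + 1) (flat L J) (ordAt L α (flat L J))) (hg2 _ I rfl (Or.inl hI))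
  have h3 := Submodule.mem_sup_right (S := PV (e + 1) (flat L I) (ordAt L α (flat L I))) (hg2 _ J rfl (Or.inr hJ))
  have h4 := Submodule.add_mem _ (Submodule.sub_mem _ h1 h2) h3
  have hs := eq_span_of_mem hI hcI fun h0 => by simp [h0] at hcI'
  generalize ordAt L α (flat L I) = k at h4 ⊢
  suffices H : ∀ A, A = flat L I → g' (flat L I) - g' (flat L J) - b (flat L I) (flat L J) ∈
      PV e A k ⊔ PV e (flat L J) (ordAt L α (flat L J)) from H _ rfl
  rintro A hA
  rw [hs] at hA
  rw [hA]
  refine mem_PV_sup_of_mul hcI' (hIJ hcI) (((hg1 _).sub (hg1 _)).sub (hb _ _)) ?_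
  rw [← hs]
  convert h4 using 1
  funext y
  simp only [Pi.sub_apply, Pi.add_apply]; ring

theorem solv (hL : ∀ i, L i ≠ 0) (hnp : ∀ i j, i ≠ j → ∀ c : ℂ, L i ≠ c • L j) (hα0 : 0 < α) (hα1 : α < 1)
    {e : ℕ} (hα : α * card ι ≤ e + 4) : Solv L α e := by
  have hbig : ∀ᶠ m in atTop, Solv L α m := by
    have h1 := eventually_exists_sub_mem_PV (e + 1) ((univ.image (flat L)).filter fun A => finrank ℂ A = 1) (by simp)
    filter_upwards [h1] with m hm b hb
    choose q hq hq' using fun W => hm (fun V => -b V W) fun V => (Pol _ m).neg_mem (hb V W)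
    refine ⟨fun A => if finrank ℂ A = 2 then q A else 0, fun A => ?_, fun I J hI hJ hIJ => ?_⟩
    · by_cases h2 : finrank ℂ A = 2
      · simpa only [if_pos h2] using hq A
      · simp only [if_neg h2]; exact IsPol.zero
    · simp only [if_pos hJ, hI, OfNat.one_ne_ofNat, if_false]
      refine Submodule.mem_sup_left ?_
      have h2 := hq' (flat L J) (flat L I) (by simp [hI])
      have h3 : (0 : E 4 → ℂ) - q (flat L J) - b (flat L I) (flat L J) = -(q (flat L J) - -b (flat L I) (flat L J)) := by ring
      rw [h3]
      exact (PV _ _ _).neg_mem ⟨h2.1, VanS_mono le_rfl ((ordAt_le hα0 hα _).trans_eq (by rw [hI])) h2.2⟩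
  obtain ⟨N, hN⟩ := Filter.eventually_atTop.1 hbig
  have h1 : ∀ m, Solv L α (e + m) → Solv L α e := by
    intro m
    induction m with
    | zero => exact id
    | succ m ih => exact fun h => ih (h.of_succ hL hnp hα0 hα1 (by push_cast; linarith))
  exact h1 N (hN _ (by omega))

end

section

variable {ι : Type*} {L : ι → E 4 →ₗ[ℂ] ℂ} {α : ℝ}

theorem nonempty_of_finrank {I : Set ι} (hI : finrank ℂ (flat L I) < 4) : I.Nonempty := by
  rw [Set.nonempty_iff_ne_empty]
  rintro rfl
  rw [show flat L ∅ = ⊤ by simp [flat], finrank_top, Module.finrank_fin_fun] at hI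
  omega

variable [Fintype ι]

theorem exists_glue_link (hL : ∀ i, L i ≠ 0) (hnp : ∀ i j, i ≠ j → ∀ c : ℂ, L i ≠ c • L j) (hα0 : 0 < α) (hα1 : α < 1)
    {V : Submodule ℂ (E 4)} (hV : finrank ℂ V = 1) {h : E 4 →ₗ[ℂ] ℂ} {v : E 4} (hvV : v ∈ V) (hv : h v = 1) {j : ℕ}
    (hj : ordAt L α V ≤ j) {t : Submodule ℂ (E 4) → ker h → ℂ} (ht : ∀ W, IsPol j (t W)) :
    ∃ G, IsPol j G ∧ ∀ W : Submodule ℂ (E 4), finrank ℂ W = 2 → V ≤ W →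
      G - t W ∈ VanS (W.comap (ker h).subtype) (ordAt L α W) := by
  have hE : finrank ℂ (E 4) = 4 := by simp [E]
  have hK : finrank ℂ (ker h) = 3 := by
    have := finrank_ker_of_eq_one hv; omega
  have hcard : card {i // V ≤ ker (L i)} = mlt L V := Fintype.card_subtype _
  have h1 : α * card {i // V ≤ ker (L i)} ≤ j + 3 := by
    rw [hcard]
    refine (Int.le_ceil _).trans ?_
    have := hj
    rw [ordAt, hV] at this
    have h2 : ⌈α * mlt L V⌉ ≤ j + 3 := by omega
    exact_mod_cast h2
  obtain ⟨G, hG, hG'⟩ := exists_glue_dim_three hK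
    (L := fun i : {i // V ≤ ker (L i)} => L i ∘ₗ (ker h).subtype) (e := j)
    (t := fun U => t (U.map (ker h).subtype ⊔ V))
    (fun i h0 => hL i (eq_zero_of_ker hv (fun y => LinearMap.congr_fun h0 y) (i.2 hvV)))
    (fun i k hik s h0 => hnp i k (Subtype.coe_ne_coe.2 hik) s (sub_eq_zero.1 (eq_zero_of_ker hv
      (fun y => sub_eq_zero.2 (LinearMap.congr_fun h0 y)) (by
        rw [LinearMap.sub_apply, LinearMap.smul_apply, mem_ker.1 (i.2 hvV), mem_ker.1 (k.2 hvV),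
          smul_zero, sub_zero]))))
    hα0 hα1 h1 fun U => ht _
  refine ⟨G, hG, fun W hW hVW => ?_⟩
  have h2 := finrank_comap_ker (hVW hvV) hv
  have h3 := hG' (W.comap (ker h).subtype) (by omega)
  have h4 : (W.comap (ker h).subtype).map (ker h).subtype ⊔ V = W := by
    refine le_antisymm (sup_le (Submodule.map_comap_le _ _) hVW) fun y hy => ?_
    rw [eq_prj_add hv y]
    refine Submodule.add_mem_sup ⟨prj hv y, ?_, rfl⟩ (V.smul_mem _ hvV)
    exact W.sub_mem hy (W.smul_mem _ (hVW hvV))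
  rw [h4] at h3
  refine VanS_mono le_rfl ?_ h3
  have hm : mlt L W ≤ mlt (fun i : {i // V ≤ ker (L i)} => L i ∘ₗ (ker h).subtype)
      (W.comap (ker h).subtype) := by
    rw [mlt, mlt, ← Finset.card_map (Function.Embedding.subtype _)]
    refine Finset.card_le_card fun i hi => ?_
    simp only [mem_filter, mem_univ, true_and] at hi
    refine Finset.mem_map.2 ⟨⟨i, hVW.trans hi⟩, ?_, rfl⟩
    simp only [mem_filter, mem_univ, true_and]
    exact fun y hy => hi hy
  have hm' : α * mlt L W ≤ _ := mul_le_mul_of_nonneg_left (Nat.cast_le (α := ℝ).2 hm) hα0.le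
  have := Int.ceil_mono hm'
  rw [ordAt, hW]
  exact Int.toNat_le_toNat (by omega)

theorem exists_local_lift (hL : ∀ i, L i ≠ 0) (hnp : ∀ i j, i ≠ j → ∀ c : ℂ, L i ≠ c • L j) (hα0 : 0 < α) (hα1 : α < 1)
    {e : ℕ} {g : Submodule ℂ (E 4) → E 4 → ℂ} (hg : ∀ A, IsPol e (g A)) {V : Submodule ℂ (E 4)} (hV : finrank ℂ V = 1)
    (hyp : ∀ W : Submodule ℂ (E 4), finrank ℂ W = 2 → V ≤ W → 2 ≤ mlt L W → g V - g W ∈ PV e V (ordAt L α V) ⊔ PV e W (ordAt L α W)) :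
    ∃ p, IsPol e p ∧ p - g V ∈ VanS V (ordAt L α V) ∧
      ∀ W : Submodule ℂ (E 4), finrank ℂ W = 2 → V ≤ W → 2 ≤ mlt L W → p - g W ∈ VanS W (ordAt L α W) := by
  obtain ⟨v, hv0, rfl⟩ := exists_span_eq hV
  set V := span ℂ {v} with hVs
  have hvV : v ∈ V := mem_span_singleton_self v
  obtain ⟨h, hv⟩ := exists_dual_eq_one hv0
  have hN : ∀ j, ∃ G : ker h → ℂ, IsPol j G ∧ (ordAt L α V ≤ j → j ≤ e → ∀ W : Submodule ℂ (E 4), finrank ℂ W = 2 → V ≤ W →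
      G - rcmp h v e j (g W) ∈ VanS (W.comap (ker h).subtype) (ordAt L α W)) := by
    intro j
    by_cases hj : ordAt L α V ≤ j ∧ j ≤ e
    swap
    · exact ⟨0, IsPol.zero, fun h1 h2 => absurd ⟨h1, h2⟩ hj⟩
    obtain ⟨G, hG, hG'⟩ := exists_glue_link hL hnp hα0 hα1 hV hvV hv hj.1 (t := fun W => rcmp h v e j (g W))
      fun W => (hg W).rcmp hj.2
    exact ⟨G, hG, fun _ _ => hG'⟩
  choose G hG hG' using hN
  set q : ℕ → ker h → ℂ := fun j => if j < ordAt L α V then rcmp h v e j (g V) else G j with hq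
  have hq' : ∀ j, j ≤ e → IsPol j (q j) := fun j hj => by
    by_cases h1 : j < ordAt L α V
    · simp only [hq, if_pos h1]; exact (hg V).rcmp hj
    · simp only [hq, if_neg h1]; exact hG j
  have hp := IsPol.glue hv hq'
  refine ⟨glue hv e q, hp, ?_, fun W hW hVW hm => ?_⟩
  · rw [mem_VanS_span_iff hv (hp.sub (hg V))]
    intro j hj hj'
    rw [map_sub, rcmp_glue hv hq' hj, hq]
    simp only [if_pos hj', sub_self]
  · rw [mem_VanS_iff hv (hVW hvV) (hp.sub (hg W))]
    intro j hj
    rw [map_sub, rcmp_glue hv hq' hj, hq]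
    by_cases h1 : j < ordAt L α V
    · have h2 := hyp W hW hVW hm
      rw [PV_sup_eq_DS hv (hVW hvV), mem_DS] at h2
      have h3 := h2.2 j hj
      rw [if_pos h1, map_sub] at h3
      simp only [if_pos h1]
      exact h3.2
    · simp only [if_neg h1]
      exact hG' j (by omega) hj W hW hVW

/-- Interpolation along the lines and planes of a four dimensional arrangement. -/
theorem exists_glue_dim_four (hL : ∀ i, L i ≠ 0) (hnp : ∀ i j, i ≠ j → ∀ c : ℂ, L i ≠ c • L j) (hα0 : 0 < α) (hα1 : α < 1)
    {e : ℕ} (hα : α * card ι ≤ e + 4) {g : Submodule ℂ (E 4) → E 4 → ℂ} (hg : ∀ A, IsPol e (g A))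
    (hyp : ∀ I J, finrank ℂ (flat L I) = 1 → finrank ℂ (flat L J) = 2 → flat L I ≤ flat L J →
      g (flat L I) - g (flat L J) ∈ PV e (flat L I) (ordAt L α (flat L I)) ⊔ PV e (flat L J) (ordAt L α (flat L J))) :
    ∃ G, IsPol e G ∧ ∀ I, finrank ℂ (flat L I) = 1 ∨ finrank ℂ (flat L I) = 2 →
      G - g (flat L I) ∈ VanS (flat L I) (ordAt L α (flat L I)) := by
  have hE : finrank ℂ (E 4) = 4 := by simp [E]
  have hlift : ∀ A : Submodule ℂ (E 4), ∃ p, IsPol e p ∧ ((finrank ℂ A = 2 → p = g A) ∧ ∀ I, A = flat L I → finrank ℂ A = 1 →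
      p - g A ∈ VanS A (ordAt L α A) ∧
      ∀ W : Submodule ℂ (E 4), finrank ℂ W = 2 → A ≤ W → 2 ≤ mlt L W → p - g W ∈ VanS W (ordAt L α W)) := by
    intro A
    by_cases hA : ∃ I, A = flat L I ∧ finrank ℂ A = 1
    · obtain ⟨I, rfl, hI⟩ := hA
      obtain ⟨p, hp, h1⟩ := exists_local_lift hL hnp hα0 hα1 hg hI fun W hW hIW hm => by
        obtain ⟨J, -, rfl⟩ := flat_of_two_le_mlt hL hnp hm (by omega)
        exact hyp I J hI hW hIW
      exact ⟨p, hp, fun h => by omega, fun _ _ _ => h1⟩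
    · exact ⟨g A, hg A, fun _ => rfl, fun I h1 h2 => absurd ⟨I, h1, h2⟩ hA⟩
  choose q hq hq2 hq1 using hlift
  obtain ⟨G, hG, hG'⟩ := exists_glue_flats hL hα0 (by exact_mod_cast hα) hq fun I J hJ hI hIJ => by
    have h0 := mt finrank_eq_zero.1 hI
    have h1 := finrank_mono hIJ
    by_cases hm : mlt L (flat L J) ≤ 1
    · rw [ordAt_eq_zero_of_mlt_le_one hα1 hm (finrank_flat_lt hL hJ)]
      exact ((hq _).sub (hq _)).vanS_zero _
    have h2 : ¬ 4 ≤ finrank ℂ (flat L J) + 1 := fun h => hm (mlt_le_one hL hnp (by omega))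
    by_cases h3 : finrank ℂ (flat L I) = finrank ℂ (flat L J)
    · rw [eq_of_le_of_finrank_eq hIJ h3, sub_self]
      exact zero_mem _
    have hJ2 : finrank ℂ (flat L J) = 2 := by omega
    rw [hq2 _ hJ2]
    exact (hq1 _ I rfl (by omega)).2 _ hJ2 hIJ (by omega)
  refine ⟨G, hG, fun I hI => ?_⟩
  have h1 := hG' I (nonempty_of_finrank (L := L) (by omega)) fun h => by rw [h, finrank_bot] at hI; omega
  rcases hI with hI | hI
  · have h2 := (VanS _ _).add_mem h1 (hq1 _ I rfl hI).1
    rwa [sub_add_sub_cancel] at h2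
  · rwa [hq2 _ hI] at h1

end

section

section general
variable {V : Type*} [AddCommGroup V] [Module ℂ V]

theorem exists_ne_zero_iff_of_exact [FiniteDimensional ℂ V] {κ P : Type*} [Fintype κ] [Fintype P] (e : ℕ)
    (A : κ → Submodule ℂ V) (o : κ → ℕ) (s t : P → κ)
    (mid : ∀ g : κ → V → ℂ, (∀ k, IsPol e (g k)) →
      (∀ p, g (s p) - g (t p) ∈ PV e (A (s p)) (o (s p)) ⊔ PV e (A (t p)) (o (t p))) →
      ∃ G, IsPol e G ∧ ∀ k, G - g k ∈ VanS (A k) (o k))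
    (surj : ∀ b : P → V → ℂ, (∀ p, IsPol e (b p)) → ∃ g : κ → V → ℂ, (∀ k, IsPol e (g k)) ∧
      ∀ p, g (s p) - g (t p) - b p ∈ PV e (A (s p)) (o (s p)) ⊔ PV e (A (t p)) (o (t p))) :
    (∃ p, p ≠ 0 ∧ IsPol e p ∧ ∀ k, p ∈ VanS (A k) (o k)) ↔
      (finrank ℂ (Pol V e) : ℤ)
        - ∑ k, ((finrank ℂ (Pol V e) : ℤ) - finrank ℂ (PV e (A k) (o k)))
        + ∑ p, ((finrank ℂ (Pol V e) : ℤ) -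
            finrank ℂ ↥(PV e (A (s p)) (o (s p)) ⊔ PV e (A (t p)) (o (t p)))) ≠ 0 := by
  have : FiniteDimensional ℂ (Pol V e) := finite_Pol V e
  have hle : ∀ k, PV e (A k) (o k) ≤ Pol V e := fun k => inf_le_left
  let F : κ → Submodule ℂ (Pol V e) := fun k => (PV e (A k) (o k)).submoduleOf (Pol V e)
  have hsup : ∀ p, F (s p) ⊔ F (t p) = (PV e (A (s p)) (o (s p)) ⊔ PV e (A (t p)) (o (t p))).submoduleOf (Pol V e) :=
    fun p => (Submodule.submoduleOf_sup_of_le (hle _) (hle _)).symm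
  have h1 := finrank_iInf_of_exact F s t (fun g hg => by
      obtain ⟨G, hG, hG'⟩ := mid (fun k => g k) (fun k => (g k).2) fun p => by
        have := hg p
        rw [hsup] at this
        exact this
      exact ⟨⟨G, hG⟩, fun k => ⟨hG.sub (g k).2, hG' k⟩⟩)
    fun b => by
      obtain ⟨g, hg, hg'⟩ := surj (fun p => b p) fun p => (b p).2
      exact ⟨fun k => ⟨g k, hg k⟩, fun p => by rw [hsup]; exact hg' p⟩
  have h2 : ∀ k, finrank ℂ (F k) = finrank ℂ (PV e (A k) (o k)) := fun k =>
    (Submodule.submoduleOfEquivOfLe (hle k)).finrank_eq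
  have h3 : ∀ p, finrank ℂ ↥(F (s p) ⊔ F (t p)) =
      finrank ℂ ↥(PV e (A (s p)) (o (s p)) ⊔ PV e (A (t p)) (o (t p))) := fun p => by
    rw [hsup]; exact (Submodule.submoduleOfEquivOfLe (sup_le (hle _) (hle _))).finrank_eq
  simp only [h2, h3] at h1
  rw [← h1, Nat.cast_ne_zero, Ne, finrank_eq_zero, ← Ne, Submodule.ne_bot_iff]
  constructor
  · rintro ⟨p, hp0, hp, hp'⟩
    exact ⟨⟨p, hp⟩, mem_iInf _ |>.2 fun k => ⟨hp, hp' k⟩, fun h => hp0 (congrArg Subtype.val h)⟩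
  · rintro ⟨p, hp, hp0⟩
    exact ⟨p, fun h => hp0 (Subtype.ext h), p.2, fun k => (mem_iInf _ |>.1 hp k).2⟩

end general

variable {ι : Type*} [Fintype ι] {L : ι → E 4 →ₗ[ℂ] ℂ} {α : ℝ}

/-- The flats of dimension `r`. -/
def flats (L : ι → E 4 →ₗ[ℂ] ℂ) (r : ℕ) : Finset (Submodule ℂ (E 4)) :=
  (univ.image (flat L)).filter fun A => finrank ℂ A = r

theorem mem_flats {r : ℕ} {A : Submodule ℂ (E 4)} : A ∈ flats L r ↔ (∃ I, flat L I = A) ∧ finrank ℂ A = r := by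
  simp [flats]

theorem ordAt_mono (hα0 : 0 < α) {V W : Submodule ℂ (E 4)} (hV : finrank ℂ V = 1) (hW : finrank ℂ W = 2)
    (h : V ≤ W) : ordAt L α W ≤ ordAt L α V + 1 := by
  have h1 : α * mlt L W ≤ α * mlt L V := mul_le_mul_of_nonneg_left (Nat.cast_le (α := ℝ).2 (mlt_anti h)) hα0.le
  have := Int.ceil_mono h1
  rw [ordAt, ordAt, hV, hW]
  omega

theorem exists_ne_zero_iff_dim_four (hL : ∀ i, L i ≠ 0) (hnp : ∀ i j, i ≠ j → ∀ c : ℂ, L i ≠ c • L j) (hα0 : 0 < α) (hα1 : α < 1)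
    {e : ℕ} (hα : α * card ι ≤ e + 4) :
    (∃ p, p ≠ 0 ∧ IsPol e p ∧ ∀ I, finrank ℂ (flat L I) = 1 ∨ finrank ℂ (flat L I) = 2 →
      p ∈ VanS (flat L I) (ordAt L α (flat L I))) ↔
    ((e + 3).choose 3 : ℤ)
      + ∑ p ∈ (flats L 2 ×ˢ flats L 1).filter (fun p => p.2 ≤ p.1),
          ((ordAt L α p.2 : ℤ) * (ordAt L α p.1 + 1).choose 2 - 2 * (ordAt L α p.1 + 1).choose 3)
      - ∑ W ∈ flats L 2, (((e : ℤ) + 1) * (ordAt L α W + 1).choose 2 - 2 * (ordAt L α W + 1).choose 3)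
      - ∑ V ∈ flats L 1, ((ordAt L α V + 2).choose 3 : ℤ) ≠ 0 := by
  have hE : finrank ℂ (E 4) = 4 := by simp [E]
  set T := flats L 2 ∪ flats L 1 with hT
  have hTm : ∀ A, A ∈ T ↔ ∃ I, flat L I = A ∧ (finrank ℂ A = 1 ∨ finrank ℂ A = 2) := fun A => by
    rw [hT, Finset.mem_union, mem_flats, mem_flats, ← and_or_left, exists_and_right, or_comm]
  set TP := (flats L 2 ×ˢ flats L 1).filter fun p => p.2 ≤ p.1 with hTP
  have hTPm : ∀ p, p ∈ TP ↔ (((∃ J, flat L J = p.1) ∧ finrank ℂ p.1 = 2) ∧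
      (∃ I, flat L I = p.2) ∧ finrank ℂ p.2 = 1) ∧ p.2 ≤ p.1 := fun p => by
    rw [hTP, mem_filter, Finset.mem_product, mem_flats, mem_flats]
  have hP : ∀ p : TP, (∃ I, flat L I = p.1.2) ∧ (∃ J, flat L J = p.1.1) ∧ finrank ℂ p.1.2 = 1 ∧
      finrank ℂ p.1.1 = 2 ∧ p.1.2 ≤ p.1.1 := fun p => by
    have := (hTPm _).1 p.2
    tauto
  let s : TP → T := fun p => ⟨p.1.2, (hTm _).2 ((hP p).1.imp fun I h => ⟨h, Or.inl (hP p).2.2.1⟩)⟩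
  let t : TP → T := fun p => ⟨p.1.1, (hTm _).2 ((hP p).2.1.imp fun I h => ⟨h, Or.inr (hP p).2.2.2.1⟩)⟩
  have key := exists_ne_zero_iff_of_exact e (fun A : T => A.1) (fun A => ordAt L α A.1) s t
    (fun g hg hg' => by
      obtain ⟨G, hG, hG'⟩ := exists_glue_dim_four hL hnp hα0 hα1 hα (g := fun A => if h : A ∈ T then g ⟨A, h⟩ else 0)
        (fun A => by
          by_cases h : A ∈ T
          · simp only [dif_pos h]; exact hg _
          · simp only [dif_neg h]; exact IsPol.zero)
        fun I J hI hJ hIJ => by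
          have h1 : flat L I ∈ T := (hTm _).2 ⟨I, rfl, Or.inl hI⟩
          have h2 : flat L J ∈ T := (hTm _).2 ⟨J, rfl, Or.inr hJ⟩
          simp only [dif_pos h1, dif_pos h2]
          exact hg' ⟨(flat L J, flat L I), (hTPm _).2 ⟨⟨⟨⟨J, rfl⟩, hJ⟩, ⟨I, rfl⟩, hI⟩, hIJ⟩⟩
      refine ⟨G, hG, fun A => ?_⟩
      obtain ⟨I, hI, hI'⟩ := (hTm _).1 A.2
      have h1 := hG' I (by rwa [hI])
      rw [hI] at h1
      simpa only [dif_pos A.2] using h1)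
    fun b hb => by
      obtain ⟨g, hg, hg'⟩ := solv hL hnp hα0 hα1 hα (fun V W => if h : (W, V) ∈ TP then b ⟨(W, V), h⟩ else 0) fun V W => by
        by_cases h : (W, V) ∈ TP
        · simp only [dif_pos h]; exact hb _
        · simp only [dif_neg h]; exact IsPol.zero
      refine ⟨fun A => g A, fun A => hg A, fun p => ?_⟩
      obtain ⟨⟨I, hI⟩, ⟨J, hJ⟩, h1, h2, h3⟩ := hP p
      have h4 := hg' I J (by rwa [hI]) (by rwa [hJ]) (by rwa [hI, hJ])
      rw [hI, hJ] at h4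
      simpa only [dif_pos p.2] using h4
  have hex : (∃ p, p ≠ 0 ∧ IsPol e p ∧ ∀ I, finrank ℂ (flat L I) = 1 ∨ finrank ℂ (flat L I) = 2 →
      p ∈ VanS (flat L I) (ordAt L α (flat L I))) ↔
      ∃ p, p ≠ 0 ∧ IsPol e p ∧ ∀ A : T, p ∈ VanS A.1 (ordAt L α A.1) := by
    refine exists_congr fun p => and_congr_right fun _ => and_congr_right fun _ => ⟨fun h A => ?_, fun h I hI => ?_⟩
    · obtain ⟨I, hI, hI'⟩ := (hTm _).1 A.2
      rw [← hI]; exact h I (by rwa [hI])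
    · exact h ⟨flat L I, (hTm _).2 ⟨I, rfl, hI⟩⟩
  have hV : ∀ V : Submodule ℂ (E 4), finrank ℂ V = 1 →
      (finrank ℂ (Pol (E 4) e) : ℤ) - finrank ℂ (PV e V (ordAt L α V)) = (ordAt L α V + 2).choose 3 := fun V hV => by
    have := ordAt_le (L := L) hα0 hα V
    rw [finrank_PV_line (m := 2) hE hV (ordAt L α V), sum_ite_lt_choose (by omega) 2]
    push_cast; ring
  have hW : ∀ W : Submodule ℂ (E 4), finrank ℂ W = 2 →
      (finrank ℂ (Pol (E 4) e) : ℤ) - finrank ℂ (PV e W (ordAt L α W)) =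
        ((e : ℤ) + 1) * (ordAt L α W + 1).choose 2 - 2 * (ordAt L α W + 1).choose 3 := fun W hW => by
    have := ordAt_le (L := L) hα0 hα W
    have h1 := sum_sum_ite_lt (k := ordAt L α W) (N := e + 1) (by omega)
    rw [finrank_PV_plane hE hW (ordAt L α W)]
    zify at h1 ⊢
    linarith
  have hVW : ∀ V W : Submodule ℂ (E 4), finrank ℂ V = 1 → finrank ℂ W = 2 → V ≤ W →
      (finrank ℂ (Pol (E 4) e) : ℤ) - finrank ℂ ↥(PV e V (ordAt L α V) ⊔ PV e W (ordAt L α W)) =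
        (ordAt L α V : ℤ) * (ordAt L α W + 1).choose 2 - 2 * (ordAt L α W + 1).choose 3 := fun V W hV hW hVW => by
    have := ordAt_le (L := L) hα0 hα V
    have h1 := sum_sum_ite_lt (k := ordAt L α W) (N := ordAt L α V) (ordAt_mono hα0 hV hW hVW)
    rw [finrank_PV_sup hE hV hW hVW (ordAt L α W) (ordAt L α V), ← Finset.sum_filter,
      show (range (e + 1)).filter (fun j => j < ordAt L α V) = range (ordAt L α V) by ext; simp; omega]
    zify at h1 ⊢
    linarith
  have hd : Disjoint (flats L 2) (flats L 1) := Finset.disjoint_left.2 fun A h1 h2 => by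
    have := (mem_flats.1 h1).2.symm.trans (mem_flats.1 h2).2
    omega
  have hU : ∀ f : Submodule ℂ (E 4) → ℤ, ∑ A ∈ T, f A = ∑ A ∈ flats L 2, f A + ∑ A ∈ flats L 1, f A := fun f =>
    Finset.sum_union hd
  rw [hex, key]
  have h1 : ∑ A : T, ((finrank ℂ (Pol (E 4) e) : ℤ) - finrank ℂ (PV e A.1 (ordAt L α A.1))) =
      ∑ W ∈ flats L 2, (((e : ℤ) + 1) * (ordAt L α W + 1).choose 2 - 2 * (ordAt L α W + 1).choose 3) +
        ∑ V ∈ flats L 1, ((ordAt L α V + 2).choose 3 : ℤ) := by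
    rw [Finset.sum_coe_sort T fun A => (finrank ℂ (Pol (E 4) e) : ℤ) - finrank ℂ (PV e A (ordAt L α A)), hU]
    exact congrArg₂ _ (sum_congr rfl fun A hA => hW A (mem_flats.1 hA).2)
      (sum_congr rfl fun A hA => hV A (mem_flats.1 hA).2)
  have h2 : ∑ p : TP, ((finrank ℂ (Pol (E 4) e) : ℤ) - finrank ℂ
      ↥(PV e p.1.2 (ordAt L α p.1.2) ⊔ PV e p.1.1 (ordAt L α p.1.1))) =
      ∑ p ∈ TP, ((ordAt L α p.2 : ℤ) * (ordAt L α p.1 + 1).choose 2 - 2 * (ordAt L α p.1 + 1).choose 3) := by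
    rw [← Finset.sum_coe_sort TP]
    exact sum_congr rfl fun p _ => hVW p.1.2 p.1.1 (hP p).2.2.1 (hP p).2.2.2.1 (hP p).2.2.2.2
  rw [h1, ← h2, finrank_Pol (E 4) (m := 3) hE e]
  refine not_congr (Eq.congr ?_ rfl)
  ring

end

section

variable {ι : Type*} [Fintype ι] {L : ι → E 4 →ₗ[ℂ] ℂ} {α : ℝ}

theorem exists_ne_zero_iff_link (hL : ∀ i, L i ≠ 0) (hnp : ∀ i j, i ≠ j → ∀ c : ℂ, L i ≠ c • L j) (hα0 : 0 < α) (hα1 : α < 1)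
    {V : Submodule ℂ (E 4)} (hV : finrank ℂ V = 1) {e : ℕ} (he : ordAt L α V ≤ e) :
    (∃ p, p ≠ 0 ∧ IsPol e p ∧ (∀ w ∈ V, ∀ y, p (y + w) = p y) ∧ ∀ J : Set ι, J.Nonempty → V ≤ flat L J →
      p ∈ VanS (flat L J) (ordAt L α (flat L J))) ↔
    ((e + 2).choose 2 : ℤ) - ∑ W ∈ (flats L 2).filter (fun W => V ≤ W), ((ordAt L α W + 1).choose 2 : ℤ) ≠ 0 := by
  have hE : finrank ℂ (E 4) = 4 := by simp [E]
  obtain ⟨v, hv0, hVs⟩ := exists_span_eq hV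
  have hvV : v ∈ V := hVs ▸ mem_span_singleton_self v
  obtain ⟨h, hv⟩ := exists_dual_eq_one hv0
  have hK : finrank ℂ (ker h) = 3 := by
    have := finrank_ker_of_eq_one hv; omega
  set T := (flats L 2).filter fun W => V ≤ W with hT
  have hTm : ∀ W, W ∈ T ↔ ((∃ J, flat L J = W) ∧ finrank ℂ W = 2) ∧ V ≤ W := fun W => by
    rw [hT, mem_filter, mem_flats]
  have key := exists_ne_zero_iff_of_exact e (fun W : T => W.1.comap (ker h).subtype) (fun W => ordAt L α W.1)
    (Empty.elim : Empty → T) Empty.elim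
    (fun g hg _ => by
      obtain ⟨G, hG, hG'⟩ := exists_glue_link hL hnp hα0 hα1 hV hvV hv he
        (t := fun W => if h : W ∈ T then g ⟨W, h⟩ else 0) fun W => by
          by_cases h : W ∈ T
          · simp only [dif_pos h]; exact hg _
          · simp only [dif_neg h]; exact IsPol.zero
      refine ⟨G, hG, fun W => ?_⟩
      have h1 := (hTm _).1 W.2
      simpa only [dif_pos W.2] using hG' W h1.1.2 h1.2)
    fun b hb => ⟨fun _ => 0, fun _ => IsPol.zero, fun p => p.elim⟩
  have hiff : (∃ p, p ≠ 0 ∧ IsPol e p ∧ (∀ w ∈ V, ∀ y, p (y + w) = p y) ∧ ∀ J : Set ι, J.Nonempty → V ≤ flat L J →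
      p ∈ VanS (flat L J) (ordAt L α (flat L J))) ↔
      ∃ p, p ≠ 0 ∧ IsPol e p ∧ ∀ W : T, p ∈ VanS (W.1.comap (ker h).subtype) (ordAt L α W.1) := by
    constructor
    · rintro ⟨p, hp0, hp, hpV, hpJ⟩
      refine ⟨fun z => p z, fun h0 => hp0 (funext fun y => ?_), hp.comp (ker h).subtype, fun W => ?_⟩
      · rw [eq_prj_add hv y, hpV _ (V.smul_mem _ hvV)]
        exact congrFun h0 (prj hv y)
      · obtain ⟨⟨⟨J, hJ⟩, hW⟩, hVW⟩ := (hTm _).1 W.2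
        have h1 := hpJ J (nonempty_of_finrank (L := L) (by rw [hJ]; omega)) (by rwa [hJ])
        rw [hJ] at h1
        exact VanS_comp h1 (ker h).subtype (Submodule.map_comap_le _ _)
    · rintro ⟨p, hp0, hp, hpW⟩
      have hp' := hp.comp (prj hv)
      have hinv : ∀ w ∈ V, ∀ y, p (prj hv (y + w)) = p (prj hv y) := fun w hw y => by
        rw [hVs] at hw
        obtain ⟨a, rfl⟩ := Submodule.mem_span_singleton.1 hw
        congr 1
        ext1
        rw [prj_coe, prj_coe, map_add, map_smul, hv, smul_eq_mul, mul_one, add_smul, add_sub_add_right_eq_sub]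
      refine ⟨fun y => p (prj hv y), fun h0 => hp0 (funext fun z => ?_), hp', hinv, fun J hJ hVJ => ?_⟩
      · have := congrFun h0 (z : E 4)
        have h1 := prj_add hv z 0
        rw [zero_smul, add_zero] at h1
        exact (congrArg p h1).symm.trans this
      · have h1 := finrank_mono hVJ
        by_cases hm : mlt L (flat L J) ≤ 1
        · rw [ordAt_eq_zero_of_mlt_le_one hα1 hm (finrank_flat_lt hL hJ)]
          exact hp'.vanS_zero _
        have h2 : ¬ 4 ≤ finrank ℂ (flat L J) + 1 := fun h => hm (mlt_le_one hL hnp (by omega))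
        by_cases h3 : finrank ℂ V = finrank ℂ (flat L J)
        · rw [← eq_of_le_of_finrank_eq hVJ h3]
          refine VanS_mono le_rfl he fun w hw u => ⟨Polynomial.C (p (prj hv u)), fun t => ?_⟩
          show p (prj hv (w + t • u)) = _
          rw [add_comm, hinv w hw, map_smul, hp.2, eval_C]
        · refine VanS_comp (hpW ⟨flat L J, (hTm _).2 ⟨⟨⟨J, rfl⟩, by omega⟩, hVJ⟩⟩) (prj hv) ?_
          rintro _ ⟨y, hy, rfl⟩
          exact (flat L J).sub_mem hy ((flat L J).smul_mem _ (hVJ hvV))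
  have hr : ∑ W : T, ((finrank ℂ (Pol (ker h) e) : ℤ) -
      finrank ℂ (PV e (W.1.comap (ker h).subtype) (ordAt L α W.1))) =
      ∑ W ∈ T, ((ordAt L α W + 1).choose 2 : ℤ) := by
    rw [← Finset.sum_coe_sort T]
    refine sum_congr rfl fun W _ => ?_
    obtain ⟨⟨-, hW⟩, hVW⟩ := (hTm _).1 W.2
    have h1 := finrank_comap_ker (hVW hvV) hv
    have h2 := ordAt_mono (L := L) hα0 hV hW hVW
    have h3 : finrank ℂ (W.1.comap (ker h).subtype) = 1 := by omega
    have h4 := finrank_PV_line (m := 1) hK h3 (ordAt L α W.1) e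
    rw [sum_ite_lt_choose (k := ordAt L α W.1) (by omega) 1] at h4
    rw [h4]
    push_cast; ring
  rw [hiff, key, hr, finrank_Pol (ker h) (m := 2) hK e, Finset.univ_eq_empty, Finset.sum_empty, add_zero]

end

theorem exists_polynomial_of_growth {φ : ℂ → ℂ} (hφ : Differentiable ℂ φ) {K : ℝ} {k : ℕ}
    (h : ∀ t, ‖φ t‖ ≤ K * (1 + ‖t‖) ^ k) : ∃ Q : Polynomial ℂ, ∀ t, φ t = Q.eval t := by
  have h0 : ∀ j, k < j → iteratedDeriv j φ 0 = 0 := fun j hj => by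
    rw [← norm_le_zero_iff]
    have hlim : Tendsto (fun R : ℝ => j.factorial * (|K| * 2 ^ k) / R) atTop (nhds 0) :=
      tendsto_const_nhds.div_atTop Filter.tendsto_id
    refine ge_of_tendsto hlim ?_
    filter_upwards [Filter.eventually_ge_atTop 1] with R hR
    have hR0 : 0 < R := by linarith
    refine (Complex.norm_iteratedDeriv_le_of_forall_mem_sphere_norm_le j hR0 hφ.diffContOnCl
      (C := |K| * 2 ^ k * R ^ k) fun z hz => ?_).trans ?_
    · rw [mem_sphere_zero_iff_norm] at hz
      have := h z
      rw [hz] at this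
      refine this.trans ?_
      rw [mul_assoc, ← mul_pow]
      have : (1 + R) ^ k ≤ (2 * R) ^ k := pow_le_pow_left₀ (by linarith) (by linarith) k
      gcongr
      exact le_abs_self K
    · rw [div_le_div_iff₀ (by positivity) hR0]
      have : R ^ k * R ≤ R ^ j := by rw [← pow_succ]; exact pow_le_pow_right₀ hR hj
      have := mul_le_mul_of_nonneg_left this (show 0 ≤ j.factorial * (|K| * 2 ^ k) by positivity)
      linarith
  refine ⟨∑ j ∈ range (k + 1), Polynomial.C ((j.factorial : ℂ)⁻¹ * iteratedDeriv j φ 0) * Polynomial.X ^ j, fun t => ?_⟩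
  rw [← Complex.taylorSeries_eq_of_entire' 0 t hφ, tsum_eq_sum (s := range (k + 1)), Polynomial.eval_finsetSum]
  · simp
  · intro j hj
    rw [h0 j (by simpa using hj), mul_zero, zero_mul]

theorem tendsto_mul_norm (M : ℝ) : Tendsto (fun c : ℂ => M * ‖c‖) (nhdsWithin 0 {0}ᶜ) (nhds 0) := by
  have : ContinuousAt (fun c : ℂ => M * ‖c‖) 0 := by fun_prop
  rw [ContinuousAt, norm_zero, mul_zero] at this
  exact this.mono_left nhdsWithin_le_nhds

theorem tendsto_of_norm_sub_le {ψ : ℂ → ℂ} {s M : ℝ} {b : ℂ} (hs : 0 < s)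
    (h : ∀ c : ℂ, c ≠ 0 → ‖c‖ ≤ s → ‖ψ c - b‖ ≤ M * ‖c‖) : Tendsto ψ (nhdsWithin 0 {0}ᶜ) (nhds b) := by
  refine tendsto_iff_norm_sub_tendsto_zero.2 (squeeze_zero' (Eventually.of_forall fun _ => norm_nonneg _)
    (g := fun c : ℂ => M * ‖c‖) ?_ (tendsto_mul_norm M))
  filter_upwards [self_mem_nhdsWithin, nhdsWithin_le_nhds (closedBall_mem_nhds (0 : ℂ) hs)] with c hc0 hc
  exact h c hc0 (mem_closedBall_zero_iff.1 hc)

theorem leading_coeff_bounds {R : ℝ} (hR : 1 < R) {k : ℕ} {C M : ℝ} {φ : ℂ → ℂ} {b : ℂ}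
    (hφ : DifferentiableOn ℂ φ (ball 0 R)) (h : ∀ᶠ t in nhdsWithin 0 {0}ᶜ, ‖φ t‖ ≤ C * ‖t‖ ^ k)
    (hM : ∀ t, ‖t‖ = 1 → ‖φ t‖ ≤ M)
    (hb : Tendsto (fun c : ℂ => (c ^ k)⁻¹ * φ c) (nhdsWithin 0 {0}ᶜ) (nhds b)) :
    ‖b‖ ≤ 3 * M ∧ ∀ t : ℂ, ‖t‖ ≤ 1 / 2 → ‖φ t - b * t ^ k‖ ≤ 12 * M * ‖t‖ ^ (k + 1) := by
  constructor
  · refine le_of_tendsto hb.norm ?_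
    filter_upwards [self_mem_nhdsWithin, nhdsWithin_le_nhds (closedBall_mem_nhds (0 : ℂ) one_half_pos)] with c hc0 hc
    have hcn : 0 < ‖c‖ := norm_pos_iff.2 hc0
    rw [norm_mul, norm_inv, norm_pow, inv_mul_le_iff₀ (by positivity), mul_comm]
    exact norm_le_of_order hR hφ h hM (mem_closedBall_zero_iff.1 hc)
  · obtain ⟨a, ha⟩ := exists_leading hR hφ h hM
    rwa [tendsto_nhds_unique hb (tendsto_of_norm_sub_le (M := 12 * M) one_half_pos fun c hc0 hc => ?_)]
    have hcn : 0 < ‖c‖ := norm_pos_iff.2 hc0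
    have hck : c ^ k ≠ 0 := pow_ne_zero k hc0
    rw [show (c ^ k)⁻¹ * φ c - a = (c ^ k)⁻¹ * (φ c - a * c ^ k) by field_simp, norm_mul, norm_inv, norm_pow,
      inv_mul_le_iff₀ (by positivity)]
    refine (ha c hc).trans (le_of_eq ?_)
    ring

theorem co_near (V : Submodule ℂ (E n)) {v : E n} {U : Set (E n)} (hU : U ∈ nhds v) :
    ∃ r : ℝ, 0 < r ∧ ∀ y, ∀ c : ℂ, ‖c‖ * ‖co V y‖ < r → v + c • co V y ∈ U := by
  obtain ⟨r, hr, hrU⟩ := Metric.mem_nhds_iff.1 hU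
  refine ⟨r, hr, fun y c h => hrU ?_⟩
  rwa [Metric.mem_ball, dist_eq_norm, add_sub_cancel_left, norm_smul]

theorem co_add_smul_co {V W : Submodule ℂ (E n)} (hVW : V ≤ W) {v : E n} (hv : v ∈ V) (c : ℂ) (y : E n) :
    co W (v + c • co V y) = c • co W y := by
  rw [map_add, co_eq_zero_iff.2 (hVW hv), zero_add, map_smul, co_apply V, map_sub, co_eq_zero_iff.2 (hVW (pr_mem V y)), sub_zero]

/-- The transverse leading form of order `k` of a germ vanishing to order `k` along `V`. -/
theorem exists_leading_form {V : Submodule ℂ (E n)} {v : E n} (hv : v ∈ V) {U : Set (E n)} (hU : U ∈ nhds v)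
    {g : E n → ℂ} (hg : DifferentiableOn ℂ g U) {k : ℕ} (hO : Ord V k v g) :
    ∃ p, IsPol k p ∧ (∀ w ∈ V, ∀ y, p (y + w) = p y) ∧
      ∀ u, Tendsto (fun c : ℂ => (c ^ k)⁻¹ * g (v + c • co V u)) (nhdsWithin 0 {0}ᶜ) (nhds (p u)) := by
  obtain ⟨C, hC⟩ := hO
  obtain ⟨r, hr, hrU⟩ := co_near V (inter_mem (interior_mem_nhds.2 hU) hC)
  have hD : ∀ s > 0, ∀ u, s * (2 * ‖co V u‖) < r → ∀ a : ℂ, ‖a‖ = s → 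
      DifferentiableOn ℂ (fun c : ℂ => g (v + (a * c) • co V u)) (ball 0 2) := by
    intro s hs u hsu a ha c hc
    have h1 : v + (a * c) • co V u ∈ interior U := (hrU u _ (by
      rw [norm_mul, ha, mul_assoc]
      rw [mem_ball_zero_iff] at hc
      refine lt_of_le_of_lt ?_ hsu
      gcongr)).1
    have h2 : DifferentiableAt ℂ (fun c : ℂ => v + (a * c) • co V u) c := by fun_prop
    exact ((hg.differentiableAt (mem_interior_iff_mem_nhds.1 h1)).comp c h2).differentiableWithinAt
  have hB : ∀ u, ∀ c : ℂ, ‖c‖ * ‖co V u‖ < r → ‖g (v + c • co V u)‖ ≤ C * (‖c‖ * ‖co V u‖) ^ k := fun u c h => by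
    have := (hrU u c h).2
    rwa [Set.mem_ofPred_eq, co_add_smul_co le_rfl hv, norm_smul] at this
  have key : ∀ N : ℝ, 0 < N → ∃ s : ℝ, 0 < s ∧ ∃ M : ℝ, ∀ u, ‖co V u‖ ≤ N → ∃ b : ℂ, ∀ c : ℂ, c ≠ 0 → ‖c‖ ≤ s →
      ‖(c ^ k)⁻¹ * g (v + c • co V u) - b‖ ≤ M * ‖c‖ := by
    intro N hN
    set σ := r / (4 * N) with hσ
    have hσ0 : 0 < σ := by positivity
    have hσc : (σ : ℂ) ≠ 0 := by exact_mod_cast hσ0.ne'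
    have hσn : ‖(σ : ℂ)‖ = σ := Complex.norm_of_nonneg hσ0.le
    have h4 : σ * (2 * N) < r := by rw [hσ]; field_simp; linarith
    refine ⟨σ / 2, by positivity, 12 * (|C| * r ^ k) * (σ ^ (k + 1))⁻¹, fun u hu => ?_⟩
    have h5 : σ * (2 * ‖co V u‖) < r := lt_of_le_of_lt (by gcongr) h4
    have hB' : ∀ c : ℂ, ‖c‖ < 2 → ‖g (v + (σ * c) • co V u)‖ ≤ C * (σ * ‖c‖ * ‖co V u‖) ^ k := fun c hc => by
      have := hB u (σ * c) (by rw [norm_mul, hσn]; nlinarith [norm_nonneg (co V u), mul_le_mul_of_nonneg_right hc.le (norm_nonneg (co V u))])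
      rwa [norm_mul, hσn] at this
    obtain ⟨a, ha⟩ := exists_leading (R := 2) (k := k) (C := C * (σ * ‖co V u‖) ^ k) (M := |C| * r ^ k) one_lt_two (hD σ hσ0 u h5 σ hσn)
      (nhdsWithin_le_nhds (by
        filter_upwards [ball_mem_nhds (0 : ℂ) two_pos] with c hc
        refine (hB' c (mem_ball_zero_iff.1 hc)).trans (le_of_eq ?_)
        rw [mul_right_comm, mul_pow, mul_assoc])) fun c hc => by
        refine (hB' c (by rw [hc]; exact one_lt_two)).trans ?_
        have : σ * ‖c‖ * ‖co V u‖ ≤ r := by rw [hc]; nlinarith [norm_nonneg (co V u)]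
        gcongr
        exact le_abs_self C
    refine ⟨a * ((σ : ℂ) ^ k)⁻¹, fun c hc0 hc => ?_⟩
    have h6 := ha (c / σ) (by rw [norm_div, hσn, div_le_iff₀ hσ0]; linarith)
    rw [mul_div_cancel₀ _ hσc] at h6
    have h7 : (c ^ k)⁻¹ * g (v + c • co V u) - a * ((σ : ℂ) ^ k)⁻¹ = (c ^ k)⁻¹ * (g (v + c • co V u) - a * (c / σ) ^ k) := by
      rw [div_pow]; field_simp
    rw [h7, norm_mul, norm_inv, norm_pow]
    have hcn : 0 < ‖c‖ := norm_pos_iff.2 hc0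
    refine (mul_le_mul_of_nonneg_left h6 (by positivity)).trans (le_of_eq ?_)
    rw [norm_div, hσn, div_pow]
    field_simp
    ring
  have hex : ∀ u, ∃ b : ℂ, Tendsto (fun c : ℂ => (c ^ k)⁻¹ * g (v + c • co V u)) (nhdsWithin 0 {0}ᶜ) (nhds b) := by
    intro u
    obtain ⟨s, hs, M, hM⟩ := key (‖co V u‖ + 1) (by positivity)
    obtain ⟨b, hb⟩ := hM u (by linarith)
    exact ⟨b, tendsto_of_norm_sub_le hs hb⟩
  choose p hp using hex
  have hp0 : ∀ {u b}, Tendsto (fun c : ℂ => (c ^ k)⁻¹ * g (v + c • co V u)) (nhdsWithin 0 {0}ᶜ) (nhds b) → p u = b :=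
    fun h => tendsto_nhds_unique (hp _) h
  have hbd : ∀ u, ‖p u‖ ≤ C * ‖co V u‖ ^ k := by
    intro u
    refine le_of_tendsto (hp u).norm ?_
    filter_upwards [(tendsto_mul_norm ‖co V u‖).eventually_lt_const hr, self_mem_nhdsWithin] with c hc hc0
    rw [mul_comm] at hc
    have hcn : 0 < ‖c‖ := norm_pos_iff.2 hc0
    rw [norm_mul, norm_inv, norm_pow, inv_mul_le_iff₀ (by positivity)]
    refine (hB u c hc).trans (le_of_eq ?_)
    rw [mul_pow]; ring
  have hdiff : ∀ u w, Differentiable ℂ fun t : ℂ => p (u + t • w) := by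
    intro u w t₀
    obtain ⟨s, hs, M, hM⟩ := key (‖co V u‖ + (‖t₀‖ + 1) * ‖co V w‖ + 1) (by positivity)
    have hN : ∀ t ∈ ball (0 : ℂ) (‖t₀‖ + 1), ‖co V (u + t • w)‖ ≤ ‖co V u‖ + (‖t₀‖ + 1) * ‖co V w‖ + 1 := fun t ht => by
      rw [mem_ball_zero_iff] at ht
      rw [map_add, map_smul]
      refine (norm_add_le _ _).trans ?_
      rw [norm_smul]
      nlinarith [mul_le_mul_of_nonneg_right ht.le (norm_nonneg (co V w))]
    have hunif : ∀ t ∈ ball (0 : ℂ) (‖t₀‖ + 1), ∀ c : ℂ, c ≠ 0 → ‖c‖ ≤ s →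
        ‖(c ^ k)⁻¹ * g (v + c • co V (u + t • w)) - p (u + t • w)‖ ≤ M * ‖c‖ := fun t ht => by
      obtain ⟨b, hb⟩ := hM _ (hN t ht)
      rwa [hp0 (tendsto_of_norm_sub_le hs hb)]
    have hT : TendstoUniformlyOn (fun (c : ℂ) (t : ℂ) => (c ^ k)⁻¹ * g (v + c • co V (u + t • w))) (fun t => p (u + t • w))
        (nhdsWithin 0 {0}ᶜ) (ball 0 (‖t₀‖ + 1)) := by
      rw [Metric.tendstoUniformlyOn_iff]
      intro ε hε
      filter_upwards [(tendsto_mul_norm M).eventually_lt_const hε, self_mem_nhdsWithin, nhdsWithin_le_nhds (closedBall_mem_nhds (0 : ℂ) hs)] with c hc hc0 hcs t ht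
      rw [dist_comm, dist_eq_norm]
      exact (hunif t ht c hc0 (mem_closedBall_zero_iff.1 hcs)).trans_lt hc
    have hQ : ∀ᶠ c : ℂ in nhdsWithin 0 {0}ᶜ, DifferentiableOn ℂ (fun t : ℂ => (c ^ k)⁻¹ * g (v + c • co V (u + t • w)))
        (ball 0 (‖t₀‖ + 1)) := by
      filter_upwards [(tendsto_mul_norm (‖co V u‖ + (‖t₀‖ + 1) * ‖co V w‖ + 1)).eventually_lt_const hr] with c hc t ht
      have h1 := (hrU (u + t • w) c (lt_of_le_of_lt (by rw [mul_comm]; gcongr; exact hN t ht) hc)).1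
      have h2 : DifferentiableAt ℂ (fun t : ℂ => v + c • (co V u + t • co V w)) t := by fun_prop
      rw [show (fun t : ℂ => v + c • (co V u + t • co V w)) = fun t => v + c • co V (u + t • w) by simp only [map_add, map_smul]] at h2
      exact (((hg.differentiableAt (mem_interior_iff_mem_nhds.1 h1)).comp t h2).const_mul _).differentiableWithinAt
    refine (hT.tendstoLocallyUniformlyOn.differentiableOn hQ Metric.isOpen_ball).differentiableAt
      (Metric.isOpen_ball.mem_nhds (by rw [mem_ball_zero_iff]; linarith))
  have hsmul : ∀ (t : ℂ) y, p (t • y) = t ^ k * p y := by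
    intro t y
    have h1 : Continuous fun t : ℂ => p (t • y) := by simpa only [zero_add] using (hdiff 0 y).continuous
    refine congrFun (Continuous.ext_on (dense_compl_singleton 0) h1 ((continuous_pow k).mul continuous_const) fun t ht => hp0 ?_) t
    have h2 : Tendsto (fun c : ℂ => c * t) (nhdsWithin 0 {0}ᶜ) (nhdsWithin 0 {0}ᶜ) := by
      have h3 : ContinuousAt (fun c : ℂ => c * t) 0 := by fun_prop
      rw [ContinuousAt, zero_mul] at h3
      exact tendsto_nhdsWithin_iff.2 ⟨h3.mono_left nhdsWithin_le_nhds,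
        eventually_mem_nhdsWithin.mono fun c hc => mul_ne_zero hc ht⟩
    refine (((hp y).comp h2).const_mul (t ^ k)).congr fun c => ?_
    have ht' : t ≠ 0 := ht
    rw [Function.comp_apply, map_smul, smul_smul, mul_pow, mul_inv]
    field_simp
  refine ⟨p, ⟨fun u w => ?_, hsmul⟩, fun w hw y => ?_, hp⟩
  · refine exists_polynomial_of_growth (hdiff u w) (K := |C| * (‖co V u‖ + ‖co V w‖) ^ k) (k := k) fun t => (hbd _).trans ?_
    rw [mul_assoc, ← mul_pow, map_add, map_smul]
    have : ‖co V u + t • co V w‖ ≤ (‖co V u‖ + ‖co V w‖) * (1 + ‖t‖) := by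
      refine (norm_add_le _ _).trans ?_
      rw [norm_smul]
      nlinarith [norm_nonneg (co V u), norm_nonneg (co V w), norm_nonneg t, mul_nonneg (norm_nonneg t) (norm_nonneg (co V u))]
    gcongr
    exact le_abs_self C
  · refine hp0 ?_
    rw [map_add, co_eq_zero_iff.2 hw, add_zero]
    exact hp y

section

variable {ι : Type*} [Fintype ι] {L : ι → E n →ₗ[ℂ] ℂ}

/-- A nonzero form of degree `k`, invariant under `V`, with the vanishing orders imposed by `α`
along all flats containing `V`. -/
def HasForm (L : ι → E n →ₗ[ℂ] ℂ) (α : ℝ) (V : Submodule ℂ (E n)) (k : ℕ) : Prop :=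
  ∃ p, p ≠ 0 ∧ IsPol k p ∧ (∀ w ∈ V, ∀ y, p (y + w) = p y) ∧
    ∀ J : Set ι, J.Nonempty → V ≤ flat L J → p ∈ VanS (flat L J) (ordAt L α (flat L J))

theorem HasForm.of_ord {α : ℝ} {V : Submodule ℂ (E n)} {x : E n} (hx : x ∈ V) {U : Set (E n)} (hU : U ∈ nhds x)
    {g : E n → ℂ} (hg : DifferentiableOn ℂ g U) {k : ℕ} (hk : Ord V k x g) (hk' : ¬ Ord V (k + 1) x g)
    (hO : ∀ J : Set ι, J.Nonempty → x ∈ flat L J → Ord (flat L J) (ordAt L α (flat L J)) x g) :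
    HasForm L α V k := by
  have hprx : Tendsto (pr V) (nhds x) (nhds x) := by
    have := (continuous_lin (pr V)).tendsto x
    rwa [pr_of_mem hx] at this
  have hcont : ContinuousAt g x := (hg.differentiableAt hU).continuousAt
  have hM : ∀ᶠ y in nhds x, ‖g y‖ < ‖g x‖ + 1 := hcont.norm.eventually_lt continuousAt_const (by simp)
  obtain ⟨C, hC⟩ := hk
  have hgood : ∀ᶠ y in nhds x, (∀ c : ℂ, ‖c‖ ≤ 2 → dil V c y ∈ U ∩ {y | ‖g y‖ < ‖g x‖ + 1} ∩ {y | ‖g y‖ ≤ C * ‖co V y‖ ^ k}) ∧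
      U ∈ nhds (pr V y) ∧ Ord V k (pr V y) g ∧
      ∀ J : Set ι, J.Nonempty → x ∈ flat L J → Ord (flat L J) (ordAt L α (flat L J)) (pr V y) g := by
    refine (dil_near hx (inter_mem (inter_mem hU hM) hC)).and ((hprx.eventually (eventually_mem_nhds_iff.2 hU)).and
      ((hprx.eventually (Ord.eventually ⟨C, hC⟩)).and (eventually_all.2 fun J => ?_)))
    by_cases h : J.Nonempty ∧ x ∈ flat L J
    · exact (hprx.eventually (hO J h.1 h.2).eventually).mono fun y hy _ _ => hy
    · exact Eventually.of_forall fun y h1 h2 => absurd ⟨h1, h2⟩ h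
  have hfreq : ∃ᶠ y in nhds x, ¬ ∀ t : ℂ, ‖t‖ ≤ 1 / 2 → ‖g (dil V t y)‖ ≤ 12 * (‖g x‖ + 1) * ‖t‖ ^ (k + 1) :=
    Filter.not_eventually.1 fun h => hk' (Ord.of_leading hx h)
  obtain ⟨y, hy, hyU, hU', hk1, hO'⟩ := (hfreq.and_eventually hgood).exists
  obtain ⟨p, hp, hpV, hlim⟩ := exists_leading_form (pr_mem V y) hU' hg hk1
  refine ⟨p, fun h0 => hy ?_, hp, hpV, fun J hJ hVJ => ?_⟩
  · have := (leading_coeff_bounds (R := 2) (k := k) (C := C * ‖co V y‖ ^ k) (M := ‖g x‖ + 1) one_lt_two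
      (differentiableOn_dil hg fun c hc => (hyU c hc).1.1)
      (nhdsWithin_le_nhds (by
        filter_upwards [ball_mem_nhds (0 : ℂ) two_pos] with c hc
        refine ((hyU c (mem_ball_zero_iff.1 hc).le).2).trans (le_of_eq ?_)
        rw [co_dil, norm_smul, mul_pow]; ring))
      (fun c hc => (hyU c (by rw [hc]; exact one_le_two)).1.2.le) (hlim y)).2
    simpa only [h0, Pi.zero_apply, zero_mul, sub_zero] using this
  · obtain ⟨C', hC'⟩ := hO' J hJ (hVJ hx)
    obtain ⟨C₁, hC₁⟩ := hk1
    refine Ord.vanS hp (hVJ (pr_mem V y)) ⟨3 * C', ?_⟩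
    obtain ⟨r, hr, hrU⟩ := co_near V (inter_mem (inter_mem (interior_mem_nhds.2 hU') hC') hC₁)
    have h0 : Tendsto (fun z => 2 * ‖co V z‖) (nhds (pr V y)) (nhds 0) := by
      have := ((continuous_lin (co V)).norm.const_mul 2).tendsto (pr V y)
      rwa [co_eq_zero_iff.2 (pr_mem V y), norm_zero, mul_zero] at this
    filter_upwards [h0.eventually_lt_const hr] with z hz
    have hmem : ∀ c : ℂ, ‖c‖ ≤ 2 → _ := fun c hc => hrU z c (lt_of_le_of_lt (by gcongr) hz)
    rw [mul_assoc]
    refine (leading_coeff_bounds (R := 2) (k := k) (C := C₁ * ‖co V z‖ ^ k) one_lt_two ?_ ?_ (fun c hc => ?_) (hlim z)).1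
    · intro c hc
      have h2 : DifferentiableAt ℂ (fun c : ℂ => pr V y + c • co V z) c := by fun_prop
      exact ((hg.differentiableAt (mem_interior_iff_mem_nhds.1 (hmem c (mem_ball_zero_iff.1 hc).le).1.1)).comp c h2).differentiableWithinAt
    · refine nhdsWithin_le_nhds ?_
      filter_upwards [ball_mem_nhds (0 : ℂ) two_pos] with c hc
      refine ((hmem c (mem_ball_zero_iff.1 hc).le).2).trans (le_of_eq ?_)
      rw [co_add_smul_co le_rfl (pr_mem V y), norm_smul, mul_pow]; ring
    · refine ((hmem c (by rw [hc]; exact one_le_two)).1.2).trans (le_of_eq ?_)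
      rw [co_add_smul_co hVJ (pr_mem V y), norm_smul, hc, one_mul]

theorem exists_hasForm_of_jump (hL : ∀ i, L i ≠ 0) {α : ℝ} (hα0 : 0 < α) {x : E n} {U : Set (E n)} (hU : U ∈ nhds x)
    {g : E n → ℂ} (hg : DifferentiableOn ℂ g U)
    (hfin : ∀ β, 0 < β → β < α → FinAt (fun y => ofReal (‖g y‖ ^ 2 * ‖∏ i, L i y‖ ^ (-2 * β))) x)
    (hinf : ¬ FinAt (fun y => ofReal (‖g y‖ ^ 2 * ‖∏ i, L i y‖ ^ (-2 * α))) x) :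
    ∃ I : Set ι, I.Nonempty ∧ ∃ k : ℕ, α * mlt L (flat L I) = (n - finrank ℂ (flat L I) : ℕ) + k ∧
      HasForm L α (flat L I) k := by
  obtain ⟨β, hβ0, hβα, hβ⟩ := exists_exponent hα0 (card ι)
  have hO := fun I hI hx => Ord.of_finAt_exponent (I := I) hL hβ0.le hβ hU hg (hfin β hβ0 hβα) hI hx
  have hex : ∃ I : Set ι, I.Nonempty ∧ ∃ hx : x ∈ flat L I, ∀ k, Ord (flat L I) k x g →
      ((n - finrank ℂ (flat L I) : ℕ) : ℝ) + k ≤ α * mlt L (flat L I) := by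
    by_contra! h
    exact hinf (FinAt.of_ord hL hg hU h)
  obtain ⟨I, hI, hx, h⟩ := hex
  have h1 := h _ (hO I hI hx)
  have h2 : α * mlt L (flat L I) ≤ (n - finrank ℂ (flat L I) : ℕ) + ordAt L α (flat L I) := by
    have h3 : ⌈α * mlt L (flat L I)⌉ ≤ ((n - finrank ℂ (flat L I) : ℕ) : ℤ) + ordAt L α (flat L I) := by
      rw [ordAt]; omega
    exact_mod_cast Int.ceil_le.1 h3
  refine ⟨I, hI, ordAt L α (flat L I), le_antisymm h2 h1, HasForm.of_ord hx hU hg (hO I hI hx) (fun h3 => ?_) hO⟩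
  have := h _ h3
  push_cast at this
  linarith

theorem exists_jump_of_hasForm (hL : ∀ i, L i ≠ 0) {α : ℝ} (hα0 : 0 < α) {I : Set ι} (hI : I.Nonempty) {k : ℕ}
    (hk : α * mlt L (flat L I) = (n - finrank ℂ (flat L I) : ℕ) + k) (hF : HasForm L α (flat L I) k) :
    ∃ (x : E n) (p : E n → ℂ), Differentiable ℂ p ∧
      (∀ β, β < α → FinAt (fun y => ofReal (‖p y‖ ^ 2 * ‖∏ i, L i y‖ ^ (-2 * β))) x) ∧
      ¬ FinAt (fun y => ofReal (‖p y‖ ^ 2 * ‖∏ i, L i y‖ ^ (-2 * α))) x := by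
  obtain ⟨p, hp0, hp, -, hpJ⟩ := hF
  obtain ⟨x, hx, hgen⟩ : ∃ x ∈ flat L I, ∀ i, L i x = 0 → flat L I ≤ ker (L i) := by
    obtain ⟨x, hx, h⟩ := Module.Dual.exists_forall_mem_ne_zero_of_forall_exists (flat L I)
      (fun i : {i // ¬ flat L I ≤ ker (L i)} => L i)
      fun i => (SetLike.not_le_iff_exists.1 i.2).imp fun _ h => h
    exact ⟨x, hx, fun i hi => by_contra fun h' => h ⟨i, h'⟩ hi⟩
  refine ⟨x, p, hp.differentiable, fun β hβ => FinAt.of_ord_exponent hL hβ univ_mem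
    hp.differentiable.differentiableOn fun J hJ hxJ => Ord.of_vanS hp (hpJ J hJ (le_iInf₂ fun i hi => hgen i (mem_flat.1 hxJ i hi))) hxJ,
    fun h => hp0 ?_⟩
  have h1 := Ord.vanS hp hx (Ord.of_finAt hL hα0.le hx (finrank_flat_lt hL hI) univ_mem hp.differentiable.differentiableOn h
    (k := k + 1) (by rw [hk]; push_cast; linarith))
  funext u
  obtain ⟨Q, hQ⟩ := h1 0 (zero_mem _) u
  have h2 : Polynomial.C (p u) * Polynomial.X ^ k = Polynomial.X ^ (k + 1) * Q := Polynomial.funext fun t => by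
    simpa [hp.2, mul_comm (p u)] using hQ t
  simpa [Polynomial.coeff_X_pow_mul'] using congrArg (Polynomial.coeff · k) h2

end

section

theorem exists_integrableOn_iff_finAt {x : E n} {U : Set (E n)} (hU : U ∈ nhds x) {g f : E n → ℂ} (hg : DifferentiableOn ℂ g U)
    (hf : Continuous f) (β : ℝ) :
    (∃ W ∈ nhds x, IntegrableOn (fun y => ‖g y‖ ^ 2 * ‖f y‖ ^ β) W) ↔
      FinAt (fun y => ofReal (‖g y‖ ^ 2 * ‖f y‖ ^ β)) x := by
  have h0 : ∀ W : Set (E n), 0 ≤ᵐ[volume.restrict W] fun y => ‖g y‖ ^ 2 * ‖f y‖ ^ β :=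
    fun W => Eventually.of_forall fun y => by positivity
  constructor
  · rintro ⟨W, hW, h⟩
    exact ⟨W, hW, ((hasFiniteIntegral_iff_ofReal (h0 W)).1 h.2).ne⟩
  · rintro ⟨W, hW, h⟩
    refine ⟨W ∩ interior U, inter_mem hW (interior_mem_nhds.2 hU), ?_, (hasFiniteIntegral_iff_ofReal (h0 _)).2
      ((lintegral_mono_set Set.inter_subset_left).trans_lt h.lt_top)⟩
    refine AEStronglyMeasurable.mul ?_ (hf.norm.measurable.pow_const β).aestronglyMeasurable
    exact (((hg.continuousOn.mono interior_subset).norm.pow 2).aestronglyMeasurable isOpen_interior.measurableSet).mono_measure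
      (Measure.restrict_mono Set.inter_subset_right le_rfl)

theorem mem_JC_iff {D : Arrangement n} (hred : D.Reduced) {α : ℝ} (h0 : 0 < α) :
    α ∈ D.JC ↔ ∃ I : Set D.ι, I.Nonempty ∧ ∃ k : ℕ,
      α * mlt D.g (flat D.g I) = (n - finrank ℂ (flat D.g I) : ℕ) + k ∧ HasForm D.g α (flat D.g I) k := by
  have hf : D.f = fun y => ∏ i, D.g i y := by
    funext y
    simp only [Arrangement.f, hred _, pow_one]
  have hc : Continuous fun y => ∏ i, D.g i y := continuous_finsetProd _ fun i _ => continuous_lin (D.g i)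
  constructor
  · rintro ⟨-, x, U, g, hU, hg, hfin, hinf⟩
    rw [hf] at hfin hinf
    refine exists_hasForm_of_jump D.g_ne h0 hU hg (fun β hβ hβα => (exists_integrableOn_iff_finAt hU hg hc _).1 (hfin β hβ hβα)) fun h => ?_
    obtain ⟨W, hW, hi⟩ := (exists_integrableOn_iff_finAt hU hg hc _).2 h
    exact hinf W hW hi
  · rintro ⟨I, hI, k, hk, hF⟩
    obtain ⟨x, p, hp, hfin, hinf⟩ := exists_jump_of_hasForm D.g_ne h0 hI hk hF
    refine ⟨h0, x, Set.univ, p, univ_mem, hp.differentiableOn, ?_⟩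
    rw [hf]
    exact ⟨fun β _ hβ => (exists_integrableOn_iff_finAt univ_mem hp.differentiableOn hc _).2 (hfin β hβ),
      fun W hW h => hinf ((exists_integrableOn_iff_finAt univ_mem hp.differentiableOn hc _).1 ⟨W, hW, h⟩)⟩

variable {ι : Type*} [Fintype ι] {L : ι → E 4 →ₗ[ℂ] ℂ} {α : ℝ}

theorem ordAt_eq_zero_of_mlt_le (hα : α < 1) {V : Submodule ℂ (E 4)} (h : mlt L V ≤ 4 - finrank ℂ V) :
    ordAt L α V = 0 := by
  have : ⌈α * mlt L V⌉ ≤ (mlt L V : ℤ) := Int.ceil_le.2 (mul_le_of_le_one_left (Nat.cast_nonneg _) hα.le)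
  rw [ordAt]
  omega

theorem ordAt_eq_of_eq {V : Submodule ℂ (E 4)} {k : ℕ} (hk : α * mlt L V = (4 - finrank ℂ V : ℕ) + k) :
    ordAt L α V = k := by
  rw [ordAt, hk, ← Nat.cast_add, Int.ceil_natCast]
  omega

/-- The vanishing condition is void along hyperplanes. -/
theorem IsPol.mem_VanS_hyperplane (hL : ∀ i, L i ≠ 0) (hnp : ∀ i j, i ≠ j → ∀ c : ℂ, L i ≠ c • L j) (hα : α < 1)
    {V : Submodule ℂ (E 4)} (hV : finrank ℂ V = 3) {e : ℕ} {p : E 4 → ℂ} (hp : IsPol e p) :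
    p ∈ VanS V (ordAt L α V) := by
  rw [ordAt_eq_zero_of_mlt_le hα (by rw [hV]; exact mlt_le_one hL hnp (by rw [hV, Module.finrank_fin_fun]))]
  exact hp.vanS_zero V

theorem hasForm_of_finrank_two (hL : ∀ i, L i ≠ 0) (hnp : ∀ i j, i ≠ j → ∀ c : ℂ, L i ≠ c • L j) (hα : α < 1)
    {V : Submodule ℂ (E 4)} (hV : finrank ℂ V = 2) {k : ℕ} (hk : α * mlt L V = 2 + k) : HasForm L α V k := by
  obtain ⟨l, hl, hVl⟩ := V.exists_le_ker_of_lt_top (lt_top_iff_ne_top.2 fun h => by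
    rw [h, finrank_top, Module.finrank_fin_fun] at hV
    omega)
  obtain ⟨y, hy⟩ : ∃ y, l y ≠ 0 := by
    by_contra! h
    exact hl (LinearMap.ext h)
  refine ⟨fun y => l y ^ k, fun h => pow_ne_zero k hy (congrFun h y), IsPol.linear_pow l k, fun w hw y => ?_, fun J hJ hJV => ?_⟩
  · simp only [map_add, mem_ker.1 (hVl hw), add_zero]
  · have h1 := finrank_mono hJV
    have h2 := finrank_flat_lt hL hJ
    obtain h3 | h3 : finrank ℂ (flat L J) = 2 ∨ finrank ℂ (flat L J) = 3 := by omega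
    · rw [← eq_of_le_of_finrank_eq hJV (by rw [hV, h3]), ordAt_eq_of_eq (k := k) (by rw [hk, hV]; norm_num)]
      exact linear_pow_mem_VanS hVl k
    · exact (IsPol.linear_pow l k).mem_VanS_hyperplane hL hnp hα h3

theorem hasForm_bot_iff (hL : ∀ i, L i ≠ 0) (hnp : ∀ i j, i ≠ j → ∀ c : ℂ, L i ≠ c • L j) (hα : α < 1)
    {e : ℕ} (he : α * card ι = e + 4) :
    HasForm L α ⊥ e ↔ ∃ p, p ≠ 0 ∧ IsPol e p ∧
      ∀ I : Set ι, finrank ℂ (flat L I) = 1 ∨ finrank ℂ (flat L I) = 2 →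
        p ∈ VanS (flat L I) (ordAt L α (flat L I)) := by
  refine exists_congr fun p => and_congr_right fun _ => and_congr_right fun hp => ⟨fun h I hI => ?_, fun h => ⟨fun w hw y => ?_, fun J hJ _ => ?_⟩⟩
  · exact h.2 I (nonempty_of_finrank (L := L) (by omega)) bot_le
  · rw [(mem_bot ℂ).1 hw, add_zero]
  · have h2 := finrank_flat_lt hL hJ
    obtain h3 | h3 | h3 : finrank ℂ (flat L J) = 0 ∨ (finrank ℂ (flat L J) = 1 ∨ finrank ℂ (flat L J) = 2) ∨
      finrank ℂ (flat L J) = 3 := by omega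
    · rw [finrank_eq_zero.1 h3, ordAt_eq_of_eq (k := e)]
      · intro w hw u
        refine ⟨Polynomial.C (p u), fun t => ?_⟩
        rw [(mem_bot ℂ).1 hw, zero_add, hp.2, eval_C]
      · rw [show mlt L ⊥ = card ι by simp [mlt], he, finrank_bot]
        norm_num [add_comm]
    · exact h J h3
    · exact hp.mem_VanS_hyperplane hL hnp hα h3

theorem finsum_mem_eq_sum_of_zero {β : Type*} {s : Set β} {t : Finset β} {F G : β → ℤ} (hst : s ⊆ t)
    (h : ∀ x ∈ t, F x = G x) (h0 : ∀ x ∈ t, x ∉ s → G x = 0) : ∑ᶠ x ∈ s, F x = ∑ x ∈ t, G x := by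
  rw [← sum_congr rfl h]
  refine finsum_mem_eq_sum_of_inter_support_eq F (Set.ext fun x => and_congr_left fun hx => ⟨fun h => hst h, fun hxt => ?_⟩)
  by_contra hxs
  exact hx ((h x hxt).trans (h0 x hxt hxs))

theorem choose_toNat_sub_one (a : ℤ) {c r : ℕ} (h : c < r) :
    (a - 1).toNat.choose r = ((a - (c + 1 : ℕ)).toNat + c).choose r := by
  by_cases h1 : (c + 1 : ℕ) ≤ a
  · congr 1
    omega
  · rw [Nat.choose_eq_zero_of_lt, Nat.choose_eq_zero_of_lt] <;> omega

theorem ceil_rat_div (i d μ : ℕ) : ⌈(i * μ : ℚ) / (d : ℚ)⌉ = ⌈(i : ℝ) / d * μ⌉ := by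
  rw [← Rat.ceil_cast (α := ℝ)]
  push_cast
  rw [mul_div_right_comm]

theorem choose_of_finrank_two {W : Submodule ℂ (E 4)} (hW : finrank ℂ W = 2) {r : ℕ} (hr : 1 < r) :
    ((⌈α * mlt L W⌉ - 1).toNat.choose r) = (ordAt L α W + 1).choose r := by
  rw [choose_toNat_sub_one _ hr, ordAt, hW]

theorem choose_of_finrank_one {V : Submodule ℂ (E 4)} (hV : finrank ℂ V = 1) :
    ((⌈α * mlt L V⌉ - 1).toNat.choose 3) = (ordAt L α V + 2).choose 3 := by
  rw [choose_toNat_sub_one _ (show 2 < 3 by norm_num), ordAt, hV]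

theorem mem_edges_iff {D : Arrangement 4} {r : ℕ} (hr : r < 4) {W : Submodule ℂ (E 4)} :
    W ∈ D.edges ∧ finrank ℂ W = r ↔ W ∈ flats D.g r := by
  rw [mem_flats]
  refine and_congr_left fun h => ⟨fun ⟨I, _, hI⟩ => ⟨I, hI.symm⟩, fun ⟨I, hI⟩ => ⟨I, ?_, hI.symm⟩⟩
  subst hI
  exact nonempty_of_finrank (L := D.g) (by omega)

/-- The correction term of a pair of flats `V ≤ W`. -/
theorem pair_term (h0 : 0 < α) {W V : Submodule ℂ (E 4)} (hW : finrank ℂ W = 2) (hV : finrank ℂ V = 1)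
    (hVW : V ≤ W) :
    (2 * ((⌈α * mlt L W⌉ - 1).toNat.choose 3 : ℤ) - ((⌈α * mlt L W⌉ - 1).toNat.choose 2 : ℤ) * (⌈α * mlt L V⌉ - 3)) =
      -((ordAt L α V : ℤ) * ((ordAt L α W + 1).choose 2) - 2 * ((ordAt L α W + 1).choose 3)) := by
  have hab : ⌈α * mlt L W⌉ ≤ ⌈α * mlt L V⌉ := Int.ceil_mono (by gcongr; exact mlt_anti hVW)
  rw [choose_of_finrank_two hW one_lt_two, choose_of_finrank_two hW (by norm_num)]
  obtain h | h : 3 ≤ ⌈α * mlt L V⌉ ∨ ordAt L α W = 0 := by rw [ordAt, hW]; omega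
  · have : (ordAt L α V : ℤ) = ⌈α * mlt L V⌉ - 3 := by rw [ordAt, hV]; omega
    rw [this]
    ring
  · simp [h, Nat.choose]

theorem link_sum_eq {D : Arrangement 4} {V : Submodule ℂ (E 4)} {i : ℕ} (hα : α < 1) (hi : α = (i : ℝ) / D.muRed V) :
    ∑ᶠ W ∈ {W | W ∈ D.edges ∧ finrank ℂ W = 2 ∧ 3 ≤ D.muRed W ∧ V ≤ W},
      ((⌈(i * D.muRed W : ℚ) / (D.muRed V : ℚ)⌉ - 1).toNat.choose 2 : ℤ) =
    ∑ W ∈ (flats D.g 2).filter (fun W => V ≤ W), ((ordAt D.g α W + 1).choose 2 : ℤ) := by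
  refine finsum_mem_eq_sum_of_zero (fun W ⟨h1, h2, _, h4⟩ => mem_coe.2
    (mem_filter.2 ⟨(mem_edges_iff (by norm_num)).1 ⟨h1, h2⟩, h4⟩))
    (fun W hW => ?_) fun W hW h => ?_
  all_goals
    rw [mem_filter, ← mem_edges_iff (by norm_num)] at hW
  · rw [ceil_rat_div, ← hi]
    exact_mod_cast choose_of_finrank_two hW.1.2 one_lt_two
  · rw [ordAt_eq_zero_of_mlt_le hα]
    · rfl
    rw [hW.1.2]
    by_contra h'
    exact h ⟨hW.1.1, hW.1.2, not_le.1 h', hW.2⟩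

theorem flats_sum_eq {D : Arrangement 4} {e d : ℕ} (hα : α < 1) (hi : α = ((e + 4 : ℕ) : ℝ) / d) :
    ∑ᶠ W ∈ {W | W ∈ D.edges ∧ finrank ℂ W = 2 ∧ 3 ≤ D.muRed W},
      (2 * ((⌈((e + 4 : ℕ) * D.muRed W : ℚ) / (d : ℚ)⌉ - 1).toNat.choose 3 : ℤ) -
        (((e + 4 : ℕ) : ℤ) - 3) * ((⌈((e + 4 : ℕ) * D.muRed W : ℚ) / (d : ℚ)⌉ - 1).toNat.choose 2 : ℤ)) =
    ∑ W ∈ flats D.g 2, -(((e : ℤ) + 1) * ((ordAt D.g α W + 1).choose 2) - 2 * ((ordAt D.g α W + 1).choose 3)) := by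
  refine finsum_mem_eq_sum_of_zero (fun W ⟨h1, h2, _⟩ => mem_coe.2 ((mem_edges_iff (by norm_num)).1 ⟨h1, h2⟩))
    (fun W hW => ?_) fun W hW h => ?_
  all_goals
    rw [← mem_edges_iff (by norm_num)] at hW
  · rw [ceil_rat_div, ← hi, show D.muRed W = mlt D.g W from rfl, choose_of_finrank_two hW.2 one_lt_two,
      choose_of_finrank_two hW.2 (by norm_num)]
    push_cast
    ring
  · rw [ordAt_eq_zero_of_mlt_le hα]
    · simp [Nat.choose]
    rw [hW.2]
    by_contra h'
    exact h ⟨hW.1, hW.2, not_le.1 h'⟩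

theorem lines_sum_eq {D : Arrangement 4} {i d : ℕ} (hα : α < 1) (hi : α = (i : ℝ) / d) :
    ∑ᶠ V ∈ {V | V ∈ D.edges ∧ finrank ℂ V = 1 ∧ 4 ≤ D.muRed V},
      ((⌈(i * D.muRed V : ℚ) / (d : ℚ)⌉ - 1).toNat.choose 3 : ℤ) =
    ∑ V ∈ flats D.g 1, ((ordAt D.g α V + 2).choose 3 : ℤ) := by
  refine finsum_mem_eq_sum_of_zero (fun V ⟨h1, h2, _⟩ => mem_coe.2 ((mem_edges_iff (by norm_num)).1 ⟨h1, h2⟩))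
    (fun V hV => ?_) fun V hV h => ?_
  all_goals
    rw [← mem_edges_iff (by norm_num)] at hV
  · rw [ceil_rat_div, ← hi]
    exact_mod_cast choose_of_finrank_one hV.2
  · rw [ordAt_eq_zero_of_mlt_le hα]
    · rfl
    rw [hV.2]
    by_contra h'
    exact h ⟨hV.1, hV.2, not_le.1 h'⟩

theorem pairs_sum_eq {D : Arrangement 4} {i d : ℕ} (h0 : 0 < α) (hα : α < 1) (hi : α = (i : ℝ) / d) :
    ∑ᶠ p ∈ {p : Submodule ℂ (Fin 4 → ℂ) × Submodule ℂ (Fin 4 → ℂ) |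
        (p.1 ∈ D.edges ∧ finrank ℂ p.1 = 2 ∧ 3 ≤ D.muRed p.1) ∧
        (p.2 ∈ D.edges ∧ finrank ℂ p.2 = 1 ∧ 4 ≤ D.muRed p.2) ∧ p.2 ≤ p.1},
      (2 * ((⌈(i * D.muRed p.1 : ℚ) / (d : ℚ)⌉ - 1).toNat.choose 3 : ℤ) -
        ((⌈(i * D.muRed p.1 : ℚ) / (d : ℚ)⌉ - 1).toNat.choose 2 : ℤ) * (⌈(i * D.muRed p.2 : ℚ) / (d : ℚ)⌉ - 3)) =
    ∑ p ∈ (flats D.g 2 ×ˢ flats D.g 1).filter (fun p => p.2 ≤ p.1),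
      -((ordAt D.g α p.2 : ℤ) * ((ordAt D.g α p.1 + 1).choose 2) - 2 * ((ordAt D.g α p.1 + 1).choose 3)) := by
  have h24 : 2 < 4 := by norm_num
  have h14 : 1 < 4 := by norm_num
  refine finsum_mem_eq_sum_of_zero (fun p ⟨h1, h2, h3⟩ => mem_coe.2 (mem_filter.2 ⟨Finset.mem_product.2
    ⟨(mem_edges_iff h24).1 ⟨h1.1, h1.2.1⟩, (mem_edges_iff h14).1 ⟨h2.1, h2.2.1⟩⟩, h3⟩)) (fun p hp => ?_) fun p hp h => ?_
  all_goals
    rw [mem_filter, Finset.mem_product, ← mem_edges_iff h24, ← mem_edges_iff h14] at hp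
    obtain ⟨⟨⟨hW, hW2⟩, hV, hV1⟩, hVW⟩ := hp
  · rw [ceil_rat_div, ceil_rat_div, ← hi]
    exact pair_term h0 hW2 hV1 hVW
  · have hW0 : ¬ 3 ≤ D.muRed p.1 ∨ ¬ 4 ≤ D.muRed p.2 := by
      by_contra! h'
      exact h ⟨⟨hW, hW2, h'.1⟩, ⟨hV, hV1, h'.2⟩, hVW⟩
    obtain h' | h' := hW0
    · rw [ordAt_eq_zero_of_mlt_le (V := p.1) hα]
      · simp [Nat.choose]
      · rw [hW2]
        exact lt_succ_iff.1 (not_le.1 h')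
    · have hV0 : ordAt D.g α p.2 = 0 := ordAt_eq_zero_of_mlt_le hα (by rw [hV1]; exact lt_succ_iff.1 (not_le.1 h'))
      have := ordAt_mono (L := D.g) h0 hV1 hW2 hVW
      rw [hV0, Nat.choose_eq_zero_of_lt (show ordAt D.g α p.1 + 1 < 3 by omega)]
      simp

theorem jc_dim_four {D : Arrangement 4} (hred : D.Reduced) (hess : D.Essential)
    {α : ℝ} (h0 : 0 < α) (h1 : α < 1) :
    α ∈ D.JC ↔
      ((∃ W ∈ D.edges, finrank ℂ W = 2 ∧ 3 ≤ D.muRed W ∧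
          ∃ k : ℤ, (D.muRed W : ℝ) * α = (k : ℝ) ∧ 2 ≤ k ∧ k < (D.muRed W : ℤ)) ∨
       (∃ V ∈ D.edges, finrank ℂ V = 1 ∧ 4 ≤ D.muRed V ∧
          ∃ i : ℕ, 3 ≤ i ∧ i < D.muRed V ∧ α = (i : ℝ) / (D.muRed V : ℝ) ∧ HasForm D.g α V (i - 3)) ∨
       (∃ i : ℕ, 4 ≤ i ∧ i < D.degree ∧ α = (i : ℝ) / (D.degree : ℝ) ∧ HasForm D.g α ⊥ (i - 4))) := by
  have hlt : ∀ {m c k : ℕ}, 0 < c → α * m = c + k → c + k < m := fun {m c k} hc h => by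
    have h2 : (0 : ℝ) < α * m := by rw [h]; positivity
    have h3 : α * m < m := mul_lt_of_lt_one_left (pos_of_mul_pos_right h2 h0.le) h1
    rw [h] at h3
    exact_mod_cast h3
  have hdeg : D.degree = mlt D.g ⊥ := by simp [Arrangement.degree, hred _, mlt]
  rw [mem_JC_iff hred h0]
  constructor
  · rintro ⟨I, hI, k, hk, hF⟩
    have h4 : finrank ℂ (flat D.g I) < 4 := finrank_flat_lt D.g_ne hI
    have hm := hlt (Nat.sub_pos_of_lt h4) hk
    have hpos : (mlt D.g (flat D.g I) : ℝ) ≠ 0 := by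
      rw [Nat.cast_ne_zero]
      omega
    have hα := eq_div_of_mul_eq hpos hk
    obtain h | h | h | h : finrank ℂ (flat D.g I) = 0 ∨ finrank ℂ (flat D.g I) = 1 ∨
      finrank ℂ (flat D.g I) = 2 ∨ finrank ℂ (flat D.g I) = 3 := by omega
    all_goals rw [h] at hm hk hα
    · rw [finrank_eq_zero.1 h] at hm hα hF
      refine .inr (.inr ⟨4 + k, by omega, by rwa [hdeg], by rw [hdeg, hα]; norm_num, by rwa [Nat.add_sub_cancel_left]⟩)
    · refine .inr (.inl ⟨_, ⟨I, hI, rfl⟩, h, lt_of_le_of_lt (Nat.le_add_right _ k) hm, 3 + k, by omega, hm, ?_, by rwa [Nat.add_sub_cancel_left]⟩)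
      exact hα.trans (by norm_num; rfl)
    · refine .inl ⟨_, ⟨I, hI, rfl⟩, h, lt_of_le_of_lt (Nat.le_add_right _ k) hm, (2 + k : ℕ), ?_, by omega, by exact_mod_cast hm⟩
      rw [mul_comm]
      exact hk.trans (by norm_num)
    · have := mlt_le_one D.g_ne D.nonproportional (V := flat D.g I) (by rw [h, Module.finrank_fin_fun])
      omega
  · rintro (⟨W, ⟨I, hI, rfl⟩, hW, h3, k, hk, hk2, -⟩ | ⟨V, ⟨I, hI, rfl⟩, hV, h3, i, hi, -, hα, hF⟩ | ⟨i, hi, hid, hα, hF⟩)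
    · lift k to ℕ using by omega
      obtain ⟨k, rfl⟩ := Nat.exists_eq_add_of_le (show 2 ≤ k by omega)
      have hk' : α * mlt D.g (flat D.g I) = 2 + k := by rw [mul_comm]; exact hk.trans (by norm_num)
      exact ⟨I, hI, k, by rw [hk']; erw [hW]; norm_num, hasForm_of_finrank_two D.g_ne D.nonproportional h1 hW hk'⟩
    · refine ⟨I, hI, i - 3, ?_, hF⟩
      rw [Nat.cast_sub hi]
      erw [hV]
      refine ((eq_div_iff (by norm_cast; omega)).1 hα).trans ?_
      norm_num
    · refine ⟨Set.univ, @Set.univ_nonempty _ D.nonemptyι, i - 4, ?_⟩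
      have hb : flat D.g Set.univ = ⊥ := by
        rw [← show _ = _ from hess]
        simp [flat]
      rw [hb, Nat.cast_sub hi, finrank_bot, ← hdeg]
      refine ⟨((eq_div_iff (by norm_cast; omega)).1 hα).trans ?_, hF⟩
      norm_num

end

end HypArr

/-- **Corollary 2.** Combinatorial description of the jumping coefficients in `(0,1)` of a
reduced essential central hyperplane arrangement in `ℂ⁴`. -/
theorem jc_dim4_criterion (D : Arrangement 4) (hred : D.Reduced) (hess : D.Essential)
    (hd : 4 < D.degree) (α : ℝ) (h0 : 0 < α) (h1 : α < 1) :
    α ∈ D.JC ↔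
      ((∃ W ∈ D.edges, Module.finrank ℂ W = 2 ∧ 3 ≤ D.muRed W ∧
          ∃ k : ℤ, (D.muRed W : ℝ) * α = (k : ℝ) ∧ 2 ≤ k ∧ k < (D.muRed W : ℤ)) ∨
       (∃ V ∈ D.edges, Module.finrank ℂ V = 1 ∧ 4 ≤ D.muRed V ∧
          ∃ i : ℕ, 3 ≤ i ∧ i < D.muRed V ∧ α = (i : ℝ) / (D.muRed V : ℝ) ∧
            (((i - 1).choose 2 : ℤ) -
              ∑ᶠ W ∈ {W | W ∈ D.edges ∧ Module.finrank ℂ W = 2 ∧ 3 ≤ D.muRed W ∧ V ≤ W},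
                (((⌈(i * D.muRed W : ℚ) / (D.muRed V : ℚ)⌉ - 1).toNat.choose 2 : ℤ))) ≠ 0) ∨
       (∃ i : ℕ, 4 ≤ i ∧ i < D.degree ∧ α = (i : ℝ) / (D.degree : ℝ) ∧
          (((i - 1).choose 3 : ℤ)
            - (∑ᶠ p ∈ {p : Submodule ℂ (Fin 4 → ℂ) × Submodule ℂ (Fin 4 → ℂ) |
                  (p.1 ∈ D.edges ∧ Module.finrank ℂ p.1 = 2 ∧ 3 ≤ D.muRed p.1) ∧
                  (p.2 ∈ D.edges ∧ Module.finrank ℂ p.2 = 1 ∧ 4 ≤ D.muRed p.2) ∧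
                  p.2 ≤ p.1},
                (2 * ((⌈(i * D.muRed p.1 : ℚ) / (D.degree : ℚ)⌉ - 1).toNat.choose 3 : ℤ)
                  - ((⌈(i * D.muRed p.1 : ℚ) / (D.degree : ℚ)⌉ - 1).toNat.choose 2 : ℤ) *
                      (⌈(i * D.muRed p.2 : ℚ) / (D.degree : ℚ)⌉ - 3)))
            + (∑ᶠ W ∈ {W | W ∈ D.edges ∧ Module.finrank ℂ W = 2 ∧ 3 ≤ D.muRed W},
                (2 * ((⌈(i * D.muRed W : ℚ) / (D.degree : ℚ)⌉ - 1).toNat.choose 3 : ℤ)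
                  - ((i : ℤ) - 3) *
                      ((⌈(i * D.muRed W : ℚ) / (D.degree : ℚ)⌉ - 1).toNat.choose 2 : ℤ)))
            - (∑ᶠ V ∈ {V | V ∈ D.edges ∧ Module.finrank ℂ V = 1 ∧ 4 ≤ D.muRed V},
                ((⌈(i * D.muRed V : ℚ) / (D.degree : ℚ)⌉ - 1).toNat.choose 3 : ℤ))) ≠ 0)) := by
  rw [HypArr.jc_dim_four hred hess h0 h1]
  refine or_congr Iff.rfl (or_congr
    (exists_congr fun V => and_congr_right fun _ => and_congr_right fun hV => and_congr_right fun _ => exists_congr fun i =>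
      and_congr_right fun hi => and_congr_right fun him => and_congr_right fun hα => ?_)
    (exists_congr fun i => and_congr_right fun hi => and_congr_right fun hid => and_congr_right fun hα => ?_))
  · rw [HypArr.link_sum_eq h1 hα]
    obtain ⟨e, rfl⟩ := Nat.exists_eq_add_of_le' hi
    refine HypArr.exists_ne_zero_iff_link D.g_ne D.nonproportional h0 h1 hV (HypArr.ordAt_eq_of_eq ?_).le
    refine ((eq_div_iff (by norm_cast; omega)).1 hα).trans ?_
    erw [hV]
    push_cast
    ring
  · obtain ⟨e, rfl⟩ := Nat.exists_eq_add_of_le' hi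
    have hcard : α * Fintype.card D.ι = e + 4 := by
      rw [show Fintype.card D.ι = D.degree by simp [Arrangement.degree, hred _], (eq_div_iff (by norm_cast; omega)).1 hα]
      push_cast
      rfl
    rw [HypArr.pairs_sum_eq h0 h1 hα, HypArr.flats_sum_eq h1 hα, HypArr.lines_sum_eq h1 hα, Finset.sum_neg_distrib,
      Finset.sum_neg_distrib, sub_neg_eq_add, ← sub_eq_add_neg]
    exact (HypArr.hasForm_bot_iff D.g_ne D.nonproportional h1 hcard).trans
      (HypArr.exists_ne_zero_iff_dim_four D.g_ne D.nonproportional h0 h1 hcard.le)
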